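/- Let M = M_1 *_B M_2 be an amalgamated free product of σ-finite von Neumann algebras, and let Q ⊆ M be a von Neumann subalgebra with expectation satisfying: (i) Q is amenable relative to M_1 inside M; (ii) the inclusion Q ∩ M_1 ⊆ M_1 is with expectation and Q ∩ M_1 does not embed with expectation into B inside M_1 (Q ∩ M_1 ⋠_{M_1} B). Then Q ⊆ M_1. -/

import Mathlib

/- Framework: von Neumann algebras are modeled concretely as `VonNeumannAlgebra H` for a
complex Hilbert space `H` (in the relevant statements, `H` plays the role of the standard
form Hilbert space `L²(M)`).  Conditional expectations, normality (complete additivity,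
phrased via preservation of suprema of upward-directed sets in the Loewner order),
faithfulness, σ-finiteness, standard forms, Jones basic constructions `⟨M, Q⟩ = (JQJ)'`,
amalgamated free products, Popa's intertwining relation `A ≼_M B` and relative amenability
are all defined below. -/

open scoped InnerProductSpace ComplexOrder

noncomputable section

namespace AFP

variable {H : Type*} [NormedAddCommGroup H] [InnerProductSpace ℂ H] [CompleteSpace H]

abbrev BH (H : Type*) [NormedAddCommGroup H] [InnerProductSpace ℂ H] [CompleteSpace H] :=
  H →L[ℂ] H

/-- A (self-adjoint) projection in `B(H)`. -/
def IsProjection (p : BH H) : Prop := IsSelfAdjoint p ∧ IsIdempotentElem p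

/-- A map defined (at least) on `N ⊆ B(H)` is *normal* on `N` if it preserves suprema of
upward-directed subsets of `N` (with respect to the Loewner order on `B(H)`). -/
def IsNormalOn (N : Set (BH H)) (Φ : BH H → BH H) : Prop :=
  ∀ S : Set (BH H), S ⊆ N → S.Nonempty → DirectedOn (· ≤ ·) S →
    ∀ x ∈ N, IsLUB S x → IsLUB (Φ '' S) (Φ x)

/-- A complex-valued functional is normal on `N` if it preserves suprema of upward-directed
subsets of `N` (using the standard partial order on `ℂ`). -/
def IsNormalFunctionalOn (N : Set (BH H)) (φ : BH H → ℂ) : Prop :=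
  ∀ S : Set (BH H), S ⊆ N → S.Nonempty → DirectedOn (· ≤ ·) S →
    ∀ x ∈ N, IsLUB S x → IsLUB (φ '' S) (φ x)

/-- A map is faithful on `N` if it kills no nonzero positive element of `N`. -/
def FaithfulOn (N : Set (BH H)) (Φ : BH H → BH H) : Prop :=
  ∀ x ∈ N, 0 ≤ x → Φ x = 0 → x = 0

/-- A conditional expectation from `N` onto `P ⊆ N` (as subsets of `B(H)`):
a unital positive `P`-bimodular projection of `N` onto `P`. -/
structure IsCondExp (N P : Set (BH H)) (Φ : BH H → BH H) : Prop where
  subset : P ⊆ N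
  map_add : ∀ x ∈ N, ∀ y ∈ N, Φ (x + y) = Φ x + Φ y
  map_smul : ∀ (c : ℂ), ∀ x ∈ N, Φ (c • x) = c • Φ x
  maps_to : ∀ x ∈ N, Φ x ∈ P
  fixes : ∀ x ∈ P, Φ x = x
  pos : ∀ x ∈ N, 0 ≤ x → 0 ≤ Φ x
  bimod : ∀ a ∈ P, ∀ b ∈ P, ∀ x ∈ N, Φ (a * x * b) = a * Φ x * b

/-- The inclusion `P ⊆ N` is *with expectation*: there is a faithful normal conditional
expectation of `N` onto `P`. -/
def WithExpectation (N P : Set (BH H)) : Prop :=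
  ∃ Φ : BH H → BH H, IsCondExp N P Φ ∧ FaithfulOn N Φ ∧ IsNormalOn N Φ

/-- σ-finiteness (countable decomposability) of a von Neumann algebra viewed as a subset
of `B(H)`: any family of pairwise orthogonal nonzero projections in it is countable. -/
def SigmaFinite (N : Set (BH H)) : Prop :=
  ∀ F : Set (BH H), F ⊆ N → (∀ p ∈ F, IsProjection p ∧ p ≠ 0) →
    (∀ p ∈ F, ∀ q ∈ F, p ≠ q → p * q = 0) → F.Countable

/-- Conjugation `T ↦ J T J` of a bounded operator by a conjugate-linear isometric involution. -/
def conjJ (J : H ≃ₗᵢ⋆[ℂ] H) (T : BH H) : BH H where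
  toFun := fun ξ => J (T (J.symm ξ))
  map_add' := by intro ξ η; simp
  map_smul' := by intro c ξ; simp [map_smulₛₗ]
  cont := J.continuous.comp (T.continuous.comp J.symm.continuous)

/-- Standard form data for a von Neumann algebra `M ⊆ B(H)`: the modular conjugation `J`
and the self-dual positive cone `L²(M)₊`, with their basic properties. -/
structure StandardForm (M : VonNeumannAlgebra H) where
  J : H ≃ₗᵢ⋆[ℂ] H
  cone : Set H
  J_involutive : ∀ ξ, J (J ξ) = ξ
  J_fixes_cone : ∀ ξ ∈ cone, J ξ = ξ
  commutant_eq : Set.centralizer (M : Set (BH H)) = conjJ J '' (M : Set (BH H))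
  selfdual : cone = {ξ : H | ∀ η ∈ cone, 0 ≤ ⟪ξ, η⟫_ℂ}
  cone_invariant : ∀ x ∈ (M : Set (BH H)), ∀ ξ ∈ cone, x (conjJ J x ξ) ∈ cone

/-- The Jones basic construction `⟨M, Q⟩ = (JQJ)'` associated with a subalgebra `Q ⊆ M`,
where `J` is the modular conjugation of `M` in its standard form `H = L²(M)`. -/
def basicConstruction (J : H ≃ₗᵢ⋆[ℂ] H) (Q : Set (BH H)) : Set (BH H) :=
  Set.centralizer (conjJ J '' Q)

/-- The corner `e N e` of a subset `N ⊆ B(H)` by a projection `e`. -/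
def Corner (e : BH H) (N : Set (BH H)) : Set (BH H) := {x | x ∈ N ∧ e * x * e = x}

/-- Popa's intertwining relation `A ≼_N C`: `A` embeds with expectation into `C` inside `N`.
There are projections `e ∈ A`, `f ∈ C`, a nonzero partial isometry `v ∈ eNf` and a unital
normal *-homomorphism `θ : eAe → fCf` such that `θ(eAe) ⊆ fCf` is with expectation and
`a v = v θ(a)` for all `a ∈ eAe`. -/
def EmbedsWE (N A C : Set (BH H)) : Prop :=
  ∃ (e f v : BH H) (θ : BH H → BH H),
    e ∈ A ∧ IsProjection e ∧
    f ∈ C ∧ IsProjection f ∧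
    v ∈ N ∧ v ≠ 0 ∧ v * star v * v = v ∧ e * v = v ∧ v * f = v ∧
    (∀ x ∈ Corner e A, θ x ∈ Corner f C) ∧
    (∀ x ∈ Corner e A, ∀ y ∈ Corner e A, θ (x + y) = θ x + θ y) ∧
    (∀ (c : ℂ), ∀ x ∈ Corner e A, θ (c • x) = c • θ x) ∧
    (∀ x ∈ Corner e A, ∀ y ∈ Corner e A, θ (x * y) = θ x * θ y) ∧
    (∀ x ∈ Corner e A, θ (star x) = star (θ x)) ∧
    θ e = f ∧
    IsNormalOn (Corner e A) θ ∧
    WithExpectation (Corner f C) (θ '' Corner e A) ∧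
    (∀ a ∈ Corner e A, a * v = v * θ a)

/-- Amalgamated free product structure `M = M₁ *_B M₂`: `M` is generated by `M₁` and `M₂`,
which both contain `B`, and `E : M → B` is a faithful normal conditional expectation with
respect to which `M₁` and `M₂` are freely independent with amalgamation over `B`
(`E` kills every reduced word with letters alternating between `ker E ∩ M₁` and
`ker E ∩ M₂`; `E` restricts to the given expectations `Eᵢ : Mᵢ → B`). -/
structure IsAFP (M M₁ M₂ B : VonNeumannAlgebra H) (E : BH H → BH H) : Prop where
  le₁ : (B : Set (BH H)) ⊆ (M₁ : Set (BH H))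
  le₂ : (B : Set (BH H)) ⊆ (M₂ : Set (BH H))
  le₁M : (M₁ : Set (BH H)) ⊆ (M : Set (BH H))
  le₂M : (M₂ : Set (BH H)) ⊆ (M : Set (BH H))
  generated : Set.centralizer (Set.centralizer ((M₁ : Set (BH H)) ∪ (M₂ : Set (BH H)))) = M
  condExp : IsCondExp (M : Set (BH H)) (B : Set (BH H)) E
  faithful : FaithfulOn (M : Set (BH H)) E
  normal : IsNormalOn (M : Set (BH H)) E
  free : ∀ (n : ℕ) (x : Fin n → BH H) (ι : Fin n → Bool), 0 < n →
    (∀ k, x k ∈ (if ι k then (M₁ : Set (BH H)) else (M₂ : Set (BH H))) ∧ E (x k) = 0) →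
    (∀ (k : ℕ) (h : k + 1 < n), ι ⟨k, Nat.lt_of_succ_lt h⟩ ≠ ι ⟨k + 1, h⟩) →
    E (List.ofFn x).prod = 0

/-- `P` is amenable relative to `Q` inside `M` (all sitting in `B(L²(M))`, `J` being the
modular conjugation of `M`): there is a conditional expectation `Φ : ⟨M, Q⟩ → P` whose
restriction to `M` is faithful and normal. -/
def AmenableRel (J : H ≃ₗᵢ⋆[ℂ] H) (Mset P Q : Set (BH H)) : Prop :=
  ∃ Φ : BH H → BH H, IsCondExp (basicConstruction J Q) P Φ ∧
    FaithfulOn Mset Φ ∧ IsNormalOn Mset Φ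

/-- Amenability (injectivity) of a von Neumann algebra `P ⊆ B(H)`: there is a conditional
expectation from all of `B(H)` onto `P`. -/
def IsAmenableVN (P : Set (BH H)) : Prop :=
  ∃ Φ : BH H → BH H, IsCondExp (Set.univ) P Φ


open scoped InnerProductSpace ComplexOrder
open Filter Topology
set_option linter.all false
local notation "VN" => VonNeumannAlgebra
instance : Algebra ℝ (BH H) := inferInstance
instance : Algebra ℂ (BH H) := inferInstance
instance : IsTopologicalRing (BH H) := inferInstance
instance : T2Space (BH H) := inferInstance
instance : StarRing (BH H) := inferInstance
instance : StarModule ℂ (BH H) := inferInstance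
instance : PosPart (BH H) := inferInstance
instance : NegPart (BH H) := inferInstance
instance : IsOrderedAddMonoid (BH H) := inferInstance
instance : AddRightMono (BH H) := inferInstance
instance : AddLeftMono (BH H) := inferInstance
instance : StarOrderedRing (BH H) := inferInstance
instance : ContinuousFunctionalCalculus ℝ (BH H) IsSelfAdjoint := inferInstance
local notation "BB" => BH H
local notation "SB" => Set BB
local notation "Pj" => IsStarProjection
local notation "cL" => Iff.mp Complex.le_def
local notation "⟪" a "," b "⟫" => inner ℂ a b
theorem vst {N : VN H} {x : BB} (h : x ∈ N) : star x ∈ N := star_mem (S := VN H) h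
theorem vsb {N : VN H} {x y : BB} (h : x ∈ N) (k : y ∈ N) : x - y ∈ N := sub_mem (S := VN H) h k
theorem vad {N : VN H} {x y : BB} (h : x ∈ N) (k : y ∈ N) : x + y ∈ N := add_mem (S := VN H) h k
theorem vze (N : VN H) : (0 : BB) ∈ N := zero_mem (S := VN H) N
theorem Asub (x y : BB) (ξ : H) : (x - y) ξ = x ξ - y ξ := rfl
theorem Aadd (x y : BB) (ξ : H) : (x + y) ξ = x ξ + y ξ := rfl
theorem Asmul (c : ℂ) (x : BB) (ξ : H) : (c • x) ξ = c • x ξ := rfl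
theorem Aone (ξ : H) : (1 : BB) ξ = ξ := rfl
theorem Azero (ξ : H) : (0 : BB) ξ = 0 := rfl
variable {x y a p q w b T e g Y X f v z m k u Z S r s V l P : BH H} {N : VN H}
open scoped ENNReal
theorem mapp (S T : BB) (ξ : H) : (S * T) ξ = S (T ξ) := rfl
theorem nonneg_iff : 0 ≤ x ↔ ∀ ξ, 0 ≤ ⟪ξ, x ξ⟫ := by
  rw [ContinuousLinearMap.nonneg_iff_isPositive, ContinuousLinearMap.isPositive_iff_complex]
  refine forall_congr' fun ξ => ?_
  rw [← inner_conj_symm ξ, Complex.le_def]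
  generalize ⟪x ξ, ξ⟫ = w
  simp only [Complex.zero_re, Complex.conj_re, Complex.zero_im, Complex.conj_im, Complex.ext_iff]
  simp [and_comm, eq_comm]
theorem le_iff : x ≤ y ↔ ∀ ξ, ⟪ξ, x ξ⟫ ≤ ⟪ξ, y ξ⟫ := by
  rw [← sub_nonneg, nonneg_iff]
  simp [inner_sub_right, sub_nonneg]
theorem star_inner (x : BB) (ξ η : H) : ⟪star x ξ, η⟫ = ⟪ξ, x η⟫ :=
  ContinuousLinearMap.adjoint_inner_left x η ξ
theorem inner_star (x : BB) (ξ η : H) : ⟪ξ, star x η⟫ = ⟪x ξ, η⟫ :=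
  ContinuousLinearMap.adjoint_inner_right x ξ η
theorem sa_inner (hx : IsSelfAdjoint x) (ξ η : H) : ⟪x ξ, η⟫ = ⟪ξ, x η⟫ := by
  rw [← star_inner, hx.star_eq]
theorem normsq_inner (x : BB) (ξ : H) : ⟪ξ, (star x * x) ξ⟫ = ((‖x ξ‖ ^ 2 : ℝ) : ℂ) := by
  rw [mapp, inner_star, inner_self_eq_norm_sq_to_K]; simp
theorem inner_ext {x y : H} (h : ∀ z, ⟪z, x⟫ = ⟪z, y⟫) : x = y := ext_inner_left ℂ h
theorem op_ext_inner (h : ∀ ξ, ⟪ξ, x ξ⟫ = ⟪ξ, y ξ⟫) : x = y :=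
  le_antisymm (le_iff.2 fun ξ => (h ξ).le) (le_iff.2 fun ξ => (h ξ).ge)
theorem vn_smul (c : ℂ) (hx : x ∈ N) : c • x ∈ N :=
  N.toStarSubalgebra.smul_mem hx c
theorem vn_iff : x ∈ N ↔ ∀ y ∈ N.commutant, y * x = x * y := by
  conv_lhs => rw [← N.commutant_commutant]
  rw [VonNeumannAlgebra.mem_commutant_iff]
theorem comm_iff : y ∈ N.commutant ↔ ∀ x ∈ N, x * y = y * x :=
  VonNeumannAlgebra.mem_commutant_iff
theorem comm_app (hy : y ∈ N.commutant) (hx : x ∈ N) (ξ : H) :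
    y (x ξ) = x (y ξ) := by
  have := comm_iff.1 hy x hx
  exact (congrArg (fun T : BB => T ξ) this).symm
def vnComm (S : SB) (hS : ∀ x ∈ S, star x ∈ S) : VN H where
  toStarSubalgebra :=
    { Subalgebra.centralizer ℂ S with
      star_mem' := by
        intro a ha
        have ha' : a ∈ S.centralizer := ha
        change star a ∈ S.centralizer
        intro x hx
        have := congrArg star (ha' (star x) (hS x hx))
        simpa using this.symm }
  centralizer_centralizer' := by
    change S.centralizer.centralizer.centralizer = S.centralizer
    simp
theorem mem_vnComm {S : SB} {hS} : y ∈ vnComm S hS ↔ ∀ x ∈ S, x * y = y * x :=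
  Iff.rfl
theorem coe_vnComm {S : SB} {hS} : (vnComm S hS : SB) = S.centralizer := rfl
def vnInf (N₁ N₂ : VN H) : VN H :=
  vnComm ((N₁.commutant : SB) ∪ N₂.commutant) (by
    rintro x (h | h)
    · exact Or.inl (vst h)
    · exact Or.inr (vst h))
theorem mem_vnInf {N₁ N₂ : VN H} : x ∈ vnInf N₁ N₂ ↔ x ∈ N₁ ∧ x ∈ N₂ := by
  rw [vn_iff (N := N₁), vn_iff (N := N₂)]
  exact ⟨fun h => ⟨fun y hy => h y (Or.inl hy), fun y hy => h y (Or.inr hy)⟩,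
    fun h y hy => hy.elim (h.1 y) (h.2 y)⟩
theorem coe_vnInf {N₁ N₂ : VN H} : (vnInf N₁ N₂ : SB) = (N₁ : SB) ∩ N₂ := by
  ext x; exact mem_vnInf
theorem cfc_mem_vn (hx : x ∈ N) (f : ℝ → ℝ) : cfc f x ∈ N :=
  vn_iff.2 fun y hy => (((show Commute x y from (vn_iff.1 hx y hy).symm).cfc_real f).eq).symm
theorem posPart_mem (hx : x ∈ N) : x⁺ ∈ N :=
  vn_iff.2 fun y hy => (((show Commute x y from (vn_iff.1 hx y hy).symm).cfcₙ_real _).eq).symm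
theorem sqrt_mem (hx : x ∈ N) : CFC.sqrt x ∈ N :=
  vn_iff.2 fun y hy => (((show Commute x y from (vn_iff.1 hx y hy).symm).cfcₙ_nnreal _).eq).symm
theorem star_proj (hp : Pj p) : star p = p := hp.isSelfAdjoint.star_eq
theorem proj_mul (hp : Pj p) : p * p = p := hp.isIdempotentElem
def pr (K : Submodule ℂ H) : BB := K.topologicalClosure.starProjection
theorem pr_proj (K : Submodule ℂ H) : Pj (pr K) :=
  isStarProjection_starProjection
theorem pr_apply {K : Submodule ℂ H} {ξ : H} (h : ξ ∈ K) : pr K ξ = ξ :=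
  Submodule.starProjection_eq_self_iff.2 (K.le_topologicalClosure h)
theorem pr_mem (K : Submodule ℂ H) (ξ : H) : pr K ξ ∈ K.topologicalClosure :=
  Submodule.starProjection_apply_mem _ _
theorem pr_eq_self {K : Submodule ℂ H} {ξ : H} : pr K ξ = ξ ↔ ξ ∈ K.topologicalClosure :=
  Submodule.starProjection_eq_self_iff
theorem pr_eq_zero {K : Submodule ℂ H} {ξ : H} : pr K ξ = 0 ↔ ∀ η ∈ K, ⟪η, ξ⟫ = 0 := by
  rw [pr, Submodule.starProjection_apply_eq_zero_iff, Submodule.orthogonal_closure,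
    Submodule.mem_orthogonal]
theorem op_eq_on_closure {K : Submodule ℂ H} (h : ∀ ξ ∈ K, S ξ = T ξ) {ξ : H}
    (hξ : ξ ∈ K.topologicalClosure) : S ξ = T ξ :=
  closure_minimal (s := (K : Set H)) (t := {ξ | S ξ = T ξ}) h
    (isClosed_eq S.continuous T.continuous) hξ
theorem op_mem_closure {K L : Submodule ℂ H} (h : ∀ ξ ∈ K, S ξ ∈ L.topologicalClosure)
    {ξ : H} (hξ : ξ ∈ K.topologicalClosure) : S ξ ∈ L.topologicalClosure :=
  closure_minimal (s := (K : Set H)) (t := {ξ | S ξ ∈ L.topologicalClosure}) h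
    (L.isClosed_topologicalClosure.preimage S.continuous) hξ
theorem mul_pr_eq {K : Submodule ℂ H} (h : ∀ ξ ∈ K, S ξ = T ξ) :
    S * pr K = T * pr K := by
  ext ξ; exact op_eq_on_closure h (pr_mem K ξ)
theorem pr_mul_eq {K L : Submodule ℂ H} (h : ∀ ξ ∈ K, S ξ ∈ L.topologicalClosure) :
    pr L * S * pr K = S * pr K := by
  ext ξ; exact pr_eq_self.2 (op_mem_closure h (pr_mem K ξ))
theorem pr_mem_vn {K : Submodule ℂ H}
    (h : ∀ y ∈ N.commutant, ∀ ξ ∈ K, y ξ ∈ K.topologicalClosure) : pr K ∈ N := by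
  refine vn_iff.2 fun y hy => ?_
  have h1 := pr_mul_eq (h y hy)
  have h2 := congrArg star (pr_mul_eq (h (star y) (star_mem hy)))
  simp only [star_mul, star_star, (pr_proj K).isSelfAdjoint.star_eq] at h2
  rw [← h1, ← h2, mul_assoc]; simp only [mul_assoc, proj_mul (pr_proj K)]
def rp (x : BB) : BB := pr x.range
theorem rp_proj (x : BB) : Pj (rp x) := pr_proj _
theorem rp_mul (x : BB) : rp x * x = x := by
  ext ξ; exact pr_apply ⟨ξ, rfl⟩
theorem mul_rp (h : y * x = 0) : y * rp x = 0 := by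
  have := mul_pr_eq (K := x.range) (S := y) (T := 0) (by
    rintro _ ⟨η, rfl⟩; exact congrArg (fun T : BB => T η) h)
  rw [rp, this, zero_mul]
theorem rp_mem (hx : x ∈ N) : rp x ∈ N := by
  refine pr_mem_vn fun y hy ξ hξ => ?_
  obtain ⟨η, rfl⟩ := hξ
  refine Submodule.le_topologicalClosure _ ⟨y η, ?_⟩
  exact (comm_app hy hx η).symm
theorem mul_rp_of (h : y * x = x) : y * rp x = rp x := by
  have := mul_rp (x := x) (y := y - 1) (by rw [sub_mul, h, one_mul, sub_self])
  rwa [sub_mul, one_mul, sub_eq_zero] at this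
def sp (a : BB) : BB := rp a⁺
theorem sp_proj (a : BB) : Pj (sp a) := rp_proj _
theorem sp_mem (ha : a ∈ N) : sp a ∈ N := rp_mem (posPart_mem ha)
theorem negPart_mul_sp (a : BB) : a⁻ * sp a = 0 := mul_rp (CFC.negPart_mul_posPart a)
theorem mul_sp (a : BB) (ha : IsSelfAdjoint a) : a * sp a = a⁺ ∧ sp a * a = a⁺ := by
  have h1 := negPart_mul_sp a
  have hn : IsSelfAdjoint a⁻ := IsSelfAdjoint.of_nonneg (CFC.negPart_nonneg a)
  have hp : IsSelfAdjoint a⁺ := IsSelfAdjoint.of_nonneg (CFC.posPart_nonneg a)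
  have h2 : sp a * a⁺ = a⁺ := rp_mul _
  have h1' := congrArg star h1
  have h2' := congrArg star h2
  simp only [star_mul, hn.star_eq, hp.star_eq, star_proj (sp_proj a), star_zero] at h1' h2'
  have h3 := CFC.posPart_sub_negPart a ha
  constructor
  · rw [← congrArg (· * sp a) h3]; simp [sub_mul, h1, h2']
  · rw [← congrArg (sp a * ·) h3]; simp [mul_sub, h1', h2]
theorem sp_eq_zero (ha : IsSelfAdjoint a) (h : sp a = 0) : a ≤ 0 := by
  have : a⁺ = 0 := by rw [← (mul_sp a ha).1, h, mul_zero]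
  exact (CFC.posPart_eq_zero_iff a ha).1 this
theorem sp_cut (x : BB) (hx : IsSelfAdjoint x) (c : ℝ) :
    (c : ℂ) • sp (x - (c : ℂ) • 1) ≤ x * sp (x - (c : ℂ) • 1) ∧
    x * (1 - sp (x - (c : ℂ) • 1)) ≤ (c : ℂ) • (1 - sp (x - (c : ℂ) • 1)) ∧
    Commute x (sp (x - (c : ℂ) • 1)) := by
  have ha : IsSelfAdjoint (x - (c : ℂ) • (1 : BB)) := by
    refine hx.sub ?_
    simp [IsSelfAdjoint, star_smul]
  obtain ⟨h1, h2⟩ := mul_sp _ ha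
  set e := sp (x - (c : ℂ) • 1)
  have h3 := CFC.posPart_sub_negPart _ ha
  refine ⟨?_, ?_, ?_⟩
  · rw [← sub_nonneg]
    have : x * e - (c : ℂ) • e = (x - (c : ℂ) • (1 : BB))⁺ := by rw [← h1]; simp [sub_mul]
    rw [this]; exact CFC.posPart_nonneg _
  · rw [← sub_nonneg]
    have : (c : ℂ) • (1 - e) - x * (1 - e) = (x - (c : ℂ) • (1 : BB))⁻ := by
      have h4 : (x - (c : ℂ) • (1 : BB))⁻ = (x - (c : ℂ) • (1 : BB)) * e - (x - (c : ℂ) • 1) := by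
        rw [h1]; exact (sub_eq_iff_eq_add.2 (sub_eq_iff_eq_add'.1 h3)).symm
      rw [h4]; simp only [sub_mul, mul_sub, smul_mul_assoc, one_mul, mul_one, smul_sub]; abel
    rw [this]; exact CFC.negPart_nonneg _
  · have : x * e - e * x = (x - (c : ℂ) • (1 : BB)) * e - e * (x - (c : ℂ) • (1 : BB)) := by
      simp [sub_mul, mul_sub]
    rw [h1, h2, sub_self] at this
    exact sub_eq_zero.1 this
theorem douglas {V : Type*} [AddCommGroup V] [Module ℂ V] (f g : V →ₗ[ℂ] H) (C : ℝ) (hC : 0 ≤ C)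
    (h : ∀ v, ‖g v‖ ≤ C * ‖f v‖) :
    ∃ T : BB, (∀ v, T (f v) = g v) ∧ T * pr (LinearMap.range f) = T ∧ ‖T‖ ≤ C := by
  let K := (LinearMap.range f).topologicalClosure
  let e : V →ₗ[ℂ] K := f.codRestrict K fun v => Submodule.le_topologicalClosure _ ⟨v, rfl⟩
  have hd : DenseRange e := by
    intro y
    rw [closure_subtype]
    have : (Subtype.val '' Set.range e) = (LinearMap.range f : Set H) := by
      ext z; simp [e, Set.mem_image]
    rw [this]
    exact y.2
  have hn : ∀ v, ‖g v‖ ≤ C * ‖e v‖ := h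
  let T0 := g.extendOfNorm e
  refine ⟨T0.comp K.orthogonalProjectionOnto, fun v => ?_, ?_, ?_⟩
  · have : K.orthogonalProjectionOnto (f v) = e v := by
      have := Submodule.orthogonalProjectionOnto_mem_subspace_eq_self (K := K) (e v)
      exact this
    simp only [ContinuousLinearMap.comp_apply, this]
    exact LinearMap.extendOfNorm_eq hd ⟨C, hn⟩ v
  · ext ξ
    simp only [mapp, ContinuousLinearMap.comp_apply]
    congr 1
    exact Submodule.orthogonalProjectionOnto_mem_subspace_eq_self (K := K) (K.orthogonalProjectionOnto ξ)
  · refine (ContinuousLinearMap.opNorm_comp_le _ _).trans ?_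
    calc _ ≤ C * 1 := mul_le_mul (LinearMap.opNorm_extendOfNorm_le hd hC hn)
          (Submodule.orthogonalProjectionOnto_norm_le _) (by positivity) hC
      _ = C := mul_one C
theorem zorn_family {α : Type*} (good : α → Prop) (R : α → α → Prop) :
    ∃ S : Set α, (∀ a ∈ S, good a) ∧ S.Pairwise R ∧
      ∀ a, good a → (∀ b ∈ S, R a b ∧ R b a) → a ∈ S := by
  obtain ⟨S, hS⟩ := zorn_subset {S : Set α | (∀ a ∈ S, good a) ∧ S.Pairwise R} (by
    intro c hc hch
    refine ⟨⋃₀ c, ⟨?_, ?_⟩, fun s hs => Set.subset_sUnion_of_mem hs⟩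
    · rintro a ⟨s, hs, ha⟩; exact (hc hs).1 a ha
    · exact (Set.pairwise_sUnion hch.directedOn).2 fun s hs => (hc hs).2)
  refine ⟨S, hS.prop.1, hS.prop.2, fun a ha hab => ?_⟩
  have : insert a S ∈ {S : Set α | (∀ a ∈ S, good a) ∧ S.Pairwise R} :=
    ⟨by rintro b (rfl | hb); exacts [ha, hS.prop.1 b hb],
      hS.prop.2.insert fun b hb _ => hab b hb⟩
  exact hS.le_of_ge this (Set.subset_insert a S) (Set.mem_insert a S)
theorem sqrt_facts (hT : 0 ≤ T) : IsSelfAdjoint (CFC.sqrt T) ∧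
    CFC.sqrt T * CFC.sqrt T = T ∧ 0 ≤ CFC.sqrt T :=
  ⟨IsSelfAdjoint.of_nonneg (CFC.sqrt_nonneg T), CFC.sqrt_mul_sqrt_self T hT, CFC.sqrt_nonneg T⟩
theorem sa_of_nonneg (hT : 0 ≤ T) : IsSelfAdjoint T := IsSelfAdjoint.of_nonneg hT
theorem cs_form {V : Type*} [AddCommGroup V] [Module ℂ V] (s : V → V → ℂ)
    (hadd : ∀ x y z, s x (y + z) = s x y + s x z) (hsmul : ∀ (c : ℂ) x y, s x (c • y) = c * s x y)
    (hsymm : ∀ x y, s y x = star (s x y)) (hpos : ∀ x, 0 ≤ s x x) (x y : V) :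
    ‖s x y‖ ^ 2 ≤ (s x x).re * (s y y).re := by
  let core : PreInnerProductSpace.Core ℂ V :=
    { inner := s
      conj_inner_symm := fun x y => (hsymm y x).symm
      re_inner_nonneg := fun x => (cL (hpos x)).1
      add_left := fun x y z => by
        change s (x + y) z = s x z + s y z
        rw [hsymm z (x + y), hadd, star_add, ← hsymm, ← hsymm]
      smul_left := fun x y c => by
        change s (c • x) y = (starRingEnd ℂ) c * s x y
        rw [hsymm y (c • x), hsmul, star_mul', ← hsymm]; rfl }
  have := @InnerProductSpace.Core.inner_mul_inner_self_le ℂ V _ _ _ core x y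
  have h2 : ‖s y x‖ = ‖s x y‖ := by rw [hsymm x y]; simp
  calc ‖s x y‖ ^ 2 = ‖s x y‖ * ‖s y x‖ := by rw [h2, sq]
    _ ≤ _ := this
theorem cs_op (hT : 0 ≤ T) (ξ η : H) :
    ‖⟪ξ, T η⟫‖ ^ 2 ≤ (⟪ξ, T ξ⟫).re * (⟪η, T η⟫).re := by
  refine cs_form (fun ξ η : H => ⟪ξ, T η⟫) ?_ ?_ ?_ ?_ ξ η
  · intro x y z; simp [inner_add_right]
  · intro c x y; simp [inner_smul_right]
  · intro x y; rw [← sa_inner (sa_of_nonneg hT), ← inner_conj_symm]; rfl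
  · exact nonneg_iff.1 hT
theorem norm_sq_le_op (hT : 0 ≤ T) (ξ : H) :
    ‖T ξ‖ ^ 2 ≤ ‖T‖ * (⟪ξ, T ξ⟫).re := by
  obtain ⟨h1, h2, -⟩ := sqrt_facts hT
  set a := CFC.sqrt T
  have e1 : (⟪ξ, T ξ⟫).re = ‖a ξ‖ ^ 2 := by
    have := normsq_inner a ξ
    rw [h1.star_eq, h2] at this
    rw [this, Complex.ofReal_re]
  have e2 : ‖T‖ = ‖a‖ * ‖a‖ := by rw [← h2, ← CStarRing.norm_star_mul_self (x := a), h1.star_eq]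
  have e3 : T ξ = a (a ξ) := by rw [← h2]; rfl
  rw [e1, e2, e3]
  have := a.le_opNorm (a ξ)
  calc ‖a (a ξ)‖ ^ 2 ≤ (‖a‖ * ‖a ξ‖) ^ 2 := by gcongr
    _ = _ := by ring
theorem op_zero_of (hT : 0 ≤ T) {ξ : H} (h : ⟪ξ, T ξ⟫ = 0) : T ξ = 0 := by
  have := norm_sq_le_op hT ξ
  rw [h] at this
  simpa using this
theorem polar (hx : x ∈ N) : ∃ u ∈ N, ∃ a ∈ N, 0 ≤ a ∧ a * a = star x * x ∧
    u * a = x ∧ star u * x = a ∧ u * star u * u = u ∧ star u * u * a = a ∧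
    (∀ y, y * x = 0 → y * u = 0) ∧ (∀ y, x * y = 0 → u * y = 0) := by
  have hp : 0 ≤ star x * x := star_mul_self_nonneg x
  obtain ⟨h1, h2, h3⟩ := sqrt_facts hp
  have ha : CFC.sqrt (star x * x) ∈ N := sqrt_mem (mul_mem (star_mem hx) hx)
  set a := CFC.sqrt (star x * x)
  have hn : ∀ ξ, ‖x ξ‖ = ‖a ξ‖ := fun ξ => by
    have e1 := normsq_inner a ξ
    rw [h1.star_eq, h2, normsq_inner] at e1
    have : ‖x ξ‖ ^ 2 = ‖a ξ‖ ^ 2 := by exact_mod_cast e1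
    exact (sq_eq_sq₀ (norm_nonneg _) (norm_nonneg _)).1 this
  obtain ⟨u, hu1, hu2, -⟩ := douglas (a : H →ₗ[ℂ] H) (x : H →ₗ[ℂ] H) 1 zero_le_one
    (fun ξ => by rw [one_mul]; exact (hn ξ).le)
  have hua : u * a = x := by ext ξ; exact hu1 ξ
  have hue : u * rp a = u := hu2
  have hes := star_proj (rp_proj a)
  have hea : rp a * a = a := rp_mul a
  have hae : a * rp a = a := by simpa [h1.star_eq, hes] using congrArg star hea
  have hD : (star u * u - rp a) = 0 := by
    have e0 : (star u * u - rp a) * rp a = star u * u - rp a := by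
      rw [sub_mul, mul_assoc, hue, proj_mul (rp_proj a)]
    have e1 : a * (star u * u - rp a) * a = 0 := by
      have : star x * x = a * (star u * u) * a := by
        rw [← hua]; simp [h1.star_eq, mul_assoc]
      rw [mul_sub, sub_mul, ← this, hae, h2, sub_self]
    have e2 : a * (star u * u - rp a) = 0 := by
      rw [← e0, ← mul_assoc]; exact mul_rp e1
    have e3 : (star u * u - rp a) * a = 0 := by
      simpa [h1.star_eq, hes] using congrArg star e2
    rw [← e0]; exact mul_rp e3
  have hD' := sub_eq_zero.1 hD
  have huN : u ∈ N := vn_iff.2 fun y hy => by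
    have e1 : (y * u - u * y) * a = 0 := by
      rw [sub_mul, mul_assoc, hua, mul_assoc, vn_iff.1 ha y hy, ← mul_assoc, hua,
        vn_iff.1 hx y hy, sub_self]
    have e2 := mul_rp e1
    rwa [sub_mul, mul_assoc, hue, mul_assoc, vn_iff.1 (rp_mem ha) y hy, ← mul_assoc, hue,
      sub_eq_zero] at e2
  refine ⟨u, huN, a, ha, h3, h2, hua, ?_, ?_, ?_, ?_, ?_⟩
  · rw [← hua, ← mul_assoc, hD', hea]
  · rw [mul_assoc, hD', hue]
  · rw [hD', hea]
  · intro y hy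
    rw [← hua, ← mul_assoc] at hy
    rw [← hue, ← mul_assoc]; exact mul_rp hy
  · intro y hy
    have e1 : a * y = 0 := by
      ext ξ
      have : ‖a (y ξ)‖ = 0 := by
        rw [← hn]; simpa using congrArg (fun T : BB => T ξ) hy
      simpa using this
    have e2 : star y * a = 0 := by simpa [h1.star_eq] using congrArg star e1
    have e3 : rp a * y = 0 := by simpa [hes] using congrArg star (mul_rp e2)
    rw [← hue, mul_assoc, e3, mul_zero]
theorem anti_cauchy {ι : Type*} [Preorder ι] [Nonempty ι] (r : ι → ℝ) (h : Antitone r)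
    (hb : ∀ i, 0 ≤ r i) {δ : ℝ} (hδ : 0 < δ) : ∃ N, ∀ n, N ≤ n → r N - r n < δ := by
  have hbdd : BddBelow (Set.range r) := ⟨0, by rintro _ ⟨s, rfl⟩; exact hb s⟩
  obtain ⟨N, hN⟩ := exists_lt_of_ciInf_lt (lt_add_of_pos_right (⨅ i, r i) hδ)
  exact ⟨N, fun n _ => by have := ciInf_le hbdd n; linarith⟩
theorem vigier_aux {ι : Type*} [Preorder ι] [IsDirectedOrder ι] (f : ι → BB) (hf : Monotone f)
    (i0 : ι) (hx : IsLUB (Set.range f) x) (ξ : H) {ε : ℝ} (hε : 0 < ε)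
    (hcon : ∀ i, ε ≤ (⟪ξ, (x - f i) ξ⟫).re) : False := by
  haveI : Nonempty ι := ⟨i0⟩
  obtain ⟨r, hr⟩ : ∃ r : ι → ℝ, ∀ s, r s = (⟪ξ, (x - f s) ξ⟫).re := ⟨_, fun _ => rfl⟩
  have hpos : ∀ s : ι, 0 ≤ x - f s := fun s => sub_nonneg.2 (hx.1 ⟨s, rfl⟩)
  have hanti : Antitone r := fun s t h => by
    rw [hr, hr]
    exact (cL (le_iff.1 (sub_le_sub_left (hf h) x) ξ)).1
  simp only [← hr] at hcon
  obtain ⟨C, hCd⟩ : ∃ C, C = ‖x - f i0‖ := ⟨_, rfl⟩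
  have hC0 : 0 ≤ C := hCd ▸ norm_nonneg _
  have hdiff : ∀ s t : ι, i0 ≤ s → s ≤ t → ‖(x - f s) ξ - (x - f t) ξ‖ ^ 2 ≤ C * (r s - r t) := by
    intro s t h0 h
    have hp : 0 ≤ f t - f s := sub_nonneg.2 (hf h)
    have h1 := norm_sq_le_op hp ξ
    have h2 : ‖f t - f s‖ ≤ C := hCd ▸
      CStarAlgebra.norm_le_norm_of_nonneg_of_le hp (sub_le_sub (hx.1 ⟨t, rfl⟩) (hf h0))
    have h3 : (x - f s) ξ - (x - f t) ξ = (f t - f s) ξ := by simp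
    have h4 : r s - r t = (⟪ξ, (f t - f s) ξ⟫).re := by simp [hr, inner_sub_right]
    rw [h3, h4]
    refine h1.trans (mul_le_mul_of_nonneg_right h2 (cL (nonneg_iff.1 hp ξ)).1)
  have hcs : CauchySeq (fun s : ι => (x - f s) ξ) := by
    suffices hs : ∀ δ : ℝ, 0 < δ → ∃ N', ∀ n, N' ≤ n → dist ((x - f n) ξ) ((x - f N') ξ) < δ by
      refine Metric.cauchy_iff.2 ⟨inferInstance, fun δ hδ => ?_⟩
      obtain ⟨N', hN'⟩ := hs (δ / 2) (half_pos hδ)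
      refine ⟨_, image_mem_map (Ici_mem_atTop N'), ?_⟩
      rintro _ ⟨a, ha, rfl⟩ _ ⟨b, hb, rfl⟩
      have h1 := hN' a ha
      have h2 := hN' b hb
      rw [dist_comm] at h2
      calc _ ≤ _ := dist_triangle _ ((x - f N') ξ) _
        _ < δ := by linarith
    intro δ hδ
    have hC : 0 < C + 1 := by positivity
    obtain ⟨N, hN⟩ := anti_cauchy r hanti (fun i => hε.le.trans (hcon i))
      (δ := δ ^ 2 / (C + 1)) (by positivity)
    obtain ⟨N', h1, h2⟩ := exists_ge_ge N i0
    refine ⟨N', fun n hn => ?_⟩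
    have h3 := hdiff N' n h2 hn
    have h6 : r N' - r n < δ ^ 2 / (C + 1) := by
      have := hN n (h1.trans hn); have := hanti h1; linarith
    rw [dist_comm, dist_eq_norm]
    refine lt_of_pow_lt_pow_left₀ 2 hδ.le ?_
    have h7 : 0 ≤ r N' - r n := sub_nonneg.2 (hanti hn)
    rw [lt_div_iff₀ hC] at h6
    calc _ ≤ C * (r N' - r n) := h3
      _ ≤ (r N' - r n) * (C + 1) := by nlinarith
      _ < δ ^ 2 := h6
  obtain ⟨ζ, hζ⟩ := cauchySeq_tendsto_of_complete hcs
  have hkey : ∀ (s : ι) (η : H), ‖⟪ζ, η⟫‖ ^ 2 ≤ r i0 * (⟪η, (x - f s) η⟫).re := by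
    intro s η
    refine le_of_tendsto (((hζ.inner tendsto_const_nhds).norm).pow 2) ?_
    obtain ⟨N', h1, h2⟩ := exists_ge_ge s i0
    filter_upwards [eventually_ge_atTop N'] with t ht
    have h3 := cs_op (hpos t) ξ η
    rw [← sa_inner (sa_of_nonneg (hpos t))] at h3
    rw [← hr] at h3
    refine h3.trans (mul_le_mul (hanti (h2.trans ht)) ?_ ?_ ?_)
    · exact (cL (le_iff.1 (sub_le_sub_left (hf (h1.trans ht)) x) η)).1
    · exact (cL (nonneg_iff.1 (hpos t) η)).1
    · exact hε.le.trans (hcon i0)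
  have hr0 : 0 < r i0 := hε.trans_le (hcon i0)
  let R : BB := (((r i0)⁻¹ : ℝ) : ℂ) • InnerProductSpace.rankOne ℂ ζ ζ
  have hR : ∀ η, ⟪η, R η⟫ = (((r i0)⁻¹ * ‖⟪ζ, η⟫‖ ^ 2 : ℝ) : ℂ) := by
    intro η
    simp only [R, Asmul, InnerProductSpace.rankOne_apply, inner_smul_right]
    rw [← inner_conj_symm η ζ]
    push_cast
    rw [← Complex.mul_conj']
  have hub : x - R ∈ upperBounds (Set.range f) := by
    rintro _ ⟨s, rfl⟩
    rw [le_sub_iff_add_le, ← le_sub_iff_add_le', le_iff]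
    intro η
    rw [hR]
    have h1 := hkey s η
    have h2 := cL (nonneg_iff.1 (hpos s) η)
    refine Complex.le_def.2 ⟨?_, by rw [Complex.ofReal_im]; exact h2.2⟩
    rw [Complex.ofReal_re, inv_mul_le_iff₀ hr0]
    exact h1
  have h0 : R ≤ 0 := by simpa using hx.2 hub
  have h1 := (le_iff.1 h0 ζ)
  rw [hR] at h1
  have h2 := (cL h1).1
  simp only [Complex.ofReal_re, Azero, inner_zero_right,
    Complex.zero_re, inner_self_eq_norm_sq_to_K] at h2
  have hζ0 : ζ = 0 := by
    by_contra hne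
    have : 0 < ‖ζ‖ := norm_pos_iff.2 hne
    have : 0 < ‖((‖ζ‖ : ℂ)) ^ 2‖ := norm_pos_iff.2 (pow_ne_zero 2 (by exact_mod_cast this.ne'))
    have : 0 < (r i0)⁻¹ * ‖((‖ζ‖ : ℂ)) ^ 2‖ ^ 2 := mul_pos (inv_pos.2 hr0) (pow_pos this 2)
    exact absurd h2 (not_le.2 this)
  have h3 : Tendsto r atTop (𝓝 (⟪ξ, ζ⟫).re) := by
    rw [show r = fun s => (⟪ξ, (x - f s) ξ⟫).re from funext hr]
    exact (Complex.continuous_re.tendsto _).comp (tendsto_const_nhds.inner hζ)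
  have h4 := ge_of_tendsto h3 (Eventually.of_forall fun s => hcon s)
  rw [hζ0, inner_zero_right, Complex.zero_re] at h4
  linarith
theorem vigier {S : SB} (hne : S.Nonempty) (hdir : DirectedOn (· ≤ ·) S) 
    (hx : IsLUB S x) (ξ : H) {ε : ℝ} (hε : 0 < ε) : ∃ s ∈ S, (⟪ξ, (x - s) ξ⟫).re < ε := by
  by_contra hcon
  push Not at hcon
  obtain ⟨s0, hs0⟩ := hne
  haveI : IsDirectedOrder S := ⟨fun a b => by
    obtain ⟨c, hc, h1, h2⟩ := hdir a.1 a.2 b.1 b.2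
    exact ⟨⟨c, hc⟩, h1, h2⟩⟩
  exact vigier_aux (fun s : S => s.1) (fun a b h => h) ⟨s0, hs0⟩ (by simpa using hx) ξ hε
    fun s => hcon s.1 s.2
variable {M : VonNeumannAlgebra H} (sf : StandardForm M)
theorem inner_conj_iso (J : H ≃ₗᵢ⋆[ℂ] H) (a b : H) : ⟪J a, J b⟫ = ⟪b, a⟫ := by
  have key : ∀ a b : H, (⟪J a, J b⟫).re = (⟪b, a⟫).re := fun a b => by
    have h1 := norm_add_sq (𝕜 := ℂ) (J a) (J b)
    have h2 := norm_add_sq (𝕜 := ℂ) b a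
    rw [← map_add, J.norm_map, J.norm_map, J.norm_map, add_comm a b, h2] at h1
    simp only [RCLike.re_to_complex] at h1
    linarith
  apply Complex.ext (key a b)
  have := key (Complex.I • a) b
  rw [map_smulₛₗ, inner_smul_left, inner_smul_right] at this
  simpa using this
namespace StandardForm
theorem Jsymm (ξ : H) : sf.J.symm ξ = sf.J ξ := by
  rw [LinearIsometryEquiv.symm_apply_eq, sf.J_involutive]
theorem inner_J (a b : H) : ⟪sf.J a, sf.J b⟫ = ⟪b, a⟫ := inner_conj_iso _ a b
theorem inner_J' (a b : H) : ⟪sf.J a, b⟫ = ⟪sf.J b, a⟫ := by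
  rw [← sf.inner_J, sf.J_involutive]
def c (x : BB) : BB := conjJ sf.J x
theorem c_apply (x : BB) (ξ : H) : sf.c x ξ = sf.J (x (sf.J ξ)) := by
  change sf.J (x (sf.J.symm ξ)) = _; rw [Jsymm]
theorem c_J (x : BB) (ξ : H) : sf.c x (sf.J ξ) = sf.J (x ξ) := by
  rw [c_apply, sf.J_involutive]
theorem J_c (x : BB) (ξ : H) : sf.J (sf.c x ξ) = x (sf.J ξ) := by
  rw [c_apply, sf.J_involutive]
theorem c_c (x : BB) : sf.c (sf.c x) = x := by
  ext ξ; rw [c_apply, c_apply, sf.J_involutive, sf.J_involutive]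
theorem c_mul (x y : BB) : sf.c (x * y) = sf.c x * sf.c y := by
  ext ξ; simp only [mapp, c_apply, sf.J_involutive]
theorem c_add (x y : BB) : sf.c (x + y) = sf.c x + sf.c y := by
  ext ξ; simp [c_apply]
theorem c_sub (x y : BB) : sf.c (x - y) = sf.c x - sf.c y := by
  ext ξ; simp [c_apply]
theorem c_one : sf.c 1 = 1 := by
  ext ξ; simp [c_apply, sf.J_involutive]
theorem c_zero : sf.c 0 = 0 := by
  ext ξ; simp [c_apply]
theorem c_star (x : BB) : sf.c (star x) = star (sf.c x) := by
  ext ξ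
  refine ext_inner_right ℂ fun η => ?_
  rw [star_inner, c_apply, c_apply, sf.inner_J', inner_star, ← sf.inner_J, sf.J_involutive]
theorem c_smul (a : ℂ) (x : BB) : sf.c (a • x) = (star a) • sf.c x := by
  ext ξ; simp [c_apply, map_smulₛₗ]
theorem c_inj (h : sf.c x = sf.c y) : x = y := by
  rw [← sf.c_c x, h, sf.c_c]
theorem c_proj (h : Pj p) : Pj (sf.c p) :=
  ⟨by rw [IsIdempotentElem, ← c_mul, proj_mul h], by rw [IsSelfAdjoint, ← c_star, star_proj h]⟩
theorem c_nonneg (h : 0 ≤ x) : 0 ≤ sf.c x := by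
  rw [nonneg_iff] at *
  intro ξ
  rw [c_apply, ← sf.inner_J, sf.J_involutive, sa_inner (sa_of_nonneg (nonneg_iff.2 h))]
  exact h _
theorem c_mem (h : x ∈ M) : sf.c x ∈ M.commutant := by
  have : sf.c x ∈ conjJ sf.J '' (M : SB) := ⟨x, h, rfl⟩
  rw [← sf.commutant_eq] at this
  exact comm_iff.2 fun y hy => this y hy
theorem c_mem' (h : y ∈ M.commutant) : sf.c y ∈ M := by
  have : y ∈ Set.centralizer (M : SB) := fun x hx => comm_iff.1 h x hx
  rw [sf.commutant_eq] at this
  obtain ⟨x, hx, rfl⟩ := this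
  change sf.c (sf.c x) ∈ M
  rw [c_c]; exact hx
theorem c_comm (hx : x ∈ M) (hy : y ∈ M) : x * sf.c y = sf.c y * x :=
  comm_iff.1 (sf.c_mem hy) x hx
theorem mem_cone {ξ : H} : ξ ∈ sf.cone ↔ ∀ η ∈ sf.cone, 0 ≤ ⟪ξ, η⟫ := by
  conv_lhs => rw [sf.selfdual]
  rfl
theorem cone_zero : (0 : H) ∈ sf.cone := sf.mem_cone.2 fun η _ => by simp
theorem cone_add {ξ η : H} (h : ξ ∈ sf.cone) (h' : η ∈ sf.cone) : ξ + η ∈ sf.cone :=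
  sf.mem_cone.2 fun ζ hζ => by
    rw [inner_add_left]; exact add_nonneg (sf.mem_cone.1 h ζ hζ) (sf.mem_cone.1 h' ζ hζ)
theorem cone_smul {ξ : H} (h : ξ ∈ sf.cone) {r : ℝ} (hr : 0 ≤ r) : r • ξ ∈ sf.cone :=
  sf.mem_cone.2 fun ζ hζ => by
    rw [show r • ξ = (r : ℂ) • ξ from rfl, inner_smul_left, Complex.conj_ofReal]
    exact mul_nonneg (by exact_mod_cast hr) (sf.mem_cone.1 h ζ hζ)
theorem cone_closed : IsClosed sf.cone := by
  have : sf.cone = ⋂ η ∈ sf.cone, {ξ | 0 ≤ ⟪ξ, η⟫} := by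
    ext ξ; simpa using sf.mem_cone
  rw [this]
  refine isClosed_biInter fun η _ => ?_
  have hc : Continuous fun ξ : H => ⟪ξ, η⟫ := by fun_prop
  exact isClosed_Ici.preimage hc
theorem cone_convex : Convex ℝ sf.cone := fun _ hx _ hy _ _ ha hb _ =>
  sf.cone_add (sf.cone_smul hx ha) (sf.cone_smul hy hb)
theorem cone_inv (hx : x ∈ M) {ξ : H} (h : ξ ∈ sf.cone) : x (sf.c x ξ) ∈ sf.cone :=
  sf.cone_invariant x hx ξ h
theorem cone_real {ξ η : H} (h : ξ ∈ sf.cone) (h' : η ∈ sf.cone) : 0 ≤ (⟪ξ, η⟫).re :=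
  (cL (sf.mem_cone.1 h η h')).1
theorem sform {ξ η : H} (hξ : ξ ∈ sf.cone) (hη : η ∈ sf.cone) :
    (∀ x ∈ M, 0 ≤ ⟪ξ, x (sf.c x η)⟫) ∧
    (∀ x ∈ M, ∀ y ∈ M, ⟪ξ, x (sf.c y η)⟫ = star ⟪ξ, y (sf.c x η)⟫) ∧
    ∀ x ∈ M, ∀ y ∈ M, ‖⟪ξ, y (sf.c x η)⟫‖ ^ 2 ≤
      (⟪ξ, x (sf.c x η)⟫).re * (⟪ξ, y (sf.c y η)⟫).re := by
  have h1 : ∀ x ∈ M, 0 ≤ ⟪ξ, x (sf.c x η)⟫ := fun x hx => sf.mem_cone.1 hξ _ (sf.cone_inv hx hη)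
  have h2 : ∀ x ∈ M, ∀ y ∈ M, ⟪ξ, x (sf.c y η)⟫ = star ⟪ξ, y (sf.c x η)⟫ := by
    intro x hx y hy
    have : star ⟪ξ, y (sf.c x η)⟫ = ⟪y (sf.c x η), ξ⟫ := inner_conj_symm _ _
    rw [this, ← mapp x, sf.c_comm hx hy, mapp, ← sf.inner_J, sf.J_c, sf.J_fixes_cone ξ hξ]
    have : sf.J (x η) = sf.c x η := by rw [← sf.c_J, sf.J_fixes_cone η hη]
    rw [this]
  refine ⟨h1, h2, fun x hx y hy => ?_⟩
  let V := (M.toStarSubalgebra.toSubalgebra.toSubmodule)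
  refine cs_form (V := V) (fun x y => ⟪ξ, y.1 (sf.c x.1 η)⟫) ?_ ?_ ?_ ?_ ⟨x, hx⟩ ⟨y, hy⟩
  · intro x y z; simp [inner_add_right]
  · intro c x y; simp [inner_smul_right]
  · intro x y; exact h2 x.1 x.2 y.1 y.2
  · intro x; exact h1 x.1 x.2
theorem _root_.AFP.nearest {K : Set H} (hne : K.Nonempty) (hcl : IsClosed K) (hc : Convex ℝ K)
    (ξ : H) : ∃ q ∈ K, ∀ k ∈ K, (⟪ξ - q, k - q⟫).re ≤ 0 := by
  letI : InnerProductSpace ℝ H := InnerProductSpace.rclikeToReal ℂ H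
  obtain ⟨q, hq, h⟩ := exists_norm_eq_iInf_of_complete_convex hne hcl.isComplete hc ξ
  refine ⟨q, hq, fun k hk => ?_⟩
  have := (norm_eq_iInf_iff_real_inner_le_zero hc hq).1 h k hk
  exact this
theorem moreau {ξ : H} (h : sf.J ξ = ξ) : ∃ a ∈ sf.cone, ∃ b ∈ sf.cone, ξ = a - b ∧ ⟪a, b⟫ = 0 := by
  obtain ⟨q, hq, hv⟩ := nearest ⟨0, sf.cone_zero⟩ sf.cone_closed sf.cone_convex ξ
  have e0 : (⟪ξ - q, q⟫).re = 0 := by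
    have h1 := hv 0 sf.cone_zero
    have h2 := hv (q + q) (sf.cone_add hq hq)
    simp only [zero_sub, inner_neg_right, Complex.neg_re, add_sub_cancel_right] at h1 h2
    linarith
  have him : ∀ η ∈ sf.cone, (⟪q - ξ, η⟫).im = 0 := fun η hη => by
    have h1 : ⟪q - ξ, η⟫ = ⟪η, q - ξ⟫ := by
      have := sf.inner_J (q - ξ) η
      rwa [map_sub, h, sf.J_fixes_cone q hq, sf.J_fixes_cone η hη] at this
    have h2 := inner_conj_symm (𝕜 := ℂ) (q - ξ) η
    rw [← h1] at h2
    have h3 := congrArg Complex.im h2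
    rw [Complex.conj_im] at h3
    linarith
  have hb : q - ξ ∈ sf.cone := sf.mem_cone.2 fun η hη => by
    refine Complex.le_def.2 ⟨?_, (him η hη).symm⟩
    have h1 := hv (q + η) (sf.cone_add hq hη)
    rw [add_sub_cancel_left] at h1
    rw [← neg_sub, inner_neg_left]
    rw [Complex.neg_re]
    exact neg_nonneg.2 h1
  refine ⟨q, hq, q - ξ, hb, by abel, ?_⟩
  have h1 := sf.mem_cone.1 hq _ hb
  have h2 := cL h1
  have h3 : ⟪q - ξ, q⟫ = 0 := by
    apply Complex.ext
    · rw [← neg_sub, inner_neg_left, Complex.neg_re, e0]; simp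
    · exact him q hq
  rw [← inner_conj_symm, h3, map_zero]
theorem cone_span (h : ∀ ξ ∈ sf.cone, T ξ = 0) : T = 0 := by
  have hr : ∀ ξ, sf.J ξ = ξ → T ξ = 0 := fun ξ hξ => by
    obtain ⟨a, ha, b, hb, rfl, -⟩ := sf.moreau hξ
    rw [map_sub, h a ha, h b hb, sub_zero]
  ext ξ
  have h1 := hr (ξ + sf.J ξ) (by rw [map_add, sf.J_involutive, add_comm])
  have h2 := hr (Complex.I • (ξ - sf.J ξ)) (by
    rw [map_smulₛₗ, map_sub, sf.J_involutive, ← neg_sub (sf.J ξ), smul_neg]; simp only [Complex.conj_I, neg_smul])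
  rw [map_smul, smul_eq_zero_iff_right Complex.I_ne_zero, map_sub, sub_eq_zero] at h2
  rw [map_add, ← h2, ← two_smul ℂ, smul_eq_zero_iff_right two_ne_zero] at h1
  simpa using h1
theorem zero_of_xJxJ (hx : x ∈ M) {ξ : H} (hξ : ξ ∈ sf.cone)
    (h : star x (x (sf.c (star x * x) ξ)) = 0) : x ξ = 0 := by
  have hm : star x * x ∈ M := mul_mem (star_mem hx) hx
  have h1 := (sf.sform hξ hξ).2.2 1 (one_mem M) _ hm
  rw [← mapp, ← mapp] at h
  rw [mapp, ] at h
  rw [h] at h1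
  simp only [inner_zero_right, Complex.zero_re, mul_zero] at h1
  rw [sf.c_one, Aone, normsq_inner] at h1
  have : ‖x ξ‖ ^ 2 = 0 := by
    have := pow_eq_zero_iff (two_ne_zero) |>.1 (le_antisymm h1 (sq_nonneg _))
    rw [norm_eq_zero] at this
    exact_mod_cast this
  simpa using this
theorem zero_of_pJpJ (hx : x ∈ M) (h : (star x * x) * sf.c (star x * x) = 0) : x = 0 :=
  sf.cone_span fun ξ hξ => sf.zero_of_xJxJ hx hξ (by
    have := congrArg (fun T : BB => T ξ) h
    simpa using this)
end StandardForm
def orb (N : VN H) (ξ : H) : Submodule ℂ H :=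
  (N.toStarSubalgebra.toSubalgebra.toSubmodule).map
    ((ContinuousLinearMap.apply ℂ H ξ : BB →L[ℂ] H) : BB →ₗ[ℂ] H)
theorem mem_orb {ξ η : H} : η ∈ orb N ξ ↔ ∃ x ∈ N, x ξ = η := Iff.rfl
theorem orb_mem (hx : x ∈ N) (ξ : H) : x ξ ∈ orb N ξ := mem_orb.2 ⟨x, hx, rfl⟩
theorem self_mem_orb (N : VN H) (ξ : H) : ξ ∈ orb N ξ := mem_orb.2 ⟨1, one_mem N, rfl⟩
theorem pr_orb_mem (N : VN H) (ξ : H) : pr (orb N ξ) ∈ N.commutant := by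
  refine pr_mem_vn fun y hy η hη => ?_
  rw [VonNeumannAlgebra.commutant_commutant] at hy
  obtain ⟨x, hx, rfl⟩ := mem_orb.1 hη
  exact Submodule.le_topologicalClosure _ (mem_orb.2 ⟨y * x, mul_mem hy hx, rfl⟩)
theorem pr_orb_mem' (N : VN H) (ξ : H) : pr (orb N.commutant ξ) ∈ N := by
  simpa using pr_orb_mem N.commutant ξ
theorem pr_orb_self (N : VN H) (ξ : H) : pr (orb N ξ) ξ = ξ := pr_apply (self_mem_orb N ξ)
theorem pr_orb_zero {ξ η : H} : pr (orb N ξ) η = 0 ↔ ∀ x ∈ N, ⟪x ξ, η⟫ = 0 := by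
  rw [pr_eq_zero]
  exact ⟨fun h x hx => h _ (orb_mem hx ξ), fun h z hz => by
    obtain ⟨x, hx, rfl⟩ := mem_orb.1 hz; exact h x hx⟩
theorem mul_pr_orb (hx : x ∈ N) {ξ : H} (h : x ξ = 0) :
    x * pr (orb N.commutant ξ) = 0 := by
  have := mul_pr_eq (K := orb N.commutant ξ) (S := x) (T := 0) (by
    intro η hη
    obtain ⟨y, hy, rfl⟩ := mem_orb.1 hη
    rw [← comm_app hy hx, h]; simp)
  simpa using this
theorem proj_norm_le (hp : Pj p) (ξ : H) : ‖p ξ‖ ≤ ‖ξ‖ := by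
  have h1 : ‖p‖ ≤ 1 := hp.norm_le
  calc ‖p ξ‖ ≤ ‖p‖ * ‖ξ‖ := p.le_opNorm ξ
    _ ≤ 1 * ‖ξ‖ := by gcongr
    _ = _ := one_mul _
theorem mul_pr_span {G : Set H} (h : ∀ z ∈ G, S z = T z) :
    S * pr (Submodule.span ℂ G) = T * pr (Submodule.span ℂ G) := by
  refine mul_pr_eq fun ξ hξ => ?_
  have : Submodule.span ℂ G ≤ (S - T).ker :=
    Submodule.span_le.2 fun z hz => by
      change (S - T) z = 0
      rw [Asub, h z hz, sub_self]
  have h1 : (S - T) ξ = 0 := this hξ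
  rwa [Asub, sub_eq_zero] at h1
theorem pr_span_mem {G : Set H}
    (h : ∀ y ∈ N.commutant, ∀ ξ ∈ G, y ξ ∈ Submodule.span ℂ G) : pr (Submodule.span ℂ G) ∈ N := by
  refine pr_mem_vn fun y hy ξ hξ => Submodule.le_topologicalClosure _ ?_
  have : Submodule.span ℂ G ≤ (Submodule.span ℂ G).comap (y : H →ₗ[ℂ] H) :=
    Submodule.span_le.2 fun z hz => h y hy z hz
  exact this hξ
def orbG (N : VN H) (S : Set H) : Set H := {z | ∃ a ∈ S, ∃ y ∈ N, y a = z}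
theorem pr_orbG_mem (N : VN H) (S : Set H) : pr (Submodule.span ℂ (orbG N.commutant S)) ∈ N :=
  pr_span_mem fun y hy _ ⟨a, ha, x, hx, h⟩ =>
    Submodule.subset_span ⟨a, ha, y * x, mul_mem hy hx, by rw [← h]; rfl⟩
theorem mul_pr_orbG {S : Set H} (hx : x ∈ N) (h : ∀ a ∈ S, x a = 0) :
    x * pr (Submodule.span ℂ (orbG N.commutant S)) = 0 := by
  have := mul_pr_span (G := orbG N.commutant S) (S := x) (T := 0) (by
    rintro _ ⟨a, ha, y, hy, rfl⟩
    rw [← comm_app hy hx, h a ha]; simp)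
  simpa using this
theorem pr_orbG_self {S : Set H} {a : H} (ha : a ∈ S) :
    pr (Submodule.span ℂ (orbG N S)) a = a :=
  pr_apply (Submodule.subset_span ⟨a, ha, 1, one_mem N, rfl⟩)
variable {M : VonNeumannAlgebra H} (sf : StandardForm M)
namespace StandardForm
theorem J_cone_app {ξ : H} (h : ξ ∈ sf.cone) (x : BB) : sf.J (x ξ) = sf.c x ξ := by
  rw [← sf.c_J, sf.J_fixes_cone ξ h]
theorem cone_orth {a b : H} (ha : a ∈ sf.cone) (hb : b ∈ sf.cone) (h : ⟪a, b⟫ = 0) 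
    (hx : x ∈ M) : ⟪a, x b⟫ = 0 := by
  have h1 := (sf.sform ha hb).2.2 1 (one_mem M) x hx
  rw [sf.c_one] at h1
  simp only [Aone, h, Complex.zero_re, zero_mul] at h1
  simpa using le_antisymm h1 (sq_nonneg _)
theorem cone_orth' {a b : H} (ha : a ∈ sf.cone) (hb : b ∈ sf.cone) (h : ⟪a, b⟫ = 0) 
    (hy : y ∈ M.commutant) : ⟪a, y b⟫ = 0 := by
  have h1 := sf.cone_orth ha hb h (sf.c_mem' hy)
  rw [← sf.J_cone_app hb, ← sf.J_fixes_cone a ha, sf.inner_J] at h1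
  rw [← inner_conj_symm, h1, map_zero]
theorem cone_orth_pr {a b : H} (ha : a ∈ sf.cone) (hb : b ∈ sf.cone) (h : ⟪a, b⟫ = 0) :
    pr (orb M.commutant a) b = 0 := by
  rw [pr_orb_zero]
  intro y hy
  rw [← inner_star]
  exact sf.cone_orth' ha hb h (star_mem hy)
theorem powers_stormer {ξ η : H} (hξ : ξ ∈ sf.cone) (hη : η ∈ sf.cone) {δ : ℝ}
    (h : ∀ x ∈ M, (∀ ζ, ‖x ζ‖ ≤ ‖ζ‖) → (⟪ξ, x ξ⟫).re - (⟪η, x η⟫).re ≤ δ) : ‖ξ - η‖ ^ 2 ≤ δ := by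
  obtain ⟨a, ha, b, hb, hab, h0⟩ := sf.moreau (ξ := ξ - η) (by
    rw [map_sub, sf.J_fixes_cone ξ hξ, sf.J_fixes_cone η hη])
  have h0' : ⟪b, a⟫ = 0 := by rw [← inner_conj_symm, h0, map_zero]
  set e := pr (orb M.commutant a)
  set f := pr (orb M.commutant b)
  have he : e ∈ M := pr_orb_mem' M a
  have hf : f ∈ M := pr_orb_mem' M b
  have hfe : f * e = 0 := mul_pr_orb hf (sf.cone_orth_pr hb ha h0')
  have hx1 : (e - f) (ξ - η) = a + b := by
    rw [hab]
    simp only [Asub, map_sub]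
    rw [show e a = a from pr_orb_self _ a, show f b = b from pr_orb_self _ b,
      show e b = 0 from sf.cone_orth_pr ha hb h0, show f a = 0 from sf.cone_orth_pr hb ha h0']
    abel
  have hsa : IsSelfAdjoint (e - f) := (pr_proj _).isSelfAdjoint.sub (pr_proj _).isSelfAdjoint
  have hn : ∀ ζ, ‖(e - f) ζ‖ ≤ ‖ζ‖ := by
    intro ζ
    have hef : e * f = 0 := by
      simpa [star_proj (pr_proj (orb M.commutant a)), star_proj (pr_proj (orb M.commutant b)), e, f]
        using congrArg star hfe
    have hee : e * e = e := proj_mul (pr_proj _)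
    have hff : f * f = f := proj_mul (pr_proj _)
    have hp : Pj (e + f) := ⟨by
      rw [IsIdempotentElem, add_mul, mul_add, mul_add, hee, hff, hef, hfe]; simp,
      (pr_proj _).isSelfAdjoint.add (pr_proj _).isSelfAdjoint⟩
    have h1 : star (e - f) * (e - f) = star (e + f) * (e + f) := by
      rw [hsa.star_eq, hp.isSelfAdjoint.star_eq, sub_mul, mul_sub, mul_sub, add_mul, mul_add, mul_add,
        hee, hff, hef, hfe]; simp
    have h2 := normsq_inner (e - f) ζ
    rw [h1, normsq_inner] at h2
    have h3 : ‖(e + f) ζ‖ ^ 2 = ‖(e - f) ζ‖ ^ 2 := by exact_mod_cast h2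
    rw [← (sq_eq_sq₀ (norm_nonneg _) (norm_nonneg _)).1 h3]
    exact proj_norm_le hp ζ
  have h1 := h (e - f) (sub_mem he hf) hn
  have h2 : (⟪ξ, (e - f) ξ⟫).re - (⟪η, (e - f) η⟫).re = (⟪a + b, ξ + η⟫).re := by
    rw [← hx1, sa_inner hsa]
    simp only [inner_sub_left, map_add, inner_add_right, Complex.add_re, Complex.sub_re]
    have : (⟪η, (e - f) ξ⟫).re = (⟪ξ, (e - f) η⟫).re := by
      rw [← sa_inner hsa, ← inner_conj_symm, Complex.conj_re]
    linarith
  have h3 : ‖ξ - η‖ ^ 2 = (⟪a - b, ξ - η⟫).re := by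
    rw [← hab]; exact (inner_self_eq_norm_sq (𝕜 := ℂ) _).symm
  have h4 := sf.cone_real ha hη
  have h5 := sf.cone_real hb hξ
  rw [h2] at h1
  simp only [inner_add_left, inner_add_right, inner_sub_left, inner_sub_right, Complex.add_re,
    Complex.sub_re] at h1 h3
  linarith
theorem cone_sum {ι : Type*} {f : ι → H} (hf : ∀ i, f i ∈ sf.cone) {x : H} (h : HasSum f x) :
    x ∈ sf.cone := by
  refine sf.cone_closed.mem_of_tendsto h (Eventually.of_forall fun s => ?_)
  classical
  induction s using Finset.induction_on with
  | empty => simpa using sf.cone_zero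
  | insert a s ha ih => rw [Finset.sum_insert ha]; exact sf.cone_add (hf a) ih
theorem sep_aux {S : Set H} (hS1 : ∀ a ∈ S, a ∈ sf.cone ∧ ‖a‖ = 1)
    (hS3 : ∀ a, (a ∈ sf.cone ∧ ‖a‖ = 1) → (∀ b ∈ S, ⟪a, b⟫ = 0 ∧ ⟪b, a⟫ = 0) → a ∈ S) :
    pr (Submodule.span ℂ (orbG M.commutant S)) = 1 := by
  have hpM := pr_orbG_mem M S
  set p := pr (Submodule.span ℂ (orbG M.commutant S))
  have hp1 : Pj (1 - p) := (pr_proj _).one_sub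
  have hq : 1 - p ∈ M := sub_mem (one_mem M) hpM
  by_contra hne
  have : ¬ ((1 - p) * sf.c (1 - p) = 0) := fun h => by
    have := sf.zero_of_pJpJ hq (by rwa [star_proj hp1, proj_mul hp1])
    exact hne (sub_eq_zero.1 this).symm
  have : ∃ ζ ∈ sf.cone, ((1 - p) * sf.c (1 - p)) ζ ≠ 0 := by
    by_contra hh
    push Not at hh
    exact this (sf.cone_span hh)
  obtain ⟨ζ, hζ, hne'⟩ := this
  set η := ((1 - p) * sf.c (1 - p)) ζ
  have hη : η ∈ sf.cone := sf.cone_inv hq hζ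
  have hpη : p η = 0 := by
    have : p * (1 - p) = 0 := by rw [mul_sub, proj_mul (pr_proj _), mul_one, sub_self]
    change (p * (1 - p)) _ = 0
    rw [this]; rfl
  have horth : ∀ b ∈ S, ⟪b, η⟫ = 0 := fun b hb => by
    have hpb : p b = b := pr_orbG_self hb
    rw [← hpb, sa_inner (pr_proj _).isSelfAdjoint, hpη, inner_zero_right]
  let η' := (‖η‖⁻¹ : ℝ) • η
  have hη' : η' ∈ S := by
    refine hS3 η' ⟨sf.cone_smul hη (by positivity), ?_⟩ fun b hb => ?_
    · simp only [η', norm_smul, norm_inv, norm_norm]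
      exact inv_mul_cancel₀ (norm_ne_zero_iff.2 hne')
    · have h1 : ⟪b, η'⟫ = 0 := by
        rw [show η' = ((‖η‖⁻¹ : ℝ) : ℂ) • η from rfl, inner_smul_right, horth b hb, mul_zero]
      exact ⟨by rw [← inner_conj_symm, h1, map_zero], h1⟩
  have h1 := horth η' hη'
  rw [show η' = ((‖η‖⁻¹ : ℝ) : ℂ) • η from rfl, inner_smul_left, mul_eq_zero] at h1
  rcases h1 with h1 | h1
  · simp at h1; exact hne' h1
  · exact hne' (inner_self_eq_zero.1 h1)
theorem sep_sum {ι : Type*} [Countable ι] (a : ι → H) (h1 : ∀ i, a i ∈ sf.cone ∧ ‖a i‖ = 1)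
    (h2 : ∀ i j, i ≠ j → ⟪a i, a j⟫ = 0) :
    ∃ ξ ∈ sf.cone, ∀ x ∈ M, x ξ = 0 → ∀ i, x (a i) = 0 := by
  obtain ⟨f, hf⟩ := exists_injective_nat ι
  obtain ⟨w, hw0⟩ : ∃ w : ι → H, ∀ i, w i = (((1 / 2 : ℝ) ^ f i : ℝ) : ℂ) • a i :=
    ⟨_, fun _ => rfl⟩
  have hwc : ∀ i, w i ∈ sf.cone := fun i => by
    rw [hw0]; exact sf.cone_smul (r := (1 / 2 : ℝ) ^ f i) (h1 i).1 (by positivity)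
  have hw : Summable w := by
    refine Summable.of_norm ?_
    have : (fun i => ‖w i‖) = (fun n : ℕ => (1 / 2 : ℝ) ^ n) ∘ f := by
      funext i
      rw [hw0, norm_smul, (h1 i).2, mul_one, Function.comp]
      simp
    rw [this]
    exact summable_geometric_two.comp_injective hf
  obtain ⟨ξ, hξ⟩ := hw
  have hξc := sf.cone_sum hwc hξ
  refine ⟨ξ, hξc, fun x hx h0 i => ?_⟩
  have hsw : pr (orb M.commutant (a i)) ξ = w i := by
    refine (hξ.mapL (pr (orb M.commutant (a i)))).unique ?_
    have e1 : pr (orb M.commutant (a i)) (w i) = w i := by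
      rw [hw0, map_smul, pr_orb_self]
    conv => arg 2; rw [← e1]
    refine hasSum_single i fun j hj => ?_
    rw [hw0, map_smul, sf.cone_orth_pr (h1 i).1 (h1 j).1 (h2 i j hj.symm), smul_zero]
  have h3 : sf.c (pr (orb M.commutant (a i))) ξ = w i := by
    rw [← sf.J_cone_app hξc, hsw, sf.J_fixes_cone _ (hwc i)]
  have h4 : x (w i) = 0 := by
    rw [← h3, ← comm_app (sf.c_mem (pr_orb_mem' M (a i))) hx, h0, map_zero]
  rw [hw0, map_smul, smul_eq_zero] at h4
  refine h4.resolve_left ?_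
  exact_mod_cast (by positivity : ((1 / 2 : ℝ) ^ f i) ≠ 0)
theorem exists_sep (hσ : SigmaFinite (M : SB)) :
    ∃ ξ ∈ sf.cone, ∀ x ∈ M, x ξ = 0 → x = 0 := by
  obtain ⟨S, hS1, hS2, hS3⟩ := zorn_family (fun ζ : H => ζ ∈ sf.cone ∧ ‖ζ‖ = 1)
    (fun a b => ⟪a, b⟫ = 0)
  have hne : ∀ a ∈ S, a ≠ 0 := fun a ha h => by
    have := (hS1 a ha).2
    rw [h, norm_zero] at this
    exact zero_ne_one this
  have hs0 : ∀ a ∈ S, ∀ b ∈ S, a ≠ b → pr (orb M.commutant a) b = 0 := fun a ha b hb hab =>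
    sf.cone_orth_pr (hS1 a ha).1 (hS1 b hb).1 (hS2 ha hb hab)
  have hinj : Set.InjOn (fun a => pr (orb M.commutant a)) S := fun a ha b hb hab => by
    by_contra hne'
    have h1 := hs0 a ha b hb hne'
    change pr _ = pr _ at hab
    rw [hab, pr_orb_self] at h1
    exact hne b hb h1
  have hcount : S.Countable := by
    refine Set.countable_of_injective_of_countable_image hinj (hσ _ ?_ ?_ ?_)
    · rintro _ ⟨a, _, rfl⟩; exact pr_orb_mem' M a
    · rintro _ ⟨a, ha, rfl⟩
      refine ⟨⟨(pr_proj _).isSelfAdjoint, (pr_proj _).isIdempotentElem⟩, fun h0 => ?_⟩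
      have h1 := pr_orb_self M.commutant a
      change pr _ = 0 at h0
      rw [h0] at h1
      exact hne a ha h1.symm
    · rintro _ ⟨a, ha, rfl⟩ _ ⟨b, hb, rfl⟩ hne'
      exact mul_pr_orb (pr_orb_mem' M a) (hs0 a ha b hb fun h => hne' (by rw [h]))
  haveI := hcount.to_subtype
  obtain ⟨ξ, hξ, h⟩ := sf.sep_sum (fun i : S => i.1) (fun i => hS1 i.1 i.2)
    (fun i j hij => hS2 i.2 j.2 (fun h => hij (Subtype.ext h)))
  refine ⟨ξ, hξ, fun x hx h0 => ?_⟩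
  have h1 := mul_pr_orbG hx (S := S) (fun a ha => h x hx h0 ⟨a, ha⟩)
  rwa [sf.sep_aux hS1 hS3, mul_one] at h1
end StandardForm
def osum {ι : Type*} (p : ι → BB) : BB := pr (Submodule.span ℂ {z | ∃ i, p i z = z})
section osum
variable {ι : Type*} {p : ι → BH H}
theorem osum_proj : Pj (osum p) := pr_proj _
theorem mul_osum (hp : ∀ i, Pj (p i)) (h : ∀ i, S * p i = T * p i) :
    S * osum p = T * osum p := mul_pr_span (by
  rintro z ⟨i, hz⟩
  rw [← hz, ← mapp, ← mapp, h i])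
theorem osum_mul (hp : ∀ i, Pj (p i)) (i : ι) : osum p * p i = p i := by
  ext ξ
  exact pr_apply (Submodule.subset_span ⟨i, by
    change (p i * p i) ξ = p i ξ; rw [proj_mul (hp i)]⟩)
theorem mul_osum' (hp : ∀ i, Pj (p i)) (i : ι) : p i * osum p = p i := by
  simpa [star_proj (hp i), star_proj (osum_proj (p := p))] using congrArg star (osum_mul hp i)
theorem osum_mem (h : ∀ i, p i ∈ N) : osum p ∈ N :=
  pr_span_mem fun y hy z ⟨i, hz⟩ => Submodule.subset_span ⟨i, by
    rw [← comm_app hy (h i), hz]⟩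
theorem psum_proj (hp : ∀ i, Pj (p i)) (ho : ∀ i j, i ≠ j → p i * p j = 0)
    (t : Finset ι) : Pj (∑ i ∈ t, p i) := by
  classical
  refine ⟨?_, ?_⟩
  · rw [IsIdempotentElem, Finset.sum_mul_sum]
    refine Finset.sum_congr rfl fun i hi => ?_
    rw [Finset.sum_eq_single i (fun j _ hj => ho i j hj.symm) (fun h => absurd hi h), proj_mul (hp i)]
  · rw [IsSelfAdjoint, star_sum]
    exact Finset.sum_congr rfl fun i _ => star_proj (hp i)
theorem osum_hasSum (hp : ∀ i, Pj (p i)) (ho : ∀ i j, i ≠ j → p i * p j = 0) (v : H) :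
    HasSum (fun i => p i v) (osum p v) := by
  classical
  have key : ∀ η ∈ Submodule.span ℂ {z | ∃ i, p i z = z}, ∃ t0 : Finset ι, ∀ t, t0 ⊆ t →
      (∑ i ∈ t, p i) η = η := by
    intro η hη
    induction hη using Submodule.span_induction with
    | mem z hz =>
      obtain ⟨i, hz⟩ := hz
      refine ⟨{i}, fun t ht => ?_⟩
      rw [← hz, ← mapp, Finset.sum_mul, Finset.sum_eq_single i (fun j _ hj => ho j i hj)
        (fun h => absurd (ht (Finset.mem_singleton_self i)) h), proj_mul (hp i)]
    | zero => exact ⟨∅, fun t _ => by simp⟩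
    | add x y _ _ hx hy =>
      obtain ⟨t1, h1⟩ := hx
      obtain ⟨t2, h2⟩ := hy
      exact ⟨t1 ∪ t2, fun t ht => by
        rw [map_add, h1 t (Finset.union_subset_left ht), h2 t (Finset.union_subset_right ht)]⟩
    | smul a x _ hx =>
      obtain ⟨t1, h1⟩ := hx
      exact ⟨t1, fun t ht => by rw [map_smul, h1 t ht]⟩
  rw [HasSum, SummationFilter.unconditional_filter, Metric.tendsto_atTop]
  intro ε hε
  have h1 : osum p v ∈ (Submodule.span ℂ {z | ∃ i, p i z = z}).topologicalClosure := pr_mem _ v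
  obtain ⟨η, hη, hd⟩ := Metric.mem_closure_iff.1 h1 ε hε
  obtain ⟨t0, ht0⟩ := key η hη
  refine ⟨t0, fun t ht => ?_⟩
  have hq := psum_proj hp ho t
  have e1 : (∑ i ∈ t, p i v) = (∑ i ∈ t, p i) (osum p v) := by
    rw [← mapp, Finset.sum_mul, Finset.sum_congr rfl (fun i _ => mul_osum' hp i)]; simp
  have e2 : osum p v - (∑ i ∈ t, p i v) = (1 - ∑ i ∈ t, p i) (osum p v - η) := by
    rw [map_sub, Asub, Asub, ← e1, ht0 t ht]; simp
  rw [dist_comm, dist_eq_norm, e2]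
  refine (proj_norm_le hq.one_sub _).trans_lt ?_
  rwa [← dist_eq_norm]
theorem proj_normsq (hq : Pj q) (v : H) : ⟪v, q v⟫ = ((‖q v‖ ^ 2 : ℝ) : ℂ) := by
  rw [← normsq_inner, star_proj hq, proj_mul hq]
theorem osum_normsq (hp : ∀ i, Pj (p i)) (ho : ∀ i j, i ≠ j → p i * p j = 0) (v : H) :
    HasSum (fun i => ‖p i v‖ ^ 2) (‖osum p v‖ ^ 2) := by
  have h1 := (osum_hasSum hp ho v).mapL (innerSL ℂ v)
  simp only [innerSL_apply_apply, proj_normsq (hp _), proj_normsq osum_proj] at h1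
  exact_mod_cast h1
theorem psum_le (hp : ∀ i, Pj (p i)) (ho : ∀ i j, i ≠ j → p i * p j = 0)
    (t : Finset ι) : ∑ i ∈ t, p i ≤ osum p := by
  rw [le_iff]
  intro v
  rw [proj_normsq (psum_proj hp ho t), proj_normsq osum_proj]
  have : (∑ i ∈ t, p i) v = (∑ i ∈ t, p i) (osum p v) := by
    rw [← mapp, Finset.sum_mul, Finset.sum_congr rfl (fun i _ => mul_osum' hp i)]
  rw [this]
  have := proj_norm_le (psum_proj hp ho t) (osum p v)
  exact_mod_cast pow_le_pow_left₀ (norm_nonneg _) this 2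
theorem proj_nonneg (hq : Pj q) : 0 ≤ q := hq.nonneg
theorem osum_lub (hp : ∀ i, Pj (p i)) (ho : ∀ i j, i ≠ j → p i * p j = 0) :
    IsLUB (Set.range fun t : Finset ι => ∑ i ∈ t, p i) (osum p) := by
  refine ⟨by rintro _ ⟨t, rfl⟩; exact psum_le hp ho t, fun y hy => ?_⟩
  rw [le_iff]
  intro v
  have h1 := (osum_hasSum hp ho v).mapL (innerSL ℂ v)
  refine le_of_tendsto h1 (Eventually.of_forall fun t => ?_)
  have h2 := le_iff.1 (hy ⟨t, rfl⟩) v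
  simpa using h2
theorem psum_directed (hp : ∀ i, Pj (p i)) :
    DirectedOn (· ≤ ·) (Set.range fun t : Finset ι => ∑ i ∈ t, p i) := by
  classical
  rintro _ ⟨s, rfl⟩ _ ⟨t, rfl⟩
  refine ⟨_, ⟨s ∪ t, rfl⟩, ?_, ?_⟩
  · exact Finset.sum_le_sum_of_subset_of_nonneg Finset.subset_union_left fun i _ _ => proj_nonneg (hp i)
  · exact Finset.sum_le_sum_of_subset_of_nonneg Finset.subset_union_right fun i _ _ => proj_nonneg (hp i)
end osum
structure NF (N : VN H) (φ : BB → ℂ) : Prop where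
  add : ∀ x ∈ N, ∀ y ∈ N, φ (x + y) = φ x + φ y
  smul : ∀ (c : ℂ), ∀ x ∈ N, φ (c • x) = c * φ x
  pos : ∀ x ∈ N, 0 ≤ x → 0 ≤ φ x
  normal : ∀ S : SB, S ⊆ N → S.Nonempty → DirectedOn (· ≤ ·) S → ∀ x ∈ N, IsLUB S x →
    ∀ ε : ℝ, 0 < ε → ∃ s ∈ S, (φ x).re - (φ s).re < ε
theorem herm_of_pos {φ : BB → ℂ} (hadd : ∀ x ∈ N, ∀ y ∈ N, φ (x + y) = φ x + φ y)
    (hsmul : ∀ (c : ℂ), ∀ x ∈ N, φ (c • x) = c * φ x) (hpos : ∀ x ∈ N, 0 ≤ φ (star x * x))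
    (hx : x ∈ N) (hy : y ∈ N) : φ (star y * x) = star (φ (star x * y)) := by
  have hm : ∀ {a b : BB}, a ∈ N → b ∈ N → star a * b ∈ N := fun ha hb => mul_mem (star_mem ha) hb
  have h1 : (φ (star x * y) + φ (star y * x)).im = 0 := by
    have e : star (x + y) * (x + y) = (star x * x + star y * y) + (star x * y + star y * x) := by
      rw [star_add]; noncomm_ring
    have h := hpos _ (add_mem hx hy)
    rw [e, hadd _ (add_mem (hm hx hx) (hm hy hy)) _ (add_mem (hm hx hy) (hm hy hx)),
      hadd _ (hm hx hx) _ (hm hy hy), hadd _ (hm hx hy) _ (hm hy hx)] at h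
    have h2 := (cL h).2
    have h3 := (cL (hpos x hx)).2
    have h4 := (cL (hpos y hy)).2
    simp only [Complex.add_im, Complex.zero_im] at h2 h3 h4 ⊢
    linarith
  have h2 : (φ (star x * y) - φ (star y * x)).re = 0 := by
    have e : star (x + Complex.I • y) * (x + Complex.I • y) = (star x * x + star y * y) +
        (Complex.I • (star x * y) + (-Complex.I) • (star y * x)) := by
      rw [star_add, star_smul, add_mul, mul_add, mul_add, smul_mul_assoc, mul_smul_comm,
        smul_mul_assoc, mul_smul_comm, smul_smul]
      simp only [RCLike.star_def, Complex.conj_I, neg_mul, Complex.I_mul_I, neg_neg, one_smul]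
      abel
    have hIy := vn_smul Complex.I hy
    have h := hpos _ (add_mem hx hIy)
    rw [e, hadd _ (add_mem (hm hx hx) (hm hy hy)) _ (add_mem (vn_smul _ (hm hx hy)) (vn_smul _ (hm hy hx))),
      hadd _ (hm hx hx) _ (hm hy hy), hadd _ (vn_smul _ (hm hx hy)) _ (vn_smul _ (hm hy hx)),
      hsmul _ _ (hm hx hy), hsmul _ _ (hm hy hx)] at h
    have h2 := (cL h).2
    have h3 := (cL (hpos x hx)).2
    have h4 := (cL (hpos y hy)).2
    simp only [Complex.add_im, Complex.zero_im, Complex.mul_im, Complex.I_re, Complex.I_im,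
      Complex.neg_re, Complex.neg_im, Complex.sub_re] at h2 h3 h4 ⊢
    linarith
  apply Complex.ext
  · rw [Complex.sub_re] at h2
    rw [RCLike.star_def, Complex.conj_re]; linarith
  · rw [Complex.add_im] at h1
    rw [RCLike.star_def, Complex.conj_im]; linarith
theorem cs_pos {φ : BB → ℂ} (hadd : ∀ x ∈ N, ∀ y ∈ N, φ (x + y) = φ x + φ y)
    (hsmul : ∀ (c : ℂ), ∀ x ∈ N, φ (c • x) = c * φ x) (hpos : ∀ x ∈ N, 0 ≤ φ (star x * x))
    (hx : x ∈ N) (hy : y ∈ N) :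
    ‖φ (star x * y)‖ ^ 2 ≤ (φ (star x * x)).re * (φ (star y * y)).re := by
  have hm : ∀ {a b : BB}, a ∈ N → b ∈ N → star a * b ∈ N := fun ha hb => mul_mem (star_mem ha) hb
  refine cs_form (V := N.toStarSubalgebra.toSubalgebra.toSubmodule)
    (fun x y => φ (star x.1 * y.1)) ?_ ?_ ?_ ?_ ⟨x, hx⟩ ⟨y, hy⟩
  · intro x y z
    rw [Submodule.coe_add, mul_add, hadd _ (hm x.2 y.2) _ (hm x.2 z.2)]
  · intro c x y
    rw [Submodule.coe_smul, mul_smul_comm, hsmul _ _ (hm x.2 y.2)]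
  · intro x y; exact herm_of_pos hadd hsmul hpos x.2 y.2
  · intro x; exact hpos x.1 x.2
namespace NF
variable {φ : BH H → ℂ}
theorem pos' (h : NF N φ) (hx : x ∈ N) : 0 ≤ φ (star x * x) :=
  h.pos _ (mul_mem (star_mem hx) hx) (star_mul_self_nonneg x)
theorem cs (h : NF N φ) (hx : x ∈ N) (hy : y ∈ N) :
    ‖φ (star x * y)‖ ^ 2 ≤ (φ (star x * x)).re * (φ (star y * y)).re :=
  cs_pos h.add h.smul (fun _ => h.pos') hx hy
theorem zero (h : NF N φ) : φ 0 = 0 := by simpa using h.smul 0 0 (zero_mem N)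
theorem sub (h : NF N φ) (hx : x ∈ N) (hy : y ∈ N) : φ (x - y) = φ x - φ y := by
  have := h.add (x - y) (sub_mem hx hy) y hy
  rw [sub_add_cancel] at this
  rw [this]; ring
theorem mono (h : NF N φ) (hx : x ∈ N) (hy : y ∈ N) (hxy : x ≤ y) : (φ x).re ≤ (φ y).re := by
  have := h.pos (y - x) (sub_mem hy hx) (sub_nonneg.2 hxy)
  rw [h.sub hy hx] at this
  have := (cL this).1
  rw [Complex.sub_re, Complex.zero_re] at this
  linarith
theorem real (h : NF N φ) (hx : x ∈ N) (h0 : 0 ≤ x) : φ x = ((φ x).re : ℂ) := by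
  apply Complex.ext (by simp)
  rw [Complex.ofReal_im]
  exact (cL (h.pos x hx h0)).2.symm
theorem osum_approx (h : NF N φ) {ι : Type*} {p : ι → BB} (hp : ∀ i, Pj (p i))
    (ho : ∀ i j, i ≠ j → p i * p j = 0) (hN : ∀ i, p i ∈ N) {ε : ℝ} (hε : 0 < ε) :
    ∃ t : Finset ι, (φ (AFP.osum p)).re - (φ (∑ i ∈ t, p i)).re < ε := by
  obtain ⟨_, ⟨t, rfl⟩, ht⟩ := h.normal _ (by rintro _ ⟨t, rfl⟩; exact sum_mem fun i _ => hN i)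
    (Set.range_nonempty _) (psum_directed hp) _ (osum_mem hN) (osum_lub hp ho) ε hε
  exact ⟨t, ht⟩
theorem sum (h : NF N φ) {ι : Type*} {p : ι → BB} (hN : ∀ i, p i ∈ N) (t : Finset ι) :
    φ (∑ i ∈ t, p i) = ∑ i ∈ t, φ (p i) := by
  classical
  induction t using Finset.induction_on with
  | empty => simpa using h.zero
  | insert a s ha ih =>
    rw [Finset.sum_insert ha, Finset.sum_insert ha, h.add _ (hN a) _ (sum_mem fun i _ => hN i), ih]
end NF
theorem proj_sub (hp : Pj p) (hq : Pj q) (h : q * p = p) :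
    Pj (q - p) := by
  have h' : p * q = p := by simpa [star_proj hp, star_proj hq] using congrArg star h
  exact ⟨by rw [IsIdempotentElem, sub_mul, mul_sub, mul_sub, proj_mul hp, proj_mul hq, h, h']; simp,
    hq.isSelfAdjoint.sub hp.isSelfAdjoint⟩
theorem proj_swap (hp : Pj p) (hq : Pj q) (h : q * p = p) :
    p * q = p := by simpa [star_proj hp, star_proj hq] using congrArg star h
theorem proj_le (hp : Pj p) (hq : Pj q) (h : q * p = p) :
    p ≤ q := sub_nonneg.1 (proj_nonneg (proj_sub hp hq h))
theorem max_proj (N : VN H) (good : BB → Prop) :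
    ∃ S : SB, (∀ p ∈ S, Pj p ∧ p ∈ N ∧ s * p = p ∧ good p) ∧
      (∀ p q : S, p ≠ q → p.1 * q.1 = 0) ∧
      ∀ p, Pj p → p ∈ N → s * p = p → good p → osum (fun i : S => i.1) * p = 0 → p = 0 := by
  obtain ⟨S, h1, h2, h3⟩ := zorn_family
    (fun p : BB => Pj p ∧ p ∈ N ∧ s * p = p ∧ good p) (fun p q => p * q = 0)
  refine ⟨S, h1, fun p q hpq => h2 p.2 q.2 fun h => hpq (Subtype.ext h), fun p hp hN hs hg h0 => ?_⟩
  have hS : ∀ i : S, Pj i.1 := fun i => (h1 i.1 i.2).1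
  have hb : ∀ b ∈ S, b * p = 0 := fun b hb => by
    have e : b * osum (fun i : S => i.1) = b := mul_osum' (p := fun i : S => i.1) hS ⟨b, hb⟩
    rw [← e, mul_assoc, h0, mul_zero]
  have hm := h3 p ⟨hp, hN, hs, hg⟩ fun b hb' => ⟨by
    simpa [star_proj hp, star_proj (h1 b hb').1] using congrArg star (hb b hb'), hb b hb'⟩
  rw [← hb p hm, proj_mul hp]
theorem osum_le {ι : Type*} {p : ι → BB} (hp : ∀ i, Pj (p i)) 
    (h : ∀ i, s * p i = p i) : s * osum p = osum p := by
  have := mul_osum (S := s) (T := 1) hp (fun i => by rw [h i, one_mul])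
  rwa [one_mul] at this
theorem NF.real_pos {φ : BB → ℂ} (h : NF N φ) (hp : p ∈ N) (h0 : 0 ≤ p) :
    0 ≤ (φ p).re := (cL (h.pos p hp h0)).1
theorem local_dom {δ : BB → ℂ} (h : NF N δ) (h1 : δ 1 ≠ 0) {ξ : H}
    (hsep : ∀ x ∈ N, x ξ = 0 → x = 0) : ∃ q ∈ N, ∃ C : ℝ, Pj q ∧ 0 < C ∧ δ q ≠ 0 ∧
      ∀ p ∈ N, Pj p → q * p = p → (δ p).re ≤ C * ‖p ξ‖ ^ 2 := by
  obtain ⟨S, hS1, hS2, hS3⟩ := max_proj N (s := 1) (fun p => δ p = 0)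
  have hSp : ∀ i : S, Pj i.1 := fun i => (hS1 i.1 i.2).1
  have hSN : ∀ i : S, i.1 ∈ N := fun i => (hS1 i.1 i.2).2.1
  obtain ⟨z, hz⟩ : ∃ z, z = osum (fun i : S => i.1) := ⟨_, rfl⟩
  have hzp : Pj z := hz ▸ osum_proj
  have hzN : z ∈ N := hz ▸ osum_mem hSN
  have hδz : (δ z).re ≤ 0 := by
    refine le_of_forall_pos_lt_add fun ε hε => ?_
    obtain ⟨t, ht⟩ := h.osum_approx hSp hS2 hSN hε
    rw [h.sum hSN, Finset.sum_eq_zero (fun i _ => (hS1 i.1 i.2).2.2.2), ← hz] at ht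
    simpa using ht
  have hs : Pj (1 - z) := hzp.one_sub
  have hsN : 1 - z ∈ N := sub_mem (one_mem N) hzN
  have hzs : z * (1 - z) = 0 := by rw [mul_sub, proj_mul hzp, mul_one, sub_self]
  have hfaith : ∀ p ∈ N, Pj p → (1 - z) * p = p → (δ p).re ≤ 0 → p = 0 := by
    intro p hp hpp hsp h0
    refine hS3 p hpp hp (one_mul p) ?_ ?_
    · rw [h.real hp (proj_nonneg hpp), le_antisymm h0 (h.real_pos hp (proj_nonneg hpp))]; simp
    · rw [← hz, ← hsp, ← mul_assoc, hzs, zero_mul]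
  have hs0 : 1 - z ≠ 0 := fun h0 => h1 (by
    rw [sub_eq_zero.1 h0, h.real hzN (proj_nonneg hzp),
      le_antisymm hδz (h.real_pos hzN (proj_nonneg hzp))]; simp)
  have hsξ : 0 < ‖(1 - z) ξ‖ ^ 2 := by
    have : (1 - z) ξ ≠ 0 := fun h0 => hs0 (hsep _ hsN h0)
    have := norm_pos_iff.2 this
    positivity
  obtain ⟨C, hC0, hC⟩ : ∃ C : ℝ, 0 < C ∧ (δ (1 - z)).re < C * ‖(1 - z) ξ‖ ^ 2 := by
    have h0 := h.real_pos hsN (proj_nonneg hs)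
    refine ⟨((δ (1 - z)).re + 1) / ‖(1 - z) ξ‖ ^ 2, by positivity, ?_⟩
    rw [div_mul_cancel₀ _ hsξ.ne']; linarith
  obtain ⟨R, hR1, hR2, hR3⟩ := max_proj N (s := 1 - z) (fun p => C * ‖p ξ‖ ^ 2 ≤ (δ p).re)
  have hRp : ∀ i : R, Pj i.1 := fun i => (hR1 i.1 i.2).1
  have hRN : ∀ i : R, i.1 ∈ N := fun i => (hR1 i.1 i.2).2.1
  obtain ⟨r, hr⟩ : ∃ r, r = osum (fun i : R => i.1) := ⟨_, rfl⟩
  have hrp : Pj r := hr ▸ osum_proj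
  have hrN : r ∈ N := hr ▸ osum_mem hRN
  have hsr : (1 - z) * r = r := hr ▸ osum_le hRp fun i => (hR1 i.1 i.2).2.2.1
  have hδr : C * ‖r ξ‖ ^ 2 ≤ (δ r).re := by
    have h2 := (osum_normsq hRp hR2 ξ).mul_left C
    rw [← hr] at h2
    refine le_of_tendsto h2 (Eventually.of_forall fun t => ?_)
    calc _ ≤ ∑ i ∈ t, (δ i.1).re := Finset.sum_le_sum fun i _ => (hR1 i.1 i.2).2.2.2
      _ = (δ (∑ i ∈ t, i.1)).re := by rw [h.sum hRN, Complex.re_sum]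
      _ ≤ _ := h.mono (sum_mem fun i _ => hRN i) hrN (hr ▸ psum_le hRp hR2 t)
  have hq := proj_sub hrp hs hsr
  have hqN : 1 - z - r ∈ N := sub_mem hsN hrN
  have hrs := proj_swap hrp hs hsr
  refine ⟨1 - z - r, hqN, C, hq, hC0, fun h0 => ?_, fun p hp hpp hqp => ?_⟩
  · have : 1 - z - r = 0 := hfaith _ hqN hq (by rw [mul_sub, proj_mul hs, hsr]) (by rw [h0]; simp)
    rw [sub_eq_zero] at this
    rw [this] at hC
    exact absurd hδr (not_le.2 hC)
  · by_contra hcon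
    push Not at hcon
    have hsp : (1 - z) * p = p := by
      rw [← hqp, ← mul_assoc, mul_sub, proj_mul hs, hsr]
    have hrp0 : r * p = 0 := by
      rw [← hqp, ← mul_assoc, mul_sub, hrs, proj_mul hrp, sub_self, zero_mul]
    have := hR3 p hpp hp hsp hcon.le (by rw [← hr, hrp0])
    rw [this, h.zero] at hcon
    simp at hcon
theorem sp_le (hq : Pj q) (hx : 0 ≤ x) {c : ℝ} (hc : 0 < c)
    (hqx : q * x = x) : q * sp (x - (c : ℂ) • 1) = sp (x - (c : ℂ) • 1) := by
  have hsa := sa_of_nonneg hx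
  obtain ⟨h1, -, h2⟩ := sp_cut x hsa c
  have he := sp_proj (x - (c : ℂ) • 1)
  set e := sp (x - (c : ℂ) • 1)
  have h3 : ∀ ξ, e ((1 - q) ξ) = 0 := fun ξ => by
    have h4 := le_iff.1 h1 ((1 - q) ξ)
    have h5 : ⟪(1 - q) ξ, (x * e) ((1 - q) ξ)⟫ = 0 := by
      rw [← mapp, h2.eq, mul_assoc e x, mul_sub, mul_one]
      have : x * q = x := by simpa [hsa.star_eq, star_proj hq] using congrArg star hqx
      rw [this, sub_self, mul_zero]; simp
    rw [h5, Asmul, inner_smul_right, proj_normsq he] at h4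
    have h6 : c * ‖e ((1 - q) ξ)‖ ^ 2 ≤ 0 := by exact_mod_cast h4
    have h7 : ‖e ((1 - q) ξ)‖ ^ 2 ≤ 0 := by
      by_contra hh; push Not at hh; exact absurd h6 (not_le.2 (mul_pos hc hh))
    simpa using le_antisymm h7 (sq_nonneg _)
  have h4 : e * (1 - q) = 0 := by ext ξ; exact h3 ξ
  have h5 : e * q = e := by rw [mul_sub, mul_one, sub_eq_zero] at h4; exact h4.symm
  simpa [star_proj he, star_proj hq] using congrArg star h5
theorem binary_step (hq : Pj q) (hx : x ∈ N) (h0 : 0 ≤ x)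
    (h1 : x ≤ 1) (hqx : q * x = x) : ∃ p ∈ N, Pj p ∧ q * p = p ∧
      0 ≤ (2 : ℂ) • x - p ∧ (2 : ℂ) • x - p ≤ 1 := by
  have hsa := sa_of_nonneg h0
  have hm : sp (x - ((1 / 2 : ℝ) : ℂ) • 1) ∈ N := sp_mem (sub_mem hx (vn_smul _ (one_mem N)))
  have hle := sp_le hq h0 (c := 1 / 2) (by norm_num) hqx
  obtain ⟨h2, h3, h4⟩ := sp_cut x hsa (1 / 2)
  have he := sp_proj (x - ((1 / 2 : ℝ) : ℂ) • 1)
  set e := sp (x - ((1 / 2 : ℝ) : ℂ) • 1)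
  have hxe : x * e = e * x * e := by rw [← h4.eq, mul_assoc, proj_mul he]
  have hxe' : x * (1 - e) = (1 - e) * x * (1 - e) := by
    rw [show (1 - e) * x = x * (1 - e) by rw [mul_sub, sub_mul, h4.eq]; simp, mul_assoc, proj_mul he.one_sub]
  have h5 : x * e ≤ e := by
    have := star_left_conjugate_le_conjugate h1 e
    rwa [star_proj he, mul_one, proj_mul he, ← hxe] at this
  have h6 : 0 ≤ x * (1 - e) := by
    have := star_left_conjugate_nonneg h0 (1 - e)
    rwa [star_proj he.one_sub, ← hxe'] at this
  have s1 : (2 : ℂ) • x = (2 : ℂ) • (x * e) + (2 : ℂ) • (x * (1 - e)) := by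
    rw [← smul_add, ← mul_add]; simp
  have two : ∀ {a b : BB}, a ≤ b → (2 : ℂ) • a ≤ (2 : ℂ) • b := fun hab => by
    rw [two_smul, two_smul]; exact add_le_add hab hab
  have h2' := two h2
  have h3' := two h3
  have h5' := two h5
  have h6' := two h6
  rw [smul_smul, show (2 : ℂ) * ((1 / 2 : ℝ) : ℂ) = 1 by push_cast; norm_num, one_smul] at h2' h3'
  rw [smul_zero] at h6'
  rw [two_smul ℂ e] at h5'
  refine ⟨e, hm, he, hle, ?_, ?_⟩
  · rw [sub_nonneg, s1]; exact le_add_of_le_of_nonneg h2' h6'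
  · rw [s1, sub_le_iff_le_add]
    calc _ ≤ (e + e) + (1 - e) := add_le_add h5' h3'
      _ = _ := by abel
theorem binary_pos (hq : Pj q) (ψ : BB → ℝ)
    (hadd : ∀ x ∈ N, ∀ y ∈ N, ψ (x + y) = ψ x + ψ y)
    (hsmul : ∀ (c : ℝ), ∀ x ∈ N, ψ ((c : ℂ) • x) = c * ψ x) (K : ℝ)
    (hK : ∀ x ∈ N, 0 ≤ x → x ≤ 1 → - K ≤ ψ x)
    (hp : ∀ p ∈ N, Pj p → q * p = p → 0 ≤ ψ p) (hx : x ∈ N) (h0 : 0 ≤ x)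
    (hqx : q * x = x) : 0 ≤ ψ x := by
  have key : ∀ n : ℕ, ∀ x ∈ N, 0 ≤ x → x ≤ 1 → q * x = x → - (K * (1 / 2) ^ n) ≤ ψ x := by
    intro n
    induction n with
    | zero => intro x hx h0 h1 _; simpa using hK x hx h0 h1
    | succ n ih =>
      intro x hx h0 h1 hqx
      obtain ⟨p, hpN, hpp, hqp, h2, h3⟩ := binary_step hq hx h0 h1 hqx
      have h4 := ih _ (sub_mem (vn_smul 2 hx) hpN) h2 h3 (by rw [mul_sub, mul_smul_comm, hqx, hqp])
      have h5 := hp p hpN hpp hqp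
      have h6 := hadd _ (sub_mem (vn_smul 2 hx) hpN) p hpN
      have h7 := hsmul 2 x hx
      rw [sub_add_cancel] at h6
      push_cast at h7
      rw [pow_succ]
      linarith
  have key' : ∀ x ∈ N, 0 ≤ x → x ≤ 1 → q * x = x → 0 ≤ ψ x := fun x hx h0 h1 hqx => by
    have ht : Tendsto (fun n : ℕ => - (K * (1 / 2 : ℝ) ^ n)) atTop (𝓝 0) := by
      have := ((tendsto_pow_atTop_nhds_zero_of_lt_one (r := (1 / 2 : ℝ)) (by norm_num)
        (by norm_num)).const_mul K).neg
      simpa using this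
    exact le_of_tendsto ht (Eventually.of_forall fun n => key n x hx h0 h1 hqx)
  have hpos : 0 < ‖x‖ + 1 := by positivity
  have ha : 0 ≤ (((‖x‖ + 1)⁻¹ : ℝ) : ℂ) • x := smul_nonneg (by exact_mod_cast (inv_pos.2 hpos).le) h0
  have h1 : (((‖x‖ + 1)⁻¹ : ℝ) : ℂ) • x ≤ 1 := by
    refine (CStarAlgebra.norm_le_one_iff_of_nonneg _ ha).1 ?_
    rw [norm_smul, Complex.norm_real, Real.norm_of_nonneg (inv_pos.2 hpos).le, inv_mul_le_one₀ hpos]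
    linarith
  have h2 := key' _ (vn_smul _ hx) ha h1 (by rw [mul_smul_comm, hqx])
  rw [hsmul _ _ hx] at h2
  exact nonneg_of_mul_nonneg_right h2 (inv_pos.2 hpos)
theorem douglasN (N : VN H) {f g : BB → H} (fa : ∀ x ∈ N, ∀ y ∈ N, f (x + y) = f x + f y)
    (fs : ∀ (c : ℂ), ∀ x ∈ N, f (c • x) = c • f x) (ga : ∀ x ∈ N, ∀ y ∈ N, g (x + y) = g x + g y)
    (gs : ∀ (c : ℂ), ∀ x ∈ N, g (c • x) = c • g x) {C : ℝ} (hC : 0 ≤ C)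
    (h : ∀ x ∈ N, ‖g x‖ ≤ C * ‖f x‖) : ∃ T : BB, (∀ x ∈ N, T (f x) = g x) ∧ ‖T‖ ≤ C ∧
      ∀ ζ, (∀ x ∈ N, ⟪f x, ζ⟫ = 0) → T ζ = 0 := by
  obtain ⟨T, h1, h2, h3⟩ := douglas (V := N.toStarSubalgebra)
    { toFun := fun x => f x.1, map_add' := fun x y => fa _ x.2 _ y.2, map_smul' := fun c x => fs c _ x.2 }
    { toFun := fun x => g x.1, map_add' := fun x y => ga _ x.2 _ y.2, map_smul' := fun c x => gs c _ x.2 }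
    C hC (fun v => h v.1 v.2)
  refine ⟨T, fun x hx => h1 ⟨x, hx⟩, h3, fun ζ hζ => ?_⟩
  rw [← h2, mapp, pr_eq_zero.2, map_zero]
  rintro _ ⟨x, rfl⟩
  exact hζ _ x.2
theorem norm_le_closure {K : Submodule ℂ H} {v : H} (hv : v ∈ K.topologicalClosure) {D : ℝ}
    (hD : 0 ≤ D) (h : ∀ w ∈ K, ‖⟪v, w⟫‖ ≤ D * ‖w‖) : ‖v‖ ≤ D := by
  have h1 : ‖⟪v, v⟫‖ ≤ D * ‖v‖ :=
    closure_minimal (t := {w | ‖⟪v, w⟫‖ ≤ D * ‖w‖}) h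
      (isClosed_le (by fun_prop) (by fun_prop)) hv
  rw [inner_self_eq_norm_sq_to_K, norm_pow] at h1
  rcases eq_or_ne v 0 with rfl | h0
  · simpa using hD
  · have h3 := norm_pos_iff.2 h0
    simp at h1
    nlinarith
theorem dom_corner {δ : BB → ℂ} (h : NF N δ) (hqN : q ∈ N)
    (hq : Pj q) {ξ : H} {C : ℝ} (hC : 0 ≤ C)
    (hle : ∀ p ∈ N, Pj p → q * p = p → (δ p).re ≤ C * ‖p ξ‖ ^ 2) (hy : y ∈ N) :
    (δ (star (y * q) * (y * q))).re ≤ C * ‖y (q ξ)‖ ^ 2 := by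
  have h1 := binary_pos (N := N) hq (fun x => C * (⟪ξ, x ξ⟫).re - (δ x).re)
    (fun x hx y hy => by simp only [h.add x hx y hy, Aadd, inner_add_right, Complex.add_re]; ring)
    (fun c x hx => by simp only [h.smul _ x hx, Asmul, inner_smul_right, Complex.re_ofReal_mul]; ring)
    (δ 1).re (fun x hx h0 h1 => by
      have h2 := h.mono hx (one_mem N) h1
      have h3 := (cL (nonneg_iff.1 h0 ξ)).1
      have := mul_nonneg hC h3
      linarith)
    (fun p hp hpp hqp => by
      rw [proj_normsq hpp, Complex.ofReal_re]
      linarith [hle p hp hpp hqp]) (x := star (y * q) * (y * q))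
    (mul_mem (star_mem (mul_mem hy hqN)) (mul_mem hy hqN)) (star_mul_self_nonneg _)
    (by rw [star_mul, star_proj hq]; simp only [← mul_assoc, proj_mul hq])
  simp only [normsq_inner, Complex.ofReal_re] at h1
  rw [mapp] at h1
  linarith
theorem dom {δ : BB → ℂ} (h : NF N δ) (h1 : δ 1 ≠ 0) {ξ : H}
    (hsep : ∀ x ∈ N, x ξ = 0 → x = 0) :
    ∃ κ : H, κ ≠ 0 ∧ ∀ y ∈ N, ‖y κ‖ ^ 2 ≤ (δ (star y * y)).re := by
  obtain ⟨q, hqN, C, hq, hC, hδq, hle⟩ := local_dom h h1 hsep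
  have hcor := fun {y} (hy : y ∈ N) => dom_corner h hqN hq hC.le hle hy
  have hpos := fun {y} (hy : y ∈ N) => h.real_pos (mul_mem (star_mem hy) hy) (star_mul_self_nonneg y)
  have hcs : ∀ y ∈ N, ∀ x ∈ N, ‖δ (star y * (x * q))‖ ≤
      Real.sqrt (C * (δ (star y * y)).re) * ‖x (q ξ)‖ := fun y hy x hx => by
    refine abs_le_of_sq_le_sq' ?_ (by positivity) |>.2
    rw [mul_pow, Real.sq_sqrt (mul_nonneg hC.le (hpos hy))]
    calc _ ≤ (δ (star y * y)).re * (δ (star (x * q) * (x * q))).re := h.cs hy (mul_mem hx hqN)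
      _ ≤ (δ (star y * y)).re * (C * ‖x (q ξ)‖ ^ 2) := mul_le_mul_of_nonneg_left (hcor hx) (hpos hy)
      _ = _ := by ring
  have hξ : 0 < ‖ξ‖ := norm_pos_iff.2 fun h0 => h1 (by
    rw [hsep 1 (one_mem N) (by simp [h0]), h.zero])
  obtain ⟨T, hT1, -, hT3⟩ := douglasN N (f := fun x => x (q ξ)) (g := fun x => δ (x * q) • ξ)
    (fun x _ y _ => rfl) (fun c x _ => rfl)
    (fun x hx y hy => by simp only [add_mul, h.add _ (mul_mem hx hqN) _ (mul_mem hy hqN), add_smul])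
    (fun c x hx => by simp only [smul_mul_assoc, h.smul _ _ (mul_mem hx hqN), mul_smul])
    (C := Real.sqrt (C * (δ (star 1 * 1)).re) * ‖ξ‖) (by positivity) (fun x hx => by
      have := hcs 1 (one_mem N) x hx
      simp only [star_one, one_mul] at this
      rw [norm_smul]
      simp only [star_one, one_mul]
      calc _ ≤ _ := mul_le_mul_of_nonneg_right this hξ.le
        _ = _ := by ring)
  have hin : ∀ x ∈ N, ⟪star T ξ, x (q ξ)⟫ = δ (x * q) * (‖ξ‖ ^ 2 : ℝ) := fun x hx => by
    rw [star_inner, hT1 x hx, inner_smul_right, inner_self_eq_norm_sq_to_K]; simp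
  have hK : star T ξ ∈ (orb N (q ξ)).topologicalClosure := by
    rw [← pr_eq_self]
    refine inner_ext fun z => ?_
    have hp := pr_proj (orb N (q ξ))
    have : T (z - pr (orb N (q ξ)) z) = 0 := hT3 _ fun x hx => by
      rw [inner_sub_right, ← sa_inner hp.isSelfAdjoint, pr_apply (orb_mem hx _), sub_self]
    rw [← sa_inner hp.isSelfAdjoint, inner_star, inner_star]
    rw [map_sub, sub_eq_zero] at this
    rw [this]
  have hb : ∀ y ∈ N, ‖y (star T ξ)‖ ≤ ‖ξ‖ ^ 2 * Real.sqrt (C * (δ (star y * y)).re) := fun y hy => by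
    refine norm_le_closure (K := orb N (q ξ)) (op_mem_closure (fun v hv => ?_) hK) (by positivity) fun w hw => ?_
    · obtain ⟨x, hx, rfl⟩ := mem_orb.1 hv
      exact Submodule.le_topologicalClosure _ (orb_mem (mul_mem hy hx) _)
    · obtain ⟨x, hx, rfl⟩ := mem_orb.1 hw
      have := hin (star y * x) (mul_mem (star_mem hy) hx)
      rw [mapp, inner_star] at this
      rw [this, norm_mul, mul_assoc, Complex.norm_real, Real.norm_of_nonneg (by positivity)]
      have := hcs y hy x hx
      nlinarith [sq_nonneg ‖ξ‖]
  have hκ : star T ξ ≠ 0 := fun h0 => by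
    have := hin 1 (one_mem N)
    rw [h0, inner_zero_left, one_mul] at this
    have h2 : ((‖ξ‖ ^ 2 : ℝ) : ℂ) ≠ 0 := by exact_mod_cast (pow_pos hξ 2).ne'
    exact hδq ((mul_eq_zero.1 this.symm).resolve_right h2)
  have hD : 0 < ‖ξ‖ ^ 2 * Real.sqrt C := by positivity
  refine ⟨(((‖ξ‖ ^ 2 * Real.sqrt C)⁻¹ : ℝ) : ℂ) • star T ξ, smul_ne_zero (by
    exact_mod_cast (inv_pos.2 hD).ne') hκ, fun y hy => ?_⟩
  have h2 := hb y hy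
  rw [Real.sqrt_mul hC.le, ← mul_assoc] at h2
  rw [map_smul, norm_smul, Complex.norm_real, Real.norm_of_nonneg (inv_pos.2 hD).le]
  have h3 : (‖ξ‖ ^ 2 * Real.sqrt C)⁻¹ * ‖y (star T ξ)‖ ≤ Real.sqrt (δ (star y * y)).re := by
    rw [inv_mul_le_iff₀ hD]; exact h2
  calc _ ≤ Real.sqrt (δ (star y * y)).re ^ 2 := by gcongr
    _ = _ := Real.sq_sqrt (hpos hy)
theorem max_exists {K : Set H} (hne : K.Nonempty) (hcl : IsClosed K) {R : ℝ} (hR : ∀ ζ ∈ K, ‖ζ‖ ^ 2 ≤ R)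
    {g : H → ℝ} (hg : Continuous g) (hconv : ∀ c : ℝ, Convex ℝ {ζ | ζ ∈ K ∧ c ≤ g ζ})
    (hb : BddAbove (g '' K)) : ∃ ζ ∈ K, ∀ ζ' ∈ K, g ζ' ≤ g ζ := by
  have hS : ∀ c, IsClosed {ζ | ζ ∈ K ∧ c ≤ g ζ} := fun c => hcl.inter (isClosed_le continuous_const hg)
  have hn : ∀ j : ℕ, ∃ q, (q ∈ K ∧ sSup (g '' K) - 1 / ((j : ℝ) + 1) ≤ g q) ∧
      ∀ k, (k ∈ K ∧ sSup (g '' K) - 1 / ((j : ℝ) + 1) ≤ g k) → (⟪0 - q, k - q⟫).re ≤ 0 := by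
    intro j
    obtain ⟨q, h1, h2⟩ := nearest (K := {ζ | ζ ∈ K ∧ sSup (g '' K) - 1 / ((j : ℝ) + 1) ≤ g ζ}) (by
      obtain ⟨_, ⟨k, hk, rfl⟩, hlt⟩ := exists_lt_of_lt_csSup (hne.image g)
        (show sSup (g '' K) - 1 / ((j : ℝ) + 1) < sSup (g '' K) from sub_lt_self _ (by positivity))
      exact ⟨k, hk, hlt.le⟩) (hS _) (hconv _) 0
    exact ⟨q, h1, h2⟩
  choose q hq1 hq2 using hn
  have hmono : ∀ j l : ℕ, j ≤ l → sSup (g '' K) - 1 / ((j : ℝ) + 1) ≤ g (q l) := fun j l hjl => by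
    refine le_trans ?_ (hq1 l).2
    have : (j : ℝ) ≤ l := by exact_mod_cast hjl
    gcongr
  have hsq : ∀ j l : ℕ, j ≤ l → ‖q l - q j‖ ^ 2 ≤ ‖q l‖ ^ 2 - ‖q j‖ ^ 2 := fun j l hjl => by
    have h1 := hq2 j (q l) ⟨(hq1 l).1, hmono j l hjl⟩
    have h2 : ‖q l‖ ^ 2 = ‖q j + (q l - q j)‖ ^ 2 := by rw [add_sub_cancel]
    have h3 := norm_add_sq (𝕜 := ℂ) (q j) (q l - q j)
    simp only [zero_sub, inner_neg_left, Complex.neg_re, RCLike.re_eq_complex_re] at h1 h3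
    linarith
  have hc : CauchySeq q := by
    rw [Metric.cauchySeq_iff']
    intro ε hε
    obtain ⟨N, hN⟩ := anti_cauchy (fun j => R - ‖q j‖ ^ 2) (fun j l hjl => by
      have := hsq j l hjl
      have := sq_nonneg ‖q l - q j‖
      change R - _ ≤ R - _
      linarith) (fun j => by have := hR _ (hq1 j).1; linarith) (pow_pos hε 2)
    refine ⟨N, fun n hn => ?_⟩
    rw [dist_eq_norm]
    refine lt_of_pow_lt_pow_left₀ 2 hε.le ?_
    have := hN n hn
    have := hsq N n hn
    linarith
  obtain ⟨z, hz⟩ := cauchySeq_tendsto_of_complete hc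
  refine ⟨z, hcl.mem_of_tendsto hz (Eventually.of_forall fun j => (hq1 j).1), fun ζ' h' => ?_⟩
  have h1 : sSup (g '' K) ≤ g z := by
    have h2 : Tendsto (fun j : ℕ => sSup (g '' K) - 1 / ((j : ℝ) + 1)) atTop (𝓝 (sSup (g '' K) - 0)) :=
      tendsto_const_nhds.sub tendsto_one_div_add_atTop_nhds_zero_nat
    rw [sub_zero] at h2
    exact le_of_tendsto_of_tendsto h2 ((hg.tendsto z).comp hz) (Eventually.of_forall fun j => (hq1 j).2)
  exact (le_csSup hb ⟨ζ', h', rfl⟩).trans h1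
theorem infDist_nearest {P : Set H} {ζ q : H} (hq : q ∈ P) (h : ∀ k ∈ P, (⟪ζ - q, k - q⟫).re ≤ 0) :
    Metric.infDist ζ P = ‖ζ - q‖ := by
  refine le_antisymm (by rw [← dist_eq_norm]; exact Metric.infDist_le_dist_of_mem hq) ?_
  refine (Metric.le_infDist ⟨q, hq⟩).2 fun k hk => ?_
  rw [dist_eq_norm]
  refine (sq_le_sq₀ (norm_nonneg _) (norm_nonneg _)).1 ?_
  have h3 := norm_sub_sq (𝕜 := ℂ) (ζ - q) (k - q)
  rw [sub_sub_sub_cancel_right, RCLike.re_eq_complex_re] at h3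
  have := h k hk
  nlinarith [sq_nonneg ‖k - q‖]
theorem penal {P K : Set H} (hPn : P.Nonempty) (hPc : IsClosed P) (hPv : Convex ℝ P)
    (hKn : K.Nonempty) (hKc : IsClosed K) (hKv : Convex ℝ K) {R : ℝ} (hR : ∀ ζ ∈ K, ‖ζ‖ ^ 2 ≤ R)
    (ξ : H) {n : ℝ} (hn : 0 ≤ n) : ∃ ζ ∈ K, ∃ q ∈ P, (∀ k ∈ P, (⟪ζ - q, k - q⟫).re ≤ 0) ∧
      ∀ ζ' ∈ K, (⟪ζ' - ζ, ξ⟫).re + 2 * n * (⟪ζ' - ζ, q - ζ⟫).re ≤ 0 := by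
  have hcs : ∀ x : H, (⟪x, ξ⟫).re ≤ ‖x‖ * ‖ξ‖ := fun x =>
    (Complex.re_le_norm _).trans (norm_inner_le_norm x ξ)
  have hR0 : 0 ≤ R := by obtain ⟨k, hk⟩ := hKn; exact (sq_nonneg _).trans (hR k hk)
  obtain ⟨ζ, hζ, hmax⟩ := max_exists hKn hKc hR
    (g := fun ζ => (⟪ζ, ξ⟫).re - n * Metric.infDist ζ P ^ 2)
    (((Complex.continuous_re.comp (by fun_prop)).sub
      (continuous_const.mul ((Metric.continuous_infDist_pt P).pow 2))))
    (by
      rintro c x ⟨hx, hcx⟩ y ⟨hy, hcy⟩ a b ha hb hab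
      refine ⟨hKv hx hy ha hb hab, ?_⟩
      obtain ⟨p, hp, hp'⟩ := nearest hPn hPc hPv x
      obtain ⟨q, hq, hq'⟩ := nearest hPn hPc hPv y
      have h1 := infDist_nearest hp hp'
      have h2 := infDist_nearest hq hq'
      have h3 : Metric.infDist (a • x + b • y) P ≤ a * ‖x - p‖ + b * ‖y - q‖ := by
        refine (Metric.infDist_le_dist_of_mem (hPv hp hq ha hb hab)).trans ?_
        rw [dist_eq_norm, show a • x + b • y - (a • p + b • q) = a • (x - p) + b • (y - q) by
          rw [smul_sub, smul_sub]; abel]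
        refine (norm_add_le _ _).trans ?_
        rw [norm_smul, norm_smul, Real.norm_of_nonneg ha, Real.norm_of_nonneg hb]
      have h4 : Metric.infDist (a • x + b • y) P ^ 2 ≤ a * ‖x - p‖ ^ 2 + b * ‖y - q‖ ^ 2 := by
        have h5 := pow_le_pow_left₀ Metric.infDist_nonneg h3 2
        have h6 : a * ‖x - p‖ ^ 2 + b * ‖y - q‖ ^ 2 - (a * ‖x - p‖ + b * ‖y - q‖) ^ 2 =
          a * b * (‖x - p‖ - ‖y - q‖) ^ 2 := by
          obtain rfl : b = 1 - a := by linarith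
          ring
        have : 0 ≤ a * b * (‖x - p‖ - ‖y - q‖) ^ 2 := by positivity
        linarith
      simp only [h1, h2] at hcx hcy
      have h7 : (⟪a • x + b • y, ξ⟫).re = a * (⟪x, ξ⟫).re + b * (⟪y, ξ⟫).re := by
        rw [show a • x + b • y = (a : ℂ) • x + (b : ℂ) • y from rfl, inner_add_left, inner_smul_left,
          inner_smul_left, Complex.conj_ofReal, Complex.conj_ofReal, Complex.add_re,
          Complex.re_ofReal_mul, Complex.re_ofReal_mul]
      rw [h7]
      have h8 := mul_le_mul_of_nonneg_left h4 hn
      have h9 : c = a * c + b * c := by rw [← add_mul, hab, one_mul]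
      have h10 := mul_le_mul_of_nonneg_left hcx ha
      have h11 := mul_le_mul_of_nonneg_left hcy hb
      nlinarith)
    ⟨Real.sqrt R * ‖ξ‖, by
      rintro _ ⟨x, hx, rfl⟩
      have h1 := hcs x
      have h2 : ‖x‖ ≤ Real.sqrt R := Real.le_sqrt_of_sq_le (hR x hx)
      have h3 := mul_le_mul_of_nonneg_right h2 (norm_nonneg ξ)
      have : 0 ≤ n * Metric.infDist x P ^ 2 := by positivity
      change _ - _ ≤ _
      linarith⟩
  obtain ⟨q, hq, hq'⟩ := nearest hPn hPc hPv ζ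
  refine ⟨ζ, hζ, q, hq, hq', fun ζ' h' => ?_⟩
  obtain ⟨w, hw⟩ : ∃ w, w = ζ' - ζ := ⟨_, rfl⟩
  rw [← hw]
  have key : ∀ s : ℝ, 0 < s → s ≤ 1 → (⟪w, ξ⟫).re + 2 * n * (⟪w, q - ζ⟫).re ≤ s * (n * ‖w‖ ^ 2) := by
    intro s hs hs1
    have h1 := hmax (ζ + s • w) (by
      have := hKv hζ h' (sub_nonneg.2 hs1) hs.le (by ring)
      rwa [show ζ + s • w = (1 - s) • ζ + s • ζ' by rw [hw, smul_sub, sub_smul, one_smul]; abel])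
    simp only [infDist_nearest hq hq'] at h1
    have h2 : Metric.infDist (ζ + s • w) P ^ 2 ≤ ‖(ζ - q) + (s : ℂ) • w‖ ^ 2 := by
      refine pow_le_pow_left₀ Metric.infDist_nonneg ?_ 2
      refine (Metric.infDist_le_dist_of_mem hq).trans (le_of_eq ?_)
      rw [dist_eq_norm, show s • w = (s : ℂ) • w from rfl]; congr 1; abel
    rw [norm_add_sq (𝕜 := ℂ), inner_smul_right, RCLike.re_eq_complex_re, Complex.re_ofReal_mul, norm_smul,
      Complex.norm_real, Real.norm_of_nonneg hs.le] at h2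
    have h3 : (⟪ζ - q, w⟫).re = - (⟪w, q - ζ⟫).re := by
      rw [← inner_conj_symm, Complex.conj_re, ← neg_sub q ζ, inner_neg_right, Complex.neg_re]
    rw [h3] at h2
    rw [inner_add_left, show s • w = (s : ℂ) • w from rfl, inner_smul_left, Complex.conj_ofReal, Complex.add_re,
      Complex.re_ofReal_mul] at h1
    have h4 := mul_le_mul_of_nonneg_left h2 hn
    refine le_of_mul_le_mul_left ?_ hs
    rw [show s • w = (s : ℂ) • w from rfl] at h4
    nlinarith
  have ht : Tendsto (fun m : ℕ => 1 / ((m : ℝ) + 1) * (n * ‖w‖ ^ 2)) atTop (𝓝 (0 * (n * ‖w‖ ^ 2))) :=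
    tendsto_one_div_add_atTop_nhds_zero_nat.mul_const _
  rw [zero_mul] at ht
  refine ge_of_tendsto ht (Eventually.of_forall fun m => key _ (by positivity) ?_)
  rw [div_le_one (by positivity)]
  have : (0 : ℝ) ≤ m := by positivity
  linarith
theorem inner_self' (x : H) : ⟪x, x⟫ = ((‖x‖ ^ 2 : ℝ) : ℂ) := by
  rw [inner_self_eq_norm_sq_to_K]; simp
theorem NF.residual {φ : BB → ℂ} (h : NF N φ) {ζ : H}
    (hζ : ∀ x ∈ N, ‖x ζ‖ ^ 2 ≤ (φ (star x * x)).re) : NF N (fun x => φ x - ⟪ζ, x ζ⟫) where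
  add x hx y hy := by simp only [h.add x hx y hy, Aadd, inner_add_right]; ring
  smul c x hx := by simp only [h.smul c x hx, Asmul, inner_smul_right]; ring
  pos x hx h0 := by
    obtain ⟨h1, h2, -⟩ := sqrt_facts h0
    have h3 := hζ _ (sqrt_mem hx)
    have h4 := normsq_inner (CFC.sqrt x) ζ
    rw [h1.star_eq, h2] at h3 h4
    rw [h4, h.real hx h0]
    exact_mod_cast sub_nonneg.2 h3
  normal S hS hne hd x hx hlub ε hε := by
    obtain ⟨s, hs, h1⟩ := h.normal S hS hne hd x hx hlub ε hε
    refine ⟨s, hs, ?_⟩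
    have h2 := (cL (le_iff.1 (hlub.1 hs) ζ)).1
    simp only [Complex.sub_re]
    linarith
theorem contr_comb {y κ ζ : H} {v w t r : ℝ} (hv : ‖ζ‖ = v) (hw : ‖y‖ ≤ w) (hw0 : 0 ≤ w) (ht : 0 ≤ t) (ht1 : t ≤ 1)
    (h : v ^ 2 + w ^ 2 ≤ r) : ‖((1 - t ^ 2 : ℝ) : ℂ) • ζ + (t : ℂ) • y‖ ^ 2 ≤ r := by
  have hv0 : 0 ≤ v := hv ▸ norm_nonneg _
  have ht2 : t ^ 2 ≤ 1 := by nlinarith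
  have h1 : ‖((1 - t ^ 2 : ℝ) : ℂ) • ζ + (t : ℂ) • y‖ ≤ (1 - t ^ 2) * v + t * w := by
    refine (norm_add_le _ _).trans ?_
    rw [norm_smul, norm_smul, Complex.norm_real, Complex.norm_real, Real.norm_of_nonneg ht,
      Real.norm_of_nonneg (by linarith), hv]
    gcongr
  refine (pow_le_pow_left₀ (norm_nonneg _) h1 2).trans (le_trans ?_ h)
  have h2 : v ^ 2 + w ^ 2 - ((1 - t ^ 2) * v + t * w) ^ 2 =
    ((1 - t ^ 2) * w - t * v) ^ 2 + t ^ 2 * (1 - t ^ 2) * (v ^ 2 + w ^ 2) := by ring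
  have : 0 ≤ t ^ 2 * (1 - t ^ 2) * (v ^ 2 + w ^ 2) := mul_nonneg (mul_nonneg (sq_nonneg _) (by linarith)) (by positivity)
  nlinarith [sq_nonneg ((1 - t ^ 2) * w - t * v)]
namespace StandardForm
variable {M : VN H} (sf : StandardForm M)
theorem thmA_step {ξ : H} (hξ : ξ ∈ sf.cone) (hsep : ∀ x ∈ M, x ξ = 0 → x = 0) {φ : BB → ℂ}
    (h : NF M φ) {n : ℝ} (hn : 0 ≤ n) : ∃ ζ, ∃ q ∈ sf.cone, (∀ x ∈ M, φ x = ⟪ζ, x ζ⟫) ∧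
      2 * n * ‖ζ - q‖ ^ 2 ≤ Real.sqrt (φ 1).re * ‖ξ‖ := by
  have hK0 : ∀ x ∈ M, 0 ≤ (φ (star x * x)).re := fun x hx => (cL (h.pos' hx)).1
  obtain ⟨ζ, hζ, q, hq, hq', hvar⟩ := penal ⟨0, sf.cone_zero⟩ sf.cone_closed sf.cone_convex
    (K := {ζ | ∀ x ∈ M, ‖x ζ‖ ≤ Real.sqrt (φ (star x * x)).re}) ⟨0, fun x hx => by simp⟩
    (by
      simp only [Set.setOf_forall]
      exact isClosed_biInter fun x _ => isClosed_le (by fun_prop) continuous_const)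
    (by
      intro a ha b hb s t hs ht hst x hx
      have e : x (s • a + t • b) = (s : ℂ) • x a + (t : ℂ) • x b := by
        rw [show s • a + t • b = (s : ℂ) • a + (t : ℂ) • b from rfl, map_add, map_smul, map_smul]
      rw [e]
      refine (norm_add_le _ _).trans ?_
      rw [norm_smul, norm_smul, Complex.norm_real, Complex.norm_real, Real.norm_of_nonneg hs,
        Real.norm_of_nonneg ht]
      have h1 := mul_le_mul_of_nonneg_left (ha x hx) hs
      have h2 := mul_le_mul_of_nonneg_left (hb x hx) ht
      have : s * Real.sqrt (φ (star x * x)).re + t * Real.sqrt (φ (star x * x)).re = Real.sqrt (φ (star x * x)).re := by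
        rw [← add_mul, hst, one_mul]
      linarith)
    (R := (φ 1).re) (fun a ha => by
      have := ha 1 (one_mem M)
      simp only [star_one, one_mul, Aone] at this
      calc _ ≤ Real.sqrt (φ 1).re ^ 2 := by gcongr
        _ = _ := Real.sq_sqrt (by simpa using hK0 1 (one_mem M))) ξ hn
  have hζ' : ∀ x ∈ M, ‖x ζ‖ ^ 2 ≤ (φ (star x * x)).re := fun x hx => by
    rw [← Real.sq_sqrt (hK0 x hx)]; exact pow_le_pow_left₀ (norm_nonneg _) (hζ x hx) 2
  have e0 : (⟪ζ - q, q⟫).re = 0 := by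
    have h1 := hq' 0 sf.cone_zero
    have h2 := hq' (q + q) (sf.cone_add hq hq)
    simp only [zero_sub, inner_neg_right, Complex.neg_re, add_sub_cancel_right] at h1 h2
    linarith
  have e1 : ∀ k ∈ sf.cone, 0 ≤ (⟪q - ζ, k⟫).re := fun k hk => by
    have := hq' k hk
    rw [inner_sub_right, Complex.sub_re, e0] at this
    rw [← neg_sub, inner_neg_left, Complex.neg_re]; linarith
  have hres := h.residual hζ'
  refine ⟨ζ, q, hq, ?_, ?_⟩
  swap
  · have h1 := hvar 0 (fun x hx => by simp)
    simp only [zero_sub, inner_neg_left, Complex.neg_re] at h1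
    have h2 : (⟪ζ, q - ζ⟫).re = - ‖ζ - q‖ ^ 2 := by
      have h3 : (⟪ζ - q, ζ - q⟫).re = ‖ζ - q‖ ^ 2 := by
        rw [inner_self_eq_norm_sq_to_K]; norm_cast
      have h4 : (⟪q, ζ - q⟫).re = 0 := by rw [← inner_conj_symm, Complex.conj_re, e0]
      rw [inner_sub_left, Complex.sub_re, h4] at h3
      rw [← neg_sub, inner_neg_right, Complex.neg_re]; linarith
    have h3 : (⟪ζ, ξ⟫).re ≤ Real.sqrt (φ 1).re * ‖ξ‖ := by
      refine (Complex.re_le_norm _).trans ((norm_inner_le_norm ζ ξ).trans ?_)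
      have := hζ 1 (one_mem M)
      simp only [star_one, one_mul, Aone] at this
      gcongr
    rw [h2] at h1
    linarith
  · by_cases hδ : φ 1 - ⟪ζ, (1 : BB) ζ⟫ = 0
    · intro x hx
      have := hres.cs (one_mem M) hx
      simp only [star_one, one_mul, hδ, Complex.zero_re, zero_mul] at this
      have h2 : φ x - ⟪ζ, x ζ⟫ = 0 := by
        rw [← norm_eq_zero]; exact pow_eq_zero_iff (two_ne_zero) |>.1 (le_antisymm this (sq_nonneg _))
      exact sub_eq_zero.1 h2
    · exfalso
      obtain ⟨κ, hκ, hdom⟩ := dom hres hδ hsep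
      obtain ⟨ρ, hρ⟩ : ∃ ρ, ρ = ξ + ((2 * n : ℝ) : ℂ) • (q - ζ) := ⟨_, rfl⟩
      have hvar' : ∀ ζ', (∀ x ∈ M, ‖x ζ'‖ ^ 2 ≤ (φ (star x * x)).re) → (⟪ζ' - ζ, ρ⟫).re ≤ 0 := fun ζ' h' => by
        have := hvar ζ' (fun x hx => Real.le_sqrt_of_sq_le (h' x hx))
        rw [hρ, inner_add_right, inner_smul_right, Complex.add_re, Complex.re_ofReal_mul]
        exact this
      have hp := (pr_proj (orb M.commutant ρ)).one_sub
      have hpM : 1 - pr (orb M.commutant ρ) ∈ M := sub_mem (one_mem M) (pr_orb_mem' M ρ)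
      have hpρ : (1 - pr (orb M.commutant ρ)) ρ = 0 := by
        rw [Asub, pr_orb_self]; simp
      obtain ⟨p, hpe⟩ : ∃ p, p = 1 - pr (orb M.commutant ρ) := ⟨_, rfl⟩
      rw [← hpe] at hp hpM hpρ
      have hu := sf.cone_inv hpM hξ
      have h1 : (⟪ρ, p (sf.c p ξ)⟫).re = 0 := by
        rw [← sa_inner hp.isSelfAdjoint, hpρ]; simp
      have h2 : ⟪ξ, p (sf.c p ξ)⟫ = ((‖p (sf.c p ξ)‖ ^ 2 : ℝ) : ℂ) := by
        have hcp := sf.c_proj hp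
        have hcc := sf.c_comm hpM hpM
        have : Pj (p * sf.c p) := ⟨by
          rw [IsIdempotentElem, mul_assoc, ← mul_assoc (sf.c p), ← hcc, mul_assoc, proj_mul hcp, ← mul_assoc, proj_mul hp],
          by rw [IsSelfAdjoint, star_mul, star_proj hp, star_proj hcp, hcc]⟩
        exact proj_normsq this ξ
      have hu0 : p (sf.c p ξ) = 0 := by
        rw [hρ, inner_add_left, inner_smul_left, Complex.conj_ofReal, Complex.add_re, Complex.re_ofReal_mul, h2,
          Complex.ofReal_re] at h1
        have := mul_nonneg (by positivity : 0 ≤ 2 * n) (e1 _ hu)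
        have h3 : ‖p (sf.c p ξ)‖ ^ 2 = 0 := le_antisymm (by linarith) (sq_nonneg _)
        simpa using h3
      have hp0 : p = 0 := hsep p hpM (sf.zero_of_xJxJ hpM hξ (by
        rw [star_proj hp, proj_mul hp, hu0, map_zero]))
      have hpr1 : pr (orb M.commutant ρ) = 1 := by rw [hp0] at hpe; exact (sub_eq_zero.1 hpe.symm).symm
      have k1 : ∀ y ∈ M.commutant, ‖y‖ ≤ 1 → (⟪y κ, ρ⟫).re ≤ 0 := fun y hy hy1 => by
        have k2 : ∀ t : ℝ, 0 < t → t ≤ 1 → (⟪y κ, ρ⟫).re ≤ t * (⟪ζ, ρ⟫).re := fun t ht ht1 => by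
          have := hvar' (((1 - t ^ 2 : ℝ) : ℂ) • ζ + (t : ℂ) • y κ) (fun x hx => by
            rw [map_add, map_smul, map_smul, ← comm_app hy hx]
            refine contr_comb (κ := 0) rfl (w := ‖x κ‖) ?_ (norm_nonneg _) ht.le ht1 ?_
            · calc _ ≤ ‖y‖ * ‖x κ‖ := y.le_opNorm _
                _ ≤ 1 * ‖x κ‖ := by gcongr
                _ = _ := one_mul _
            · have := hdom x hx
              rw [normsq_inner, Complex.sub_re, Complex.ofReal_re] at this
              linarith)
          rw [show ((1 - t ^ 2 : ℝ) : ℂ) • ζ + (t : ℂ) • y κ - ζ = (t : ℂ) • y κ - ((t ^ 2 : ℝ) : ℂ) • ζ by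
            push_cast; rw [sub_smul, one_smul]; abel, inner_sub_left, inner_smul_left, inner_smul_left,
            Complex.conj_ofReal, Complex.conj_ofReal, Complex.sub_re, Complex.re_ofReal_mul, Complex.re_ofReal_mul] at this
          refine le_of_mul_le_mul_left ?_ ht
          nlinarith
        have ht : Tendsto (fun m : ℕ => 1 / ((m : ℝ) + 1) * (⟪ζ, ρ⟫).re) atTop (𝓝 (0 * (⟪ζ, ρ⟫).re)) :=
          tendsto_one_div_add_atTop_nhds_zero_nat.mul_const _
        rw [zero_mul] at ht
        refine ge_of_tendsto ht (Eventually.of_forall fun m => k2 _ (by positivity) ?_)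
        rw [div_le_one (by positivity)]
        have : (0 : ℝ) ≤ m := by positivity
        linarith
      have k3 : ∀ y ∈ M.commutant, ⟪y κ, ρ⟫ = 0 := fun y hy => by
        obtain ⟨z, hz⟩ : ∃ z, z = ⟪y κ, ρ⟫ := ⟨_, rfl⟩
        have hD : 0 < ‖y‖ * ‖z‖ + 1 := by positivity
        have := k1 ((((‖y‖ * ‖z‖ + 1)⁻¹ : ℝ) : ℂ) • z • y) (vn_smul _ (vn_smul _ hy)) (by
          rw [norm_smul, norm_smul, Complex.norm_real, Real.norm_of_nonneg (inv_pos.2 hD).le, inv_mul_le_one₀ hD]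
          linarith)
        rw [Asmul, Asmul, inner_smul_left, inner_smul_left, ← hz,
          Complex.conj_ofReal, Complex.re_ofReal_mul, ← Complex.normSq_eq_conj_mul_self, Complex.ofReal_re] at this
        have h5 : Complex.normSq z ≤ 0 := by
          by_contra hh; push Not at hh; exact absurd this (not_le.2 (mul_pos (inv_pos.2 hD) hh))
        rw [← hz]; exact Complex.normSq_eq_zero.1 (le_antisymm h5 (Complex.normSq_nonneg _))
      apply hκ
      have : pr (orb M.commutant ρ) κ = 0 := pr_orb_zero.2 fun y hy => by
        rw [← inner_conj_symm, ← star_inner, k3 _ (star_mem hy), map_zero]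
      rwa [hpr1] at this
theorem vec_diff (hx : ∀ ζ, ‖x ζ‖ ≤ ‖ζ‖) (a b : H) :
    ‖⟪a, x a⟫ - ⟪b, x b⟫‖ ≤ ‖a - b‖ * (‖a‖ + ‖b‖) := by
  have e : ⟪a, x a⟫ - ⟪b, x b⟫ = ⟪a - b, x a⟫ + ⟪b, x (a - b)⟫ := by
    rw [inner_sub_left, map_sub, inner_sub_right]; ring
  rw [e]
  have h1 := (norm_inner_le_norm (𝕜 := ℂ) (a - b) (x a)).trans (mul_le_mul_of_nonneg_left (hx a) (norm_nonneg _))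
  have h2 := (norm_inner_le_norm (𝕜 := ℂ) b (x (a - b))).trans (mul_le_mul_of_nonneg_left (hx (a - b)) (norm_nonneg _))
  refine (norm_add_le _ _).trans ?_
  linarith
theorem thmA (hσ : SigmaFinite (M : SB)) {φ : BB → ℂ} (h : NF M φ) :
    ∃ ξ ∈ sf.cone, ∀ x ∈ M, φ x = ⟪ξ, x ξ⟫ := by
  obtain ⟨ξ0, hξ0, hsep⟩ := sf.exists_sep hσ
  have hst := fun n : ℕ => sf.thmA_step hξ0 hsep h (n := (n : ℝ) + 1) (by positivity)
  choose ζ q hq h1 h2 using hst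
  obtain ⟨D, hD⟩ : ∃ D, D = Real.sqrt (φ 1).re * ‖ξ0‖ := ⟨_, rfl⟩
  have hr : Tendsto (fun n => ‖ζ n - q n‖) atTop (𝓝 0) := by
    have h3 : Tendsto (fun n => ‖ζ n - q n‖ ^ 2) atTop (𝓝 0) := by
      have h4 : Tendsto (fun m : ℕ => 1 / ((m : ℝ) + 1) * D) atTop (𝓝 (0 * D)) :=
        tendsto_one_div_add_atTop_nhds_zero_nat.mul_const _
      rw [zero_mul] at h4
      refine squeeze_zero (fun n => sq_nonneg _) (fun n => ?_) h4
      have h5 := h2 n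
      rw [← hD] at h5
      rw [one_div, ← div_eq_inv_mul, le_div_iff₀ (by positivity)]
      nlinarith [mul_nonneg (by positivity : (0 : ℝ) ≤ (n : ℝ) + 1) (sq_nonneg ‖ζ n - q n‖)]
    have := h3.sqrt
    simpa [Real.sqrt_sq] using this
  have hζn : ∀ n, ‖ζ n‖ = Real.sqrt (φ 1).re := fun n => by
    have := h1 n 1 (one_mem M)
    rw [Aone, inner_self'] at this
    rw [this, Complex.ofReal_re,
      Real.sqrt_sq (norm_nonneg _)]
  obtain ⟨s, hs⟩ : ∃ s : ℕ → ℝ, ∀ n, s n = ‖ζ n - q n‖ * (2 * Real.sqrt (φ 1).re + ‖ζ n - q n‖) :=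
    ⟨_, fun _ => rfl⟩
  have hs0 : Tendsto s atTop (𝓝 0) := by
    have := hr.mul (tendsto_const_nhds (x := 2 * Real.sqrt (φ 1).re) |>.add hr)
    rw [zero_mul] at this
    exact this.congr fun n => (hs n).symm
  have hd : ∀ n, ∀ x ∈ M, (∀ ζ, ‖x ζ‖ ≤ ‖ζ‖) → |(φ x).re - (⟪q n, x (q n)⟫).re| ≤ s n := fun n x hx hc => by
    rw [h1 n x hx, ← Complex.sub_re, hs]
    refine (Complex.abs_re_le_norm _).trans ((vec_diff hc _ _).trans ?_)
    refine mul_le_mul_of_nonneg_left ?_ (norm_nonneg _)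
    have : ‖q n‖ ≤ ‖ζ n‖ + ‖ζ n - q n‖ := by
      rw [show q n = ζ n - (ζ n - q n) by abel]
      exact (norm_sub_le _ _).trans (by rw [sub_sub_cancel])
    rw [hζn] at *
    linarith
  have hps : ∀ n m, ‖q n - q m‖ ^ 2 ≤ s n + s m := fun n m =>
    sf.powers_stormer (hq n) (hq m) fun x hx hc => by
      have h3 := abs_le.1 (hd n x hx hc)
      have h4 := abs_le.1 (hd m x hx hc)
      linarith [h3.1, h4.2]
  have hc : CauchySeq q := by
    rw [Metric.cauchySeq_iff]
    intro ε hε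
    obtain ⟨N, hN⟩ := eventually_atTop.1 (hs0.eventually (gt_mem_nhds (show (0 : ℝ) < ε ^ 2 / 2 by positivity)))
    refine ⟨N, fun m hm n hn => ?_⟩
    rw [dist_eq_norm]
    refine lt_of_pow_lt_pow_left₀ 2 hε.le ?_
    have h3 := hps m n
    have h4 := hN m hm
    have h5 := hN n hn
    linarith
  obtain ⟨z, hz⟩ := cauchySeq_tendsto_of_complete hc
  have hζz : Tendsto ζ atTop (𝓝 z) := by
    have := (tendsto_zero_iff_norm_tendsto_zero.2 hr).add hz
    simpa using this
  refine ⟨z, sf.cone_closed.mem_of_tendsto hz (Eventually.of_forall hq), fun x hx => ?_⟩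
  exact tendsto_nhds_unique (tendsto_const_nhds.congr fun n => h1 n x hx)
    (hζz.inner ((x.continuous.tendsto z).comp hζz))
end StandardForm
theorem lemX {ξ κ : H} {C : ℝ} (hC : 0 ≤ C) (h : ∀ m ∈ N, ‖m κ‖ ≤ C * ‖m ξ‖) :
    ∃ x ∈ N.commutant, x ξ = κ ∧ ‖x‖ ≤ C := by
  obtain ⟨T, h1, h2, h3⟩ := douglasN N (f := fun x => x ξ) (g := fun x => x κ) (by simp) (by simp)
    (by simp) (by simp) hC h
  refine ⟨T, comm_iff.2 fun n hn => ?_, by simpa using h1 1 (one_mem N), h2⟩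
  have e1 := comm_iff.1 (pr_orb_mem N ξ) n hn
  have e2 : T * pr (orb N ξ) = T := by
    ext ζ
    have := h3 (ζ - pr (orb N ξ) ζ) (pr_orb_zero.1 (by
      rw [map_sub, ← mapp, proj_mul (pr_proj _), sub_self]))
    rw [map_sub, sub_eq_zero] at this
    rw [mapp, this]
  have e3 : (n * T) * pr (orb N ξ) = (T * n) * pr (orb N ξ) := mul_pr_eq fun z hz => by
    obtain ⟨m, hm, rfl⟩ := mem_orb.1 hz
    rw [mapp, mapp, h1 m hm, ← mapp n m ξ, h1 _ (mul_mem hn hm), mapp]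
  rw [mul_assoc, e2, mul_assoc, e1, ← mul_assoc, e2] at e3
  exact e3
theorem NF.vec (N : VN H) (ξ : H) : NF N (fun x => ⟪ξ, x ξ⟫) where
  add x hx y hy := by simp [inner_add_right]
  smul c x hx := by simp [inner_smul_right]
  pos x hx h := nonneg_iff.1 h ξ
  normal S hS hne hd x hx hl ε hε := by
    obtain ⟨s, hs, h⟩ := vigier hne hd hl ξ hε
    exact ⟨s, hs, by simpa [inner_sub_right] using h⟩
abbrev CE (N D : VN H) (F : BB → BB) := IsCondExp (N : SB) (D : SB) F
abbrev Inv (N : VN H) (F : BB → BB) (ξ : H) := ∀ x ∈ N, ⟪ξ, F x ξ⟫ = ⟪ξ, x ξ⟫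
section CE
variable {N D : VN H} {F : BH H → BH H}
theorem IsCondExp.mono {N P : SB} {F} (h : IsCondExp N P F) (hN : ∀ x ∈ N, ∀ y ∈ N, x - y ∈ N)
    (hx : x ∈ N) (hy : y ∈ N) (hxy : x ≤ y) : F x ≤ F y := by
  have := h.map_add (y - x) (hN _ hy _ hx) x hx
  rw [sub_add_cancel] at this
  rw [this]
  exact le_add_of_nonneg_left (h.pos _ (hN _ hy _ hx) (sub_nonneg.2 hxy))
theorem IsCondExp.nf (h : CE N D F)
    (hn : IsNormalOn (N : SB) F) {ψ : BB → ℂ} (hψ : NF D ψ) : NF N (fun x => ψ (F x)) where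
  add x hx y hy := by rw [h.map_add x hx y hy, hψ.add _ (h.maps_to x hx) _ (h.maps_to y hy)]
  smul c x hx := by rw [h.map_smul c x hx, hψ.smul _ _ (h.maps_to x hx)]
  pos x hx h0 := hψ.pos _ (h.maps_to x hx) (h.pos x hx h0)
  normal S hS hne hd x hx hl ε hε := by
    obtain ⟨s, ⟨t, ht, rfl⟩, h'⟩ := hψ.normal (F '' S) (by rintro _ ⟨t, ht, rfl⟩; exact h.maps_to t (hS ht))
      (hne.image F) (by
        rintro _ ⟨a, ha, rfl⟩ _ ⟨b, hb, rfl⟩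
        obtain ⟨z, hz, h1, h2⟩ := hd a ha b hb
        exact ⟨F z, ⟨z, hz, rfl⟩, h.mono (fun x hx y hy => vsb hx hy) (hS ha) (hS hz) h1,
          h.mono (fun x hx y hy => vsb hx hy) (hS hb) (hS hz) h2⟩) _ (h.maps_to x hx)
      (hn S hS hne hd x hx hl) ε hε
    exact ⟨t, ht, h'⟩
namespace IsCondExp
theorem nf' (h : CE N D F) : ∀ v : H, (∀ x ∈ N, ∀ y ∈ N, ⟪v, F (x + y) v⟫ = ⟪v, F x v⟫ + ⟪v, F y v⟫) ∧
    (∀ (c : ℂ), ∀ x ∈ N, ⟪v, F (c • x) v⟫ = c * ⟪v, F x v⟫) ∧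
    ∀ x ∈ N, 0 ≤ ⟪v, F (star x * x) v⟫ := fun v =>
  ⟨fun x hx y hy => by rw [h.map_add x hx y hy]; simp [inner_add_right],
   fun c x hx => by rw [h.map_smul c x hx]; simp [inner_smul_right],
   fun x hx => nonneg_iff.1 (h.pos _ (mul_mem (vst hx) hx) (star_mul_self_nonneg x)) v⟩
theorem star' (h : CE N D F) (hx : x ∈ N) : F (star x) = star (F x) := by
  refine op_ext_inner fun v => ?_
  obtain ⟨h1, h2, h3⟩ := h.nf' v
  have := herm_of_pos (φ := fun x => ⟪v, F x v⟫) h1 h2 h3 (one_mem N) hx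
  simp only [mul_one, star_one, one_mul] at this
  rw [this, inner_star]
  exact inner_conj_symm _ _
theorem left (h : CE N D F) (ha : a ∈ D) (hx : x ∈ N) : F (a * x) = a * F x := by
  simpa using h.bimod a ha 1 (one_mem D) x hx
theorem right (h : CE N D F) (ha : a ∈ D) (hx : x ∈ N) : F (x * a) = F x * a := by
  simpa using h.bimod 1 (one_mem D) a ha x hx
theorem sub (h : CE N D F) (hx : x ∈ N) (hy : y ∈ N) : F (x - y) = F x - F y := by
  have := h.map_add (x - y) (sub_mem hx hy) y hy
  rw [sub_add_cancel] at this
  rw [this, add_sub_cancel_right]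
theorem zero (h : CE N D F) : F 0 = 0 := h.fixes 0 (zero_mem D)
theorem kadison (h : CE N D F) (hx : x ∈ N) : star (F x) * F x ≤ F (star x * x) := by
  have hF := h.maps_to x hx
  have hFs := vst hF
  have hxs := vst hx
  have h0 := h.pos (star (x - F x) * (x - F x)) (mul_mem (vst (sub_mem hx (h.subset hF)))
    (sub_mem hx (h.subset hF))) (star_mul_self_nonneg _)
  rw [star_sub, sub_mul, mul_sub, mul_sub, h.sub (sub_mem (mul_mem hxs hx) (mul_mem hxs (h.subset hF)))
    (sub_mem (mul_mem (h.subset hFs) hx) (mul_mem (h.subset hFs) (h.subset hF))),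
    h.sub (mul_mem hxs hx) (mul_mem hxs (h.subset hF)), h.sub (mul_mem (h.subset hFs) hx)
    (mul_mem (h.subset hFs) (h.subset hF)), h.right hF hxs, h.left hFs hx,
    h.left hFs (h.subset hF), h.fixes _ hF, h.star' hx, sub_self, sub_zero, sub_nonneg] at h0
  exact h0
theorem kad_norm (h : CE N D F) (hx : x ∈ N) (v : H) : ‖F x v‖ ^ 2 ≤ (⟪v, F (star x * x) v⟫).re := by
  have := (cL (le_iff.1 (h.kadison hx) v)).1
  rwa [normsq_inner, Complex.ofReal_re] at this
theorem norm_le (h : CE N D F) (hx : x ∈ N) : ‖F x‖ ≤ ‖x‖ := by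
  refine ContinuousLinearMap.opNorm_le_bound _ (norm_nonneg _) fun v => ?_
  refine abs_le_of_sq_le_sq' ?_ (by positivity) |>.2
  refine (h.kad_norm hx v).trans ?_
  have h1 : star x * x ≤ ((‖x‖ ^ 2 : ℝ) : ℂ) • (1 : BB) := le_iff.2 fun ξ => by
    rw [normsq_inner, Asmul, inner_smul_right, Aone,
      inner_self', ← Complex.ofReal_mul]
    norm_cast
    rw [← mul_pow]; gcongr; exact x.le_opNorm ξ
  have h2 := h.mono (fun x hx y hy => vsb hx hy) (mul_mem (vst hx) hx)
    (vn_smul _ (one_mem N)) h1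
  rw [h.map_smul _ _ (one_mem N), h.fixes 1 (one_mem D)] at h2
  have := (cL (le_iff.1 h2 v)).1
  rwa [Asmul, inner_smul_right, Aone,
      inner_self', ← Complex.ofReal_mul, Complex.ofReal_re, ← mul_pow] at this
variable {ξ : H}
theorem e_app (h : CE N D F) (hi : Inv N F ξ) (hx : x ∈ N) : pr (orb D ξ) (x ξ) = F x ξ := by
  have h1 : pr (orb D ξ) (x ξ - F x ξ) = 0 := pr_orb_zero.2 fun d hd => by
    have hd' := vst hd
    rw [inner_sub_right, ← inner_star, ← inner_star, ← mapp, ← mapp, ← h.left hd' hx,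
      hi _ (mul_mem (h.subset hd') hx), sub_self]
  rw [map_sub, pr_apply (orb_mem (h.maps_to x hx) ξ), sub_eq_zero] at h1
  exact h1
theorem e_e (h : CE N D F) (hi : Inv N F ξ) (hx : x ∈ N) : pr (orb D ξ) * x * pr (orb D ξ) = F x * pr (orb D ξ) :=
  mul_pr_eq fun z hz => by
    obtain ⟨d, hd, rfl⟩ := mem_orb.1 hz
    rw [mapp, ← mapp x d, h.e_app hi (mul_mem hx (h.subset hd)), h.right hd hx, mapp]
end IsCondExp
end CE
theorem power_trick {u : ℕ → ℝ} (h0 : ∀ n, 0 ≤ u n) {K : ℝ} (hK : ∀ n, u n ≤ K)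
    (h : ∀ n, u (n + 1) ^ 2 ≤ u n * u (n + 2)) : u 1 ≤ u 0 := by
  by_contra! hlt
  have hp : 0 < u 0 := by
    rcases (h0 0).eq_or_lt with e | e
    · have := h 0; rw [← e, zero_mul] at this; nlinarith [h0 0]
    · exact e
  have key : ∀ n, 0 < u n ∧ u 1 * u n ≤ u 0 * u (n + 1) := by
    intro n
    induction n with
    | zero => exact ⟨hp, by simp [mul_comm]⟩
    | succ n ih =>
      have h1 : 0 < u (n + 1) := by
        by_contra! hc
        nlinarith [mul_pos (hp.trans hlt) ih.1]
      refine ⟨h1, ?_⟩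
      have h2 := h n
      have h3 : u 1 * u n * u (n + 1) ≤ u 0 * u n * u (n + 2) := by nlinarith [ih.2]
      have h4 : u n * (u 1 * u (n + 1)) ≤ u n * (u 0 * u (n + 2)) := by nlinarith
      exact le_of_mul_le_mul_left h4 ih.1
  have key2 : ∀ n : ℕ, u 0 * (u 1 / u 0) ^ n ≤ u n := by
    intro n
    induction n with
    | zero => simp
    | succ n ih =>
      have := (key n).2
      rw [pow_succ, ← mul_assoc]
      calc _ ≤ u n * (u 1 / u 0) := by gcongr; exact div_nonneg (h0 1) hp.le
        _ = u 1 * u n / u 0 := by ring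
        _ ≤ _ := (div_le_iff₀ hp).2 (by linarith)
  obtain ⟨n, hn⟩ := pow_unbounded_of_one_lt (K / u 0) ((one_lt_div hp).2 hlt)
  have h1 := key2 n
  rw [div_lt_iff₀ hp] at hn
  linarith [hK n]
namespace StandardForm
variable {M : VN H} (sf : StandardForm M) {D : VN H} {F : BH H → BH H} {ξ η : H}
theorem c_norm (x : BB) : ‖sf.c x‖ ≤ ‖x‖ :=
  ContinuousLinearMap.opNorm_le_bound _ (norm_nonneg _) fun v => by
    rw [c_apply, LinearIsometryEquiv.norm_map]
    simpa using x.le_opNorm (sf.J v)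
theorem dense_comm (hsep : ∀ x ∈ M, x ξ = 0 → x = 0) : pr (orb M.commutant ξ) = 1 := by
  have := hsep (1 - pr (orb M.commutant ξ)) (sub_mem (one_mem M) (pr_orb_mem' M ξ)) (by
    simp [pr_orb_self])
  exact (sub_eq_zero.1 this).symm
theorem dense_cone (hξ : ξ ∈ sf.cone) (hsep : ∀ x ∈ M, x ξ = 0 → x = 0) : pr (orb M ξ) = 1 := by
  have h1 := sf.c_mem' (pr_orb_mem M ξ)
  have := hsep (1 - sf.c (pr (orb M ξ))) (sub_mem (one_mem M) h1) (by
    rw [Asub, c_apply, sf.J_fixes_cone ξ hξ, pr_orb_self, sf.J_fixes_cone ξ hξ]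
    simp)
  rw [← sf.c_c (pr (orb M ξ)), ← sub_eq_zero.1 this, c_one]
theorem lemJ_D (h : CE M D F) (hη : Inv M F η) (hξ' : Inv M F ξ)
    (hy : y ∈ M) :
    ∃ d ∈ M, sf.c (star d) ξ = pr (orb D η) (sf.c (star y) ξ) ∧ ‖d‖ ≤ ‖y‖ := by
  have hx' : sf.c (star y) ∈ M.commutant := sf.c_mem (vst hy)
  obtain ⟨z, hz, e1, e2⟩ := lemX (N := M) (ξ := ξ) (κ := pr (orb D η) (sf.c (star y) ξ)) (norm_nonneg y)
    (fun m hm => by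
      have hmm : star m * m ∈ M := mul_mem (vst hm) hm
      have h0 := h.pos _ hmm (star_mul_self_nonneg m)
      obtain ⟨g1, g2, g3⟩ := sqrt_facts h0
      have gD : CFC.sqrt (F (star m * m)) ∈ D := sqrt_mem (h.maps_to _ hmm)
      generalize CFC.sqrt (F (star m * m)) = g at *
      have a0 : ∀ v : H, ⟪v, F (star m * m) v⟫ = ((‖g v‖ ^ 2 : ℝ) : ℂ) := fun v => by
        rw [← g2, ← normsq_inner, g1.star_eq]
      have ep := pr_proj (orb D η)
      have a1 : ‖m (pr (orb D η) (sf.c (star y) ξ))‖ ^ 2 = ‖g (pr (orb D η) (sf.c (star y) ξ))‖ ^ 2 := by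
        have : ((‖m (pr (orb D η) (sf.c (star y) ξ))‖ ^ 2 : ℝ) : ℂ)
            = ((‖g (pr (orb D η) (sf.c (star y) ξ))‖ ^ 2 : ℝ) : ℂ) := by
          rw [← normsq_inner, ← a0]
          generalize sf.c (star y) ξ = v
          rw [sa_inner ep.isSelfAdjoint, ← mapp (star m * m), ← mapp, ← mul_assoc, h.e_e hη hmm,
            sa_inner ep.isSelfAdjoint, ← mapp (F _), ← mapp (pr (orb D η)), ← mul_assoc,
            ← comm_iff.1 (pr_orb_mem D η) _ (h.maps_to _ hmm), mul_assoc, proj_mul ep]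
        exact_mod_cast this
      have a2 : ‖g ξ‖ ^ 2 = ‖m ξ‖ ^ 2 := by
        have := hξ' _ hmm
        rw [a0, normsq_inner] at this
        exact_mod_cast this
      have a1 := (pow_left_inj₀ (norm_nonneg _) (norm_nonneg _) two_ne_zero).1 a1
      have a2 := (pow_left_inj₀ (norm_nonneg _) (norm_nonneg _) two_ne_zero).1 a2
      rw [a1, ← a2, ← comm_app (pr_orb_mem D η) gD]
      refine (proj_norm_le ep _).trans ?_
      rw [← comm_app hx' (h.subset gD)]
      refine (ContinuousLinearMap.le_opNorm _ _).trans ?_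
      gcongr
      refine (sf.c_norm _).trans (by rw [norm_star]))
  refine ⟨star (sf.c z), vst (sf.c_mem' hz), by rw [star_star, sf.c_c, e1], ?_⟩
  rw [norm_star]
  exact (sf.c_norm z).trans e2
theorem lemJ_form (hξ : ξ ∈ sf.cone) (hη : η ∈ sf.cone) (h : CE M D F) (hiη : Inv M F η)
    (hiξ : Inv M F ξ) (hx : x ∈ M) :
    (⟪ξ, F x (sf.c (F x) η)⟫).re ≤ (⟪ξ, x (sf.c x η)⟫).re := by
  obtain ⟨s, hs⟩ : ∃ s : BB → BB → ℂ, ∀ x y, s x y = ⟪ξ, x (sf.c y η)⟫ := ⟨_, fun _ _ => rfl⟩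
  obtain ⟨s1, s2, s3⟩ := sf.sform hξ hη
  simp only [← hs] at s1 s2 s3 ⊢
  choose! d d1 d2 d3 using fun y (hy : y ∈ M) => sf.lemJ_D h hiη hiξ hy
  have hF : ∀ {x}, x ∈ M → F x ∈ M := fun hx => h.subset (h.maps_to _ hx)
  have k1 : ∀ x ∈ M, ∀ y ∈ M, s (F x) y = s x (d y) := fun x hx y hy => by
    rw [hs, hs, ← comm_app (sf.c_mem hy) (hF hx), ← comm_app (sf.c_mem (d1 y hy)) hx, ← star_inner,
      ← star_inner (sf.c (d y)), ← sf.c_star, ← sf.c_star, d2 y hy, sa_inner (pr_proj _).isSelfAdjoint,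
      h.e_app hiη hx]
  obtain ⟨A, hA⟩ : ∃ A : BB → BB, ∀ x, A x = d (F x) := ⟨_, fun _ => rfl⟩
  have A1 : ∀ x ∈ M, A x ∈ M := fun x hx => by rw [hA]; exact d1 _ (hF hx)
  have A2 : ∀ x ∈ M, ‖A x‖ ≤ ‖x‖ := fun x hx => by rw [hA]; exact (d3 _ (hF hx)).trans (h.norm_le hx)
  have A3 : ∀ x ∈ M, ∀ y ∈ M, s x (A y) = s (F x) (F y) := fun x hx y hy => by
    rw [hA, k1 _ hx _ (hF hy)]
  have A4 : ∀ x ∈ M, ∀ y ∈ M, s (A x) y = s x (A y) := fun x hx y hy => by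
    rw [s2 _ (A1 x hx) _ hy, A3 _ hy _ hx, A3 _ hx _ hy, ← s2 _ (hF hx) _ (hF hy)]
  have B1 : ∀ n, A^[n] x ∈ M ∧ ‖A^[n] x‖ ≤ ‖x‖ := fun n => by
    induction n with
    | zero => exact ⟨hx, le_rfl⟩
    | succ n ih =>
      rw [Function.iterate_succ_apply']
      exact ⟨A1 _ ih.1, (A2 _ ih.1).trans ih.2⟩
  have u := power_trick (u := fun n => (s (A^[n] x) (A^[n] x)).re) (K := ‖ξ‖ * (‖x‖ * (‖x‖ * ‖η‖)))
    (fun n => (cL (s1 _ (B1 n).1)).1) (fun n => by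
      refine (Complex.re_le_norm _).trans ?_
      rw [hs]
      refine (norm_inner_le_norm _ _).trans ?_
      gcongr
      refine (ContinuousLinearMap.le_opNorm _ _).trans ?_
      gcongr
      · exact (B1 n).2
      refine (ContinuousLinearMap.le_opNorm _ _).trans ?_
      gcongr
      exact (sf.c_norm _).trans (B1 n).2) (fun n => by
      have e : s (A^[n+1] x) (A^[n+1] x) = s (A^[n] x) (A^[n+2] x) := by
        rw [Function.iterate_succ_apply', A4 _ (B1 n).1 _ (A1 _ (B1 n).1), Function.iterate_succ_apply',
          Function.iterate_succ_apply']
      have := s3 _ (B1 (n + 2)).1 _ (B1 n).1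
      rw [← e] at this
      nlinarith [Complex.abs_re_le_norm (s (A^[n+1] x) (A^[n+1] x)), sq_abs (s (A^[n+1] x) (A^[n+1] x)).re,
        abs_nonneg (s (A^[n+1] x) (A^[n+1] x)).re])
  simp only [Function.iterate_zero, id, Function.iterate_succ, Function.comp] at u
  have v := s3 _ (A1 x hx) _ hx
  have p0 : 0 ≤ (s x x).re := (cL (s1 _ hx)).1
  have p1 : 0 ≤ (s (A x) (A x)).re := (cL (s1 _ (A1 x hx))).1
  rw [← A3 x hx x hx]
  refine (Complex.re_le_norm _).trans (abs_le_of_sq_le_sq' ?_ p0).2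
  nlinarith
theorem lemJ (hξ : ξ ∈ sf.cone) (hη : η ∈ sf.cone) (h : CE M D F) (hiη : Inv M F η)
    (hiξ : Inv M F ξ) (hsξ : ∀ x ∈ M, x ξ = 0 → x = 0) (hsη : ∀ x ∈ M, x η = 0 → x = 0) :
    sf.c (pr (orb D ξ)) = pr (orb D η) := by
  obtain ⟨s1, s2, s3⟩ := sf.sform hξ hη
  have hF : ∀ {x}, x ∈ M → F x ∈ M := fun hx => h.subset (h.maps_to _ hx)
  have k0 : ∀ d ∈ D, ∀ y ∈ M, F y = 0 → ⟪ξ, d (sf.c y η)⟫ = 0 := fun d hd y hy hy0 => by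
    have hd' := h.subset hd
    have q := fun t : ℂ => sf.lemJ_form hξ hη h hiη hiξ (add_mem hd' (vn_smul t hy))
    have e : ∀ t : ℂ, F (d + t • y) = d := fun t => by
      rw [h.map_add _ hd' _ (vn_smul t hy), h.map_smul _ _ hy, hy0, h.fixes d hd]; simp
    simp only [e, sf.c_add, sf.c_smul, Aadd, Asmul,
      map_add, map_smul, inner_add_right, inner_smul_right, Complex.add_re] at q
    rw [s2 y hy d hd'] at q
    have p0 : 0 ≤ (⟪ξ, y (sf.c y η)⟫).re := (cL (s1 _ hy)).1
    generalize (⟪ξ, d (sf.c y η)⟫) = w at *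
    generalize (⟪ξ, y (sf.c y η)⟫) = P at *
    have q' : ∀ r : ℝ, 0 ≤ r → 2 * r * ‖w‖ ^ 2 ≤ r ^ 2 * (‖w‖ ^ 2 * P.re) := fun r hr => by
      have h1 := q (-(r : ℂ) * w)
      have h2 : star (-(r : ℂ) * w) * w = ((- r * ‖w‖ ^ 2 : ℝ) : ℂ) := by
        have : star w * w = ((‖w‖ ^ 2 : ℝ) : ℂ) := by
          simpa using Complex.conj_mul' w
        rw [star_mul', mul_assoc, this]; simp
      have h3 : -(r : ℂ) * w * star w = ((- r * ‖w‖ ^ 2 : ℝ) : ℂ) := by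
        have : w * star w = ((‖w‖ ^ 2 : ℝ) : ℂ) := by
          simpa using Complex.mul_conj' w
        rw [mul_assoc, this]; simp
      rw [mul_add, Complex.add_re, h2, h3] at h1
      have h5 : star (-(r : ℂ) * w) * (-(r : ℂ) * w * P) = ((r ^ 2 * ‖w‖ ^ 2 : ℝ) : ℂ) * P := by
        rw [show star (-(r : ℂ) * w) * (-(r : ℂ) * w * P) = (star (-(r : ℂ) * w) * w) * (-(r : ℂ) * P) by ring, h2]
        push_cast; ring
      rw [h5, Complex.re_ofReal_mul, Complex.ofReal_re] at h1
      linarith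
    by_contra hw
    have hw' : 0 < ‖w‖ ^ 2 := by positivity
    have h1 := q' (1 / (P.re + 1)) (by positivity)
    have h2 : 0 < P.re + 1 := by linarith
    rw [div_pow, one_pow] at h1
    have h3 : 2 * (P.re + 1) * ‖w‖ ^ 2 ≤ ‖w‖ ^ 2 * P.re := by
      have := mul_le_mul_of_nonneg_right h1 (sq_nonneg (P.re + 1))
      field_simp at this
      linarith
    nlinarith
  have k1 : ∀ x ∈ M, ∀ y ∈ M, ⟪ξ, F x (sf.c y η)⟫ = ⟪ξ, F x (sf.c (F y) η)⟫ := fun x hx y hy => by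
    have := k0 _ (h.maps_to x hx) (y - F y) (sub_mem hy (hF hy)) (by
      rw [h.sub hy (hF hy), h.fixes _ (h.maps_to y hy), sub_self])
    rwa [sf.c_sub, Asub, map_sub, inner_sub_right, sub_eq_zero] at this
  have k2 : ∀ x ∈ M, ∀ y ∈ M, ⟪ξ, F x (sf.c y η)⟫ = ⟪ξ, x (sf.c (F y) η)⟫ := fun x hx y hy => by
    rw [k1 x hx y hy, s2 x hx _ (hF hy), k1 y hy x hx, ← s2 _ (hF hx) _ (hF hy)]
  have k3 : ∀ x ∈ M, ∀ y ∈ M, ⟪sf.c (star y) ξ, pr (orb D η) (x η) - sf.c (pr (orb D ξ)) (x η)⟫ = 0 :=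
    fun x hx y hy => by
      rw [inner_sub_right, h.e_app hiη hx, ← sa_inner (sf.c_proj (pr_proj _)).isSelfAdjoint, ← mapp (sf.c _),
        ← sf.c_mul, ← sf.J_cone_app hξ (_ * _), mapp, h.e_app hiξ (vst hy), h.star' hy,
        sf.J_cone_app hξ, sf.c_star, sf.c_star, star_inner, star_inner, comm_app (sf.c_mem hy) (hF hx),
        comm_app (sf.c_mem (hF hy)) hx, k2 x hx y hy, sub_self]
  have k4 : ∀ x ∈ M, pr (orb D η) (x η) = sf.c (pr (orb D ξ)) (x η) := fun x hx => by
    have : pr (orb M.commutant ξ) (pr (orb D η) (x η) - sf.c (pr (orb D ξ)) (x η)) = 0 :=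
      pr_orb_zero.2 fun y hy => by
        have := k3 x hx (star (sf.c y)) (vst (sf.c_mem' hy))
        rwa [star_star, sf.c_c] at this
    rw [dense_comm hsξ] at this
    exact sub_eq_zero.1 this
  have := mul_pr_eq (K := orb M η) (S := pr (orb D η)) (T := sf.c (pr (orb D ξ))) fun z hz => by
    obtain ⟨m, hm, rfl⟩ := mem_orb.1 hz
    exact k4 m hm
  rw [sf.dense_cone hη hsη, mul_one, mul_one] at this
  exact this.symm
end StandardForm
structure GV {M : VN H} (sf : StandardForm M) (F : BB → BB) (ξ : H) : Prop where
  cone : ξ ∈ sf.cone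
  sep : ∀ x ∈ M, x ξ = 0 → x = 0
  inv : Inv M F ξ
theorem gv_of {M D : VN H} {sf : StandardForm M} (hσ : SigmaFinite (M : SB)) {F : BB → BB}
    (h : CE M D F) (hf : FaithfulOn (M : SB) F) (hn : IsNormalOn (M : SB) F) {ξ0 : H}
    (hs : ∀ x ∈ M, x ξ0 = 0 → x = 0) :
    ∃ ξ, GV sf F ξ ∧ ∀ x ∈ M, ⟪ξ, x ξ⟫ = ⟪ξ0, F x ξ0⟫ := by
  obtain ⟨ξ, h1, h2⟩ := sf.thmA hσ (h.nf hn (NF.vec D ξ0))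
  refine ⟨ξ, ⟨h1, fun x hx h0 => ?_, fun x hx => ?_⟩, fun x hx => (h2 x hx).symm⟩
  · have hxx := mul_mem (vst hx) hx
    have h3 := h2 _ hxx
    rw [mapp, h0, map_zero, inner_zero_right] at h3
    have h4 := hf _ hxx (star_mul_self_nonneg x) (hs _ (h.subset (h.maps_to _ hxx))
      (op_zero_of (h.pos _ hxx (star_mul_self_nonneg x)) h3))
    exact CStarRing.star_mul_self_eq_zero_iff x |>.1 h4
  · rw [← h2 x hx, ← h2 _ (h.subset (h.maps_to _ hx)), h.fixes _ (h.maps_to x hx)]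
variable {M M₁ M₂ B A Q : VN H} {sf : StandardForm M} {E E1 EA Ψ Φ : BH H → BH H} {ξ η : H}
local notation "AF" => IsAFP M M₁ M₂ B E
section words
inductive RW (M₁ M₂ : VN H) (E : BB → BB) : Bool → BB → Prop
  | one {i} {x : BB} : x ∈ (if i then (M₁ : SB) else (M₂ : SB)) → E x = 0 → RW M₁ M₂ E i x
  | cons {i} {x w : BB} : x ∈ (if i then (M₁ : SB) else (M₂ : SB)) → E x = 0 →
      RW M₁ M₂ E (!i) w → RW M₁ M₂ E i (x * w)
inductive EW (M₁ M₂ : VN H) (E : BB → BB) : BB → Prop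
  | one {y : BB} : y ∈ M₂ → E y = 0 → EW M₁ M₂ E y
  | cons {y x w : BB} : y ∈ M₂ → E y = 0 → x ∈ M₁ → E x = 0 → EW M₁ M₂ E w → EW M₁ M₂ E (y * x * w)
theorem RW.list {i : Bool} (h : RW M₁ M₂ E i w) : ∃ (x : BB) (L : List (Bool × BB)),
    List.IsChain (fun a b : Bool × BB => a.1 ≠ b.1) ((i, x) :: L) ∧
    (∀ p ∈ ((i, x) :: L), p.2 ∈ (if p.1 then (M₁ : SB) else (M₂ : SB)) ∧ E p.2 = 0) ∧
    (((i, x) :: L).map Prod.snd).prod = w := by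
  induction h with
  | @one i x h1 h2 => exact ⟨x, [], by simp, by simpa using ⟨h1, h2⟩, by simp⟩
  | @cons i x w h1 h2 _ ih =>
    obtain ⟨x', L, a, b, c⟩ := ih
    refine ⟨x, (!i, x') :: L, List.isChain_cons_cons.2 ⟨by simp, a⟩, ?_, by
      rw [List.map_cons, List.prod_cons, c]⟩
    intro p hp
    rcases List.mem_cons.1 hp with rfl | hp
    · exact ⟨h1, h2⟩
    · exact b p hp
theorem RW.kill (h : AF) {i : Bool} (hw : RW M₁ M₂ E i w) : E w = 0 := by
  obtain ⟨x, L, a, b, rfl⟩ := hw.list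
  generalize hL : (i, x) :: L = L' at *
  have h1 := h.free L'.length (fun k => (L'[k]).2) (fun k => (L'[k]).1) (by rw [← hL]; simp)
    (fun k => b _ (List.getElem_mem _)) (fun k hk => List.isChain_iff_getElem.1 a k hk)
  rwa [show List.ofFn (fun k : Fin L'.length => (L'[k]).2) = L'.map Prod.snd by
    apply List.ext_getElem <;> simp] at h1
variable (h : AF)
local notation "EW'" => EW M₁ M₂ E
theorem EW.rw (hw : EW' w) : RW M₁ M₂ E false w := by
  induction hw with
  | one h1 h2 => exact .one (by simpa using h1) h2
  | cons h1 h2 h3 h4 _ ih =>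
    rw [mul_assoc]; exact .cons (by simpa using h1) h2 (.cons (by simpa using h3) h4 (by simpa using ih))
theorem EW.rw' (hw : EW' w) (hx : x ∈ M₁) (h0 : E x = 0) : RW M₁ M₂ E false (w * x) := by
  induction hw with
  | one h1 h2 => exact .cons (by simpa using h1) h2 (.one (by simpa using hx) h0)
  | cons h1 h2 h3 h4 _ ih =>
    rw [mul_assoc, mul_assoc]
    exact .cons (by simpa using h1) h2 (.cons (by simpa using h3) h4 (by simpa using ih))
theorem EW.mid {w' : BB} (hw : EW' w) (ha : a ∈ M₁) (h0 : E a = 0) (hw' : EW' w') :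
    EW' (w * a * w') := by
  induction hw with
  | one h1 h2 => exact .cons h1 h2 ha h0 hw'
  | cons h1 h2 h3 h4 _ ih =>
    rw [mul_assoc, mul_assoc, ← mul_assoc _ a]; exact .cons h1 h2 h3 h4 ih
theorem EW.memM (h : AF) (hw : EW' w) : w ∈ M := by
  induction hw with
  | one h1 h2 => exact h.le₂M h1
  | cons h1 h2 h3 h4 _ ih => exact mul_mem (mul_mem (h.le₂M h1) (h.le₁M h3)) ih
theorem EW.star (h : AF) (hw : EW' w) : EW' (star w) := by
  have s : ∀ {x}, x ∈ M → E x = 0 → E (Star.star x) = 0 := fun hx h0 => by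
    rw [h.condExp.star' hx, h0, star_zero]
  induction hw with
  | one h1 h2 => exact .one (vst h1) (s (h.le₂M h1) h2)
  | cons h1 h2 h3 h4 _ ih =>
    rw [star_mul, star_mul, ← mul_assoc]
    exact ih.mid (vst h3) (s (h.le₁M h3) h4) (.one (vst h1) (s (h.le₂M h1) h2))
theorem EW.bmul (h : AF) (hb : b ∈ B) (hw : EW' w) : EW' (b * w) := by
  cases hw with
  | one h1 h2 => exact .one (mul_mem (h.le₂ hb) h1) (by rw [h.condExp.left hb (h.le₂M h1), h2, mul_zero])
  | cons h1 h2 h3 h4 h5 =>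
    rw [← mul_assoc, ← mul_assoc]
    exact .cons (mul_mem (h.le₂ hb) h1) (by rw [h.condExp.left hb (h.le₂M h1), h2, mul_zero]) h3 h4 h5
theorem cen (h : AF) (hB : (B : SB) ⊆ N) (hN : (N : SB) ⊆ M)
    (hx : x ∈ N) :
    x - E x ∈ N ∧ E (x - E x) = 0 ∧ E x ∈ B ∧ x = (x - E x) + E x := by
  have h1 := h.condExp.maps_to x (hN hx)
  exact ⟨sub_mem hx (hB h1), by rw [h.condExp.sub (hN hx) (h.condExp.subset h1), h.condExp.fixes _ h1, sub_self],
    h1, by simp⟩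
theorem EW.kill (h : AF) (ha : a ∈ M₁) (hw : EW' w) (hb : b ∈ M₁) :
    E (a * w * b) = 0 := by
  obtain ⟨a1, a2, a3, a4⟩ := cen h h.le₁ h.le₁M ha
  obtain ⟨b1, b2, b3, b4⟩ := cen h h.le₁ h.le₁M hb
  generalize b - _ = b' at *
  generalize a - _ = a' at *
  have c := h.condExp
  have m := hw.memM h
  have hM := h.le₁M
  have e1 : E (a' * w * b') = 0 := by
    rw [mul_assoc]; exact RW.kill h (.cons (i := true) (by simpa using a1) a2 (by simpa using hw.rw' b1 b2))
  have e2 : E (a' * w) = 0 := RW.kill h (.cons (i := true) (by simpa using a1) a2 (by simpa using hw.rw))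
  have e3 : E (w * b') = 0 := RW.kill h (hw.rw' b1 b2)
  have e4 : E w = 0 := RW.kill h hw.rw
  rw [a4, b4, add_mul, add_mul, mul_add, mul_add, c.map_add _ _ _ _, c.map_add _ _ _ _, c.map_add _ _ _ _, e1,
    c.right b3 (mul_mem (hM a1) m), e2, mul_assoc, c.left a3 (mul_mem m (hM b1)), e3, mul_assoc,
    c.left a3 (mul_mem m (c.subset b3)), c.right b3 m, e4]
  · simp
  all_goals
    first
    | exact add_mem (mul_mem (mul_mem (hM a1) m) (hM b1)) (mul_mem (mul_mem (hM a1) m) (c.subset b3))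
    | exact add_mem (mul_mem (mul_mem (c.subset a3) m) (hM b1)) (mul_mem (mul_mem (c.subset a3) m) (c.subset b3))
    | exact mul_mem (mul_mem (hM a1) m) (hM b1)
    | exact mul_mem (mul_mem (hM a1) m) (c.subset b3)
    | exact mul_mem (mul_mem (c.subset a3) m) (hM b1)
    | exact mul_mem (mul_mem (c.subset a3) m) (c.subset b3)
def WW (M₁ M₂ : VN H) (E : BB → BB) : Submodule ℂ BB :=
  Submodule.span ℂ {x | x ∈ M₁ ∨ ∃ a ∈ M₁, ∃ w, EW M₁ M₂ E w ∧ ∃ b ∈ M₁, x = a * w * b}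
theorem WW.m0 (hm : m ∈ M₁) : m ∈ WW M₁ M₂ E := Submodule.subset_span (Or.inl hm)
theorem WW.w0 (ha : a ∈ M₁) (hw : EW' w) (hb : b ∈ M₁) : a * w * b ∈ WW M₁ M₂ E :=
  Submodule.subset_span (Or.inr ⟨a, ha, w, hw, b, hb, rfl⟩)
theorem WW.lin {S : BB →ₗ[ℂ] BB} {K : Submodule ℂ BB} (h1 : ∀ m ∈ M₁, S m ∈ K)
    (h2 : ∀ a ∈ M₁, ∀ w, EW' w → ∀ b ∈ M₁, S (a * w * b) ∈ K) (hx : x ∈ WW M₁ M₂ E) : S x ∈ K := by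
  have : WW M₁ M₂ E ≤ K.comap S := Submodule.span_le.2 (by
    rintro x (h | ⟨a, ha, w, hw, b, hb, rfl⟩)
    · exact h1 x h
    · exact h2 a ha w hw b hb)
  exact this hx
theorem WW.mul₁ (hm : m ∈ M₁) (hx : x ∈ WW M₁ M₂ E) : m * x ∈ WW M₁ M₂ E :=
  WW.lin (S := LinearMap.mulLeft ℂ m) (fun a ha => WW.m0 (mul_mem hm ha)) (fun a ha w hw b hb => by
    rw [LinearMap.mulLeft_apply, ← mul_assoc, ← mul_assoc]
    exact WW.w0 (mul_mem hm ha) hw hb) hx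
theorem WW.y0 (h : AF) (hy : y ∈ M₂) (ha : a ∈ M₁) (hw : EW' w)
    (hb : b ∈ M₁) : y * (a * w * b) ∈ WW M₁ M₂ E := by
  have c := h.condExp
  have k : ∀ {y w}, y ∈ M₂ → EW' w → y * w * b ∈ WW M₁ M₂ E := fun {y w} hy hw => by
    cases hw with
    | @one y1 h1 h2 =>
      obtain ⟨a1, a2, a3, a4⟩ := cen h h.le₂ h.le₂M (mul_mem hy h1)
      rw [a4, add_mul]
      refine add_mem ?_ (WW.m0 (mul_mem (h.le₁ a3) hb))
      have := WW.w0 (one_mem M₁) (EW.one (M₁ := M₁) a1 a2) hb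
      rwa [one_mul] at this
    | @cons y1 x w h1 h2 h3 h4 h5 =>
      obtain ⟨a1, a2, a3, a4⟩ := cen h h.le₂ h.le₂M (mul_mem hy h1)
      rw [show y * (y1 * x * w) = (y * y1) * x * w by simp only [mul_assoc], a4, add_mul, add_mul, add_mul]
      refine add_mem ?_ (WW.w0 (mul_mem (h.le₁ a3) h3) h5 hb)
      have := WW.w0 (one_mem M₁) (EW.cons a1 a2 h3 h4 h5) hb
      rwa [one_mul] at this
  obtain ⟨a1, a2, a3, a4⟩ := cen h h.le₁ h.le₁M ha
  obtain ⟨b1, b2, b3, b4⟩ := cen h h.le₂ h.le₂M hy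
  rw [a4, add_mul, add_mul, mul_add]
  refine add_mem ?_ ?_
  · rw [b4, add_mul]
    refine add_mem ?_ (WW.mul₁ (h.le₁ b3) (WW.w0 a1 hw hb))
    have := WW.w0 (one_mem M₁) (EW.cons b1 b2 a1 a2 hw) hb
    rw [one_mul] at this
    convert this using 1; simp only [mul_assoc]
  · have := k (mul_mem hy (h.le₂ a3)) hw
    convert this using 1; simp only [mul_assoc]
theorem WW.mul₂ (h : AF) (hm : m ∈ M₂) (hx : x ∈ WW M₁ M₂ E) : m * x ∈ WW M₁ M₂ E :=
  WW.lin (S := LinearMap.mulLeft ℂ m) (fun a ha => by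
    obtain ⟨b1, b2, b3, b4⟩ := cen h h.le₂ h.le₂M hm
    rw [LinearMap.mulLeft_apply, b4, add_mul]
    refine add_mem ?_ (WW.m0 (mul_mem (h.le₁ b3) ha))
    have := WW.w0 (one_mem M₁) (EW.one (M₁ := M₁) b1 b2) ha
    rwa [one_mul] at this) (fun a ha w hw b hb => WW.y0 h hm ha hw hb) hx
theorem WW.memM (h : AF) (hx : x ∈ WW M₁ M₂ E) : x ∈ M :=
  WW.lin (S := LinearMap.id) (K := M.toStarSubalgebra.toSubalgebra.toSubmodule) (fun m hm => h.le₁M hm)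
    (fun a ha w hw b hb => mul_mem (S := VN H) (mul_mem (h.le₁M ha) (hw.memM h)) (h.le₁M hb)) hx
theorem dens1 (h : AF) (hx : x ∈ M) (ζ : H) {ε : ℝ} (hε : 0 < ε) :
    ∃ w ∈ WW M₁ M₂ E, ‖(x - w) ζ‖ < ε := by
  obtain ⟨K, hK⟩ : ∃ K : Submodule ℂ H, K = (WW M₁ M₂ E).map
    ((ContinuousLinearMap.apply ℂ H ζ : BB →L[ℂ] H) : BB →ₗ[ℂ] H) := ⟨_, rfl⟩
  have mK : ∀ z, z ∈ K ↔ ∃ w ∈ WW M₁ M₂ E, w ζ = z := fun z => by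
    rw [hK, Submodule.mem_map]; rfl
  have inv : ∀ N : VN H, (∀ m ∈ N, ∀ w ∈ WW M₁ M₂ E, m * w ∈ WW M₁ M₂ E) → pr K ∈ N.commutant := fun N hN =>
    pr_mem_vn fun y hy z hz => by
      rw [VonNeumannAlgebra.commutant_commutant] at hy
      obtain ⟨w, hw, rfl⟩ := (mK z).1 hz
      exact Submodule.le_topologicalClosure _ ((mK _).2 ⟨_, hN y hy w hw, rfl⟩)
  have hx' : x ∈ Set.centralizer (Set.centralizer ((M₁ : SB) ∪ (M₂ : SB))) := by
    rw [h.generated]; exact hx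
  have e := hx' (pr K) (by
    rintro y (hy | hy)
    · exact comm_iff.1 (inv M₁ fun m hm w hw => WW.mul₁ hm hw) y hy
    · exact comm_iff.1 (inv M₂ fun m hm w hw => WW.mul₂ h hm hw) y hy)
  have e1 : pr K (x ζ) = x ζ := by
    rw [← mapp, e, mapp, pr_apply ((mK ζ).2 ⟨1, WW.m0 (one_mem M₁), rfl⟩)]
  have e2 := pr_eq_self.1 e1
  obtain ⟨z, hz, hlt⟩ := Metric.mem_closure_iff.1 (show x ζ ∈ closure (K : Set H) from e2) ε hε
  obtain ⟨w, hw, rfl⟩ := (mK z).1 hz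
  exact ⟨w, hw, by rwa [dist_eq_norm] at hlt⟩
theorem NF.plus {φ ψ : BB → ℂ} (h1 : NF N φ) (h2 : NF N ψ) : NF N (fun x => φ x + ψ x) where
  add x hx y hy := by rw [h1.add x hx y hy, h2.add x hx y hy]; ring
  smul c x hx := by rw [h1.smul c x hx, h2.smul c x hx]; ring
  pos x hx h0 := add_nonneg (h1.pos x hx h0) (h2.pos x hx h0)
  normal S hS hne hd x hx hl ε hε := by
    obtain ⟨s, hs, a⟩ := h1.normal S hS hne hd x hx hl (ε / 2) (by positivity)
    obtain ⟨t, ht, b⟩ := h2.normal S hS hne hd x hx hl (ε / 2) (by positivity)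
    obtain ⟨r, hr, c1, c2⟩ := hd s hs t ht
    have d1 := h1.mono (hS hs) (hS hr) c1
    have d2 := h2.mono (hS ht) (hS hr) c2
    exact ⟨r, hr, by simp only [Complex.add_re]; linarith⟩
theorem dens (h : AF) (hσ : SigmaFinite (M : SB)) (sf : StandardForm M) 
    (hx : x ∈ M) (α β : H) {ε : ℝ} (hε : 0 < ε) :
    ∃ w ∈ WW M₁ M₂ E, ‖(x - w) α‖ < ε ∧ ‖(x - w) β‖ < ε := by
  obtain ⟨ζ, -, hζ⟩ := sf.thmA hσ ((NF.vec M α).plus (NF.vec M β))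
  obtain ⟨w, hw, hlt⟩ := dens1 h hx ζ hε
  have hm : x - w ∈ M := sub_mem hx (WW.memM h hw)
  have e := hζ _ (mul_mem (vst hm) hm)
  rw [normsq_inner, normsq_inner, normsq_inner] at e
  have e : ‖(x - w) α‖ ^ 2 + ‖(x - w) β‖ ^ 2 = ‖(x - w) ζ‖ ^ 2 := by exact_mod_cast e
  refine ⟨w, hw, lt_of_le_of_lt (abs_le_of_sq_le_sq' ?_ (norm_nonneg _)).2 hlt,
    lt_of_le_of_lt (abs_le_of_sq_le_sq' ?_ (norm_nonneg _)).2 hlt⟩ <;> nlinarith [sq_nonneg ‖(x - w) α‖, sq_nonneg ‖(x - w) β‖]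
end words
theorem corner_sqrt (he : e ∈ N) (hp : Pj e) (hy : y ∈ N) :
    ∃ g ∈ N, IsSelfAdjoint g ∧ g * e = g ∧ e * g = g ∧ g * g = star (y * e) * (y * e) ∧
      ∀ v, ‖g v‖ = ‖y (e v)‖ := by
  have h0 : 0 ≤ star (y * e) * (y * e) := star_mul_self_nonneg _
  have hN : star (y * e) * (y * e) ∈ N :=
    mul_mem (vst (mul_mem hy he)) (mul_mem hy he)
  obtain ⟨g1, g2, g3⟩ := sqrt_facts h0
  have gN := sqrt_mem hN
  generalize CFC.sqrt (star (y * e) * (y * e)) = g at *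
  have a0 : ∀ v : H, ‖g v‖ = ‖y (e v)‖ := fun v => by
    have : ((‖g v‖ ^ 2 : ℝ) : ℂ) = ((‖y (e v)‖ ^ 2 : ℝ) : ℂ) := by
      rw [← normsq_inner, g1.star_eq, g2, normsq_inner, mapp]
    exact (pow_left_inj₀ (norm_nonneg _) (norm_nonneg _) two_ne_zero).1 (by exact_mod_cast this)
  have a1 : g * e = g := by
    ext v
    have := a0 (v - e v)
    rw [map_sub, map_sub, ← mapp e e, proj_mul hp, sub_self, map_zero, norm_zero, norm_eq_zero, sub_eq_zero] at this
    rw [mapp, this]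
  have a2 : e * g = g := by
    have := congrArg star a1
    rwa [star_mul, g1.star_eq, star_proj hp] at this
  exact ⟨g, gN, g1, a1, a2, g2, a0⟩
theorem lemR {ξ : H} (he : e ∈ N.commutant) (hp : Pj e)
    (heξ : e ξ = ξ) (hd : pr (orb N.commutant ξ) = 1) (hT : e * T * e = T)
    (hc : ∀ y ∈ N.commutant, T * (e * y * e) = e * y * e * T) : ∃ m ∈ N, m * e = T := by
  have eT : e * T = T := by rw [← hT, ← mul_assoc, ← mul_assoc, proj_mul hp]
  have Te : T * e = T := by rw [← hT, mul_assoc, proj_mul hp]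
  obtain ⟨m, hm, h1, -⟩ := lemX (N := N.commutant) (ξ := ξ) (κ := T ξ) (norm_nonneg T) (fun y hy => by
    obtain ⟨g, gN, g1, a1, a2, -, a0⟩ := corner_sqrt he hp hy
    have a3 := hc g gN
    rw [a2, a1] at a3
    rw [show y (T ξ) = y (e (T ξ)) by rw [← mapp e, eT], ← a0, show y ξ = y (e ξ) by rw [heξ], ← a0, ← mapp, ← a3]
    exact T.le_opNorm _)
  rw [VonNeumannAlgebra.commutant_commutant] at hm
  refine ⟨m, hm, ?_⟩
  have := mul_pr_eq (K := orb N.commutant ξ) (S := m * e) (T := T) fun z hz => by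
    obtain ⟨y, hy, rfl⟩ := mem_orb.1 hz
    have h2 : T (y ξ) = e (y (T ξ)) := by
      calc T (y ξ) = (T * (e * y * e)) ξ := by
            rw [← mul_assoc, ← mul_assoc, Te, mapp, heξ, mapp]
        _ = e (y (T ξ)) := by rw [hc y hy, mul_assoc, eT, mapp, mapp]
    rw [h2, ← h1, mapp, ← comm_app he hm, comm_app hy hm]
  rwa [hd, mul_one, mul_one] at this
theorem nonneg_of_dense {K : Submodule ℂ H} (hd : pr K = 1) (k : ∀ z ∈ K, 0 ≤ ⟪z, m z⟫) : 0 ≤ m := by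
  refine nonneg_iff.2 fun v => ?_
  have hv : v ∈ closure (K : Set H) := pr_eq_self.1 (by rw [hd]; rfl)
  exact closure_minimal (s := (K : Set H)) (t := {z | 0 ≤ ⟪z, m z⟫}) k
    (isClosed_Ici.preimage (f := fun z => ⟪z, m z⟫) (by fun_prop)) hv
theorem pos_of_e {ξ : H} (he : e ∈ N.commutant) (hp : Pj e)
    (heξ : e ξ = ξ) (hd : pr (orb N.commutant ξ) = 1) (hm : m ∈ N) (h0 : 0 ≤ m * e) : 0 ≤ m := by
  refine nonneg_of_dense hd fun z hz => ?_
  obtain ⟨y, hy, rfl⟩ := mem_orb.1 hz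
  obtain ⟨g, gN, g1, a1, a2, g2, -⟩ := corner_sqrt he hp hy
  have h1 : ⟪y ξ, m (y ξ)⟫ = ⟪g ξ, (m * e) (g ξ)⟫ := by
    rw [mapp, ← mapp e g, a2, ← comm_app gN hm, sa_inner g1, ← mapp g g, g2, mapp, inner_star, mapp, mapp, heξ,
      comm_app he hm, heξ, comm_app hy hm]
  rw [h1]
  exact nonneg_iff.1 h0 _
section E1
local notation "e1" => pr (orb M₁ ξ)
theorem e1_word (h : AF) (hi : Inv M E ξ) (ha : a ∈ M₁)
    (hw : EW M₁ M₂ E w) (hb : b ∈ M₁) : e1 * (a * w * b) * e1 = 0 := by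
  have := mul_pr_eq (K := orb M₁ ξ) (S := e1 * (a * w * b)) (T := 0) fun z hz => by
    obtain ⟨m, hm, rfl⟩ := mem_orb.1 hz
    rw [mapp, Azero]
    refine pr_orb_zero.2 fun n hn => ?_
    have hn' := vst hn
    have e : ⟪n ξ, (a * w * b) (m ξ)⟫ = ⟪ξ, ((star n * a) * w * (b * m)) ξ⟫ := by
      rw [← inner_star]; simp only [mapp]
    rw [e, ← hi _ (mul_mem (mul_mem (h.le₁M (mul_mem hn' ha)) (hw.memM h))
      (h.le₁M (mul_mem hb hm))), hw.kill h (mul_mem hn' ha) (mul_mem hb hm)]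
    simp
  simpa using this
theorem e1_exists (h : AF) (hσ : SigmaFinite (M : SB)) (sf : StandardForm M)
    (g : GV sf E ξ) (hx : x ∈ M) : ∃ m ∈ M₁, m * e1 = e1 * x * e1 := by
  have ep := pr_proj (orb M₁ ξ)
  have ec := pr_orb_mem M₁ ξ
  refine lemR ec ep (pr_orb_self _ _) (StandardForm.dense_comm fun x hx => g.sep x (h.le₁M hx)) ?_ fun y hy => ?_
  · rw [← mul_assoc, ← mul_assoc, proj_mul ep, mul_assoc, proj_mul ep]
  have hY : ∀ y' ∈ M₁.commutant, ∀ w ∈ WW M₁ M₂ E, (e1 * w * e1) * (e1 * y' * e1) - e1 * y' * e1 * (e1 * w * e1) = 0 := by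
    intro y' hy' w hw
    have := WW.lin (K := ⊥) (S := (LinearMap.mulRight ℂ (e1 * y' * e1) - LinearMap.mulLeft ℂ (e1 * y' * e1)) ∘ₗ
      (LinearMap.mulRight ℂ e1 ∘ₗ LinearMap.mulLeft ℂ e1)) (fun m hm => ?_) (fun a ha w hw b hb => ?_) hw
    · simp only [LinearMap.comp_apply, LinearMap.sub_apply, LinearMap.mulRight_apply, LinearMap.mulLeft_apply,
        Submodule.mem_bot] at this
      exact this
    · simp only [LinearMap.comp_apply, LinearMap.sub_apply, LinearMap.mulRight_apply, LinearMap.mulLeft_apply,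
        Submodule.mem_bot, sub_eq_zero]
      have c1 := comm_iff.1 ec m hm
      have c2 := comm_iff.1 (mul_mem (mul_mem ec hy') ec) m hm
      rw [← c1, mul_assoc m, proj_mul ep, mul_assoc m, ← mul_assoc e1 (e1 * y'), ← mul_assoc e1 e1, proj_mul ep,
        c2, c1, ← mul_assoc _ e1 m, mul_assoc (e1 * y') e1 e1, proj_mul ep]
    · simp only [LinearMap.comp_apply, LinearMap.sub_apply, LinearMap.mulRight_apply, LinearMap.mulLeft_apply,
        Submodule.mem_bot, e1_word h g.inv ha hw hb, zero_mul, mul_zero, sub_zero]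
  refine sub_eq_zero.1 (ContinuousLinearMap.ext fun v => ?_)
  by_contra hne
  obtain ⟨D, hD⟩ : ∃ D : BB, D = e1 * y * e1 := ⟨_, rfl⟩
  rw [← hD] at hne
  have hpos : 0 < ‖(e1 * x * e1 * D - D * (e1 * x * e1)) v‖ := norm_pos_iff.2 hne
  obtain ⟨w, hw, w1, w2⟩ := dens h hσ sf hx (e1 (D v)) (e1 v)
    (ε := ‖(e1 * x * e1 * D - D * (e1 * x * e1)) v‖ / (2 * (1 + ‖D‖))) (by positivity)
  have e0 := congrArg (fun S : BB => S v) (hY y hy w hw)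
  rw [← hD] at e0
  have e2 : (e1 * x * e1 * D - D * (e1 * x * e1)) v = e1 ((x - w) (e1 (D v))) - D (e1 ((x - w) (e1 v))) := by
    simp only [Asub, mapp, Azero, map_sub] at e0 ⊢
    rw [← sub_zero (_ - _), ← e0]; abel
  have b1 : ‖e1 ((x - w) (e1 (D v)))‖ ≤ ‖(x - w) (e1 (D v))‖ := proj_norm_le ep _
  have b2 : ‖D (e1 ((x - w) (e1 v)))‖ ≤ ‖D‖ * ‖(x - w) (e1 v)‖ :=
    (D.le_opNorm _).trans (by gcongr; exact proj_norm_le ep _)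
  have b3 := norm_sub_le (e1 ((x - w) (e1 (D v)))) (D (e1 ((x - w) (e1 v))))
  rw [← e2] at b3
  have b4 : ‖D‖ * ‖(x - w) (e1 v)‖ ≤ ‖D‖ * (‖(e1 * x * e1 * D - D * (e1 * x * e1)) v‖ / (2 * (1 + ‖D‖))) := by gcongr
  have b5 : ‖(e1 * x * e1 * D - D * (e1 * x * e1)) v‖ / (2 * (1 + ‖D‖)) * (1 + ‖D‖) =
      ‖(e1 * x * e1 * D - D * (e1 * x * e1)) v‖ / 2 := by
    have : 1 + ‖D‖ ≠ 0 := by positivity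
    field_simp
  nlinarith
theorem exE1 (h : AF) (hσ : SigmaFinite (M : SB)) (sf : StandardForm M)
    (g : GV sf E ξ) : ∃ F : BB → BB, CE M M₁ F ∧ FaithfulOn (M : SB) F ∧
      IsNormalOn (M : SB) F ∧ Inv M F ξ ∧
      ∀ a ∈ M₁, ∀ w, EW M₁ M₂ E w → ∀ b ∈ M₁, F (a * w * b) = 0 := by
  have ep := pr_proj (orb M₁ ξ)
  have ec := pr_orb_mem M₁ ξ
  have eξ := pr_orb_self M₁ ξ
  have hd := StandardForm.dense_comm (M := M₁) (ξ := ξ) fun x hx => g.sep x (h.le₁M hx)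
  choose! F F1 F2 using fun x (hx : x ∈ M) => e1_exists h hσ sf g hx
  have uq : ∀ {m n}, m ∈ M₁ → n ∈ M₁ → m * e1 = n * e1 → m = n := fun {m n} hm hn hmn => by
    have := congrArg (fun S : BB => S ξ) hmn
    simp only [mapp, eξ] at this
    exact sub_eq_zero.1 (g.sep _ (sub_mem (h.le₁M hm) (h.le₁M hn)) (by simp [this]))
  have hF0 : ∀ x ∈ M, 0 ≤ x → 0 ≤ F x := fun x hx h0 => pos_of_e ec ep eξ hd (F1 x hx) (by
    rw [F2 x hx]
    have := star_left_conjugate_nonneg h0 e1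
    rwa [star_proj ep] at this)
  have hFi : ∀ x ∈ M, ⟪ξ, F x ξ⟫ = ⟪ξ, x ξ⟫ := fun x hx => by
    have := congrArg (fun S : BB => ⟪ξ, S ξ⟫) (F2 x hx)
    simp only [mapp, eξ] at this
    rw [this, ← sa_inner ep.isSelfAdjoint, eξ]
  have ce : CE M M₁ F := by
    refine ⟨h.le₁M, fun x hx y hy => ?_, fun c x hx => ?_, F1, fun x hx => ?_, hF0, fun a ha b hb x hx => ?_⟩
    · refine uq (F1 _ (add_mem hx hy)) (add_mem (F1 x hx) (F1 y hy)) ?_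
      rw [F2 _ (add_mem hx hy), add_mul, F2 x hx, F2 y hy, mul_add, add_mul]
    · refine uq (F1 _ (vn_smul c hx)) (vn_smul c (F1 x hx)) ?_
      rw [F2 _ (vn_smul c hx), smul_mul_assoc, F2 x hx, mul_smul_comm, smul_mul_assoc]
    · refine uq (F1 _ (h.le₁M hx)) hx ?_
      rw [F2 _ (h.le₁M hx), ← comm_iff.1 ec x hx, mul_assoc, proj_mul ep]
    · have hm := mul_mem (mul_mem (h.le₁M ha) hx) (h.le₁M hb)
      refine uq (F1 _ hm) (mul_mem (mul_mem ha (F1 x hx)) hb) ?_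
      rw [F2 _ hm, mul_assoc _ b, comm_iff.1 ec b hb, mul_assoc a (F x), ← mul_assoc (F x), F2 x hx, ← mul_assoc e1,
        ← mul_assoc e1, ← comm_iff.1 ec a ha, mul_assoc _ b, comm_iff.1 ec b hb]
      simp only [mul_assoc]
  refine ⟨F, ce, fun x hx h0 hx0 => ?_, fun S hS hne hdir x hx hl => ⟨?_, fun z hz => ?_⟩, hFi, fun a ha w hw b hb => ?_⟩
  · have h1 := hFi x hx
    rw [hx0, Azero, inner_zero_right] at h1
    exact g.sep x hx (op_zero_of h0 h1.symm)
  · rintro _ ⟨s, hs, rfl⟩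
    exact ce.mono (fun x hx y hy => vsb hx hy) (hS hs) hx (hl.1 hs)
  · have hx0 : IsSelfAdjoint (z - F x) := by
      obtain ⟨s, hs⟩ := hne
      have h1 : 0 ≤ z - F s := sub_nonneg.2 (hz ⟨s, hs, rfl⟩)
      have h2 : 0 ≤ F x - F s := sub_nonneg.2 (ce.mono (fun x hx y hy => vsb hx hy) (hS hs) hx (hl.1 hs))
      have := (sa_of_nonneg h1).sub (sa_of_nonneg h2)
      rwa [sub_sub_sub_cancel_right] at this
    refine sub_nonneg.1 (nonneg_of_dense hd fun v hv => ?_)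
    obtain ⟨y, hy, rfl⟩ := mem_orb.1 hv
    have im : (⟪y ξ, (z - F x) (y ξ)⟫).im = 0 := by
      have := congrArg Complex.im (inner_conj_symm (y ξ) ((z - F x) (y ξ)))
      rw [sa_inner hx0, Complex.conj_im] at this
      linarith
    refine Complex.le_def.2 ⟨?_, by rw [im]; rfl⟩
    rw [Complex.zero_re]
    refine le_of_forall_pos_lt_add fun ε hε => ?_
    obtain ⟨s, hs, hlt⟩ := vigier hne hdir hl ξ (ε := ε / (1 + ‖y‖ ^ 2)) (by positivity)
    have hxs : x - s ∈ M := sub_mem hx (hS hs)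
    have h0 : 0 ≤ x - s := sub_nonneg.2 (hl.1 hs)
    have p0 := hF0 _ hxs h0
    obtain ⟨r1, r2, r3⟩ := sqrt_facts p0
    have rM := sqrt_mem (F1 _ hxs)
    generalize CFC.sqrt (F (x - s)) = r at *
    have a0 : ∀ v : H, (⟪v, F (x - s) v⟫).re = ‖r v‖ ^ 2 := fun v => by
      rw [← r2, ← Complex.ofReal_re (‖r v‖ ^ 2), ← normsq_inner, r1.star_eq]
    have a1 : ‖r (y ξ)‖ ≤ ‖y‖ * ‖r ξ‖ := by rw [← comm_app hy rM]; exact y.le_opNorm _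
    have a2 : ‖r ξ‖ ^ 2 < ε / (1 + ‖y‖ ^ 2) := by rw [← a0, hFi _ hxs]; exact hlt
    have a3 : ‖r (y ξ)‖ ^ 2 < ε := by
      calc ‖r (y ξ)‖ ^ 2 ≤ (‖y‖ * ‖r ξ‖) ^ 2 := by gcongr
        _ = ‖y‖ ^ 2 * ‖r ξ‖ ^ 2 := by ring
        _ ≤ ‖y‖ ^ 2 * (ε / (1 + ‖y‖ ^ 2)) := by gcongr
        _ < ε := by
          rw [← mul_div_assoc, div_lt_iff₀ (by positivity)]; nlinarith
    have a4 : 0 ≤ (⟪y ξ, (z - F s) (y ξ)⟫).re :=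
      (cL (nonneg_iff.1 (sub_nonneg.2 (hz ⟨s, hs, rfl⟩)) (y ξ))).1
    rw [← a0, ce.sub hx (hS hs)] at a3
    simp only [Asub, inner_sub_right, Complex.sub_re] at a3 a4 ⊢
    linarith
  · refine uq (F1 _ (mul_mem (mul_mem (h.le₁M ha) (hw.memM h)) (h.le₁M hb))) (zero_mem M₁) ?_
    rw [F2 _ (mul_mem (mul_mem (h.le₁M ha) (hw.memM h)) (h.le₁M hb)), e1_word h g.inv ha hw hb, zero_mul]
end E1
def StandardForm.cv {M : VN H} (sf : StandardForm M) (N : VN H) : VN H :=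
  vnComm (sf.c '' (N.commutant : SB)) (by
    rintro _ ⟨x, hx, rfl⟩
    exact ⟨star x, vst hx, sf.c_star x⟩)
theorem StandardForm.mem_cv (sf : StandardForm M) :
    y ∈ sf.cv N ↔ sf.c y ∈ N := by
  rw [StandardForm.cv, mem_vnComm, vn_iff, Set.forall_mem_image]
  refine forall₂_congr fun x hx => ⟨fun h => ?_, fun h => ?_⟩
  · have := congrArg sf.c h
    rwa [sf.c_mul, sf.c_mul, sf.c_c] at this
  · have := congrArg sf.c h
    rwa [sf.c_mul, sf.c_mul, sf.c_c] at this
theorem StandardForm.c_cv (sf : StandardForm M) (h : y ∈ N) :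
    sf.c y ∈ sf.cv N := sf.mem_cv.2 (by rwa [sf.c_c])
theorem StandardForm.cv_comm (sf : StandardForm M) :
    x ∈ (sf.cv N).commutant ↔ ∀ y ∈ N, sf.c y * x = x * sf.c y := by
  rw [comm_iff]
  exact ⟨fun h y hy => h _ (sf.c_cv hy), fun h y hy => by rw [← sf.c_c y]; exact h _ (sf.mem_cv.1 hy)⟩
theorem StandardForm.le_cv (sf : StandardForm M) (hN : (N : SB) ⊆ M) 
    (hx : x ∈ M) : x ∈ (sf.cv N).commutant := sf.cv_comm.2 fun y hy => (sf.c_comm hx (hN hy)).symm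
theorem StandardForm.coe_cv (sf : StandardForm M) :
    ((sf.cv N).commutant : SB) = basicConstruction sf.J (N : SB) := by
  ext x
  rw [SetLike.mem_coe, sf.cv_comm, basicConstruction, Set.mem_centralizer_iff, Set.forall_mem_image]
  rfl
section P
def LG (M₁ M₂ : VN H) (E : BB → BB) (ξ : H) : Set H := {z | ∃ w, EW M₁ M₂ E w ∧ ∃ b ∈ M₁, z = w (b ξ)}
local notation "PP" => pr (Submodule.span ℂ (LG M₁ M₂ E ξ))
theorem P_self (hw : EW M₁ M₂ E w) (hb : b ∈ M₁) : PP (w (b ξ)) = w (b ξ) :=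
  pr_apply (Submodule.subset_span ⟨w, hw, b, hb, rfl⟩)
theorem pr_span_zero {G : Set H} {v : H} (h : ∀ z ∈ G, ⟪z, v⟫ = 0) : pr (Submodule.span ℂ G) v = 0 :=
  pr_eq_zero.2 fun z hz => by
    induction hz using Submodule.span_induction with
    | mem z hz => exact h z hz
    | zero => simp
    | add x y _ _ hx hy => rw [inner_add_left, hx, hy, add_zero]
    | smul c x _ hx => rw [inner_smul_left, hx, mul_zero]
theorem P_m (h : AF) (hi : Inv M E ξ) (hm : m ∈ M₁) : PP (m ξ) = 0 := by
  refine pr_span_zero ?_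
  rintro _ ⟨w, hw, b, hb, rfl⟩
  have hb' := vst hb
  have e : ⟪w (b ξ), m ξ⟫ = ⟪ξ, (star b * star w * m) ξ⟫ := by
    simp only [mapp, inner_star]
  rw [e, ← hi _ (mul_mem (mul_mem (h.le₁M hb') ((hw.star h).memM h)) (h.le₁M hm)), (hw.star h).kill h hb' hm]
  simp
theorem P_x (h : AF) (hi : Inv M E ξ) (hx : x ∈ M₁) (h0 : E x = 0)
    (hw : EW M₁ M₂ E w) (hb : b ∈ M₁) : PP (x (w (b ξ))) = 0 := by
  refine pr_span_zero ?_
  rintro _ ⟨w', hw', b', hb', rfl⟩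
  have hb'' := vst hb'
  have e : ⟪w' (b' ξ), x (w (b ξ))⟫ = ⟪ξ, (star b' * (star w' * x * w) * b) ξ⟫ := by
    simp only [mapp, inner_star]
  have hW := (hw'.star h).mid hx h0 hw
  rw [e, ← hi _ (mul_mem (mul_mem (h.le₁M hb'') (hW.memM h)) (h.le₁M hb)), hW.kill h hb'' hb]
  simp
theorem P_B (h : AF) : PP ∈ B.commutant := by
  refine pr_span_mem ?_
  rintro y hy _ ⟨w, hw, b, hb, rfl⟩
  rw [VonNeumannAlgebra.commutant_commutant] at hy
  exact Submodule.subset_span ⟨y * w, hw.bmul h hy, b, hb, rfl⟩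
theorem P_xw (h : AF) (hi : Inv M E ξ) (hx : x ∈ M₁)
    (hw : EW M₁ M₂ E w) (hb : b ∈ M₁) : PP (x (w (b ξ))) = E x (w (b ξ)) := by
  obtain ⟨x1, x2, x3, x4⟩ := cen h h.le₁ h.le₁M hx
  conv_lhs => rw [x4]
  rw [Aadd, map_add, P_x h hi x1 x2 hw hb, zero_add, ← mapp (E x),
    P_self (hw.bmul h x3) hb]
theorem P_PxP (h : AF) (hi : Inv M E ξ) (hx : x ∈ M₁) : PP * x * PP = E x * PP := by
  refine mul_pr_span ?_
  rintro _ ⟨w, hw, b, hb, rfl⟩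
  exact P_xw h hi hx hw hb
theorem P_w (h : AF) (sf : StandardForm M) (g : GV sf E ξ) (hw : EW M₁ M₂ E w) :
    (1 - PP) * w * (1 - PP) = 0 := by
  obtain ⟨S, hS⟩ : ∃ S : BB, S = (1 - PP) * w * (1 - PP) := ⟨_, rfl⟩
  have h0 : ∀ x ∈ WW M₁ M₂ E, S (x ξ) = 0 := by
    intro x hx
    refine Submodule.span_induction ?_ (by simp) (fun x y _ _ hx hy => by simp [hx, hy])
      (fun c x _ hx => by simp [hx]) hx
    rintro x (hm | ⟨a, ha, w', hw', b, hb, rfl⟩)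
    · simp only [hS, mapp, Asub, P_m h g.inv hm, Aone, sub_zero,
        P_self hw hm, sub_self]
    · obtain ⟨x1, x2, x3, x4⟩ := cen h h.le₁ h.le₁M ha
      have e : (1 - PP) ((a * w' * b) ξ) = (a - E a) (w' (b ξ)) := by
        rw [mapp, mapp, Asub, P_xw h g.inv ha hw' hb]; rfl
      have e2 : w ((a - E a) (w' (b ξ))) = (w * (a - E a) * w') (b ξ) := rfl
      rw [hS, mapp, mapp, e, e2, Asub, P_self (hw.mid x1 x2 hw') hb]
      exact sub_self _
  rw [← hS]
  have h1 : S * pr (orb M ξ) = 0 * pr (orb M ξ) := mul_pr_eq fun z hz => by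
    obtain ⟨x, hx, rfl⟩ := mem_orb.1 hz
    rw [Azero]
    by_contra hne
    have hp : 0 < ‖S (x ξ)‖ := norm_pos_iff.2 hne
    obtain ⟨y, hy, hlt⟩ := dens1 h hx ξ (ε := ‖S (x ξ)‖ / (1 + ‖S‖)) (by positivity)
    have e : S (x ξ) = S ((x - y) ξ) := by
      rw [Asub, map_sub, h0 y hy, sub_zero]
    have b1 := S.le_opNorm ((x - y) ξ)
    rw [← e] at b1
    rw [lt_div_iff₀ (by positivity)] at hlt
    nlinarith [norm_nonneg ((x - y) ξ)]
  rwa [sf.dense_cone g.cone g.sep, mul_one, mul_one] at h1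
theorem P_C (h : AF) (sf : StandardForm M) (g : GV sf E ξ) {F : BB → BB} (hF : CE M M₁ F)
    (hi : Inv M F ξ) : PP ∈ (sf.cv M₁).commutant := by
  have hJ := sf.lemJ g.cone g.cone hF hi hi g.sep g.sep
  refine pr_mem_vn fun y hy z hz => ?_
  rw [VonNeumannAlgebra.commutant_commutant, sf.mem_cv] at hy
  have hy' := sf.c_mem (h.le₁M hy)
  rw [sf.c_c] at hy'
  have h1 : y ξ ∈ (orb M₁ ξ).topologicalClosure := by
    rw [← pr_eq_self, ← sf.c_c y, ← sf.J_cone_app g.cone]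
    nth_rewrite 1 [← hJ]
    rw [sf.c_J, pr_apply (orb_mem hy ξ)]
  refine op_mem_closure (K := Submodule.span ℂ (LG M₁ M₂ E ξ)) (fun z hz => ?_) (Submodule.le_topologicalClosure _ hz)
  refine Submodule.span_induction ?_ (by simp) (fun x y _ _ hx hy => by rw [map_add]; exact add_mem hx hy)
      (fun c x _ hx => by rw [map_smul]; exact Submodule.smul_mem _ _ hx) hz
  rintro _ ⟨w, hw, b, hb, rfl⟩
  rw [comm_app hy' (hw.memM h), comm_app hy' (h.le₁M hb), ← mapp]
  refine op_mem_closure (K := orb M₁ ξ) (fun v hv => ?_) h1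
  obtain ⟨m, hm, rfl⟩ := mem_orb.1 hv
  exact Submodule.le_topologicalClosure _ (Submodule.subset_span ⟨w, hw, b * m, mul_mem hb hm, rfl⟩)
end P
theorem form_op {η : H} {s : BB → BB → ℂ} (s1 : ∀ x ∈ N, ∀ y ∈ N, ∀ z ∈ N, s x (y + z) = s x y + s x z)
    (s2 : ∀ (c : ℂ), ∀ x ∈ N, ∀ y ∈ N, s x (c • y) = c * s x y) (s3 : ∀ x ∈ N, ∀ y ∈ N, s y x = star (s x y))
    (hb : ∀ x ∈ N, ∀ y ∈ N, ‖s x y‖ ≤ ‖x η‖ * ‖y η‖) : ∃ T : BB, ‖T‖ ≤ 1 ∧ pr (orb N η) * T = T ∧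
      T * pr (orb N η) = T ∧ ∀ x ∈ N, ∀ y ∈ N, ⟪x η, T (y η)⟫ = s x y := by
  have ep := pr_proj (orb N η)
  have h1 : ∀ y ∈ N, ∃ t, pr (orb N η) t = t ∧ ∀ x ∈ N, ⟪t, x η⟫ = s y x := by
    intro y hy
    obtain ⟨S, S1, S2, -⟩ := douglasN N (f := fun x => x η) (g := fun x => s y x • η) (fun _ _ _ _ => rfl) (fun _ _ _ => rfl)
      (fun a ha b hb => by rw [s1 y hy a ha b hb, add_smul]) (fun c a ha => by rw [s2 c y hy a ha, mul_smul])
      (C := ‖y η‖ * ‖η‖) (by positivity) (fun x hx => by rw [norm_smul]; nlinarith [hb y hy x hx, norm_nonneg η])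
    refine ⟨pr (orb N η) (((‖η‖ ^ 2 : ℝ) : ℂ)⁻¹ • star S η), by rw [← mapp, proj_mul ep], fun x hx => ?_⟩
    rw [sa_inner ep.isSelfAdjoint, pr_apply (orb_mem hx η), inner_smul_left, star_inner, S1 x hx, inner_smul_right,
      inner_self', map_inv₀, Complex.conj_ofReal]
    by_cases h0 : η = 0
    · have := hb y hy x hx
      rw [h0, map_zero, map_zero, norm_zero, mul_zero, norm_le_zero_iff] at this
      rw [this]; simp
    · have : ((‖η‖ ^ 2 : ℝ) : ℂ) ≠ 0 := by
        have := norm_pos_iff.2 h0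
        exact_mod_cast (by positivity : ‖η‖ ^ 2 ≠ 0)
      field_simp
  choose! t t1 t2 using h1
  have uq : ∀ {a b : H}, pr (orb N η) a = a → pr (orb N η) b = b → (∀ x ∈ N, ⟪a, x η⟫ = ⟪b, x η⟫) → a = b := by
    intro a b ha hb h
    have : pr (orb N η) (a - b) = 0 := pr_orb_zero.2 fun x hx => by
      rw [← inner_conj_symm, inner_sub_left, h x hx, sub_self, map_zero]
    rwa [map_sub, ha, hb, sub_eq_zero] at this
  have s4 : ∀ x ∈ N, ∀ y ∈ N, ∀ z ∈ N, s (x + y) z = s x z + s y z := fun x hx y hy z hz => by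
    rw [s3 z hz _ (add_mem hx hy), s1 z hz x hx y hy, star_add, ← s3 z hz x hx, ← s3 z hz y hy]
  have s5 : ∀ (c : ℂ), ∀ x ∈ N, ∀ z ∈ N, s (c • x) z = star c * s x z := fun c x hx z hz => by
    rw [s3 z hz _ (vn_smul c hx), s2 c z hz x hx, star_mul', ← s3 z hz x hx]
  obtain ⟨T, T1, T2, T3⟩ := douglasN N (f := fun x => x η) (g := t) (fun _ _ _ _ => rfl) (fun _ _ _ => rfl)
    (fun a ha b hb => uq (t1 _ (add_mem ha hb)) (by rw [map_add, t1 a ha, t1 b hb]) fun x hx => by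
      rw [inner_add_left, t2 _ (add_mem ha hb) x hx, t2 a ha x hx, t2 b hb x hx, s4 a ha b hb x hx])
    (fun c a ha => uq (t1 _ (vn_smul c ha)) (by rw [map_smul, t1 a ha]) fun x hx => by
      rw [inner_smul_left, t2 _ (vn_smul c ha) x hx, t2 a ha x hx, s5 c a ha x hx]; rfl)
    zero_le_one (fun y hy => by
      rw [one_mul]
      refine norm_le_closure (K := orb N η) (pr_eq_self.1 (t1 y hy)) (norm_nonneg _) fun z hz => ?_
      obtain ⟨x, hx, rfl⟩ := mem_orb.1 hz
      rw [t2 y hy x hx]; exact hb y hy x hx)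
  have Te : T * pr (orb N η) = T := by
    ext v
    have : T (v - pr (orb N η) v) = 0 := T3 _ fun x hx => by
      rw [inner_sub_right, ← sa_inner ep.isSelfAdjoint, pr_apply (orb_mem hx η), sub_self]
    rw [map_sub, sub_eq_zero] at this
    exact this.symm
  refine ⟨T, T2, ?_, Te, fun x hx y hy => ?_⟩
  · have := mul_pr_eq (K := orb N η) (S := pr (orb N η) * T) (T := T) fun z hz => by
      obtain ⟨x, hx, rfl⟩ := mem_orb.1 hz
      rw [mapp, T1 x hx, t1 x hx]
    rwa [mul_assoc, Te] at this
  · rw [T1 y hy, ← inner_conj_symm, t2 y hy x hx, s3 x hx y hy]; simp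
theorem CE.comp {D D' : VN H} {F G : BB → BB} {L : VN H} (h : CE N D F) (h' : CE L D' G) (hD : (D : SB) ⊆ L)
    (h1 : (D' : SB) ⊆ D) : CE N D' (fun x => G (F x)) where
  subset := h1.trans h.subset
  map_add x hx y hy := by
    rw [h.map_add x hx y hy, h'.map_add _ (hD (h.maps_to x hx)) _ (hD (h.maps_to y hy))]
  map_smul c x hx := by rw [h.map_smul c x hx, h'.map_smul c _ (hD (h.maps_to x hx))]
  maps_to x hx := h'.maps_to _ (hD (h.maps_to x hx))
  fixes x hx := by rw [h.fixes x (h1 hx), h'.fixes x hx]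
  pos x hx h0 := h'.pos _ (hD (h.maps_to x hx)) (h.pos x hx h0)
  bimod a ha b hb x hx := by rw [h.bimod a (h1 ha) b (h1 hb) x hx, h'.bimod a ha b hb _ (hD (h.maps_to x hx))]
theorem normal_comp {D L : VN H} {F G : BB → BB} (h : ∀ x ∈ N, F x ∈ L)
    (hm : ∀ x ∈ N, ∀ y ∈ N, x ≤ y → F x ≤ F y) (hF : IsNormalOn (N : SB) F) (hG : IsNormalOn (L : SB) G) :
    IsNormalOn (N : SB) (fun x => G (F x)) := by
  intro S hS hne hd x hx hl
  have := hG (F '' S) (by rintro _ ⟨s, hs, rfl⟩; exact h s (hS hs)) (hne.image F)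
    (by
      rintro _ ⟨a, ha, rfl⟩ _ ⟨b, hb, rfl⟩
      obtain ⟨c, hc, h1, h2⟩ := hd a ha b hb
      exact ⟨F c, ⟨c, hc, rfl⟩, hm a (hS ha) c (hS hc) h1, hm b (hS hb) c (hS hc) h2⟩) _ (h x hx) (hF S hS hne hd x hx hl)
  rwa [Set.image_image] at this
structure Dat {M : VN H} (sf : StandardForm M) (M₁ B A : VN H) (E E1 EA Ψ : BB → BB) (ξ η : H) (P : BB) : Prop where
  hσ : SigmaFinite (M : SB)
  le : (B : SB) ⊆ M₁
  leM : (M₁ : SB) ⊆ M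
  leA : (A : SB) ⊆ M₁
  ceE : CE M B E
  ce1 : CE M M₁ E1
  g : GV sf E ξ
  i1 : Inv M E1 ξ
  ceA : CE M₁ A EA
  fA : FaithfulOn (M₁ : SB) EA
  nA : IsNormalOn (M₁ : SB) EA
  ceΨ : CE (sf.cv M₁).commutant A Ψ
  gη : GV sf (fun x => Ψ (E1 x)) η
  hη : ∀ x ∈ M₁, ⟪η, x η⟫ = ⟪ξ, Ψ x ξ⟫
  iη : Inv M E1 η
  Pp : Pj P
  PB : P ∈ B.commutant
  PC : P ∈ (sf.cv M₁).commutant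
  PE : ∀ x ∈ M₁, P * x * P = E x * P
structure TDat {M : VN H} (sf : StandardForm M) (M₁ B A : VN H) (Ψ : BB → BB) (ξ η : H) (P T : BB) : Prop where
  le1 : ‖T‖ ≤ 1
  nn : 0 ≤ T
  e1 : pr (orb M₁ η) * T = T
  e1' : T * pr (orb M₁ η) = T
  TB : T ∈ B.commutant
  TA : ∀ a ∈ A, sf.c a * T = T * sf.c a
  eq : ∀ x ∈ M₁, ∀ y ∈ M₁, ⟪x η, T (y η)⟫ = ⟪ξ, Ψ (star x * P * y) ξ⟫
namespace Dat
theorem MC (d : Dat sf M₁ B A E E1 EA Ψ ξ η P) (hx : x ∈ M) : x ∈ (sf.cv M₁).commutant := sf.le_cv d.leM hx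
theorem e1η (d : Dat sf M₁ B A E E1 EA Ψ ξ η P) : pr (orb M₁ η) = pr (orb M₁ ξ) ∧ sf.c (pr (orb M₁ ξ)) = pr (orb M₁ ξ) := by
  have h1 := sf.lemJ d.g.cone d.g.cone d.ce1 d.i1 d.i1 d.g.sep d.g.sep
  exact ⟨(sf.lemJ d.g.cone d.gη.cone d.ce1 d.iη d.i1 d.g.sep d.gη.sep).symm.trans h1, h1⟩
theorem cs (d : Dat sf M₁ B A E E1 EA Ψ ξ η P) (hX : X ∈ (sf.cv M₁).commutant) (hY : Y ∈ (sf.cv M₁).commutant) :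
    ‖⟪ξ, Ψ (star X * Y) ξ⟫‖ ^ 2 ≤ (⟪ξ, Ψ (star X * X) ξ⟫).re * (⟪ξ, Ψ (star Y * Y) ξ⟫).re := by
  obtain ⟨h1, h2, h3⟩ := IsCondExp.nf' d.ceΨ ξ
  exact cs_pos (N := (sf.cv M₁).commutant) (φ := fun x => ⟪ξ, Ψ x ξ⟫) h1 h2 h3 hX hY
theorem mono (d : Dat sf M₁ B A E E1 EA Ψ ξ η P) (hX : X ∈ (sf.cv M₁).commutant) (hY : Y ∈ (sf.cv M₁).commutant)
    (h : X ≤ Y) : (⟪ξ, Ψ X ξ⟫).re ≤ (⟪ξ, Ψ Y ξ⟫).re :=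
  (cL (le_iff.1 (d.ceΨ.mono (fun x hx y hy => vsb hx hy) hX hY h) ξ)).1
theorem exT (d : Dat sf M₁ B A E E1 EA Ψ ξ η P) : ∃ T, TDat sf M₁ B A Ψ ξ η P T := by
  have hP := d.Pp
  have sP := star_proj hP
  have mC : ∀ {x}, x ∈ M₁ → x ∈ (sf.cv M₁).commutant := fun hx => d.MC (d.leM hx)
  have mS : ∀ {x : BB}, x ∈ M₁ → star x ∈ M₁ := fun hx => vst hx
  have mP : ∀ {x y}, x ∈ M₁ → y ∈ M₁ → star x * P * y ∈ (sf.cv M₁).commutant := fun hx hy =>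
    mul_mem (mul_mem (mC (mS hx)) d.PC) (mC hy)
  have PP : ∀ x y : BB, star (P * x) * (P * y) = star x * P * y := fun x y => by
    rw [star_mul, sP, mul_assoc, ← mul_assoc P P, proj_mul hP, ← mul_assoc]
  have hq : ∀ x ∈ M₁, (⟪ξ, Ψ (star x * P * x) ξ⟫).re ≤ ‖x η‖ ^ 2 := fun x hx => by
    have h1 : star x * P * x ≤ star x * x := by
      have := star_left_conjugate_nonneg (sub_nonneg.2 (proj_le hP (IsStarProjection.one _) (one_mul P))) x
      rw [mul_sub, sub_mul, mul_one] at this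
      exact sub_nonneg.1 this
    have h2 := d.mono (mP hx hx) (mC (mul_mem (mS hx) hx)) h1
    rw [← d.hη _ (mul_mem (mS hx) hx), normsq_inner, Complex.ofReal_re] at h2
    exact h2
  obtain ⟨h1, h2, h3⟩ := IsCondExp.nf' d.ceΨ ξ
  have hs : ∀ x ∈ M₁, ∀ y ∈ M₁, ⟪ξ, Ψ (star y * P * x) ξ⟫ = star ⟪ξ, Ψ (star x * P * y) ξ⟫ := fun x hx y hy => by
    have := herm_of_pos (N := (sf.cv M₁).commutant) (φ := fun x => ⟪ξ, Ψ x ξ⟫) h1 h2 h3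
      (mul_mem d.PC (mC hx)) (mul_mem d.PC (mC hy))
    rwa [PP, PP] at this
  obtain ⟨T, T1, T2, T3, T4⟩ := form_op (N := M₁) (η := η) (s := fun x y => ⟪ξ, Ψ (star x * P * y) ξ⟫)
    (fun x hx y hy z hz => by rw [mul_add, h1 _ (mP hx hy) _ (mP hx hz)])
    (fun c x hx y hy => by rw [mul_smul_comm, h2 c _ (mP hx hy)]) hs
    (fun x hx y hy => by
      have := d.cs (mul_mem d.PC (mC hx)) (mul_mem d.PC (mC hy))
      rw [PP, PP, PP] at this
      have p : (⟪ξ, Ψ (star x * P * x) ξ⟫).re * (⟪ξ, Ψ (star y * P * y) ξ⟫).re ≤ ‖x η‖ ^ 2 * ‖y η‖ ^ 2 := by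
        refine mul_le_mul (hq x hx) (hq y hy) ?_ (by positivity)
        rw [← PP]
        exact (cL (h3 _ (mul_mem d.PC (mC hy)))).1
      rw [← mul_pow] at p
      exact (sq_le_sq₀ (by positivity) (by positivity)).1 (this.trans p))
  have ep := pr_proj (orb M₁ η)
  have ext : ∀ {S S' : BB}, pr (orb M₁ η) * S = S → S * pr (orb M₁ η) = S → pr (orb M₁ η) * S' = S' →
      S' * pr (orb M₁ η) = S' → (∀ x ∈ M₁, ∀ y ∈ M₁, ⟪x η, S (y η)⟫ = ⟪x η, S' (y η)⟫) → S = S' := by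
    intro S S' a1 a2 b1 b2 hh
    have := mul_pr_eq (K := orb M₁ η) (S := S) (T := S') fun z hz => by
      obtain ⟨y, hy, rfl⟩ := mem_orb.1 hz
      have : pr (orb M₁ η) (S (y η) - S' (y η)) = 0 := pr_orb_zero.2 fun x hx => by
        rw [inner_sub_right, hh x hx y hy, sub_self]
      rwa [map_sub, ← mapp _ S, ← mapp _ S', a1, b1, sub_eq_zero] at this
    rwa [a2, b2] at this
  have eB : ∀ b ∈ M₁, b * pr (orb M₁ η) = pr (orb M₁ η) * b := comm_iff.1 (pr_orb_mem M₁ η)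
  have ec : ∀ a ∈ M₁, sf.c a * pr (orb M₁ η) = pr (orb M₁ η) * sf.c a := fun a ha => by
    rw [d.e1η.1, ← d.e1η.2, ← sf.c_mul, ← sf.c_mul, ← d.e1η.1, eB a ha]
  refine ⟨T, T1, ?_, T2, T3, ?_, ?_, T4⟩
  · refine nonneg_iff.2 fun v => ?_
    have e : ⟪v, T v⟫ = ⟪pr (orb M₁ η) v, T (pr (orb M₁ η) v)⟫ := by
      rw [sa_inner ep.isSelfAdjoint, ← mapp T, T3, ← mapp, T2]
    rw [e]
    refine closure_minimal (s := (orb M₁ η : Set H)) (t := {z | 0 ≤ ⟪z, T z⟫}) (fun z hz => ?_)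
      (isClosed_Ici.preimage (f := fun z => ⟪z, T z⟫) (by fun_prop)) (pr_mem (orb M₁ η) v)
    obtain ⟨x, hx, rfl⟩ := mem_orb.1 hz
    show 0 ≤ ⟪x η, T (x η)⟫
    rw [T4 x hx x hx, ← PP]
    exact h3 _ (mul_mem d.PC (mC hx))
  · refine comm_iff.2 fun b hb => ?_
    have hb1 := d.le hb
    refine ext ?_ ?_ ?_ ?_ fun x hx y hy => ?_
    · rw [← mul_assoc, ← eB b hb1, mul_assoc, T2]
    · rw [mul_assoc, T3]
    · rw [← mul_assoc, T2]
    · rw [mul_assoc, eB b hb1, ← mul_assoc, T3]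
    · have c1 := comm_iff.1 d.PB b hb
      rw [mapp, mapp, ← mapp b y, T4 x hx _ (mul_mem hb1 hy), ← star_inner, ← mapp, T4 _ (mul_mem (mS hb1) hx) y hy,
        star_mul, star_star, mul_assoc (star x), c1]
      simp only [mul_assoc]
  · intro a ha
    have ha1 := d.leA ha
    have hce : CE M A (fun x => Ψ (E1 x)) := CE.comp d.ce1 d.ceΨ (fun x hx => mC hx) d.leA
    have hJ := sf.lemJ d.gη.cone d.gη.cone hce d.gη.inv d.gη.inv d.gη.sep d.gη.sep
    have hcl : ∀ a ∈ A, sf.c a η ∈ (orb A η).topologicalClosure := fun a ha => by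
      rw [← pr_eq_self, ← sf.J_cone_app d.gη.cone]
      nth_rewrite 1 [← hJ]
      rw [sf.c_J, pr_apply (orb_mem ha η)]
    have k0 : ∀ h ∈ A, ∀ X ∈ (sf.cv M₁).commutant, Ψ X = h → ∀ a ∈ A, ⟪ξ, Ψ (X * a) ξ⟫ = ⟪η, h (a η)⟫ ∧
        ⟪ξ, Ψ (a * X) ξ⟫ = ⟪η, a (h η)⟫ := fun h hh X hX e a ha => by
      have i1 := d.hη _ (d.leA (mul_mem hh ha))
      have i2 := d.hη _ (d.leA (mul_mem ha hh))
      rw [d.ceΨ.fixes _ (mul_mem hh ha)] at i1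
      rw [d.ceΨ.fixes _ (mul_mem ha hh)] at i2
      rw [IsCondExp.right d.ceΨ ha hX, IsCondExp.left d.ceΨ ha hX, e, ← i1, ← i2]
      exact ⟨rfl, rfl⟩
    refine ext ?_ ?_ ?_ ?_ fun x hx y hy => ?_
    · rw [← mul_assoc, ← ec a ha1, mul_assoc, T2]
    · rw [mul_assoc, T3]
    · rw [← mul_assoc, T2]
    · rw [mul_assoc, ec a ha1, ← mul_assoc, T3]
    obtain ⟨h, hh⟩ : ∃ h, h = Ψ (star x * P * y) := ⟨_, rfl⟩
    have hA : h ∈ A := hh ▸ d.ceΨ.maps_to _ (mP hx hy)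
    have key1 : ∀ ζ ∈ (orb A η).topologicalClosure, ⟪x η, T (y ζ)⟫ = ⟪η, h ζ⟫ := fun ζ hζ => by
      refine closure_minimal (s := (orb A η : Set H)) (t := {ζ | ⟪x η, T (y ζ)⟫ = ⟪η, h ζ⟫}) (fun z hz => ?_)
        (isClosed_eq (by fun_prop) (by fun_prop)) hζ
      obtain ⟨a, ha, rfl⟩ := mem_orb.1 hz
      show ⟪x η, T (y (a η))⟫ = _
      rw [← mapp y, T4 x hx _ (mul_mem hy (d.leA ha)), ← mul_assoc, (k0 h hA _ (mP hx hy) hh.symm a ha).1]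
    have key2 : ∀ ζ ∈ (orb A η).topologicalClosure, ⟪x ζ, T (y η)⟫ = ⟪ζ, h η⟫ := fun ζ hζ => by
      refine closure_minimal (s := (orb A η : Set H)) (t := {ζ | ⟪x ζ, T (y η)⟫ = ⟪ζ, h η⟫}) (fun z hz => ?_)
        (isClosed_eq (by fun_prop) (by fun_prop)) hζ
      obtain ⟨a, ha, rfl⟩ := mem_orb.1 hz
      show ⟪x (a η), T (y η)⟫ = _
      rw [← mapp x, T4 _ (mul_mem hx (d.leA ha)) y hy, star_mul, mul_assoc, mul_assoc, ← mul_assoc (star x),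
        (k0 h hA _ (mP hx hy) hh.symm _ (vst ha)).2, inner_star]
    have m1 : ∀ {z}, z ∈ M₁ → ∀ b ∈ A, ∀ v, sf.c b (z v) = z (sf.c b v) := fun hz b hb v =>
      comm_app (sf.c_mem (d.leM (d.leA hb))) (d.leM hz) v
    rw [mapp, mapp, m1 hy a ha, key1 _ (hcl a ha), ← star_inner, ← sf.c_star, m1 hx _ (vst ha),
      key2 _ (hcl _ (vst ha)), sf.c_star, star_inner, m1 (d.leA hA) a ha]
end Dat
section Abs
theorem Phi_zero {C : VN H} (hΦ : CE C Q Φ) (hP : Pj P) (hPC : P ∈ C)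
    (hb : b ∈ C) (hZ : Z ∈ C) (h0 : Φ (star b * P * b) = 0) : Φ (Z * P * b) = 0 := by
  have sm : ∀ {x : BB}, x ∈ C → star x ∈ C := fun hx => vst hx
  have hX : Z * P * b ∈ C := mul_mem (mul_mem hZ hPC) hb
  have h1 : star (Z * P * b) * (Z * P * b) ≤ ((‖Z‖ ^ 2 : ℝ) : ℂ) • (star b * P * b) := by
    refine le_iff.2 fun v => ?_
    have e : ⟪v, (star b * P * b) v⟫ = ((‖P (b v)‖ ^ 2 : ℝ) : ℂ) := by
      rw [← proj_normsq hP, mapp, mapp, inner_star]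
    rw [normsq_inner, Asmul, inner_smul_right, e, ← Complex.ofReal_mul, ← mul_pow]
    have : ‖Z (P (b v))‖ ^ 2 ≤ (‖Z‖ * ‖P (b v)‖) ^ 2 := by gcongr; exact Z.le_opNorm _
    exact_mod_cast this
  have hbb := mul_mem (mul_mem (sm hb) hPC) hb
  have h2 := hΦ.mono (fun x hx y hy => vsb hx hy) (mul_mem (sm hX) hX) (vn_smul _ hbb) h1
  rw [hΦ.map_smul _ _ hbb, h0, smul_zero] at h2
  have h3 := (hΦ.kadison hX).trans h2
  exact CStarRing.star_mul_self_eq_zero_iff _ |>.1 (le_antisymm h3 (star_mul_self_nonneg _))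
theorem absorb (h : AF) (hσ : SigmaFinite (M : SB)) (sf : StandardForm M)
    (g : GV sf E ξ) (hE1 : CE M M₁ E1) (nE1 : IsNormalOn (M : SB) E1)
    (hw : ∀ a ∈ M₁, ∀ w, EW M₁ M₂ E w → ∀ b ∈ M₁, E1 (a * w * b) = 0) (hQ : (Q : SB) ⊆ M)
    (hΦ : CE (sf.cv M₁).commutant Q Φ) (fΦ : FaithfulOn (M : SB) Φ) (nΦ : IsNormalOn (M : SB) Φ)
    (hPC : pr (Submodule.span ℂ (LG M₁ M₂ E ξ)) ∈ (sf.cv M₁).commutant)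
    (h0 : ∀ x ∈ M₁, Φ (star x * pr (Submodule.span ℂ (LG M₁ M₂ E ξ)) * x) = 0) : (Q : SB) ⊆ M₁ := by
  have hP := pr_proj (Submodule.span ℂ (LG M₁ M₂ E ξ))
  have hPw := fun {w} (hw : EW M₁ M₂ E w) => P_w h sf g hw
  generalize pr (Submodule.span ℂ (LG M₁ M₂ E ξ)) = P at *
  have mC : ∀ {x}, x ∈ M → x ∈ (sf.cv M₁).commutant := fun hx => sf.le_cv h.le₁M hx
  have sC : ∀ {x : BB}, x ∈ (sf.cv M₁).commutant → star x ∈ (sf.cv M₁).commutant := fun hx => vst hx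
  have hΦM : CE M Q Φ := ⟨hQ, fun x hx y hy => hΦ.map_add x (mC hx) y (mC hy), fun c x hx => hΦ.map_smul c x (mC hx),
    fun x hx => hΦ.maps_to x (mC hx), hΦ.fixes, fun x hx => hΦ.pos x (mC hx), fun a ha b hb x hx => hΦ.bimod a ha b hb x (mC hx)⟩
  have z1 : ∀ Z ∈ (sf.cv M₁).commutant, ∀ b ∈ M₁, Φ (Z * P * b) = 0 := fun Z hZ b hb =>
    Phi_zero hΦ hP hPC (mC (h.le₁M hb)) hZ (h0 b hb)
  have z2 : ∀ Z ∈ (sf.cv M₁).commutant, ∀ a ∈ M₁, Φ (a * P * Z) = 0 := fun Z hZ a ha => by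
    have ha' := vst ha
    have h1 := z1 _ (sC hZ) _ ha'
    have h2 := hΦ.star' (mul_mem (mul_mem (sC hZ) hPC) (mC (h.le₁M ha')))
    rw [h1, star_zero] at h2
    rw [← h2]
    simp only [star_mul, star_star, star_proj hP, mul_assoc]
  have z3 : ∀ a ∈ M₁, ∀ w, EW M₁ M₂ E w → ∀ b ∈ M₁, Φ (a * w * b) = 0 := fun a ha w hw b hb => by
    have hwC := mC (hw.memM h)
    have haC := mC (h.le₁M ha)
    have hbC := mC (h.le₁M hb)
    have e : (1 - P) * w = (1 - P) * w * P := by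
      have := hPw hw
      rwa [mul_sub, mul_one, sub_eq_zero] at this
    have e2 : a * w * b = a * P * (w * b) + (a * (1 - P) * w) * P * b := by
      rw [mul_assoc a (1 - P) w, mul_assoc a _ P, ← e]; noncomm_ring
    rw [e2, hΦ.map_add _ (mul_mem (mul_mem haC hPC) (mul_mem hwC hbC)) _
      (mul_mem (mul_mem (mul_mem (mul_mem haC (sub_mem (one_mem _) hPC)) hwC) hPC) hbC), z2 _ (mul_mem hwC hbC) a ha,
      z1 _ (mul_mem (mul_mem haC (sub_mem (one_mem _) hPC)) hwC) b hb, add_zero]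
  have z4 : ∀ x ∈ WW M₁ M₂ E, Φ x = Φ (E1 x) := by
    intro x hx
    refine Submodule.span_induction (p := fun x hx => Φ x = Φ (E1 x)) ?_ ?_ ?_ ?_ hx
    · rintro x (hm | ⟨a, ha, w, hw', b, hb, rfl⟩)
      · rw [hE1.fixes x hm]
      · rw [z3 a ha w hw' b hb, hw a ha w hw' b hb, hΦ.zero]
    · rw [hE1.zero]
    · intro x y hx hy h1 h2
      have hx' := WW.memM h hx
      have hy' := WW.memM h hy
      rw [hΦM.map_add x hx' y hy', hE1.map_add x hx' y hy', hΦM.map_add _ (h.le₁M (hE1.maps_to x hx')) _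
        (h.le₁M (hE1.maps_to y hy')), h1, h2]
    · intro c x hx h1
      have hx' := WW.memM h hx
      rw [hΦM.map_smul c x hx', hE1.map_smul c x hx', hΦM.map_smul c _ (h.le₁M (hE1.maps_to x hx')), h1]
  have nn : IsNormalOn (M : SB) (fun x => Φ (E1 x)) := normal_comp (D := M) (fun x hx => h.le₁M (hE1.maps_to x hx))
    (fun x hx y hy => hE1.mono (fun x hx y hy => vsb hx hy) hx hy) nE1 nΦ
  have z5 : ∀ x ∈ M, Φ x = Φ (E1 x) := fun x hx => op_ext_inner fun v => by
    have n1 := hΦM.nf nΦ (NF.vec Q v)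
    have n2 : NF M (fun x => ⟪v, Φ (E1 x) v⟫) := hE1.nf nE1 (ψ := fun y => ⟪v, Φ y v⟫)
      ⟨fun x hx y hy => n1.add x (h.le₁M hx) y (h.le₁M hy), fun c x hx => n1.smul c x (h.le₁M hx),
        fun x hx => n1.pos x (h.le₁M hx), fun S hS a b x hx => n1.normal S (hS.trans h.le₁M) a b x (h.le₁M hx)⟩
    obtain ⟨α, -, hα⟩ := sf.thmA hσ n1
    obtain ⟨β, -, hβ⟩ := sf.thmA hσ n2
    beta_reduce at hα hβ
    rw [hα x hx, hβ x hx]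
    by_contra hne
    have hp : 0 < ‖⟪α, x α⟫ - ⟪β, x β⟫‖ := norm_pos_iff.2 (sub_ne_zero.2 hne)
    obtain ⟨w, hw, w1, w2⟩ := dens h hσ sf hx α β (ε := ‖⟪α, x α⟫ - ⟪β, x β⟫‖ / (‖α‖ + ‖β‖ + 1)) (by positivity)
    have hwM := WW.memM h hw
    have e : ⟪α, x α⟫ - ⟪β, x β⟫ = ⟪α, (x - w) α⟫ - ⟪β, (x - w) β⟫ := by
      have : ⟪α, w α⟫ = ⟪β, w β⟫ := by rw [← hα w hwM, ← hβ w hwM, z4 w hw]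
      simp only [Asub, inner_sub_right, this]; ring
    have b1 := norm_sub_le ⟪α, (x - w) α⟫ ⟪β, (x - w) β⟫
    rw [← e] at b1
    have b2 := norm_inner_le_norm (𝕜 := ℂ) α ((x - w) α)
    have b3 := norm_inner_le_norm (𝕜 := ℂ) β ((x - w) β)
    rw [lt_div_iff₀ (by positivity)] at w1 w2
    rcases le_total ‖(x - w) α‖ ‖(x - w) β‖ with hh | hh
    · nlinarith [norm_nonneg α, norm_nonneg β, norm_nonneg ((x - w) α), norm_nonneg ((x - w) β)]
    · nlinarith [norm_nonneg α, norm_nonneg β, norm_nonneg ((x - w) α), norm_nonneg ((x - w) β)]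
  intro y hy
  have hyM := hQ hy
  have hm1 := hE1.maps_to y hyM
  have hm := h.le₁M hm1
  have sy := vst hy
  have eP : Φ (E1 y) = y := by rw [← z5 y hyM, hΦ.fixes y hy]
  have eP' : Φ (star (E1 y)) = star y := by rw [hΦM.star' hm, eP]
  have smm := vst hm
  have k1 : Φ (star (y - E1 y) * (y - E1 y)) = Φ (star (E1 y) * E1 y) - star y * y := by
    have e : star (y - E1 y) * (y - E1 y) = star y * y - star y * E1 y - (star (E1 y) * y - star (E1 y) * E1 y) := by
      rw [star_sub]; noncomm_ring
    rw [e, hΦM.sub (sub_mem (mul_mem (hQ sy) hyM) (mul_mem (hQ sy) hm)) (sub_mem (mul_mem smm hyM) (mul_mem smm hm)),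
      hΦM.sub (mul_mem (hQ sy) hyM) (mul_mem (hQ sy) hm), hΦM.sub (mul_mem smm hyM) (mul_mem smm hm),
      hΦM.left sy hm, hΦM.right hy smm, eP, eP', hΦ.fixes _ (mul_mem sy hy), sub_self, zero_sub, neg_sub]
  have k2 : Φ (star (E1 y) * E1 y) ≤ star y * y := by
    rw [← hΦ.fixes _ (mul_mem sy hy), z5 _ (mul_mem (hQ sy) hyM)]
    exact hΦM.mono (fun x hx y hy => vsb hx hy) (mul_mem smm hm) (h.le₁M (hE1.maps_to _ (mul_mem (hQ sy) hyM)))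
      (hE1.kadison hyM)
  have hd := vsb hyM hm
  have k3 := hΦM.pos _ (mul_mem (vst hd) hd) (star_mul_self_nonneg _)
  have k4 := fΦ _ (mul_mem (vst hd) hd) (star_mul_self_nonneg _)
    (le_antisymm (by rw [k1]; exact sub_nonpos.2 k2) k3)
  rw [CStarRing.star_mul_self_eq_zero_iff, sub_eq_zero] at k4
  rw [k4]; exact hm1
theorem mkDat (h : AF) (hσ : SigmaFinite (M : SB)) (sf : StandardForm M)
    (hQ : (Q : SB) ⊆ M) (hrel : AmenableRel sf.J (M : SB) (Q : SB) (M₁ : SB))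
    (hA : WithExpectation (M₁ : SB) ((Q : SB) ∩ (M₁ : SB))) :
    ∃ E1 EA Ψ ξ η P, Dat sf M₁ B (vnInf Q M₁) E E1 EA Ψ ξ η P ∧
      ((∀ T, TDat sf M₁ B (vnInf Q M₁) Ψ ξ η P T → T = 0) → (Q : SB) ⊆ M₁) := by
  obtain ⟨ξ0, -, hξ0⟩ := sf.exists_sep hσ
  obtain ⟨ξ, g, -⟩ := gv_of (sf := sf) hσ h.condExp h.faithful h.normal hξ0
  obtain ⟨E1, c1, f1, n1, i1, k1⟩ := exE1 h hσ sf g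
  obtain ⟨EA, cA, fA, nA⟩ := hA
  obtain ⟨Φ, cΦ, fΦ, nΦ⟩ := hrel
  rw [← coe_vnInf] at cA
  rw [← sf.coe_cv] at cΦ
  have mC : ∀ {x}, x ∈ M → x ∈ (sf.cv M₁).commutant := fun hx => sf.le_cv h.le₁M hx
  have lA : ((vnInf Q M₁ : VN H) : SB) ⊆ M₁ := fun x hx => (mem_vnInf.1 hx).2
  have cE1A : CE M (vnInf Q M₁) (fun x => EA (E1 x)) := CE.comp (G := EA) c1 cA le_rfl lA
  have cΨ : CE (sf.cv M₁).commutant (vnInf Q M₁) (fun x => EA (E1 (Φ x))) := CE.comp (G := fun x => EA (E1 x)) cΦ cE1A hQ fun x hx => (mem_vnInf.1 hx).1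
  have cη : CE M (vnInf Q M₁) (fun x => EA (E1 (Φ (E1 x)))) := CE.comp (G := fun x => EA (E1 (Φ x))) c1 cΨ (fun x hx => mC (h.le₁M hx)) lA
  have m1 : ∀ x ∈ M, E1 x ∈ M := fun x hx => h.le₁M (c1.maps_to x hx)
  have mΦ : ∀ x ∈ M, Φ x ∈ M := fun x hx => hQ (cΦ.maps_to x (mC hx))
  have mo1 : ∀ x ∈ M, ∀ y ∈ M, x ≤ y → E1 x ≤ E1 y := fun x hx y hy =>
    c1.mono (fun x hx y hy => vsb hx hy) hx hy
  have moΦ : ∀ x ∈ M, ∀ y ∈ M, x ≤ y → Φ x ≤ Φ y := fun x hx y hy =>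
    cΦ.mono (fun x hx y hy => vsb hx hy) (mC hx) (mC hy)
  have nη : IsNormalOn (M : SB) (fun x => EA (E1 (Φ (E1 x)))) :=
    normal_comp (D := M) (G := fun x => EA (E1 (Φ x))) m1 mo1 n1 (normal_comp (D := M) (G := fun x => EA (E1 x)) mΦ moΦ nΦ (normal_comp (D := M) (L := M₁) (G := EA) c1.maps_to mo1 n1 nA))
  have p1 : ∀ x ∈ M, 0 ≤ x → EA (E1 x) = 0 → x = 0 := fun x hx h0 e => f1 x hx h0 (fA _ (c1.maps_to x hx) (c1.pos x hx h0) e)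
  have fη : FaithfulOn (M : SB) (fun x => EA (E1 (Φ (E1 x)))) := fun x hx h0 e => by
    refine f1 x hx h0 (fΦ _ (m1 x hx) (c1.pos x hx h0) (p1 _ (mΦ _ (m1 x hx)) ?_ e))
    exact cΦ.pos _ (mC (m1 x hx)) (c1.pos x hx h0)
  obtain ⟨η, gη, hη⟩ := gv_of (sf := sf) hσ cη fη nη g.sep
  have d : Dat sf M₁ B (vnInf Q M₁) E E1 EA (fun x => EA (E1 (Φ x))) ξ η (pr (Submodule.span ℂ (LG M₁ M₂ E ξ))) :=
    ⟨hσ, h.le₁, h.le₁M, lA, h.condExp, c1, g, i1, cA, fA, nA, cΨ, gη,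
      fun x hx => by rw [hη x (h.le₁M hx), c1.fixes x hx], fun x hx => by
        rw [hη _ (m1 x hx), hη x hx, c1.fixes _ (c1.maps_to x hx)], pr_proj _, P_B h, P_C h sf g c1 i1,
      fun x hx => P_PxP h g.inv hx⟩
  refine ⟨E1, EA, _, ξ, η, _, d, fun hT => ?_⟩
  obtain ⟨T, t⟩ := d.exT
  have T0 := hT T t
  refine absorb h hσ sf g c1 n1 k1 hQ cΦ fΦ nΦ d.PC fun x hx => ?_
  have h1 := t.eq x hx x hx
  rw [T0, Azero, inner_zero_right] at h1
  have hX := mul_mem (mul_mem (d.MC (h.le₁M (vst hx))) d.PC) (d.MC (h.le₁M hx))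
  have hp : 0 ≤ star x * pr (Submodule.span ℂ (LG M₁ M₂ E ξ)) * x := star_left_conjugate_nonneg (proj_nonneg (pr_proj _)) x
  have h2 := g.sep _ (h.le₁M (lA (cΨ.maps_to _ hX))) (op_zero_of (cΨ.pos _ hX hp) h1.symm)
  exact p1 _ (hQ (cΦ.maps_to _ hX)) (cΦ.pos _ hX hp) h2
end Abs
theorem pi_l (h : x * star x * x = x) : Pj (star x * x) :=
  ⟨by rw [IsIdempotentElem, mul_assoc, ← mul_assoc x, h], by rw [IsSelfAdjoint, star_mul, star_star]⟩
theorem pi_s (h : x * star x * x = x) : star x * x * star x = star x := by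
  have := congrArg star h; simpa only [star_mul, star_star, mul_assoc] using this
theorem pi_r (h : x * star x * x = x) : Pj (x * star x) := by
  have := pi_l (x := star x) (by rw [star_star]; exact pi_s h)
  rwa [star_star] at this
theorem psum {ι : Type*} {x : ι → BB} (hN : ∀ i, x i ∈ N) (hx : ∀ i, x i * star (x i) * x i = x i)
    (h1 : ∀ i j, i ≠ j → star (x i) * x j = 0) (h2 : ∀ i j, i ≠ j → x i * star (x j) = 0) :
    ∃ X ∈ N, (∀ i, X * (star (x i) * x i) = x i) ∧ star X * X = osum (fun i => star (x i) * x i) ∧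
      X * star X = osum (fun i => x i * star (x i)) := by
  obtain ⟨p, hp⟩ : ∃ p : ι → BB, ∀ i, p i = star (x i) * x i := ⟨_, fun _ => rfl⟩
  obtain ⟨r, hr⟩ : ∃ p : ι → BB, ∀ i, p i = x i * star (x i) := ⟨_, fun _ => rfl⟩
  have pp : ∀ i, Pj (p i) := fun i => hp i ▸ pi_l (hx i)
  have rr : ∀ i, Pj (r i) := fun i => hr i ▸ pi_r (hx i)
  have key : ∀ i j, star (x i) * x j = star (p i) * p j := by
    intro i j
    rw [star_proj (pp i)]
    by_cases h : i = j
    · subst h; rw [proj_mul (pp i), hp]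
    · rw [h1 i j h, hp, hp, mul_assoc, ← mul_assoc (x i), h2 i j h, zero_mul, mul_zero]
  have key2 : ∀ φ : ι →₀ H, ⟪φ.sum fun i v => x i v, φ.sum fun i v => x i v⟫ =
      ⟪φ.sum fun i v => p i v, φ.sum fun i v => p i v⟫ := by
    intro φ
    simp only [Finsupp.sum, sum_inner, inner_sum]
    refine Finset.sum_congr rfl fun i _ => Finset.sum_congr rfl fun j _ => ?_
    rw [← inner_star, ← inner_star, ← mapp, ← mapp, key]
  obtain ⟨X, X1, X2, -⟩ := douglas (Finsupp.lsum ℂ fun i => (p i : H →ₗ[ℂ] H)) (Finsupp.lsum ℂ fun i => (x i : H →ₗ[ℂ] H)) 1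
    zero_le_one fun φ => by
      have := key2 φ
      rw [inner_self', inner_self'] at this
      have h3 : ‖φ.sum fun i v => x i v‖ ^ 2 = ‖φ.sum fun i v => p i v‖ ^ 2 := by exact_mod_cast this
      rw [one_mul]
      exact (pow_le_pow_iff_left₀ (norm_nonneg _) (norm_nonneg _) two_ne_zero).1 h3.le
  have Xp : ∀ i, X * p i = x i := fun i => by
    ext u
    have := X1 (Finsupp.single i u)
    simpa [Finsupp.lsum_single] using this
  obtain ⟨q, hq⟩ : ∃ q, q = osum p := ⟨_, rfl⟩
  have qp : Pj q := hq ▸ osum_proj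
  have Xq : X * q = X := by
    have h3 : q * pr (LinearMap.range (Finsupp.lsum ℂ fun i => (p i : H →ₗ[ℂ] H))) = 1 * pr (LinearMap.range (Finsupp.lsum ℂ fun i => (p i : H →ₗ[ℂ] H))) :=
      mul_pr_eq fun z hz => by
        obtain ⟨φ, rfl⟩ := hz
        simp only [Finsupp.lsum_apply, Finsupp.sum, map_sum, Aone]
        refine Finset.sum_congr rfl fun i _ => ?_
        show q (p i _) = p i _
        rw [← mapp, hq, osum_mul pp]
    have h4 := congrArg star h3
    rw [one_mul, star_mul, star_proj qp, star_proj (pr_proj _)] at h4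
    rw [← X2, mul_assoc, h4]
  have pN : ∀ i, p i ∈ N := fun i => hp i ▸ mul_mem (vst (hN i)) (hN i)
  have qN : q ∈ N := hq ▸ osum_mem pN
  have xX : ∀ i, star (x i) * X = p i := fun i => by
    have := mul_osum (S := star (x i) * X) (T := p i) pp fun j => by
      rw [mul_assoc, Xp, key, star_proj (pp i)]
    rwa [← hq, mul_assoc, Xq, hq, mul_osum' pp] at this
  have Xx : ∀ i, star X * x i = p i := fun i => by
    have := congrArg star (xX i)
    rwa [star_mul, star_star, star_proj (pp i)] at this
  refine ⟨X, vn_iff.2 fun y hy => ?_, fun i => by rw [← hp, Xp], ?_, ?_⟩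
  · have := mul_osum (S := y * X) (T := X * y) pp fun i => by
      rw [mul_assoc, Xp, mul_assoc, ← comm_iff.1 hy _ (pN i), ← mul_assoc, Xp, comm_iff.1 hy _ (hN i)]
    rwa [← hq, mul_assoc, Xq, mul_assoc, ← comm_iff.1 hy _ qN, ← mul_assoc, Xq] at this
  · simp only [← hp]
    have := mul_osum (S := star X * X) (T := 1) pp fun i => by rw [mul_assoc, Xp, Xx, one_mul]
    rwa [← hq, mul_assoc, Xq, one_mul, hq] at this
  · simp only [← hr]
    have h3 := mul_osum (S := X * star X) (T := 1) rr fun i => by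
      rw [mul_assoc, hr, ← mul_assoc (star X), Xx, ← mul_assoc, Xp, one_mul]
    have h4 := mul_osum (S := osum r * X) (T := X) pp fun i => by
      rw [mul_assoc, Xp, ← hx i, ← hr, ← mul_assoc, osum_mul rr]
    rw [← hq, mul_assoc, Xq] at h4
    have h5 := congrArg star h3
    rw [one_mul, star_mul, star_mul, star_star, star_proj osum_proj, ← mul_assoc, h4] at h5
    exact h5
theorem max_pi (hp : Pj p) (hq : Pj q) (good : BB → Prop) :
    ∃ S : SB, (∀ x ∈ S, x ∈ N ∧ x * star x * x = x ∧ q * x = x ∧ x * p = x ∧ good x) ∧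
    (∀ i j : S, i ≠ j → star i.1 * j.1 = 0 ∧ i.1 * star j.1 = 0) ∧
    ∃ W ∈ N, W * star W * W = W ∧ q * W = W ∧ W * p = W ∧ star W * W = osum (fun i : S => star i.1 * i.1) ∧
      W * star W = osum (fun i : S => i.1 * star i.1) ∧
      ∀ w ∈ N, w * star w * w = w → good w → (q - W * star W) * w = w → w * (p - star W * W) = w → w = 0 := by
  obtain ⟨S, h1, h2, h3⟩ := zorn_family (fun x => x ∈ N ∧ x * star x * x = x ∧ q * x = x ∧ x * p = x ∧ good x)
    (fun a b : BB => star a * b = 0 ∧ a * star b = 0)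
  have h2' : ∀ i j : S, i ≠ j → star i.1 * j.1 = 0 ∧ i.1 * star j.1 = 0 := fun i j hij =>
    h2 i.2 j.2 fun h => hij (Subtype.ext h)
  obtain ⟨W, WN, W1, W2, W3⟩ := psum (N := N) (x := fun i : S => i.1) (fun i => (h1 _ i.2).1) (fun i => (h1 _ i.2).2.1)
    (fun i j h => (h2' i j h).1) (fun i j h => (h2' i j h).2)
  have pl : ∀ i : S, Pj (star i.1 * i.1) := fun i => pi_l (h1 _ i.2).2.1
  have prr : ∀ i : S, Pj (i.1 * star i.1) := fun i => pi_r (h1 _ i.2).2.1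
  have Wpi : W * star W * W = W := by
    have h5 : W * (star W * W) = 1 * W := by
      have h6 : star (W - W * (star W * W)) * (W - W * (star W * W)) = 0 := by
        have a := proj_mul (osum_proj (p := fun i : S => star i.1 * i.1))
        rw [← W2] at a
        have e : star (W - W * (star W * W)) * (W - W * (star W * W)) = star W * W - star W * W * (star W * W)
          - (star W * W * (star W * W) - star W * W * (star W * W) * (star W * W)) := by
          simp only [star_sub, star_mul, star_star]; noncomm_ring
        rw [e, a, a]; simp
      exact (sub_eq_zero.1 (CStarRing.star_mul_self_eq_zero_iff _ |>.1 h6)).symm.trans (one_mul W).symm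
    rw [mul_assoc, h5, one_mul]
  have qW : q * W = W := by
    have : q * (W * star W) = W * star W := W3 ▸ osum_le prr fun i => by rw [← mul_assoc, (h1 _ i.2).2.2.1]
    calc q * W = q * (W * star W) * W := by rw [mul_assoc, Wpi]
      _ = W := by rw [this, Wpi]
  have Wp : W * p = W := by
    have : p * (star W * W) = star W * W := W2 ▸ osum_le pl fun i => by
      rw [← mul_assoc]; have := congrArg star (h1 _ i.2).2.2.2.1
      rw [star_mul, star_proj hp] at this; rw [this]
    have h5 := congrArg star this
    simp only [star_mul, star_star, star_proj hp] at h5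
    calc W * p = W * (star W * W * p) := by rw [← mul_assoc, ← mul_assoc, Wpi]
      _ = W := by rw [h5, ← mul_assoc, Wpi]
  refine ⟨S, h1, h2', W, WN, Wpi, qW, Wp, W2, W3, fun w hw w1 w2 w3 w4 => ?_⟩
  have k1 : ∀ b ∈ S, star b * w = 0 := fun b hb => by
    have a := mul_osum' (p := fun i : S => i.1 * star i.1) prr ⟨b, hb⟩
    rw [← W3] at a
    have b2 := congrArg star (h1 b hb).2.2.1
    rw [star_mul, star_proj hq] at b2
    rw [← w3, ← mul_assoc, mul_sub, b2, ← pi_s (h1 b hb).2.1, mul_assoc (star b), mul_assoc (star b), a, sub_self, zero_mul]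
  have k2 : ∀ b ∈ S, w * star b = 0 := fun b hb => by
    have a := osum_mul (p := fun i : S => star i.1 * i.1) pl ⟨b, hb⟩
    rw [← W2] at a
    have b2 := congrArg star (h1 b hb).2.2.2.1
    rw [star_mul, star_proj hp] at b2
    rw [← w4, mul_assoc, sub_mul, b2]
    nth_rw 2 [← pi_s (h1 b hb).2.1]
    rw [← mul_assoc _ _ (star b), a, pi_s (h1 b hb).2.1, sub_self, mul_zero]
  have hqw : q * w = w := by
    rw [← w3, ← mul_assoc, mul_sub, proj_mul hq, ← mul_assoc, qW]
  have hwp : w * p = w := by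
    rw [← w4, mul_assoc, sub_mul, proj_mul hp, mul_assoc, Wp]
  have hS := h3 w ⟨hw, w1, hqw, hwp, w2⟩ fun b hb => ⟨⟨?_, k2 b hb⟩, k1 b hb, ?_⟩
  · exact CStarRing.star_mul_self_eq_zero_iff _ |>.1 (k1 w hS)
  · have := congrArg star (k1 b hb); rwa [star_mul, star_star, star_zero] at this
  · have := congrArg star (k2 b hb); rwa [star_mul, star_star, star_zero] at this
theorem compar (hp : Pj p) (hq : Pj q) (pN : p ∈ N) (qN : q ∈ N) :
    ∃ W ∈ N, W * star W * W = W ∧ q * W = W ∧ W * p = W ∧ ∀ y ∈ N, (q - W * star W) * y * (p - star W * W) = 0 := by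
  obtain ⟨S, h1, h2, W, WN, W1, W2, W3, -, -, h3⟩ := max_pi (N := N) hp hq fun _ => True
  refine ⟨W, WN, W1, W2, W3, fun y hy => ?_⟩
  have sW := vst WN
  have aN : q - W * star W ∈ N := sub_mem qN (mul_mem WN sW)
  have bN : p - star W * W ∈ N := sub_mem pN (mul_mem sW WN)
  have ap := proj_sub (pi_r W1) hq (by rw [← mul_assoc, W2])
  have bp := proj_sub (pi_l W1) hp (by rw [← mul_assoc]; have := congrArg star W3; rw [star_mul, star_proj hp] at this; rw [this])
  obtain ⟨u, uN, a, -, -, -, ua, -, u1, -, u2, u3⟩ := polar (mul_mem (mul_mem aN hy) bN)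
  have k1 : (q - W * star W) * u = u := by
    have := u2 (1 - (q - W * star W)) (by rw [sub_mul, one_mul, ← mul_assoc, ← mul_assoc, proj_mul ap, sub_self])
    rw [sub_mul, one_mul, sub_eq_zero] at this; exact this.symm
  have k2 : u * (p - star W * W) = u := by
    have := u3 (1 - (p - star W * W)) (by rw [mul_sub, mul_one, mul_assoc ((q - W * star W) * y), proj_mul bp, sub_self])
    rw [mul_sub, mul_one, sub_eq_zero] at this; exact this.symm
  rw [← ua, h3 u uN u1 trivial k1 k2, zero_mul]
local notation "DD" => Dat sf M₁ B A E E1 EA Ψ ξ η P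
local notation "TD" => TDat sf M₁ B A Ψ ξ η P T
local notation "eB" => pr (orb B ξ)
local notation "𝒩" => VonNeumannAlgebra.commutant (StandardForm.cv sf B)
namespace Dat
theorem BM (d : DD) (hx : x ∈ B) : x ∈ M := d.leM (d.le hx)
theorem ec (d : DD) : sf.c eB = eB := sf.lemJ d.g.cone d.g.cone d.ceE d.g.inv d.g.inv d.g.sep d.g.sep
theorem eb (d : DD) (hy : y ∈ B) : y * eB = eB * y := comm_iff.1 (pr_orb_mem B ξ) y hy
theorem eN (d : DD) : eB ∈ 𝒩 := sf.cv_comm.2 fun y hy => by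
  have := congrArg sf.c (d.eb hy); rwa [sf.c_mul, sf.c_mul, d.ec] at this
theorem MN (d : DD) (hx : x ∈ M) : x ∈ 𝒩 := sf.le_cv (fun _ h => d.BM h) hx
theorem Jξ (d : DD) (x : BB) : sf.c x ξ = sf.J (x ξ) := (sf.J_cone_app d.g.cone x).symm
theorem cN (d : DD) (hX : X ∈ 𝒩) (hb : b ∈ B) : sf.c X * b = b * sf.c X := by
  have := congrArg sf.c (sf.cv_comm.1 hX b hb); rw [sf.c_mul, sf.c_mul, sf.c_c] at this; exact this.symm
theorem ext (d : DD) (hX : X ∈ 𝒩) (hY : Y ∈ 𝒩) (h : X ξ = Y ξ) : X * eB = Y * eB := by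
  have := mul_pr_eq (K := orb B ξ) (S := sf.c X) (T := sf.c Y) fun z hz => by
    obtain ⟨b, hb, rfl⟩ := mem_orb.1 hz
    rw [← mapp, ← mapp, d.cN hX hb, d.cN hY hb, mapp, mapp, d.Jξ, d.Jξ, h]
  have h2 := congrArg sf.c this
  rwa [sf.c_mul, sf.c_mul, d.ec, sf.c_c, sf.c_c] at h2
theorem sepB (d : DD) (hx : x ∈ M) (hy : y ∈ M) (h : x ξ = y ξ) : x = y :=
  sub_eq_zero.1 (d.g.sep _ (vsb hx hy) (by rw [Asub, h, sub_self]))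
theorem eξ : eB ξ = ξ := pr_orb_self B ξ
theorem sepe (d : DD) (hx : x ∈ M) (hy : y ∈ M) (h : x * eB = y * eB) : x = y :=
  d.sepB hx hy (by have := DFunLike.congr_fun h ξ; rwa [mapp, mapp, eξ] at this)
theorem eNe (d : DD) (hX : X ∈ 𝒩) : ∃ k ∈ B, eB * X * eB = k * eB ∧ ‖k‖ ≤ ‖X‖ := by
  obtain ⟨κ, hκ⟩ : ∃ κ, κ = eB (sf.c X ξ) := ⟨_, rfl⟩
  have eκ : eB κ = κ := by rw [hκ, ← mapp, proj_mul (pr_proj _)]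
  obtain ⟨x, xM, x1, x2⟩ := lemX (N := M) (ξ := ξ) (κ := κ) (norm_nonneg X) fun m hm => by
    have mm := mul_mem (vst hm) hm
    have hE : E (star m * m) ∈ B := d.ceE.maps_to _ mm
    have h0 := d.ceE.pos _ mm (star_mul_self_nonneg m)
    obtain ⟨s1, s2, -⟩ := sqrt_facts h0
    have s3 := sqrt_mem hE
    generalize CFC.sqrt (E (star m * m)) = h at *
    have k1 : ‖m κ‖ ^ 2 = ‖h κ‖ ^ 2 := by
      have a := normsq_inner m κ
      have b := normsq_inner h κ
      rw [s1.star_eq, s2] at b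
      have : ⟪κ, (star m * m) κ⟫ = ⟪κ, E (star m * m) κ⟫ := by
        have := DFunLike.congr_fun (d.ceE.e_e d.g.inv mm) κ
        rw [mapp, mapp, mapp (E _), eκ] at this
        rw [← this, ← sa_inner (pr_proj (orb B ξ)).isSelfAdjoint, eκ]
      rw [a, b] at this; exact_mod_cast this
    have k2 : ‖h ξ‖ ^ 2 = ‖m ξ‖ ^ 2 := by
      have a := normsq_inner m ξ
      have b := normsq_inner h ξ
      rw [s1.star_eq, s2, d.g.inv _ mm, a] at b; exact_mod_cast b.symm
    have k3 : h κ = eB (sf.c X (h ξ)) := by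
      rw [hκ, ← mapp h eB, d.eb s3, mapp eB h, ← mapp h (sf.c X), ← d.cN hX s3, mapp]
    rw [(pow_left_inj₀ (norm_nonneg _) (norm_nonneg _) two_ne_zero).1 k1, ← (pow_left_inj₀ (norm_nonneg _) (norm_nonneg _) two_ne_zero).1 k2, k3]
    exact (proj_norm_le (pr_proj _) _).trans (((sf.c X).le_opNorm _).trans (by gcongr; exact sf.c_norm X))
  have kM := sf.c_mem' xM
  have kξ : sf.c x ξ = eB (X ξ) := by
    rw [d.Jξ, x1, hκ, d.Jξ]; have := sf.c_apply eB (X ξ); rw [d.ec] at this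
    rw [this]
  have kE : sf.c x = E (sf.c x) := d.sepB kM (d.BM (d.ceE.maps_to _ kM)) (by
    rw [← d.ceE.e_app d.g.inv kM, kξ, ← mapp eB eB, proj_mul (pr_proj _)])
  have kB : sf.c x ∈ B := kE ▸ d.ceE.maps_to _ kM
  refine ⟨_, kB, ?_, (sf.c_norm x).trans x2⟩
  rw [← d.ext (mul_mem (mul_mem d.eN hX) d.eN) (d.MN kM) (by rw [mapp, eξ, kξ, mapp]), mul_assoc _ eB eB, proj_mul (pr_proj _)]
theorem cz_aux (d : DD) (hz : z ∈ B) (hc : z ∈ B.commutant) (hw : w ∈ B) (h : sf.c z ξ = w ξ) (w0 : w * w = w) : z * w = z := by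
  have xM : z - z * w ∈ M := d.BM (sub_mem hz (mul_mem hz hw))
  have h0 : (z - z * w) (w ξ) = 0 := by rw [← mapp, sub_mul, mul_assoc, w0, sub_self]; rfl
  have h1 : (z - z * w) (sf.c (z - z * w) ξ) = 0 := by
    have : sf.c (z - z * w) ξ = w ξ - sf.c w (w ξ) := by rw [← comm_iff.1 hc w hw, sf.c_sub, sf.c_mul, Asub, mapp, h]
    rw [this, map_sub, ← mapp _ (sf.c w), sf.c_comm xM (d.BM hw), mapp, h0, map_zero, sub_zero]
  have h2 := sf.zero_of_xJxJ xM d.g.cone (by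
    rw [sf.c_mul, mapp, ← mapp _ (sf.c _), sf.c_comm xM (vst xM), mapp, h1, map_zero, map_zero])
  exact (sub_eq_zero.1 (d.g.sep _ xM h2)).symm
theorem cz (d : DD) (hz : z ∈ B) (hc : z ∈ B.commutant) (hp : Pj z) : sf.c z * eB = z * eB := by
  have cN : sf.c z ∈ 𝒩 := sf.cv_comm.2 fun y hy => by rw [← sf.c_mul, ← sf.c_mul, comm_iff.1 hc y hy]
  have ce : sf.c z * eB = eB * sf.c z := by have := congrArg sf.c (d.eb hz); rwa [sf.c_mul, sf.c_mul, d.ec] at this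
  obtain ⟨w, hw, k, -⟩ := d.eNe cN
  rw [← ce, mul_assoc, proj_mul (pr_proj _)] at k
  have kξ : sf.c z ξ = w ξ := by have := DFunLike.congr_fun k ξ; rwa [mapp, mapp, eξ] at this
  have w0 : w * w = w := d.sepe (d.BM (mul_mem hw hw)) (d.BM hw) (by
    rw [mul_assoc, ← k, ← mul_assoc, ← comm_iff.1 (sf.c_mem (d.BM hz)) w (d.BM hw) |>.symm, mul_assoc, ← k, ← mul_assoc, proj_mul (sf.c_proj hp)])
  have a1 := d.cz_aux hz hc hw kξ w0
  have a2 := d.cz_aux (z := 1 - z) (w := 1 - w) (sub_mem (one_mem B) hz) (sub_mem (one_mem _) hc) (sub_mem (one_mem B) hw) (by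
    rw [sf.c_sub, sf.c_one, Asub, kξ]; rfl) (by rw [mul_sub, mul_one, sub_mul, one_mul, w0, sub_self, sub_zero])
  have : (1 - z) * (1 - w) = 1 - z - w + z * w := by noncomm_ring
  rw [k]; rw [this, a1] at a2
  congr 1
  have h := sub_eq_zero.2 a2
  rw [show 1 - z - w + z - (1 - z) = z - w by abel] at h
  exact (sub_eq_zero.1 h).symm
end Dat
theorem conj_lub {S : SB} (hne : S.Nonempty) (hd : DirectedOn (· ≤ ·) S) (hx : IsLUB S x) (y : BB) :
    DirectedOn (· ≤ ·) ((fun s => star y * s * y) '' S) ∧ IsLUB ((fun s => star y * s * y) '' S) (star y * x * y) := by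
  have m : ∀ {a b : BB}, a ≤ b → star y * a * y ≤ star y * b * y := fun {a b} h => by
    have := star_left_conjugate_nonneg (sub_nonneg.2 h) y
    rwa [mul_sub, sub_mul, sub_nonneg] at this
  refine ⟨?_, ?_, fun u hu => ?_⟩
  · rintro _ ⟨a, ha, rfl⟩ _ ⟨b, hb, rfl⟩
    obtain ⟨c, hc, h1, h2⟩ := hd a ha b hb
    exact ⟨_, ⟨c, hc, rfl⟩, m h1, m h2⟩
  · rintro _ ⟨a, ha, rfl⟩; exact m (hx.1 ha)
  · refine le_iff.2 fun ζ => ?_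
    have k : ∀ s : BB, ⟪ζ, (star y * s * y) ζ⟫ = ⟪y ζ, s (y ζ)⟫ := fun s => by rw [mapp, mapp, inner_star]
    rw [k]
    obtain ⟨s0, hs0⟩ := hne
    have c0 := cL (le_iff.1 (hu ⟨s0, hs0, rfl⟩) ζ)
    have c1 := cL (le_iff.1 (hx.1 hs0) (y ζ))
    rw [k] at c0
    refine Complex.le_def.2 ⟨le_of_forall_pos_le_add fun ε hε => ?_, c1.2.symm.trans c0.2⟩
    obtain ⟨s, hs, h⟩ := vigier ⟨s0, hs0⟩ hd hx (y ζ) hε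
    have c2 := (cL (le_iff.1 (hu ⟨s, hs, rfl⟩) ζ)).1
    rw [k] at c2
    rw [Asub, inner_sub_right, Complex.sub_re] at h
    linarith
theorem mono_dir {N : SB} {F : BB → BB} {S : SB} (hS : S ⊆ N) (hd : DirectedOn (· ≤ ·) S) (hm : ∀ x ∈ N, ∀ y ∈ N, x ≤ y → F x ≤ F y) : DirectedOn (· ≤ ·) (F '' S) := by
  rintro _ ⟨a, ha, rfl⟩ _ ⟨b, hb, rfl⟩
  obtain ⟨c, hc, h1, h2⟩ := hd a ha b hb
  exact ⟨_, ⟨c, hc, rfl⟩, hm _ (hS ha) _ (hS hc) h1, hm _ (hS hb) _ (hS hc) h2⟩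
theorem inv_normal {D : VN H} {F : BB → BB} {ξ : H} (h : CE N D F) (hi : Inv N F ξ) (hd : pr (orb N.commutant ξ) = 1) : IsNormalOn (N : SB) F := by
  intro S hS hne hdir x hx hl
  have mn : ∀ {a b : BB}, a ∈ N → b ∈ N → a ≤ b → F a ≤ F b := fun ha hb => h.mono (fun x hx y hy => vsb hx hy) ha hb
  refine ⟨?_, fun u hu => sub_nonneg.1 (nonneg_of_dense hd ?_)⟩
  · rintro _ ⟨a, ha, rfl⟩; exact mn (hS ha) hx (hl.1 ha)
  · intro z hz
    obtain ⟨y, hy, rfl⟩ := mem_orb.1 hz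
    obtain ⟨s0, hs0⟩ := hne
    have c0 := cL (le_iff.1 (hu ⟨s0, hs0, rfl⟩) (y ξ))
    have c1 := cL (le_iff.1 (mn (hS hs0) hx (hl.1 hs0)) (y ξ))
    rw [Asub, inner_sub_right, sub_nonneg]
    refine Complex.le_def.2 ⟨le_of_forall_pos_le_add fun ε hε => ?_, c1.2.symm.trans c0.2⟩
    have C1 : 0 < ‖y‖ ^ 2 + 1 := by positivity
    obtain ⟨s, hs, k⟩ := vigier ⟨s0, hs0⟩ hdir hl ξ (div_pos hε C1)
    have c2 := (cL (le_iff.1 (hu ⟨s, hs, rfl⟩) (y ξ))).1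
    have xs : x - s ∈ N := vsb hx (hS hs)
    have ps := h.pos _ xs (sub_nonneg.2 (hl.1 hs))
    rw [← hi _ xs] at k
    obtain ⟨s1, s2, -⟩ := sqrt_facts ps
    have s3 := sqrt_mem (h.subset (h.maps_to _ xs))
    have k2 := normsq_inner (CFC.sqrt (F (x - s))) ξ
    have k3 := normsq_inner (CFC.sqrt (F (x - s))) (y ξ)
    rw [s1.star_eq, s2] at k2 k3
    rw [k2, Complex.ofReal_re] at k
    rw [← comm_app hy s3, h.sub hx (hS hs), Asub, inner_sub_right] at k3
    have k4 := congrArg Complex.re k3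
    rw [Complex.sub_re, Complex.ofReal_re, ← h.sub hx (hS hs)] at k4
    have k5 : ‖y (CFC.sqrt (F (x - s)) ξ)‖ ^ 2 ≤ ε := by
      calc _ ≤ (‖y‖ * ‖CFC.sqrt (F (x - s)) ξ‖) ^ 2 := by gcongr; exact y.le_opNorm _
        _ = ‖y‖ ^ 2 * ‖CFC.sqrt (F (x - s)) ξ‖ ^ 2 := by ring
        _ ≤ (‖y‖ ^ 2 + 1) * (ε / (‖y‖ ^ 2 + 1)) := by gcongr; linarith
        _ = ε := by field_simp
    linarith
structure INT (M₁ B A : VN H) (ξ : H) (e v : BB) : Prop where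
  eA : e ∈ A
  ep : Pj e
  vM : v ∈ M₁
  v0 : v ≠ 0
  pi : v * pr (orb B ξ) * star v * (v * pr (orb B ξ)) = v * pr (orb B ξ)
  ev : e * v = v
  com : ∀ a ∈ A, e * a * e = a → a * (v * pr (orb B ξ) * star v) = v * pr (orb B ξ) * star v * a
theorem corner_iff (he : Pj e) : e * x * e = x ↔ e * x = x ∧ x * e = x := by
  constructor
  · intro h; constructor
    · rw [← h, ← mul_assoc, ← mul_assoc, proj_mul he]
    · rw [← h, mul_assoc, proj_mul he]
  · rintro ⟨a, b⟩; rw [a, b]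
theorem cstar (he : Pj e) (h : e * a * e = a) : e * star a * e = star a := by
  have := congrArg star h; rwa [star_mul, star_mul, star_proj he, ← mul_assoc] at this
namespace Dat
theorem th1 (d : DD) (i : INT M₁ B A ξ e v) (ha : a ∈ A) (hc : e * a * e = a) :
    E (star v * a * v) ∈ B ∧ E (star v * a * v) * eB = star (v * eB) * a * (v * eB) ∧ a * v = v * E (star v * a * v) := by
  have h1 : star v * a * v ∈ M := d.leM (mul_mem (mul_mem (vst i.vM) (d.leA ha)) i.vM)
  have h2 : E (star v * a * v) * eB = star (v * eB) * a * (v * eB) := by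
    rw [← d.ceE.e_e d.g.inv h1, star_mul, star_proj (pr_proj _)]; simp only [mul_assoc]
  refine ⟨d.ceE.maps_to _ h1, h2, d.sepe (d.leM (mul_mem (d.leA ha) i.vM)) (d.leM (mul_mem i.vM (d.le (d.ceE.maps_to _ h1)))) ?_⟩
  rw [mul_assoc v, h2, star_mul, star_proj (pr_proj _)]
  have := i.com a ha hc
  calc a * v * eB = a * (v * eB * star v * (v * eB)) := by rw [i.pi, mul_assoc]
    _ = v * eB * star v * a * (v * eB) := by rw [← mul_assoc, this]
    _ = _ := by simp only [mul_assoc]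
theorem thmul (d : DD) (i : INT M₁ B A ξ e v) (ha : a ∈ A) (hc : e * a * e = a) (hb : b ∈ A) (hc' : e * b * e = b) :
    E (star v * (a * b) * v) = E (star v * a * v) * E (star v * b * v) := by
  obtain ⟨k1, k2, k3⟩ := d.th1 i ha hc
  obtain ⟨l1, l2, l3⟩ := d.th1 i hb hc'
  rw [mul_assoc, mul_assoc, l3, ← mul_assoc, ← mul_assoc, d.ceE.right l1 (d.leM (mul_mem (mul_mem (vst i.vM) (d.leA ha)) i.vM))]
end Dat
theorem comm_of_mem {c : BB} (h : ∀ N : VN H, c ∈ N → g ∈ N) (h1 : y * c = c * y) (h2 : star y * c = c * star y) : y * g = g * y := by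
  have hs : ∀ x ∈ ({y, star y} : SB), star x ∈ ({y, star y} : SB) := by
    rintro x (rfl | rfl)
    · exact Or.inr rfl
    · exact Or.inl (star_star _)
  refine mem_vnComm.1 (h (vnComm {y, star y} hs) (mem_vnComm.2 ?_)) y (Or.inl rfl)
  rintro x (rfl | rfl)
  exacts [h1, h2]
theorem inv_cut {c : BB} (h0 : 0 ≤ c) (hc : c ≠ 0) : ∃ e g : BB, Pj e ∧ e ≠ 0 ∧ star g = g ∧ e * g = g ∧ g * c * g = e ∧
    (∀ N : VN H, c ∈ N → e ∈ N ∧ g ∈ N) ∧ (∀ q, Pj q → q * c = c → q * e = e) ∧ ∃ δ : ℝ, 0 < δ ∧ (δ : ℂ) • e ≤ c := by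
  have hn : 0 < ‖c‖ := norm_pos_iff.2 hc
  obtain ⟨δ, hδ⟩ : ∃ δ : ℝ, δ = ‖c‖ / 2 := ⟨_, rfl⟩
  have δ0 : 0 < δ := by rw [hδ]; positivity
  obtain ⟨k1, k2, k3⟩ := sp_cut c (sa_of_nonneg h0) δ
  have ne : sp (c - (δ : ℂ) • 1) ≠ 0 := fun h => by
    have a : c ≤ (δ : ℂ) • 1 := sub_nonpos.1 (sp_eq_zero ((sa_of_nonneg h0).sub (by
      rw [IsSelfAdjoint, star_smul, star_one, Complex.star_def, Complex.conj_ofReal])) h)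
    have b := CStarAlgebra.norm_le_norm_of_nonneg_of_le h0 a
    have : ‖((δ : ℂ) • 1 : BB)‖ ≤ δ := by
      refine (norm_smul_le _ _).trans ?_
      rw [Complex.norm_real, Real.norm_of_nonneg δ0.le]
      exact mul_le_of_le_one_right δ0.le (ContinuousLinearMap.norm_id_le)
    linarith
  have e0 := sp_proj (c - (δ : ℂ) • 1)
  have eM : ∀ N : VN H, c ∈ N → sp (c - (δ : ℂ) • 1) ∈ N := fun N hN => sp_mem (vsb hN (vn_smul _ (one_mem N)))
  have le' : ∀ q, Pj q → q * c = c → q * sp (c - (δ : ℂ) • 1) = sp (c - (δ : ℂ) • 1) := fun q hq h => sp_le hq h0 δ0 h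
  generalize sp (c - (δ : ℂ) • 1) = e at *
  obtain ⟨x, hx⟩ : ∃ x, x = c * e + (δ : ℂ) • (1 - e) := ⟨_, rfl⟩
  have xδ : (δ : ℂ) • 1 ≤ x := by
    have : (δ : ℂ) • e + (δ : ℂ) • (1 - e) = (δ : ℂ) • (1 : BB) := by rw [← smul_add, add_sub_cancel]
    rw [hx, ← this]; gcongr
  have sx : IsStrictlyPositive x := by
    refine IsStrictlyPositive.of_le ⟨?_, ?_⟩ xδ
    · refine nonneg_iff.2 fun v => ?_
      rw [Asmul, inner_smul_right]
      exact mul_nonneg (by exact_mod_cast δ0.le) (by rw [Aone, inner_self']; exact_mod_cast sq_nonneg ‖v‖)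
    · exact (isUnit_one.smul (Units.mk0 (δ : ℂ) (by exact_mod_cast δ0.ne')))
  obtain ⟨t, ht⟩ : ∃ t, t = x ^ (-(1 / 2) : ℝ) := ⟨_, rfl⟩
  have t1 := CFC.conjugate_rpow_neg_one_half x sx
  have t0 : star t = t := by rw [ht]; exact (sa_of_nonneg CFC.rpow_nonneg)
  have tN : ∀ N : VN H, c ∈ N → t ∈ N := fun N hN => by
    have xN : x ∈ N := by
      rw [hx]; exact add_mem (mul_mem hN (eM N hN)) (vn_smul _ (sub_mem (one_mem N) (eM N hN)))
    rw [ht]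
    exact vn_iff.2 fun y hy => (((show Commute x y from (vn_iff.1 xN y hy).symm).cfc_nnreal _).eq).symm
  rw [← ht] at t1
  have te : e * t = t * e := comm_of_mem tN (k3.eq).symm (by rw [star_proj e0]; exact k3.eq.symm)
  have xe : x * e = c * e := by
    rw [hx, add_mul, mul_assoc, proj_mul e0, smul_mul_assoc, sub_mul, one_mul, proj_mul e0, sub_self, smul_zero, add_zero]
  refine ⟨e, t * e, e0, ne, by rw [star_mul, t0, star_proj e0, te], by rw [← mul_assoc, te, mul_assoc, proj_mul e0], ?_, fun N hN => ⟨eM N hN, mul_mem (tN N hN) (eM N hN)⟩, le', δ, δ0, ?_⟩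
  · calc t * e * c * (t * e) = t * (e * c) * (e * t) := by rw [te]; simp only [mul_assoc]
      _ = t * (c * e) * (e * t) := by rw [k3.eq]
      _ = t * x * t * e := by rw [← xe]; simp only [mul_assoc]; rw [← mul_assoc e e, proj_mul e0, te]
      _ = e := by rw [t1, one_mul]
  · refine k1.trans (sub_nonneg.1 ?_)
    have : c - c * e = star (1 - e) * c * (1 - e) := by
      rw [star_sub, star_one, star_proj e0, sub_mul, one_mul, mul_sub, mul_one, sub_mul, ← k3.eq, mul_assoc c e e, proj_mul e0]; abel
    rw [this]; exact star_left_conjugate_nonneg h0 _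
theorem polar_inter (hv : v ∈ N) : ∃ u ∈ N, u * star u * u = u ∧ (v ≠ 0 → u ≠ 0) ∧ (∀ y, y * v = 0 → y * u = 0) ∧ (∀ y, v * y = 0 → u * y = 0) ∧
    ∀ a t, a * v = v * t → star a * v = v * star t → a * u = u * t := by
  obtain ⟨u, uN, b, bN, b0, bb, ub, uv, uu, ub', l, r⟩ := polar hv
  refine ⟨u, uN, uu, fun h h' => h (by rw [← ub, h', zero_mul]), l, r, fun a t h1 h2 => ?_⟩
  have sb := (sa_of_nonneg b0).star_eq
  have key : ∀ t a : BB, a * v = v * t → star a * v = v * star t → t * (star v * v) = star v * v * t := fun t a h1 h2 => by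
    rw [mul_assoc, ← h1, ← mul_assoc, ← mul_assoc]; congr 1
    have := congrArg star h2; rwa [star_mul, star_mul, star_star, star_star, eq_comm] at this
  have tb : t * b = b * t := by
    refine comm_of_mem (c := star v * v) (fun N hN => ?_) (key t a h1 h2) (key (star t) (star a) h2 (by rw [star_star, star_star]; exact h1))
    rw [← CFC.sqrt_mul_self b b0, bb]; exact sqrt_mem hN
  have x1 : (a * u - u * t) * b = 0 := by rw [sub_mul, mul_assoc, ub, mul_assoc, tb, ← mul_assoc, ub, h1, sub_self]
  have x2 : (a * u - u * t) * star u = 0 := by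
    have : v * star (a * u - u * t) = 0 := by
      have := congrArg star x1; rw [star_mul, sb, star_zero] at this
      rw [← ub, mul_assoc, this, mul_zero]
    have := congrArg star (r _ this); rwa [star_mul, star_star, star_zero] at this
  have x3 : u * (t * (1 - star u * u)) = 0 := r _ (by
    rw [← mul_assoc, ← h1, mul_assoc, mul_sub, mul_one, ← ub]
    have : b * (star u * u) = b := by have := congrArg star ub'; rwa [star_mul, star_mul, star_star, sb] at this
    rw [mul_assoc u b, this, sub_self, mul_zero])
  rw [sub_mul, sub_eq_zero] at x2
  calc a * u = a * u * star u * u := by rw [mul_assoc a, mul_assoc a, uu]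
    _ = u * t * (star u * u) := by rw [x2, mul_assoc]
    _ = u * t := by rw [mul_sub, mul_one, mul_sub, sub_eq_zero] at x3; rw [mul_assoc]; exact x3.symm
namespace Dat
theorem th_lin (d : DD) (i : INT M₁ B A ξ e v) : (∀ x ∈ A, star v * x * v ∈ M) ∧ (∀ x ∈ A, ∀ y ∈ A, E (star v * (x + y) * v) = E (star v * x * v) + E (star v * y * v)) ∧
    (∀ (c : ℂ), ∀ x ∈ A, E (star v * (c • x) * v) = c • E (star v * x * v)) ∧ (∀ x ∈ A, E (star v * star x * v) = star (E (star v * x * v))) ∧ ∀ x ∈ A, 0 ≤ x → 0 ≤ E (star v * x * v) := by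
  have m : ∀ x ∈ A, star v * x * v ∈ M := fun x hx => d.leM (mul_mem (mul_mem (vst i.vM) (d.leA hx)) i.vM)
  refine ⟨m, fun x hx y hy => ?_, fun c x hx => ?_, fun x hx => ?_, fun x hx h0 => d.ceE.pos _ (m x hx) (star_left_conjugate_nonneg h0 v)⟩
  · rw [mul_add, add_mul, d.ceE.map_add _ (m x hx) _ (m y hy)]
  · rw [mul_smul_comm, smul_mul_assoc, d.ceE.map_smul _ _ (m x hx)]
  · rw [← d.ceE.star' (m x hx), star_mul, star_mul, star_star, mul_assoc]
theorem th_norm (d : DD) (i : INT M₁ B A ξ e v) {S : SB} (hS : S ⊆ A) (hne : S.Nonempty) (hd : DirectedOn (· ≤ ·) S) (hx : x ∈ A) (hl : IsLUB S x) :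
    IsLUB ((fun a => E (star v * a * v)) '' S) (E (star v * x * v)) := by
  obtain ⟨k1, k2⟩ := conj_lub hne hd hl v
  have := inv_normal d.ceE d.g.inv (StandardForm.dense_comm d.g.sep) _ (by rintro _ ⟨a, ha, rfl⟩; exact (d.th_lin i).1 a (hS ha)) (hne.image _) k1 _ ((d.th_lin i).1 x hx) k2
  rwa [Set.image_image] at this
theorem ev_mem (d : DD) (i : INT M₁ B A ξ e v) : ∀ b ∈ B, v * b * star v ∈ M₁ := fun b hb => mul_mem (mul_mem i.vM (d.le hb)) (vst i.vM)
theorem th_c (d : DD) (i : INT M₁ B A ξ e v) : EA (v * star v) ∈ A ∧ 0 ≤ EA (v * star v) ∧ EA (v * star v) ≠ 0 ∧ e * EA (v * star v) = EA (v * star v) ∧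
    ∀ a ∈ A, e * a * e = a → a * EA (v * star v) = EA (v * star v) * a := by
  have vv := mul_mem i.vM (vst i.vM)
  refine ⟨d.ceA.maps_to _ vv, d.ceA.pos _ vv (mul_star_self_nonneg v), fun h => i.v0 ?_, by rw [← d.ceA.left i.eA vv, ← mul_assoc, i.ev], fun a ha hc => ?_⟩
  · have := d.fA _ vv (mul_star_self_nonneg v) h
    exact CStarRing.mul_star_self_eq_zero_iff v |>.1 this
  · rw [← d.ceA.left ha vv, ← d.ceA.right ha vv]
    congr 1
    have h1 := (d.th1 i ha hc).2.2
    have h2 := congrArg star (d.th1 i (vst ha) (cstar i.ep hc)).2.2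
    rw [star_mul, star_mul, (d.th_lin i).2.2.2.1 a ha, star_star, star_star] at h2
    rw [← mul_assoc, h1, mul_assoc v _ (star v), ← h2, mul_assoc]
structure CUT (A : VN H) (e c f g : BB) : Prop where
  fA : f ∈ A
  gA : g ∈ A
  fp : Pj f
  f0 : f ≠ 0
  gs : star g = g
  fg : f * g = g
  gcg : g * c * g = f
  ef : e * f = f
  com : ∀ a ∈ A, e * a * e = a → a * g = g * a
  com' : ∀ a ∈ A, e * a * e = a → a * f = f * a
theorem th_cut (d : DD) (i : INT M₁ B A ξ e v) : ∃ f g, CUT A e (EA (v * star v)) f g := by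
  obtain ⟨c1, c2, c3, c4, c5⟩ := d.th_c i
  obtain ⟨f, g, h1, h2, h3, h4, h5, h6, h7, -⟩ := inv_cut c2 c3
  have k := fun a ha hc => comm_of_mem (y := a) (fun N hN => (h6 N hN).2) (c5 a ha hc) (c5 _ (vst ha) (cstar i.ep hc))
  exact ⟨f, g, (h6 A c1).1, (h6 A c1).2, h1, h2, h3, h4, h5, h7 e i.ep c4, k, fun a ha hc => comm_of_mem (fun N hN => (h6 N hN).1) (c5 a ha hc) (c5 _ (vst ha) (cstar i.ep hc))⟩
theorem corner_sub (i : INT M₁ B A ξ e v) (q : CUT A e (EA (v * star v)) f g) (h : f * a * f = a) : e * a * e = a := by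
  obtain ⟨h1, h2⟩ := (corner_iff q.fp).1 h
  exact (corner_iff i.ep).2 ⟨by rw [← h1, ← mul_assoc, q.ef], by rw [← h2, mul_assoc, proj_swap q.fp i.ep q.ef]⟩
theorem G_facts (d : DD) (i : INT M₁ B A ξ e v) (q : CUT A e (EA (v * star v)) f g) (hb : b ∈ B) :
    g * EA (v * b * star v) * g ∈ A ∧ f * (g * EA (v * b * star v) * g) * f = g * EA (v * b * star v) * g := by
  refine ⟨mul_mem (mul_mem q.gA (d.ceA.maps_to _ (d.ev_mem i b hb))) q.gA, (corner_iff q.fp).2 ⟨by rw [← mul_assoc, ← mul_assoc, q.fg], ?_⟩⟩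
  have : g * f = g := by have := congrArg star q.fg; rwa [star_mul, q.gs, star_proj q.fp] at this
  rw [mul_assoc _ g f, this]
theorem th_sv (d : DD) (i : INT M₁ B A ξ e v) (ha : a ∈ A) (hc : e * a * e = a) : E (star v * a * v) * star v = star v * a := by
  have h2 := congrArg star (d.th1 i (vst ha) (cstar i.ep hc)).2.2
  rw [star_mul, star_mul, (d.th_lin i).2.2.2.1 a ha, star_star, star_star] at h2
  exact h2.symm
theorem th_bi (d : DD) (i : INT M₁ B A ξ e v) (q : CUT A e (EA (v * star v)) f g) {a' : BB} (ha : a ∈ A) (hc : f * a * f = a) (ha' : a' ∈ A) (hc' : f * a' * f = a') (hb : b ∈ B) :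
    g * EA (v * (E (star v * a * v) * b * E (star v * a' * v)) * star v) * g = a * (g * EA (v * b * star v) * g) * a' := by
  have e1 := corner_sub i q hc
  have e2 := corner_sub i q hc'
  have : v * (E (star v * a * v) * b * E (star v * a' * v)) * star v = a * (v * b * star v) * a' := by
    rw [mul_assoc v, mul_assoc _ (E (star v * a' * v)), d.th_sv i ha' e2, ← mul_assoc v, ← mul_assoc v, ← (d.th1 i ha e1).2.2]; simp only [mul_assoc]
  rw [this, d.ceA.bimod a ha a' ha' _ (d.ev_mem i b hb)]
  calc _ = (g * a) * EA (v * b * star v) * (a' * g) := by simp only [mul_assoc]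
    _ = _ := by rw [← q.com a ha e1, q.com a' ha' e2]; simp only [mul_assoc]
theorem th_faith (d : DD) (i : INT M₁ B A ξ e v) (q : CUT A e (EA (v * star v)) f g) (hb : b ∈ B) (h0 : 0 ≤ b)
    (hc : E (star v * f * v) * b = b) (h : E (star v * (g * EA (v * b * star v) * g) * v) = 0) : b = 0 := by
  obtain ⟨g1, g2⟩ := d.G_facts i q hb
  have ef := corner_sub i q ((corner_iff q.fp).2 ⟨proj_mul q.fp, proj_mul q.fp⟩)
  have ym := d.ev_mem i b hb
  have yA := d.ceA.maps_to _ ym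
  have fy : f * (v * b * star v) = v * b * star v := by
    rw [← mul_assoc, ← mul_assoc, (d.th1 i q.fA ef).2.2, mul_assoc v, hc]
  have hy : f * EA (v * b * star v) = EA (v * b * star v) := by rw [← d.ceA.left q.fA ym, fy]
  have ys : star (EA (v * b * star v)) = EA (v * b * star v) := (sa_of_nonneg (d.ceA.pos _ ym (star_right_conjugate_nonneg h0 v))).star_eq
  have yf : EA (v * b * star v) * f = EA (v * b * star v) := by
    have := congrArg star hy; rwa [star_mul, ys, star_proj q.fp] at this
  have ey := corner_sub i q ((corner_iff q.fp).2 ⟨hy, yf⟩)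
  have vv := mul_mem i.vM (vst i.vM)
  have Gv : g * EA (v * b * star v) * g * v = 0 := by rw [(d.th1 i g1 (corner_sub i q g2)).2.2, h, mul_zero]
  have Gc : g * EA (v * b * star v) * g * EA (v * star v) = 0 := by rw [← d.ceA.left g1 vv, ← mul_assoc, Gv, zero_mul, d.ceA.zero]
  have gy := q.com _ yA ey
  have cc := (d.th_c i).2.2.2.2 _ yA ey
  have y0 : EA (v * b * star v) = 0 := by
    have eg : e * g * e = g := corner_sub i q ((corner_iff q.fp).2 ⟨q.fg, by have := congrArg star q.fg; rwa [star_mul, q.gs, star_proj q.fp] at this⟩)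
    have gc := (d.th_c i).2.2.2.2 g q.gA eg
    rw [← hy, ← q.gcg, ← Gc]
    calc g * EA (v * star v) * g * EA (v * b * star v) = EA (v * star v) * g * (EA (v * b * star v) * g) := by rw [gc, gy]; simp only [mul_assoc]
      _ = EA (v * star v) * (g * EA (v * b * star v) * g) := by simp only [mul_assoc]
      _ = _ := (d.th_c i).2.2.2.2 _ g1 (corner_sub i q g2) |>.symm
  have z0 := d.fA _ ym (star_right_conjugate_nonneg h0 v) y0
  obtain ⟨s1, s2, -⟩ := sqrt_facts h0
  have vs : v * CFC.sqrt b = 0 := (CStarRing.mul_star_self_eq_zero_iff _).1 (by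
    rw [star_mul, s1.star_eq, ← z0]; nth_rw 3 [← s2]; simp only [mul_assoc])
  have vb : v * b = 0 := by rw [← s2, ← mul_assoc, vs, zero_mul]
  have := d.ceE.right hb ((d.th_lin i).1 f q.fA)
  rw [mul_assoc, vb, mul_zero, d.ceE.zero] at this
  rw [← hc, ← this]
theorem th_we (d : DD) (i : INT M₁ B A ξ e v) (q : CUT A e (EA (v * star v)) f g) :
    WithExpectation (Corner (E (star v * f * v)) (B : SB)) ((fun a => E (star v * a * v)) '' Corner f (A : SB)) := by
  obtain ⟨l1, l2, l3, l4, l5⟩ := d.th_lin i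
  have ef := corner_sub i q ((corner_iff q.fp).2 ⟨proj_mul q.fp, proj_mul q.fp⟩)
  have fp : Pj (E (star v * f * v)) := ⟨by rw [IsIdempotentElem, ← d.thmul i q.fA ef q.fA ef, proj_mul q.fp], by rw [IsSelfAdjoint, ← l4 f q.fA, star_proj q.fp]⟩
  have em := d.ev_mem i
  have yA : ∀ b ∈ B, EA (v * b * star v) ∈ A := fun b hb => d.ceA.maps_to _ (em b hb)
  have mA : ∀ x ∈ M₁, ∀ y ∈ M₁, x ≤ y → EA x ≤ EA y := fun x hx y hy => d.ceA.mono (fun x hx y hy => vsb hx hy) hx hy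
  refine ⟨fun b => E (star v * (g * EA (v * b * star v) * g) * v), ⟨?_, ?_, ?_, ?_, ?_, ?_, ?_⟩, ?_, ?_⟩
  · rintro _ ⟨a, ⟨ha, hc⟩, rfl⟩
    have hc' := corner_sub i q hc
    obtain ⟨h1, h2⟩ := (corner_iff q.fp).1 hc
    refine ⟨(d.th1 i ha hc').1, (corner_iff fp).2 ⟨?_, ?_⟩⟩
    · rw [← d.thmul i q.fA ef ha hc', h1]
    · rw [← d.thmul i ha hc' q.fA ef, h2]
  · rintro x ⟨hx, -⟩ y ⟨hy, -⟩
    show E _ = E _ + E _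
    rw [← l2 _ (d.G_facts i q hx).1 _ (d.G_facts i q hy).1, mul_add, add_mul, d.ceA.map_add _ (em x hx) _ (em y hy), mul_add g, add_mul _ _ g]
  · rintro c x ⟨hx, -⟩
    show E _ = c • E _
    rw [← l3 c _ (d.G_facts i q hx).1, mul_smul_comm, smul_mul_assoc, d.ceA.map_smul _ _ (em x hx), mul_smul_comm c g, smul_mul_assoc c _ g]
  · rintro x ⟨hx, -⟩
    exact ⟨_, d.G_facts i q hx, rfl⟩
  · rintro _ ⟨a, ⟨ha, hc⟩, rfl⟩
    have h := d.th_bi i q ha hc q.fA ((corner_iff q.fp).2 ⟨proj_mul q.fp, proj_mul q.fp⟩) (one_mem B)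
    rw [mul_one, mul_one, q.gcg, ← d.thmul i ha (corner_sub i q hc) q.fA ef, ((corner_iff q.fp).1 hc).2, ((corner_iff q.fp).1 hc).2] at h
    show E (star v * (g * EA (v * E (star v * a * v) * star v) * g) * v) = _
    rw [h]
  · rintro x ⟨hx, -⟩ h0
    refine l5 _ (d.G_facts i q hx).1 ?_
    have := star_left_conjugate_nonneg (d.ceA.pos _ (em x hx) (star_right_conjugate_nonneg h0 v)) g
    rwa [q.gs] at this
  · rintro _ ⟨a, ⟨ha, hc⟩, rfl⟩ _ ⟨a', ⟨ha', hc'⟩, rfl⟩ x ⟨hx, -⟩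
    show E _ = E _ * E _ * E _
    have k1 := corner_sub i q hc
    have k2 := corner_sub i q hc'
    obtain ⟨g1, g2⟩ := d.G_facts i q hx
    have g3 := corner_sub i q g2
    rw [d.th_bi i q ha hc ha' hc' hx, d.thmul i (mul_mem ha g1) ((corner_iff i.ep).2 ⟨?_, ?_⟩) ha' k2, d.thmul i ha k1 g1 g3]
    · rw [← mul_assoc, ((corner_iff i.ep).1 k1).1]
    · rw [mul_assoc, ((corner_iff i.ep).1 g3).2]
  · rintro x ⟨hx, hc⟩ h0 h
    exact d.th_faith i q hx h0 ((corner_iff fp).1 hc).1 h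
  · intro S hS hne hd x hx hl
    have hS' : S ⊆ B := fun y hy => (hS hy).1
    obtain ⟨a1, a2⟩ := conj_lub hne hd hl (star v)
    simp only [star_star] at a1 a2
    have b0 : (fun s => v * s * star v) '' S ⊆ (M₁ : SB) := by rintro _ ⟨y, hy, rfl⟩; exact em y (hS' hy)
    have b2 := d.nA _ b0 (hne.image _) a1 _ (em x hx.1) a2
    have b1 := mono_dir b0 a1 mA
    obtain ⟨c1, c2⟩ := conj_lub ((hne.image _).image _) b1 b2 g
    rw [q.gs] at c1 c2
    have := d.th_norm i (S := (fun s => g * s * g) '' (EA '' ((fun s => v * s * star v) '' S))) (by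
      rintro _ ⟨_, ⟨_, ⟨y, hy, rfl⟩, rfl⟩, rfl⟩; exact (d.G_facts i q (hS' hy)).1) (((hne.image _).image _).image _) c1 (d.G_facts i q hx.1).1 c2
    rwa [Set.image_image, Set.image_image, Set.image_image] at this
theorem embed (d : DD) (i : INT M₁ B A ξ e v) : EmbedsWE (M₁ : SB) (A : SB) (B : SB) := by
  obtain ⟨f, g, q⟩ := d.th_cut i
  obtain ⟨l1, l2, l3, l4, l5⟩ := d.th_lin i
  have ff := (corner_iff q.fp).2 ⟨proj_mul q.fp, proj_mul q.fp⟩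
  have ef := corner_sub i q ff
  have W := d.th_we i q
  have fp : Pj (E (star v * f * v)) := ⟨by rw [IsIdempotentElem, ← d.thmul i q.fA ef q.fA ef, proj_mul q.fp], by rw [IsSelfAdjoint, ← l4 f q.fA, star_proj q.fp]⟩
  have fv := (d.th1 i q.fA ef).2.2
  obtain ⟨u, uM, uu, un, ul, ur, ui⟩ := polar_inter (mul_mem (d.leA q.fA) i.vM)
  have fv0 : f * v ≠ 0 := fun h => q.f0 (by
    have vv := mul_mem i.vM (vst i.vM)
    have : f * EA (v * star v) = 0 := by rw [← d.ceA.left q.fA vv, ← mul_assoc, h, zero_mul, d.ceA.zero]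
    have gf : g * f = g := by have := congrArg star q.fg; rwa [star_mul, q.gs, star_proj q.fp] at this
    rw [← q.gcg, ← gf, mul_assoc g, this, mul_zero, zero_mul])
  have tw : ∀ a ∈ A, f * a * f = a → a * (f * v) = f * v * E (star v * a * v) := fun a ha hc => by
    obtain ⟨h1, h2⟩ := (corner_iff q.fp).1 hc
    rw [← mul_assoc, h2, mul_assoc, ← (d.th1 i ha (corner_sub i q hc)).2.2, ← mul_assoc, h1]
  refine ⟨f, E (star v * f * v), u, fun a => E (star v * a * v), q.fA, ⟨q.fp.2, q.fp.1⟩, (d.th1 i q.fA ef).1, ⟨fp.2, fp.1⟩, uM, un fv0, uu, ?_, ?_, ?_, ?_, ?_, ?_, ?_, rfl, ?_, W, ?_⟩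
  · have := ul (1 - f) (by rw [← mul_assoc, sub_mul, one_mul, proj_mul q.fp, sub_self, zero_mul])
    rw [sub_mul, one_mul, sub_eq_zero] at this; exact this.symm
  · have := ur (1 - E (star v * f * v)) (by rw [mul_sub, mul_one, ← tw f q.fA ff, ← mul_assoc, proj_mul q.fp, sub_self])
    rw [mul_sub, mul_one, sub_eq_zero] at this; exact this.symm
  · intro x hx
    obtain ⟨Φ, hΦ, -⟩ := W
    exact hΦ.subset ⟨x, hx, rfl⟩
  · exact fun x hx y hy => l2 x hx.1 y hy.1
  · exact fun c x hx => l3 c x hx.1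
  · exact fun x hx y hy => d.thmul i hx.1 (corner_sub i q hx.2) hy.1 (corner_sub i q hy.2)
  · exact fun x hx => l4 x hx.1
  · exact fun S hS hne hd x hx hl => d.th_norm i (fun y hy => (hS hy).1) hne hd hx.1 hl
  · intro a ha
    refine ui a _ (tw a ha.1 ha.2) ?_
    have := tw (star a) (vst ha.1) (cstar q.fp ha.2)
    rwa [l4 a ha.1] at this
end Dat
structure PD {M : VN H} (sf : StandardForm M) (B A : VN H) (T p : BB) : Prop where
  pp : Pj p
  p0 : p ≠ 0
  pB : p ∈ B.commutant
  pA : ∀ a ∈ A, sf.c a * p = p * sf.c a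
  Q : ∃ Q ∈ B.commutant, p = T * Q
namespace Dat
theorem exPD (d : DD) (t : TD) (hz : z ∈ B) (hz' : z ∈ B.commutant) (zp : Pj z) (h : T * z ≠ 0) : ∃ p, PD sf B A T p ∧ p * z = p := by
  have zT : z * T = T * z := comm_iff.1 t.TB z hz
  have c0 : 0 ≤ T * z := by
    have := star_left_conjugate_nonneg t.nn z
    rwa [star_proj zp, zT, mul_assoc, proj_mul zp] at this
  obtain ⟨f, g, h1, h2, h3, h4, h5, h6, h7, -⟩ := inv_cut c0 h
  obtain ⟨k1, k2⟩ := h6 B.commutant (mul_mem t.TB hz')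
  have gc : T * z * g = g * (T * z) := comm_of_mem (fun N hN => (h6 N hN).2) rfl (by rw [(sa_of_nonneg c0).star_eq])
  have zf : z * f = f := h7 z zp (by rw [← mul_assoc, zT, mul_assoc, proj_mul zp])
  refine ⟨f, ⟨h1, h2, k1, fun a ha => comm_of_mem (fun N hN => (h6 N hN).1) ?_ ?_, z * g * g, mul_mem (mul_mem hz' k2) k2, by rw [← h5, ← gc]; simp only [mul_assoc]⟩, by rw [← comm_iff.1 k1 z hz, zf]⟩
  · rw [← mul_assoc, t.TA a ha, mul_assoc, mul_assoc, sf.c_comm (d.BM hz) (d.leM (d.leA ha))]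
  · have ha' := vst ha
    rw [← sf.c_star, ← mul_assoc, t.TA _ ha', mul_assoc, mul_assoc, sf.c_comm (d.BM hz) (d.leM (d.leA ha'))]
theorem pN (d : DD) (q : PD sf B A T p) : sf.c p ∈ 𝒩 ∧ ∀ a ∈ A, a * sf.c p = sf.c p * a := by
  refine ⟨sf.cv_comm.2 fun y hy => by rw [← sf.c_mul, ← sf.c_mul, comm_iff.1 q.pB y hy], fun a ha => ?_⟩
  have := congrArg sf.c (q.pA a ha); rwa [sf.c_mul, sf.c_mul, sf.c_c] at this
theorem FP (d : DD) (t : TD) (hx : x ∈ M₁) : (⟪ξ, Ψ (star x * P * x) ξ⟫) = ⟪x η, T (x η)⟫ := (t.eq x hx x hx).symm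
theorem cone_ne (d : DD) (t : TD) (q : PD sf B A T p) (hv : v ∈ M₁) (v0 : v ≠ 0) (h : sf.c p * (v * eB) = v * eB) : ⟪ξ, Ψ (v * P * star v) ξ⟫ ≠ 0 := by
  intro hF
  have hv' : star v ∈ M₁ := vst hv
  have h1 := d.FP t hv'
  rw [star_star, hF] at h1
  have h2 := op_zero_of t.nn h1.symm
  obtain ⟨Q, hQ, pQ⟩ := q.Q
  have h3 : p (star v η) = 0 := by
    have := congrArg star pQ
    rw [star_mul, star_proj q.pp, (sa_of_nonneg t.nn).star_eq] at this
    rw [this, mapp, h2, map_zero]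
  have h4 : eB (star v (sf.c (star v) η)) = 0 := by
    have := congrArg star h
    rw [star_mul, star_mul, star_proj (sf.c_proj q.pp), star_proj (pr_proj _)] at this
    rw [← mapp eB, ← this, mapp, ← mapp (sf.c p), ← sf.c_mul, ← sf.J_cone_app d.gη.cone, mapp p (star v), h3, map_zero, map_zero]
  have h5 := sf.cone_inv (d.leM hv') d.gη.cone
  have h6 : ⟪ξ, star v (sf.c (star v) η)⟫ = 0 := by rw [← eξ (B := B) (ξ := ξ), sa_inner (pr_proj _).isSelfAdjoint, h4, inner_zero_right]
  have h7 := sf.cone_orth_pr d.g.cone h5 h6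
  rw [StandardForm.dense_comm d.g.sep, Aone] at h7
  have h8 := sf.zero_of_xJxJ (d.leM hv') d.gη.cone (by
    rw [star_star, sf.c_mul, mapp, ← mapp (star v), sf.c_comm (d.leM hv') (d.leM hv), mapp, h7, map_zero, map_zero])
  have h9 := d.gη.sep _ (d.leM hv') h8
  exact v0 (star_eq_zero.1 h9)
theorem Tb1 (d : DD) (t : TD) (hm : m ∈ M₁) (hg : g ∈ B) (gs : star g = g) (gg : g * g = E (star m * m)) (hy : y ∈ M₁) (ζ : H) :
    ‖⟪y η, m (T ζ)⟫‖ ^ 2 ≤ ‖y η‖ ^ 2 * (⟪g ζ, T (g ζ)⟫).re := by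
  have e1 := t.e1'
  have ge : g * pr (orb M₁ η) = pr (orb M₁ η) * g := comm_iff.1 (pr_orb_mem M₁ η) g (d.le hg)
  suffices h : ∀ ζ ∈ (orb M₁ η).topologicalClosure, ‖⟪y η, m (T ζ)⟫‖ ^ 2 ≤ ‖y η‖ ^ 2 * (⟪g ζ, T (g ζ)⟫).re by
    have := h _ (pr_mem (orb M₁ η) ζ)
    have sp := (pr_proj (orb M₁ η)).isSelfAdjoint
    rwa [← mapp T, e1, ← mapp g, ge, mapp, ← mapp T, e1, sa_inner sp, ← mapp (pr (orb M₁ η)) T, t.e1] at this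
  intro ζ hζ
  refine closure_minimal (s := (orb M₁ η : Set H)) (t := {ζ | ‖⟪y η, m (T ζ)⟫‖ ^ 2 ≤ ‖y η‖ ^ 2 * (⟪g ζ, T (g ζ)⟫).re}) ?_ ?_ hζ
  · intro z hz
    obtain ⟨x, hx, rfl⟩ := mem_orb.1 hz
    show ‖⟪y η, m (T (x η))⟫‖ ^ 2 ≤ ‖y η‖ ^ 2 * (⟪g (x η), T (g (x η))⟫).re
    have sm := vst hm
    have k1 := t.eq (star m * y) (mul_mem sm hy) x hx
    rw [mapp, star_inner, star_mul, star_star] at k1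
    have k2 := t.eq (g * x) (mul_mem (d.le hg) hx) (g * x) (mul_mem (d.le hg) hx)
    have C := fun {x : BB} (hx : x ∈ M₁) => d.MC (d.leM hx)
    have k3 := d.cs (C hy) (mul_mem (mul_mem (C hm) d.PC) (C hx))
    have k4 : star (m * P * x) * (m * P * x) = star (g * x) * P * (g * x) := by
      rw [star_mul, star_mul, star_mul, gs, star_proj d.Pp]
      have a := d.PE _ (mul_mem sm hm)
      have b : P * g = g * P := (comm_iff.1 d.PB g hg).symm
      calc star x * (P * star m) * (m * P * x) = star x * (P * (star m * m) * P) * x := by simp only [mul_assoc]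
        _ = star x * (g * (g * P)) * x := by rw [a, ← gg]; simp only [mul_assoc]
        _ = _ := by rw [← b]; simp only [mul_assoc]
    have k5 : (⟪ξ, Ψ (star y * y) ξ⟫).re = ‖y η‖ ^ 2 := by
      rw [← d.hη _ (mul_mem (vst hy) hy), normsq_inner, Complex.ofReal_re]
    rw [k4, k5, ← k2, ← mul_assoc, ← mul_assoc, ← k1, mapp] at k3
    exact k3
  · exact isClosed_le (by fun_prop) (by fun_prop)
theorem Tb2 (d : DD) (t : TD) (q : PD sf B A T p) (hZ : Z ∈ 𝒩) (hp : sf.c p * Z = Z) : ∃ C : ℝ, 0 ≤ C ∧ ∀ m ∈ M₁, ‖m (sf.c Z ξ)‖ ≤ C * ‖m ξ‖ := by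
  obtain ⟨Q, hQ, pQ⟩ := q.Q
  have pZ : sf.c Z = T * Q * sf.c Z := by have := congrArg sf.c hp; rw [sf.c_mul, sf.c_c, pQ] at this; exact this.symm
  have T1 := t.le1
  refine ⟨‖Q‖ * ‖Z‖, by positivity, fun m hm => ?_⟩
  have mm := mul_mem (vst hm) hm
  have hE : E (star m * m) ∈ B := d.ceE.maps_to _ (d.leM mm)
  obtain ⟨s1, s2, -⟩ := sqrt_facts (d.ceE.pos _ (d.leM mm) (star_mul_self_nonneg m))
  have s3 := sqrt_mem hE
  generalize CFC.sqrt (E (star m * m)) = g at *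
  have k2 : ‖g ξ‖ ^ 2 = ‖m ξ‖ ^ 2 := by
    have a := normsq_inner m ξ
    have b := normsq_inner g ξ
    rw [s1.star_eq, s2, d.g.inv _ (d.leM mm), a] at b; exact_mod_cast b.symm
  have k3 : g (Q (sf.c Z ξ)) = Q (sf.c Z (g ξ)) := by
    rw [← mapp g Q, comm_iff.1 hQ g s3, mapp, ← mapp g, ← d.cN hZ s3, mapp]
  have k4 : ‖g (Q (sf.c Z ξ))‖ ≤ ‖Q‖ * ‖Z‖ * ‖m ξ‖ := by
    rw [k3, ← (pow_left_inj₀ (norm_nonneg _) (norm_nonneg _) two_ne_zero).1 k2, mul_assoc]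
    refine (Q.le_opNorm _).trans ?_
    gcongr
    exact ((sf.c Z).le_opNorm _).trans (by gcongr; exact sf.c_norm Z)
  refine norm_le_closure (K := orb M₁ η) ?_ (by positivity) fun w hw => ?_
  · have : pr (orb M₁ η) (m (sf.c Z ξ)) = m (sf.c Z ξ) := by
      rw [← mapp _ m, ← comm_iff.1 (pr_orb_mem M₁ η) m hm, mapp, pZ, ← mapp _ (T * Q * _), ← mul_assoc, ← mul_assoc, t.e1]
    exact this ▸ pr_mem _ _
  · obtain ⟨y, hy, rfl⟩ := mem_orb.1 hw
    have k5 := d.Tb1 t hm s3 s1.star_eq s2 hy (Q (sf.c Z ξ))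
    have k6 : (⟪g (Q (sf.c Z ξ)), T (g (Q (sf.c Z ξ)))⟫).re ≤ (‖Q‖ * ‖Z‖ * ‖m ξ‖) ^ 2 := by
      refine (Complex.re_le_norm _).trans ((norm_inner_le_norm _ _).trans ?_)
      rw [sq]
      refine mul_le_mul k4 (((T.le_opNorm _).trans ?_)) (norm_nonneg _) (by positivity)
      exact (mul_le_of_le_one_left (norm_nonneg _) T1).trans k4
    have k7 : m (sf.c Z ξ) = m (T (Q (sf.c Z ξ))) := by conv_lhs => rw [pZ, mapp, mapp]
    rw [k7, norm_inner_symm]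
    refine le_of_sq_le_sq ?_ (by positivity)
    calc _ ≤ _ := k5
      _ ≤ ‖y η‖ ^ 2 * (‖Q‖ * ‖Z‖ * ‖m ξ‖) ^ 2 := by gcongr
      _ = _ := by ring
theorem Tb (d : DD) (t : TD) (q : PD sf B A T p) (hZ : Z ∈ 𝒩) (hp : sf.c p * Z = Z) (he : Z * eB = Z) : ∃ v ∈ M₁, Z = v * eB := by
  obtain ⟨C, C0, hC⟩ := d.Tb2 t q hZ hp
  obtain ⟨Q, hQ, pQ⟩ := q.Q
  obtain ⟨eη, ec1⟩ := d.e1η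
  have e1Z : pr (orb M₁ ξ) (sf.c Z ξ) = sf.c Z ξ := by
    have : sf.c Z = T * Q * sf.c Z := by have := congrArg sf.c hp; rw [sf.c_mul, sf.c_c, pQ] at this; exact this.symm
    rw [this, ← mapp, ← mul_assoc, ← mul_assoc, ← eη, t.e1]
  obtain ⟨x, xM, x1, -⟩ := lemX (N := M) (ξ := ξ) (κ := sf.c Z ξ) C0 fun m hm => by
    have mm := mul_mem (vst hm) hm
    have hE : E1 (star m * m) ∈ M₁ := d.ce1.maps_to _ mm
    obtain ⟨s1, s2, -⟩ := sqrt_facts (d.ce1.pos _ mm (star_mul_self_nonneg m))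
    have s3 := sqrt_mem hE
    have k0 := hC _ s3
    generalize CFC.sqrt (E1 (star m * m)) = h at *
    generalize sf.c Z ξ = κ at *
    have k1 : ‖m κ‖ ^ 2 = ‖h κ‖ ^ 2 := by
      have a := normsq_inner m κ
      have b := normsq_inner h κ
      rw [s1.star_eq, s2] at b
      have : ⟪κ, (star m * m) κ⟫ = ⟪κ, E1 (star m * m) κ⟫ := by
        have := DFunLike.congr_fun (d.ce1.e_e d.i1 mm) κ
        rw [mapp, mapp, mapp (E1 _), e1Z] at this
        rw [← this, ← sa_inner (pr_proj (orb M₁ ξ)).isSelfAdjoint, e1Z]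
      rw [a, b] at this; exact_mod_cast this
    have k2 : ‖h ξ‖ ^ 2 = ‖m ξ‖ ^ 2 := by
      have a := normsq_inner m ξ
      have b := normsq_inner h ξ
      rw [s1.star_eq, s2, d.i1 _ mm, a] at b; exact_mod_cast b.symm
    rw [(pow_left_inj₀ (norm_nonneg _) (norm_nonneg _) two_ne_zero).1 k1, ← (pow_left_inj₀ (norm_nonneg _) (norm_nonneg _) two_ne_zero).1 k2]
    exact k0
  have vM := sf.c_mem' xM
  have vξ : sf.c x ξ = Z ξ := by rw [d.Jξ, x1, d.Jξ]; have h := sf.J.symm_apply_apply (Z ξ); rwa [sf.Jsymm] at h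
  have vE : sf.c x = E1 (sf.c x) := d.sepB vM (d.leM (d.ce1.maps_to _ vM)) (by
    rw [← d.ce1.e_app d.i1 vM, vξ]
    have := congrArg sf.J e1Z
    have h := sf.J.symm_apply_apply (Z ξ); rw [sf.Jsymm] at h
    rw [d.Jξ, ← sf.c_apply, ec1, h] at this; exact this.symm)
  have vM1 : sf.c x ∈ M₁ := by have h := d.ce1.maps_to _ vM; rwa [← vE] at h
  exact ⟨sf.c x, vM1, by rw [← he]; exact d.ext hZ (d.MN vM) vξ.symm⟩
end Dat
theorem csup (hg : g ∈ N) : ∃ z, Pj z ∧ z ∈ N ∧ z ∈ N.commutant ∧ z * g = g ∧ ∀ T : BB, (∀ y ∈ N, T * y * g = 0) → T * z = 0 := by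
  refine ⟨pr (Submodule.span ℂ (orbG N (Set.range g))), pr_proj _, pr_span_mem ?_, ?_, ?_, fun T hT => ?_⟩
  · rintro y hy _ ⟨_, ⟨ζ, rfl⟩, x, hx, rfl⟩
    exact Submodule.subset_span ⟨g (y ζ), ⟨_, rfl⟩, x, hx, by rw [← comm_app hy hg, ← comm_app hy hx]⟩
  · have := pr_orbG_mem N.commutant (Set.range g)
    rwa [VonNeumannAlgebra.commutant_commutant] at this
  · ext ζ; rw [mapp]; exact pr_orbG_self ⟨ζ, rfl⟩
  · have : T * _ = 0 * _ := mul_pr_span (G := orbG N (Set.range g)) (S := T) (T := 0) (by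
      rintro _ ⟨_, ⟨ζ, rfl⟩, x, hx, rfl⟩
      have := DFunLike.congr_fun (hT x hx) ζ
      simpa [mapp] using this)
    rw [this, zero_mul]
theorem pi_of (h : star V * V * (star V * V) = star V * V) : V * star V * V = V := by
  have : star (V * star V * V - V) * (V * star V * V - V) = 0 := by
    have e : ∀ a b : BB, a = star V * V → star (V * a - V) * (V * a - V) = star a * a * a - star a * a - a * a + a := by
      rintro a - rfl
      simp only [star_sub, star_mul, star_star, mul_sub, sub_mul, mul_assoc]; abel
    rw [mul_assoc, e _ 0 rfl, star_mul, star_star, h, h]; abel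
  exact sub_eq_zero.1 (CStarRing.star_mul_self_eq_zero_iff _ |>.1 this)
theorem max_left (hq : Pj q) (qN : q ∈ N) (gN : g ∈ N) (hg : Pj g) : ∃ S : SB,
    (∀ w ∈ S, w ∈ N ∧ w * star w * w = w ∧ q * w = w ∧ w * g = w ∧ w ≠ 0) ∧ (∀ i j : S, i ≠ j → star i.1 * j.1 = 0) ∧
    (∀ i j : S, i ≠ j → i.1 * star i.1 * (j.1 * star j.1) = 0) ∧ osum (fun i : S => i.1 * star i.1) ∈ N ∧ q * osum (fun i : S => i.1 * star i.1) = osum (fun i : S => i.1 * star i.1) ∧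
    ∀ y ∈ N, (q - osum (fun i : S => i.1 * star i.1)) * y * g = 0 := by
  obtain ⟨S, h1, h2, h3⟩ := zorn_family (fun w : BB => w ∈ N ∧ w * star w * w = w ∧ q * w = w ∧ w * g = w ∧ w ≠ 0) (fun a b => star a * b = 0)
  have o2 : ∀ i j : S, i ≠ j → star i.1 * j.1 = 0 := fun i j hij => h2 i.2 j.2 (fun h => hij (Subtype.ext h))
  have pp : ∀ i : S, Pj (i.1 * star i.1) := fun i => pi_r (h1 _ i.2).2.1
  have QN : osum (fun i : S => i.1 * star i.1) ∈ N := osum_mem fun i => mul_mem (h1 _ i.2).1 (vst (h1 _ i.2).1)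
  have qQ : q * osum (fun i : S => i.1 * star i.1) = osum (fun i : S => i.1 * star i.1) := osum_le pp fun i => by rw [← mul_assoc, (h1 _ i.2).2.2.1]
  have Qw : ∀ w ∈ S, osum (fun i : S => i.1 * star i.1) * w = w := fun w hw => by
    have := congrArg (· * w) (osum_mul pp ⟨w, hw⟩)
    simpa only [mul_assoc, ← mul_assoc w, (h1 w hw).2.1] using this
  have Qp : Pj (osum (fun i : S => i.1 * star i.1)) := osum_proj
  refine ⟨S, h1, o2, fun i j hij => by rw [mul_assoc, ← mul_assoc (star i.1), o2 i j hij]; simp, QN, qQ, fun y hy => ?_⟩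
  generalize osum (fun i : S => i.1 * star i.1) = Q at *
  by_contra hne
  obtain ⟨u, uN, u1, u2, u3, u4, -⟩ := polar_inter (mul_mem (mul_mem (vsb qN QN) hy) gN)
  have Qu : Q * u = 0 := u3 _ (by rw [← mul_assoc, ← mul_assoc, mul_sub, proj_swap Qp hq qQ, proj_mul Qp, sub_self, zero_mul, zero_mul])
  have qu : q * u = u := by
    have := u3 (1 - q) (by rw [← mul_assoc, ← mul_assoc, sub_mul, one_mul, mul_sub, proj_mul hq, qQ, sub_self, zero_mul, zero_mul])
    rwa [sub_mul, one_mul, sub_eq_zero, eq_comm] at this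
  have ug : u * g = u := by
    have := u4 (1 - g) (by rw [mul_assoc, mul_sub, proj_mul hg, mul_one, sub_self, mul_zero])
    rwa [mul_sub, mul_one, sub_eq_zero, eq_comm] at this
  have wu : ∀ w ∈ S, star w * u = 0 := fun w hw => by rw [← Qw w hw, star_mul, star_proj Qp, mul_assoc, Qu, mul_zero]
  have := h3 u ⟨uN, u1, qu, ug, u2 hne⟩ fun b hb => ⟨by rw [← star_eq_zero, star_mul, star_star, wu b hb], wu b hb⟩
  exact u2 hne (by rw [← Qw u this, Qu])
namespace Dat
theorem mkINT (d : DD) (t : TD) (q : PD sf B A T p) (hV : V ∈ 𝒩) (pi : V * star V * V = V) (V0 : V ≠ 0) (pV : sf.c p * V = V) (Ve : V * eB = V)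
    (eA : e ∈ A) (ep : Pj e) (eV : e * V = V) (com : ∀ a ∈ A, e * a * e = a → a * (V * star V) = V * star V * a) : ∃ e v, INT M₁ B A ξ e v := by
  obtain ⟨v, hv, rfl⟩ := d.Tb t q hV pV Ve
  have h : v * eB * star (v * eB) = v * eB * star v := by
    rw [star_mul, star_proj (pr_proj _), mul_assoc, ← mul_assoc eB, proj_mul (pr_proj _), mul_assoc]
  rw [h] at pi com
  exact ⟨e, v, eA, ep, hv, fun h => V0 (by rw [h, zero_mul]), pi, d.sepe (d.leM (mul_mem (d.leA eA) hv)) (d.leM hv) (by rw [mul_assoc, eV]), com⟩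
theorem nv (d : DD) (q : PD sf B A T p) (hg : g ∈ B) (zp : Pj z) (zB : z ∈ B) (zB' : z ∈ B.commutant) (pz : p * z = p)
    (hz : ∀ T : BB, (∀ y ∈ B, T * y * g = 0) → T * z = 0) : ∃ x ∈ 𝒩, sf.c p * x * (g * eB) ≠ 0 := by
  by_contra! hc
  refine q.p0 (sf.c_inj ?_)
  have : ∀ x ∈ M, sf.c p * x * eB = 0 := fun x hx => by
    have h1 := hz (sf.c p * x * eB) fun y hy => by
      rw [mul_assoc, mul_assoc, mul_assoc, ← mul_assoc eB y, ← d.eb hy, mul_assoc, ← d.eb hg, ← hc (x * y) (d.MN (mul_mem hx (d.BM hy)))]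
      simp only [mul_assoc]
    rw [mul_assoc, ← d.eb zB, ← d.cz zB zB' zp, mul_assoc, ← mul_assoc x, sf.c_comm hx (d.BM zB), ← mul_assoc, ← mul_assoc, ← sf.c_mul, pz] at h1
    rw [h1]
  have h2 : sf.c p * pr (orb M ξ) = 0 * pr (orb M ξ) := mul_pr_eq fun ζ hζ => by
    obtain ⟨x, hx, rfl⟩ := mem_orb.1 hζ
    have := DFunLike.congr_fun (this x hx) ξ
    rw [mapp, mapp, eξ] at this; exact this
  rw [sf.dense_cone d.g.cone d.g.sep, mul_one, zero_mul] at h2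
  rw [h2, sf.c_zero]
end Dat
theorem IsCondExp.fsum {D : VN H} {F : BB → BB} (h : CE N D F) {ι : Type*} (x : ι → BB) (hx : ∀ i, x i ∈ N) (s : Finset ι) : F (∑ i ∈ s, x i) = ∑ i ∈ s, F (x i) ∧ ∑ i ∈ s, x i ∈ N := by
  induction s using Finset.cons_induction with
  | empty => simp only [Finset.sum_empty]; exact ⟨h.zero, zero_mem N⟩
  | cons a s ha ih => rw [Finset.sum_cons, Finset.sum_cons, h.map_add _ (hx a) _ ih.2, ih.1]; exact ⟨rfl, add_mem (hx a) ih.2⟩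
namespace Dat
theorem eE (d : DD) (hv : v ∈ M₁) (hw : w ∈ M₁) : star (v * eB) * (w * eB) = E (star v * w) * eB ∧ P * (star v * w) * P = E (star v * w) * P ∧ E (star v * w) ∈ B := by
  have m := mul_mem (vst hv) hw
  refine ⟨?_, d.PE _ m, d.ceE.maps_to _ (d.leM m)⟩
  rw [← d.ceE.e_e d.g.inv (d.leM m), star_mul, star_proj (pr_proj _)]; simp only [mul_assoc]
theorem eE0 (d : DD) (hv : v ∈ M₁) (hw : w ∈ M₁) (h : star (v * eB) * (w * eB) = 0) : E (star v * w) = 0 := by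
  obtain ⟨h1, -, h3⟩ := d.eE hv hw
  exact d.sepe (d.BM h3) (zero_mem M) (by rw [← h1, h, zero_mul])
theorem vPv (d : DD) (hv : v ∈ M₁) (h : v * eB * star (v * eB) * (v * eB) = v * eB) : Pj (v * P * star v) := by
  obtain ⟨h1, h2, h3⟩ := d.eE hv hv
  have h5 : v * star (v * eB) = v * eB * star (v * eB) := by rw [star_mul, star_proj (pr_proj _), mul_assoc, ← mul_assoc eB, proj_mul (pr_proj _)]
  have vk : v * E (star v * v) = v := d.sepe (d.leM (mul_mem hv (d.le h3))) (d.leM hv) (by rw [mul_assoc, ← h1, ← mul_assoc, h5, h])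
  refine ⟨?_, by rw [IsSelfAdjoint]; simp only [star_mul, star_star, star_proj d.Pp, mul_assoc]⟩
  have : v * P * star v * (v * P * star v) = v * (P * (star v * v) * P) * star v := by simp only [mul_assoc]
  rw [IsIdempotentElem, this, h2, ← mul_assoc, vk]
theorem ctbl (d : DD) (t : TD) (q : PD sf B A T p) {S : SB} (h1 : ∀ w ∈ S, w ∈ 𝒩 ∧ w * star w * w = w ∧ sf.c p * w = w ∧ w * eB = w ∧ w ≠ 0)
    (h2 : ∀ i j : S, i ≠ j → star i.1 * j.1 = 0) : Countable S := by
  have : ∀ i : S, ∃ v ∈ M₁, i.1 = v * eB := fun i => by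
    obtain ⟨k1, k2, k3, k4, k5⟩ := h1 i.1 i.2
    exact d.Tb t q k1 k3 k4
  choose v vM hv using this
  have pp : ∀ i, Pj (v i * P * star (v i)) := fun i => d.vPv (vM i) (by rw [← hv i]; exact (h1 _ i.2).2.1)
  have C := fun {x : BB} (hx : x ∈ M₁) => d.MC (d.leM hx)
  have pC : ∀ i, v i * P * star (v i) ∈ (sf.cv M₁).commutant := fun i => mul_mem (mul_mem (C (vM i)) d.PC) (C (vst (vM i)))
  have oo : ∀ i j, i ≠ j → v i * P * star (v i) * (v j * P * star (v j)) = 0 := fun i j hij => by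
    have e : v i * P * star (v i) * (v j * P * star (v j)) = v i * (P * (star (v i) * v j) * P) * star (v j) := by simp only [mul_assoc]
    rw [e, (d.eE (vM i) (vM j)).2.1, d.eE0 (vM i) (vM j) (by rw [← hv i, ← hv j, h2 i j hij])]; simp
  have nn : ∀ i, 0 ≤ ⟪ξ, Ψ (v i * P * star (v i)) ξ⟫ := fun i => nonneg_iff.1 (d.ceΨ.pos _ (pC i) (proj_nonneg (pp i))) ξ
  have sm : Summable fun i => (⟪ξ, Ψ (v i * P * star (v i)) ξ⟫).re := by
    refine summable_of_sum_le (c := (⟪ξ, Ψ 1 ξ⟫).re) (fun i => (cL (nn i)).1) fun u => ?_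
    obtain ⟨f1, f2⟩ := d.ceΨ.fsum _ pC u
    have := d.mono f2 (one_mem _) ((psum_le pp oo u).trans (proj_le (osum_proj) ⟨one_mul _, IsSelfAdjoint.one _⟩ (one_mul _)))
    rwa [f1, ContinuousLinearMap.sum_apply, inner_sum, Complex.re_sum] at this
  have cs := sm.countable_support
  have : (Function.support fun i => (⟪ξ, Ψ (v i * P * star (v i)) ξ⟫).re) = Set.univ := by
    refine Set.eq_univ_of_forall fun i h0 => d.cone_ne t q (vM i) ?_ ?_ ?_
    · intro h; exact (h1 _ i.2).2.2.2.2 (by rw [hv i, h, zero_mul])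
    · rw [← hv i]; exact (h1 _ i.2).2.2.1
    · exact Complex.ext h0 (cL (nn i)).2.symm
  rw [this] at cs
  exact Set.countable_univ_iff.1 cs
theorem caseI (d : DD) (t : TD) {u : ℕ → BB} (gB : g ∈ B) (gp : Pj g) (uB : ∀ n, u n ∈ B) (u1 : ∀ n, star (u n) * u n = g)
    (u2 : ∀ n m, n ≠ m → star (u n) * u m = 0) (hT : T * g ≠ 0) : ∃ e v, INT M₁ B A ξ e v := by
  obtain ⟨z, zp, zB, zB', zg, hz⟩ := csup gB
  obtain ⟨p, q, pz⟩ := d.exPD t zB zB' zp (fun h => hT (by rw [← zg, ← mul_assoc, h, zero_mul]))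
  obtain ⟨x, xN, hx⟩ := d.nv q gB zp zB zB' pz hz
  obtain ⟨cN, cA⟩ := d.pN q
  have ge := d.eb gB
  have gN := d.MN (d.BM gB)
  have gep : Pj (g * eB) := ⟨by rw [IsIdempotentElem, mul_assoc, ← mul_assoc eB, ← ge, mul_assoc, proj_mul (pr_proj _), ← mul_assoc, proj_mul gp],
    by rw [IsSelfAdjoint, star_mul, star_proj gp, star_proj (pr_proj _), ge]⟩
  have cp := sf.c_proj q.pp
  obtain ⟨S, h1, h2, h3, QN, qQ, h4⟩ := max_left cp cN (mul_mem gN d.eN) gep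
  have we : ∀ i : S, i.1 * eB = i.1 := fun i => by
    rw [← (h1 _ i.2).2.2.2.1, mul_assoc, mul_assoc, proj_mul (pr_proj _)]
  have wg : ∀ i : S, i.1 * g = i.1 := fun i => by
    rw [← (h1 _ i.2).2.2.2.1, mul_assoc, mul_assoc, ← ge, ← mul_assoc g, proj_mul gp]
  haveI := d.ctbl t q (fun w hw => ⟨(h1 w hw).1, (h1 w hw).2.1, (h1 w hw).2.2.1, we ⟨w, hw⟩, (h1 w hw).2.2.2.2⟩) h2
  obtain ⟨σ, hσ⟩ := Countable.exists_injective_nat S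
  obtain ⟨y, hy⟩ : ∃ y : S → BB, ∀ i, y i = i.1 * star (u (σ i)) := ⟨_, fun _ => rfl⟩
  have uN := fun n => d.MN (d.BM (uB n))
  have yN : ∀ i, y i ∈ 𝒩 := fun i => by rw [hy]; exact mul_mem (h1 _ i.2).1 (vst (uN _))
  have yy : ∀ i, y i * star (y i) = i.1 * star i.1 := fun i => by
    rw [hy, star_mul, star_star, mul_assoc, ← mul_assoc _ _ (star i.1), u1, ← mul_assoc, wg]
  obtain ⟨V, VN', V1, V2, V3⟩ := psum yN (fun i => by rw [yy, hy, ← mul_assoc, (h1 _ i.2).2.1])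
    (fun i j hij => by rw [hy, hy, star_mul, star_star, mul_assoc, ← mul_assoc (star i.1), h2 i j hij]; simp)
    (fun i j hij => by rw [hy, hy, star_mul, star_star, mul_assoc, ← mul_assoc _ _ (star j.1), u2 _ _ (fun h => hij (hσ h))]; simp)
  have pi : V * star V * V = V := pi_of (by rw [V2]; exact proj_mul osum_proj)
  simp only [yy] at V3
  have pp : ∀ i : S, Pj (i.1 * star i.1) := fun i => pi_r (h1 _ i.2).2.1
  have Qp : Pj (osum (fun i : S => i.1 * star i.1)) := osum_proj
  have yp : ∀ i, Pj (star (y i) * y i) := fun i => pi_l (by rw [yy, hy, ← mul_assoc, (h1 _ i.2).2.1])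
  have Ve : V * eB = V := by
    have : eB * osum (fun i => star (y i) * y i) = osum (fun i => star (y i) * y i) := osum_le yp fun i => by
      have : y i * eB = y i := by rw [hy, mul_assoc, d.eb (vst (uB _)), ← mul_assoc, we]
      rw [← mul_assoc]; congr 1
      have := congrArg star this; rwa [star_mul, star_proj (pr_proj _)] at this
    have := proj_swap osum_proj (pr_proj _) this
    rw [← V2] at this
    calc V * eB = V * (star V * V * eB) := by conv_lhs => rw [← pi]
                                              simp only [mul_assoc]
      _ = V := by rw [this, ← mul_assoc, pi]
  have aQ : ∀ a ∈ A, osum (fun i : S => i.1 * star i.1) * a * osum (fun i : S => i.1 * star i.1) = a * osum (fun i : S => i.1 * star i.1) := fun a ha => by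
    have aN := d.MN (d.leM (d.leA ha))
    have := mul_osum (S := (sf.c p - osum (fun i : S => i.1 * star i.1)) * a) (T := 0) pp fun i => by
      have := h4 (a * i.1) (mul_mem aN (h1 _ i.2).1)
      rw [mul_assoc, mul_assoc, (h1 _ i.2).2.2.2.1, ← mul_assoc] at this
      rw [← mul_assoc, this, zero_mul, zero_mul]
    rw [zero_mul, sub_mul, sub_mul, sub_eq_zero, ← cA a ha, mul_assoc, qQ] at this
    exact this.symm
  refine d.mkINT t q VN' pi ?_ ?_ Ve (one_mem A) ⟨one_mul _, IsSelfAdjoint.one _⟩ (one_mul _) fun a ha _ => ?_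
  · rintro rfl
    rw [zero_mul] at V3
    have := h4 x xN
    rw [← V3, sub_zero] at this
    exact hx this
  · rw [← pi, V3, ← mul_assoc, qQ]
  · rw [V3]
    have h := congrArg star (aQ _ (vst ha))
    rw [star_mul, star_mul, star_mul, star_star, star_proj Qp, ← mul_assoc, aQ a ha] at h
    exact h
end Dat
def Fint (N : VN H) (g : BB) : Prop := ∀ U ∈ N, star U * U = g → g * U = U → U * star U = g
theorem sub_fix (h : (1 - q) * u = 0) : q * u = u := by rw [sub_mul, one_mul, sub_eq_zero] at h; exact h.symm
theorem sub_fix' (h : u * (1 - q) = 0) : u * q = u := by rw [mul_sub, mul_one, sub_eq_zero] at h; exact h.symm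
theorem pi_cut (hx : x ∈ N) (x0 : x ≠ 0) (hq : q * x = x) (hp : x * p = x) : ∃ u ∈ N, u * star u * u = u ∧ u ≠ 0 ∧ q * u = u ∧ u * p = u := by
  obtain ⟨u, uN, pi, u0, h1, h2, -⟩ := polar_inter hx
  exact ⟨u, uN, pi, u0 x0, sub_fix (h1 _ (by rw [sub_mul, one_mul, hq, sub_self])), sub_fix' (h2 _ (by rw [mul_sub, mul_one, hp, sub_self]))⟩
theorem fin_ex {W : BB} (gp : Pj g) (gN : g ∈ N) (hf : Fint N g) (WN : W ∈ N) (pi : W * star W * W = W) (gW : g * W = W) (Wg : W * g = W)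
    (hW : W * star W ≠ g) : ∃ y ∈ N, (g - W * star W) * y * (g - star W * W) ≠ 0 := by
  by_contra hc
  push Not at hc
  have sN := vst WN
  obtain ⟨z, zp, zN, zN', zg, hz⟩ := csup (vsb gN (mul_mem sN WN))
  have h1 := hz _ hc
  have gs : g * star W = star W := by have := congrArg star Wg; rwa [star_mul, star_proj gp] at this
  have sg : star W * g = star W := by have := congrArg star gW; rwa [star_mul, star_proj gp] at this
  have c1 := comm_iff.1 zN' _ WN
  have c2 := comm_iff.1 zN' _ gN
  have c3 := comm_iff.1 zN' _ sN
  have zz := proj_mul zp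
  obtain ⟨U, hU⟩ : ∃ U, U = z * star W + g - z * g := ⟨_, rfl⟩
  have sU : star U = W * z + g - g * z := by rw [hU]; simp only [star_sub, star_add, star_mul, star_star, star_proj zp, star_proj gp]
  have UN : U ∈ N := by rw [hU]; exact vsb (add_mem (mul_mem zN sN) gN) (mul_mem zN gN)
  have gg := proj_mul gp
  have gU : g * U = U := by rw [hU, mul_sub, mul_add, ← mul_assoc, c2, mul_assoc, gs, gg, ← mul_assoc, c2, mul_assoc, gg]
  have mv : ∀ {a b : BB} (c : BB), a * z = z * b → a * (z * c) = z * (b * c) := fun c h => by rw [← mul_assoc, h, mul_assoc]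
  have as : ∀ {a b c : BB} (x : BB), a * b = c → a * (b * x) = c * x := fun x h => by rw [← mul_assoc, h]
  have U1 : star U * U = g := by
    have : star U * U = g - (g - W * star W) * z := by
      rw [sU, hU]
      simp only [sub_mul, mul_sub, add_mul, mul_add, mul_assoc, c1, c2, c3, mv _ c1, mv _ c2, mv _ c3, zz, as _ zz, gs, sg, gW, Wg, gg, as _ gs, as _ sg, as _ gW, as _ Wg, as _ gg]; abel
    rw [this, h1, sub_zero]
  have U2 : U * star U = star W * W := by
    have : U * star U = g - z * (g - star W * W) := by
      rw [sU, hU]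
      simp only [sub_mul, mul_sub, add_mul, mul_add, mul_assoc, c1, c2, c3, mv _ c1, mv _ c2, mv _ c3, zz, as _ zz, gs, sg, gW, Wg, gg, as _ gs, as _ sg, as _ gW, as _ Wg, as _ gg]; abel
    rw [this, zg]; abel
  have h3 := hf U UN U1 gU
  exact hW (hf W WN (U2.symm.trans h3) gW)
theorem round (gp : Pj g) (gN : g ∈ N) (hf : Fint N g) {α β : H} (hβ : g β ≠ 0) :
    ∃ K : ℝ, 0 < K ∧ ∃ v ∈ N, v * star v * v = v ∧ v ≠ 0 ∧ g * v = v ∧ v * g = v ∧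
      ∀ w ∈ N, w * star w * w = w → v * star v * w = w → w * (star v * v) = w → ‖(star w * w) α‖ ^ 2 ≤ K * ‖(w * star w) β‖ ^ 2 := by
  have b0 : 0 < ‖g β‖ ^ 2 := by positivity
  have K0 : 0 < ‖α‖ ^ 2 / ‖g β‖ ^ 2 + 1 := by positivity
  have Kb : ‖α‖ ^ 2 < (‖α‖ ^ 2 / ‖g β‖ ^ 2 + 1) * ‖g β‖ ^ 2 := by rw [add_mul, div_mul_cancel₀ _ b0.ne']; linarith
  generalize ‖α‖ ^ 2 / ‖g β‖ ^ 2 + 1 = K at *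
  refine ⟨K, K0, ?_⟩
  obtain ⟨S, h1, h2, W, WN, pi, gW, Wg, W1, W2, h3⟩ := max_pi (N := N) gp gp (fun w => K * ‖(w * star w) β‖ ^ 2 < ‖(star w * w) α‖ ^ 2)
  have hW : W * star W ≠ g := fun h => by
    rw [W2] at h
    have a1 := osum_normsq (fun i : S => pi_r (h1 _ i.2).2.1) (fun i j hij => by rw [mul_assoc, ← mul_assoc (star i.1), (h2 i j hij).1]; simp) β
    have a2 := osum_normsq (fun i : S => pi_l (h1 _ i.2).2.1) (fun i j hij => by rw [mul_assoc, ← mul_assoc i.1, (h2 i j hij).2]; simp) α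
    rw [h] at a1
    have a3 := hasSum_le (fun i : S => ((h1 _ i.2).2.2.2.2).le) (a1.mul_left K) a2
    have a4 : ‖osum (fun i : S => star i.1 * i.1) α‖ ^ 2 ≤ ‖α‖ ^ 2 := by gcongr; exact proj_norm_le osum_proj α
    linarith
  obtain ⟨y, yN, hy⟩ := fin_ex gp gN hf WN pi gW Wg hW
  have sN := vst WN
  have qN := vsb gN (mul_mem WN sN)
  have pN := vsb gN (mul_mem sN WN)
  have qp := proj_sub (pi_r pi) gp (by rw [← mul_assoc, gW])
  have pp := proj_sub (pi_l pi) gp (by rw [← mul_assoc]; have := congrArg star Wg; rw [star_mul, star_proj gp] at this; rw [this])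
  have gq : g * (g - W * star W) = g - W * star W := by rw [mul_sub, proj_mul gp, ← mul_assoc, gW]
  have pg : (g - star W * W) * g = g - star W * W := by rw [sub_mul, proj_mul gp, mul_assoc, Wg]
  generalize g - W * star W = q at *
  generalize g - star W * W = p at *
  obtain ⟨u, uN, u1, u0, qu, up⟩ := pi_cut (q := q) (p := p) (mul_mem (mul_mem qN yN) pN) hy (by rw [← mul_assoc, ← mul_assoc, proj_mul qp]) (by rw [mul_assoc, proj_mul pp])
  refine ⟨u, uN, u1, u0, ?_, ?_, fun w wN w1 w2 w3 => ?_⟩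
  · rw [← qu, ← mul_assoc, gq]
  · rw [← up, mul_assoc, pg]
  · by_contra hc
    push Not at hc
    have e1 : q * w = w := by rw [← w2, ← mul_assoc, ← mul_assoc, qu]
    have e2 : w * p = w := by rw [← w3, mul_assoc, mul_assoc, up]
    have := h3 w wN w1 hc e1 e2
    rw [this] at hc
    simp at hc
theorem pi_norm (h : v * star v * v = v) (y : H) : ‖v y‖ ≤ ‖y‖ := by
  have := normsq_inner v y
  rw [proj_normsq (pi_l h)] at this
  have e : ‖(star v * v) y‖ ^ 2 = ‖v y‖ ^ 2 := by exact_mod_cast this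
  have := proj_norm_le (pi_l h) y
  have e2 : ‖(star v * v) y‖ = ‖v y‖ := (sq_eq_sq₀ (norm_nonneg _) (norm_nonneg _)).1 e
  rwa [← e2]
theorem star_fix (hq : Pj q) (h : q * x = x) : star x * q = star x := by have := congrArg star h; rwa [star_mul, star_proj hq] at this
theorem star_fix' (hq : Pj q) (h : x * q = x) : q * star x = star x := by have := congrArg star h; rwa [star_mul, star_proj hq] at this
theorem tr_pi {ξ : H} (sp : Pj s) (sN : s ∈ N) (s0 : s ≠ 0) (hf : ∀ g ∈ N, Pj g → s * g = g → Fint N g) (hs : ∀ x ∈ N, x ξ = 0 → x = 0) :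
    ∃ K : ℝ, 0 < K ∧ ∃ f ∈ N, Pj f ∧ f ≠ 0 ∧ s * f = f ∧ ∀ x ∈ N, x * star x * x = x → f * x = x → x * f = x → ‖(star x * x) ξ‖ ^ 2 ≤ K * ‖(x * star x) ξ‖ ^ 2 := by
  obtain ⟨K1, k1, v, vN, pi, v0, sv, vs, h1⟩ := round sp sN (hf s sN sp (proj_mul sp)) (α := ξ) (β := ξ) (fun h => s0 (hs _ sN h))
  have vN' := vst vN
  have ap := pi_l pi
  have aN := mul_mem vN' vN
  have sa : s * (star v * v) = star v * v := by rw [← mul_assoc, star_fix' sp vs]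
  have a0 : star v * v ≠ 0 := fun h => v0 (by rw [← pi, mul_assoc, h, mul_zero])
  have va : v * (star v * v) = v := by rw [← mul_assoc, pi]
  have r1 : ∀ x ∈ N, x * star x * x = x → star v * v * x = x → x * (star v * v) = x → ‖(star x * x) ξ‖ ^ 2 ≤ K1 * ‖(x * star x) (star v ξ)‖ ^ 2 := fun x xN px ax xa => by
    have e1 : star (v * x) * (v * x) = star x * x := by rw [star_mul, mul_assoc, ← mul_assoc (star v), ax]
    have := h1 (v * x) (mul_mem vN xN) (by rw [mul_assoc, e1, mul_assoc, ← mul_assoc x, px]) (by rw [← mul_assoc, pi]) (by rw [mul_assoc, xa])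
    rw [e1] at this
    refine this.trans ?_
    have e2 : (v * x * star (v * x)) ξ = v ((x * star x) (star v ξ)) := by rw [star_mul]; rfl
    rw [e2]
    gcongr
    exact pi_norm pi _
  generalize star v * v = a at *
  obtain ⟨K2, k2, v2, v2N, pi2, v20, av, va2, h2⟩ := round ap aN (hf a aN ap sa) (α := star v ξ) (β := ξ) (fun h => a0 (hs _ aN h))
  refine ⟨K1 * K2, by positivity, v2 * star v2, mul_mem v2N (vst v2N), pi_r pi2, fun h => v20 (by rw [← pi2, h, zero_mul]),
    by rw [← mul_assoc]; congr 1; rw [← av, ← mul_assoc, sa], fun x xN px fx xf => ?_⟩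
  have sN2 := vst v2N
  have sx := vst xN
  have fs := star_fix (pi_r pi2) fx
  have fs' := star_fix' (pi_r pi2) xf
  have y1 : star (star v2 * x) * (star v2 * x) = star x * x := by rw [star_mul, star_star, mul_assoc, ← mul_assoc v2, fx]
  have := r1 (star v2 * x) (mul_mem sN2 xN) (by rw [mul_assoc, y1, mul_assoc, ← mul_assoc x, px]) (by rw [← mul_assoc, star_fix' ap va2])
    (by rw [mul_assoc]; congr 1; rw [← xf, mul_assoc, mul_assoc, star_fix ap av])
  rw [y1] at this
  have pxx := proj_mul (pi_r px)
  have w1 : x * star x * v2 * star (x * star x * v2) = x * star x := by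
    rw [star_mul, star_proj (pi_r px), mul_assoc, ← mul_assoc v2, ← mul_assoc (v2 * _), fx, pxx]
  have t2 := h2 (x * star x * v2) (mul_mem (mul_mem xN sx) v2N) (by rw [w1, ← mul_assoc, pxx]) (by rw [← mul_assoc, ← mul_assoc, fx]) (by rw [mul_assoc, ← mul_assoc v2, pi2])
  have w2 : star (x * star x * v2) * (x * star x * v2) = star v2 * x * star (star v2 * x) := by
    rw [star_mul, star_proj (pi_r px), star_mul, star_star]
    calc _ = star v2 * (x * star x * (x * star x)) * v2 := by simp only [mul_assoc]
      _ = _ := by rw [pxx]; simp only [mul_assoc]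
  rw [w1, w2] at t2
  calc _ ≤ _ := this
    _ ≤ K1 * (K2 * ‖(x * star x) ξ‖ ^ 2) := by gcongr
    _ = _ := by ring
theorem tr_all {ξ : H} {K : ℝ} (K0 : 0 < K) (fN : f ∈ N) (fp : Pj f)
    (h : ∀ x ∈ N, x * star x * x = x → f * x = x → x * f = x → ‖(star x * x) ξ‖ ^ 2 ≤ K * ‖(x * star x) ξ‖ ^ 2) (hX : X ∈ N) (fX : f * X = X) (Xf : X * f = X) :
    ‖star X ξ‖ ^ 2 ≤ K * ‖X ξ‖ ^ 2 := by
  obtain ⟨u, uN, a, aN, a0, aa, ua, sua, pi, pa, z1, z2⟩ := polar hX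
  have uf := sub_fix' (z2 (1 - f) (by rw [mul_sub, mul_one, Xf, sub_self]))
  have fu := sub_fix (z1 (1 - f) (by rw [sub_mul, one_mul, fX, sub_self]))
  have sN := vst uN
  have key := binary_pos (N := N) (pi_l pi) (fun y => K * (⟪ξ, y ξ⟫).re - (⟪star u ξ, y (star u ξ)⟫).re) (fun x _ y _ => by simp only [Aadd, inner_add_right, Complex.add_re]; ring)
    (fun c x _ => by simp only [Asmul, inner_smul_right, Complex.re_ofReal_mul]; ring) (‖star u ξ‖ ^ 2)
    (fun x hx x0 x1 => by
      have h1 := (cL (nonneg_iff.1 x0 ξ)).1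
      have h2 := (cL (le_iff.1 x1 (star u ξ))).1
      rw [show ((1 : BB) (star u ξ)) = star u ξ from rfl, inner_self', Complex.ofReal_re] at h2
      rw [Complex.zero_re] at h1
      have := mul_nonneg K0.le h1
      linarith)
    (fun p pN pp up => by
      have su : star u * f = star u := star_fix fp fu
      have fs : f * star u = star u := star_fix' fp uf
      have fpp : f * p = p := by rw [← up, ← mul_assoc, ← mul_assoc, fs]
      have pu := proj_swap pp (pi_l pi) up
      have e1 : p * star u * star (p * star u) = p := by rw [star_mul, star_star, star_proj pp, mul_assoc, ← mul_assoc (star u), up, proj_mul pp]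
      have e2 : star (p * star u) * (p * star u) = u * p * star u := by rw [star_mul, star_star, star_proj pp, mul_assoc, ← mul_assoc p, proj_mul pp, ← mul_assoc]
      have := h (p * star u) (mul_mem pN sN) (by rw [e1, ← mul_assoc, proj_mul pp]) (by rw [← mul_assoc, fpp]) (by rw [mul_assoc, su])
      rw [e1, e2] at this
      have e3 : ‖(u * p * star u) ξ‖ ^ 2 = (⟪star u ξ, p (star u ξ)⟫).re := by
        have q : Pj (u * p * star u) := by rw [← e2]; exact pi_l (by rw [e1, ← mul_assoc, proj_mul pp])
        have := proj_normsq q ξ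
        rw [star_inner, show u (p (star u ξ)) = (u * p * star u) ξ from rfl, this, Complex.ofReal_re]
      rw [e3] at this
      rw [proj_normsq pp ξ, Complex.ofReal_re]
      linarith) (x := star X * X) (mul_mem (vst hX) hX) (star_mul_self_nonneg X) (by rw [← aa, ← mul_assoc, pa])
  rw [normsq_inner, Complex.ofReal_re] at key
  have e4 : (⟪star u ξ, (star X * X) (star u ξ)⟫).re = ‖star X ξ‖ ^ 2 := by
    have : X * star u = u * star X := by
      have : star X = a * star u := by rw [← ua, star_mul, (sa_of_nonneg a0).star_eq]
      rw [this, ← ua, mul_assoc]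
    rw [normsq_inner, Complex.ofReal_re, ← mapp, this, mapp]
    have h1 : (star u * u) (star X ξ) = star X ξ := by
      rw [← mapp]; congr 1; rw [← ua, star_mul, (sa_of_nonneg a0).star_eq, ← mul_assoc, pa]
    have := normsq_inner u (star X ξ)
    rw [h1, inner_self'] at this
    exact_mod_cast this.symm
  rw [e4] at key
  linarith
theorem iter_orth {U : BB} (UN : U ∈ N) (gp : Pj g) (gN : g ∈ N) (UU : star U * U = g) (gU : g * U = U) :
    ∃ u : ℕ → BB, (∀ n, u n ∈ N) ∧ (∀ n, star (u n) * u n = g - U * star U) ∧ ∀ n m, n ≠ m → star (u n) * u m = 0 := by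
  have pi := pi_of (V := U) (by rw [UU, proj_mul gp])
  have p0 := proj_sub (pi_r pi) gp (by rw [← mul_assoc, gU])
  have h0U : (g - U * star U) * U = 0 := by rw [sub_mul, gU, pi, sub_self]
  have gg0 : g * (g - U * star U) = g - U * star U := by rw [mul_sub, proj_mul gp, ← mul_assoc, gU]
  have N0 := vsb gN (mul_mem UN (vst UN))
  generalize g - U * star U = g0 at *
  obtain ⟨u, u0, us⟩ : ∃ u : ℕ → BB, u 0 = g0 ∧ ∀ n, u (n + 1) = U * u n := ⟨fun n => Nat.rec g0 (fun _ x => U * x) n, rfl, fun _ => rfl⟩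
  have gu : ∀ n, g * u n = u n := fun n => by cases n with
    | zero => rw [u0, gg0]
    | succ n => rw [us, ← mul_assoc, gU]
  have st : ∀ n m, star (u (n + 1)) * u (m + 1) = star (u n) * u m := fun n m => by rw [us, us, star_mul, mul_assoc, ← mul_assoc (star U), UU, gu]
  have z1 : ∀ m, star (u 0) * u (m + 1) = 0 := fun m => by rw [u0, us, star_proj p0, ← mul_assoc, h0U, zero_mul]
  refine ⟨u, fun n => ?_, fun n => ?_, fun n => ?_⟩
  · induction n with
    | zero => rw [u0]; exact N0
    | succ n ih => rw [us]; exact mul_mem UN ih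
  · induction n with
    | zero => rw [u0, star_proj p0, proj_mul p0]
    | succ n ih => rw [st, ih]
  · induction n with
    | zero => intro m hm; cases m with
      | zero => exact absurd rfl hm
      | succ m => exact z1 m
    | succ n ih => intro m hm; cases m with
      | zero => have := congrArg star (z1 n); rwa [star_mul, star_star, star_zero] at this
      | succ m => rw [st]; exact ih m (fun h => hm (by rw [h]))
namespace Dat
theorem dich (d : DD) (t : TD) (T0 : T ≠ 0) : (∃ e v, INT M₁ B A ξ e v) ∨ ∃ K : ℝ, 0 < K ∧ ∃ f ∈ B, Pj f ∧ T * f ≠ 0 ∧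
    ∀ X ∈ B, f * X = X → X * f = X → ‖star X ξ‖ ^ 2 ≤ K * ‖X ξ‖ ^ 2 := by
  obtain ⟨z, zp, zN, zN', zT, hz⟩ := csup t.TB
  rw [VonNeumannAlgebra.commutant_commutant] at zN'
  have z0 : z ≠ 0 := fun h => T0 (by rw [← zT, h, zero_mul])
  have ne : ∀ g ∈ B, Pj g → g ≠ 0 → z * g = g → T * g ≠ 0 := fun g gB gp g0 zg h => by
    have h1 : g * T = 0 := by have := congrArg star h; rwa [star_mul, star_proj gp, (sa_of_nonneg t.nn).star_eq, star_zero] at this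
    have := hz g fun y hy => by rw [comm_iff.1 hy g gB, mul_assoc, h1, mul_zero]
    exact g0 (by rw [← zg]; have := congrArg star this; rwa [star_mul, star_proj gp, star_proj zp, star_zero] at this)
  by_cases hf : ∀ g ∈ B, Pj g → z * g = g → Fint B g
  · right
    obtain ⟨K, K0, f, fB, fp, f0, zf, h⟩ := tr_pi zp zN' z0 hf (fun x hx h => d.sepB (d.BM hx) (zero_mem M) (by rw [h]; rfl))
    exact ⟨K, K0, f, fB, fp, ne f fB fp f0 zf, fun X hX => tr_all K0 fB fp h hX⟩
  · left
    simp only [Fint] at hf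
    push Not at hf
    obtain ⟨g, gB, gp, zg, U, UB, UU, gU, hU⟩ := hf
    obtain ⟨u, u1, u2, u3⟩ := iter_orth UB gp gB UU gU
    have pi := pi_of (V := U) (by rw [UU, proj_mul gp])
    have p0 := proj_sub (pi_r pi) gp (by rw [← mul_assoc, gU])
    have gB' := vsb gB (mul_mem UB (vst UB))
    exact d.caseI t gB' p0 u1 u2 u3 (ne _ gB' p0 (fun h => hU (sub_eq_zero.1 h).symm) (by rw [mul_sub, zg, ← mul_assoc]; congr 2; rw [← gU, ← mul_assoc, zg]))
end Dat
def qS (S : SB) : BB := osum (fun i : S => i.1 * star i.1)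
structure SFN (N : VN H) (g : BB) (ε : H) (K : ℝ) (S : SB) : Prop where
  K0 : 0 < K
  gN : g ∈ N
  gp : Pj g
  gε : g ε = ε
  tr : ∀ X ∈ N, g * X = X → X * g = X → ‖star X ε‖ ^ 2 ≤ K * ‖X ε‖ ^ 2
  sep : ∀ X ∈ N, X * g = X → X ε = 0 → X = 0
  w : ∀ i : S, i.1 ∈ N ∧ i.1 * star i.1 * i.1 = i.1 ∧ i.1 * g = i.1
  o : ∀ i j : S, i ≠ j → i.1 * star i.1 * (j.1 * star j.1) = 0
  Q : ∀ y ∈ N, qS S * (y * g) = y * g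
def N2 (S : SB) (ε : H) (Y : BB) : ℝ≥0∞ := ∑' i : S, ENNReal.ofReal (‖Y (i.1 ε)‖ ^ 2)
theorem osum_enorm {ι : Type*} {p : ι → BB} (hp : ∀ i, Pj (p i)) (ho : ∀ i j, i ≠ j → p i * p j = 0) (v : H) :
    ENNReal.ofReal (‖osum p v‖ ^ 2) = ∑' i, ENNReal.ofReal (‖p i v‖ ^ 2) := by
  have := osum_normsq hp ho v
  rw [← this.tsum_eq, ENNReal.ofReal_tsum_of_nonneg (fun i => by positivity) this.summable]
theorem N2_le {S : SB} {ε : H} {c : ℝ} (c0 : 0 ≤ c) (h : ∀ v, ‖X v‖ ^ 2 ≤ c * ‖Y v‖ ^ 2) : N2 S ε X ≤ ENNReal.ofReal c * N2 S ε Y := by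
  rw [N2, N2, ← ENNReal.tsum_mul_left]
  refine ENNReal.tsum_le_tsum fun i => ?_
  rw [← ENNReal.ofReal_mul c0]
  exact ENNReal.ofReal_le_ofReal (h _)
theorem N2_mul {S : SB} {ε : H} (X Y : BB) : N2 S ε (X * Y) ≤ ENNReal.ofReal (‖X‖ ^ 2) * N2 S ε Y :=
  N2_le (by positivity) fun v => by rw [mapp, ← mul_pow]; gcongr; exact X.le_opNorm _
theorem N2_contr {S : SB} {ε : H} (Y : BB) (h : ∀ v, ‖X v‖ ≤ ‖v‖) : N2 S ε (X * Y) ≤ N2 S ε Y := by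
  have := N2_le (S := S) (ε := ε) (X := X * Y) (Y := Y) zero_le_one fun v => by rw [mapp, one_mul]; gcongr; exact h _
  rwa [ENNReal.ofReal_one, one_mul] at this
theorem N2_sub {S : SB} {ε : H} (hp : Pj p) (hq : Pj q) (h : q * p = p) : N2 S ε p ≤ N2 S ε q := by
  rw [← proj_swap hp hq h]; exact N2_contr _ (proj_norm_le hp)
theorem N2_osum {S : SB} {ε : H} {ι : Type*} {p : ι → BB} (hp : ∀ i, Pj (p i)) (ho : ∀ i j, i ≠ j → p i * p j = 0) (Y : BB) :
    N2 S ε (osum p * Y) = ∑' i, N2 S ε (p i * Y) := by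
  simp only [N2, mapp]
  simp only [osum_enorm hp ho]
  exact ENNReal.tsum_comm
namespace SFN
variable {g : BH H} {ε : H} {K : ℝ} {S : Set (BH H)}
local notation "SS" => SFN N g ε K S
theorem wp (s : SS) : ∀ i : S, Pj (i.1 * star i.1) := fun i => pi_r (s.w i).2.1
theorem swap (s : SS) (hZ : Z ∈ N) : N2 S ε Z ≤ ENNReal.ofReal K * N2 S ε (star Z) := by
  have h1 : ∀ Z ∈ N, N2 S ε Z = ∑' i : S, ∑' j : S, ENNReal.ofReal (‖(star j.1 * Z * i.1) ε‖ ^ 2) := fun Z hZ => by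
    rw [N2]
    congr 1; funext i
    have e : Z (i.1 ε) = qS S (Z (i.1 ε)) := by
      have := s.Q (Z * i.1) (mul_mem hZ (s.w i).1)
      rw [mul_assoc Z, (s.w i).2.2] at this
      exact (congrArg (fun (T : BB) => T ε) this).symm
    rw [e, qS, osum_enorm s.wp s.o]
    congr 1; funext j
    congr 1
    have := (proj_normsq (s.wp j) (Z (i.1 ε))).symm
    rw [mapp, ← star_inner, inner_self'] at this
    exact_mod_cast this
  rw [h1 Z hZ, h1 _ (vst hZ), ENNReal.tsum_comm, ← ENNReal.tsum_mul_left]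
  refine ENNReal.tsum_le_tsum fun j => ?_
  rw [← ENNReal.tsum_mul_left]
  refine ENNReal.tsum_le_tsum fun i => ?_
  rw [← ENNReal.ofReal_mul s.K0.le]
  refine ENNReal.ofReal_le_ofReal ?_
  have := s.tr (star i.1 * star Z * j.1) (mul_mem (mul_mem (vst (s.w i).1) (vst hZ)) (s.w j).1)
    (by rw [mul_assoc, ← mul_assoc, star_fix' s.gp (s.w i).2.2]) (by rw [mul_assoc, (s.w j).2.2])
  simp only [star_mul, star_star] at this
  rwa [← mul_assoc] at this
theorem N2g (s : SS) : N2 S ε g < ⊤ := by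
  have h1 : N2 S ε g ≤ ENNReal.ofReal K * ∑' i : S, ENNReal.ofReal (‖(i.1 * star i.1) ε‖ ^ 2) := by
    rw [N2, ← ENNReal.tsum_mul_left]
    refine ENNReal.tsum_le_tsum fun i => ?_
    rw [← ENNReal.ofReal_mul s.K0.le]
    refine ENNReal.ofReal_le_ofReal ?_
    have := s.tr (star i.1 * g) (mul_mem (vst (s.w i).1) s.gN) (by rw [← mul_assoc, star_fix' s.gp (s.w i).2.2]) (by rw [mul_assoc, proj_mul s.gp])
    rw [star_mul, star_star, star_proj s.gp, mapp, mapp, s.gε] at this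
    refine this.trans (mul_le_mul_of_nonneg_left (le_of_eq ?_) s.K0.le)
    have := proj_normsq (s.wp i) ε
    rw [mapp, ← star_inner, inner_self'] at this
    exact_mod_cast this
  rw [← osum_enorm s.wp s.o] at h1
  exact h1.trans_lt (ENNReal.mul_lt_top ENNReal.ofReal_lt_top ENNReal.ofReal_lt_top)
theorem fin (s : SS) (h : Z * g = Z) : N2 S ε Z < ⊤ := by
  rw [← h]; exact (N2_mul _ _).trans_lt (ENNReal.mul_lt_top ENNReal.ofReal_lt_top s.N2g)
theorem Qp (s : SS) : Pj (qS S) := osum_proj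
theorem QN (s : SS) : qS S ∈ N := osum_mem fun i => mul_mem (s.w i).1 (vst (s.w i).1)
theorem wsep (s : SS) (hY : Y ∈ N) (h : ∀ i : S, Y (i.1 ε) = 0) : Y * qS S = 0 := by
  have := mul_osum (S := Y) (T := 0) s.wp fun i => by
    rw [← mul_assoc, s.sep (Y * i.1) (mul_mem hY (s.w i).1) (by rw [mul_assoc, (s.w i).2.2]) (h i), zero_mul, zero_mul]
  rw [qS, this, zero_mul]
theorem zero (s : SS) (hY : Y ∈ N) (h : N2 S ε Y = 0) : Y * qS S = 0 := s.wsep hY fun i => by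
  have := ENNReal.tsum_eq_zero.1 h i
  rw [ENNReal.ofReal_eq_zero] at this
  have h2 : ‖Y (i.1 ε)‖ ^ 2 = 0 := le_antisymm this (by positivity)
  simpa using h2
theorem QC (s : SS) (hy : y ∈ N) : qS S * y = y * qS S := by
  have h1 : ∀ y ∈ N, qS S * y * qS S = y * qS S := fun y hy => mul_osum s.wp fun i => by
    have := s.Q (y * i.1) (mul_mem hy (s.w i).1)
    rw [mul_assoc y, (s.w i).2.2] at this
    rw [← mul_assoc, mul_assoc _ y, this, mul_assoc]
  have := congrArg star (h1 _ (vst hy))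
  rw [star_mul, star_mul, star_mul, star_star, star_proj s.Qp, ← mul_assoc, h1 y hy] at this
  exact this.symm
end SFN
theorem mkSFN {ε : H} {K : ℝ} (K0 : 0 < K) (gN : g ∈ N) (gp : Pj g) (gε : g ε = ε)
    (tr : ∀ X ∈ N, g * X = X → X * g = X → ‖star X ε‖ ^ 2 ≤ K * ‖X ε‖ ^ 2) (sep : ∀ X ∈ N, X * g = X → X ε = 0 → X = 0) : ∃ S, SFN N g ε K S := by
  obtain ⟨S, h1, h2, h3, h4, h5, h6⟩ := max_left (N := N) (q := 1) ⟨one_mul _, IsSelfAdjoint.one _⟩ (one_mem N) gN gp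
  exact ⟨S, K0, gN, gp, gε, tr, sep, fun i => ⟨(h1 _ i.2).1, (h1 _ i.2).2.1, (h1 _ i.2).2.2.2.1⟩, h3, fun y hy => by
    have := h6 y hy; rw [sub_mul, sub_mul, one_mul, sub_eq_zero, mul_assoc] at this; exact this.symm⟩
theorem comm_proj {A : VN H} (eA : e ∈ A) (ep : Pj e) (h : ∀ p ∈ A, Pj p → e * p = p → p * r = r * p) :
    ∀ a ∈ A, e * a * e = a → a * r = r * a := by
  have key : ∀ x ∈ A, 0 ≤ x → e * x = x → x * r = r * x := fun x hx x0 ex => by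
    have k : ∀ u v : H, 0 ≤ (⟪u, (x * r - r * x) v⟫).re := fun u v =>
      binary_pos (N := A) ep (fun y => (⟪u, (y * r - r * y) v⟫).re)
        (fun x _ y _ => by rw [← Complex.add_re, ← inner_add_right, ← Aadd]; congr 4; rw [add_mul, mul_add]; abel)
        (fun c x _ => by rw [smul_mul_assoc, mul_smul_comm, ← smul_sub, Asmul, inner_smul_right, Complex.re_ofReal_mul])
        (‖u‖ * ((1 * ‖r‖ + ‖r‖ * 1) * ‖v‖)) (fun x hx x0 x1 => by
          have x1' : ‖x‖ ≤ 1 := (CStarAlgebra.norm_le_one_iff_of_nonneg x x0).2 x1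
          refine (abs_le.1 ((Complex.abs_re_le_norm _).trans ((norm_inner_le_norm _ _).trans ?_))).1
          gcongr
          refine ((x * r - r * x).le_opNorm v).trans ?_
          gcongr
          refine (norm_sub_le _ _).trans (add_le_add ((norm_mul_le _ _).trans ?_) ((norm_mul_le _ _).trans ?_)) <;> gcongr)
        (fun p pA pp epp => by rw [h p pA pp epp, sub_self]; simp) hx x0 ex
    refine sub_eq_zero.1 (ContinuousLinearMap.ext fun v => ?_)
    have := k (-((x * r - r * x) v)) v
    rw [inner_neg_left, inner_self', Complex.neg_re, Complex.ofReal_re] at this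
    have h0 : ‖(x * r - r * x) v‖ ^ 2 = 0 := le_antisymm (by linarith) (by positivity)
    simpa using h0
  intro a aA ha
  obtain ⟨ea, ae⟩ := (corner_iff ep).1 ha
  have se := star_fix ep ea
  have k2 : ∀ c : ℂ, star (a + c • e) * (a + c • e) * r = r * (star (a + c • e) * (a + c • e)) := fun c => by
    refine key _ (mul_mem (vst (add_mem aA (vn_smul c eA))) (add_mem aA (vn_smul c eA))) (star_mul_self_nonneg _) ?_
    rw [← mul_assoc]; congr 1
    rw [star_add, star_smul, star_proj ep, mul_add, mul_smul_comm, proj_mul ep, star_fix' ep ae]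
  have pol : (4 : ℂ) • a = star (a + (1 : ℂ) • e) * (a + (1 : ℂ) • e) + Complex.I • (star (a + Complex.I • e) * (a + Complex.I • e)) - star (a + (-1 : ℂ) • e) * (a + (-1 : ℂ) • e)
      - Complex.I • (star (a + (-Complex.I) • e) * (a + (-Complex.I) • e)) := by
    simp only [star_add, star_smul, star_proj ep, add_mul, mul_add, smul_mul_assoc, mul_smul_comm, ea, se, proj_mul ep]
    simp only [smul_add, smul_smul, star_neg, star_one, Complex.star_def, Complex.conj_I]
    match_scalars <;> ring_nf <;> simp [Complex.I_sq] <;> norm_num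
  have : ((4 : ℂ) • a) * r = r * ((4 : ℂ) • a) := by
    rw [pol, sub_mul, sub_mul, add_mul, smul_mul_assoc, smul_mul_assoc, k2, k2, k2, k2, mul_sub r, mul_sub r, mul_add r, mul_smul_comm, mul_smul_comm]
  rw [smul_mul_assoc, mul_smul_comm] at this
  exact smul_right_injective _ (by norm_num : (4 : ℂ) ≠ 0) this
structure Adm (N A : VN H) (r0 r : BB) : Prop where
  rN : r ∈ N
  rp : Pj r
  r0r : r0 * r = r
  ex : ∃ e ∈ A, Pj e ∧ e * r = r ∧ ∀ a ∈ A, e * a * e = a → a * r = r * a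
structure Cen (N : VN H) (z : BB) : Prop where
  zN : z ∈ N
  zN' : z ∈ N.commutant
  zp : Pj z
theorem Cen.c (h : Cen N z) (hx : x ∈ N) : x * z = z * x := comm_iff.1 h.zN' x hx
theorem comm_pr_mul (hp : Pj p) (hq : Pj q) (h : p * q = q * p) : Pj (p * q) :=
  ⟨by rw [IsIdempotentElem, mul_assoc, ← mul_assoc q, ← h, mul_assoc, proj_mul hq, ← mul_assoc, proj_mul hp], by rw [IsSelfAdjoint, star_mul, star_proj hp, star_proj hq, h]⟩
theorem Adm.mul {A : VN H} (hA : ∀ a ∈ A, a ∈ N) {r0 : BB} (h : Adm N A r0 r) (c : Cen N z) : Adm N A r0 (r * z) := by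
  obtain ⟨e, eA, ep, er, hc⟩ := h.ex
  refine ⟨mul_mem h.rN c.zN, comm_pr_mul h.rp c.zp (c.c h.rN), by rw [← mul_assoc, h.r0r], e, eA, ep, by rw [← mul_assoc, er], fun a ha hh => ?_⟩
  rw [← mul_assoc, hc a ha hh, mul_assoc, c.c (hA a ha), mul_assoc]
theorem Adm.cut {A : VN H} (hA : ∀ a ∈ A, a ∈ N) {r0 : BB} (h : Adm N A r0 r) (ep : Pj e) (hc : ∀ a ∈ A, e * a * e = a → a * r = r * a)
    (fA : f ∈ A) (fp : Pj f) (ef : e * f = f) : Adm N A r0 (f * r) := by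
  have fe := proj_swap fp ep ef
  have fr := hc f fA (by rw [ef, fe])
  refine ⟨mul_mem (hA f fA) h.rN, comm_pr_mul fp h.rp fr, by rw [fr, ← mul_assoc, h.r0r], f, fA, fp, by rw [← mul_assoc, proj_mul fp], fun a ha hh => ?_⟩
  obtain ⟨fa, af⟩ := (corner_iff fp).1 hh
  rw [← mul_assoc, af, mul_assoc, ← hc a ha (by rw [← hh]; calc e * (f * a * f) * e = e * f * a * (f * e) := by simp only [mul_assoc]
                                                                _ = _ := by rw [ef, fe]), ← mul_assoc, fa]
theorem Cen.mul (h : Cen N z) (h' : Cen N w) : Cen N (z * w) := ⟨mul_mem h.zN h'.zN, mul_mem h.zN' h'.zN', comm_pr_mul h.zp h'.zp (h'.c h.zN)⟩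
theorem Cen.sub (h : Cen N z) (h' : Cen N w) (e : z * w = w) : Cen N (z - w) := ⟨vsb h.zN h'.zN, vsb h.zN' h'.zN', proj_sub h'.zp h.zp e⟩
theorem Cen.one : Cen N 1 := ⟨one_mem N, one_mem _, ⟨by rw [IsIdempotentElem, mul_one], by rw [IsSelfAdjoint, star_one]⟩⟩
theorem csupC (hr : r ∈ N) : ∃ z, Cen N z ∧ z * r = r ∧ ∀ x, Cen N x → r * x = 0 → z * x = 0 := by
  obtain ⟨z, zp, zN, zN', zr, h⟩ := csup hr
  refine ⟨z, ⟨zN, zN', zp⟩, zr, fun x hx h0 => ?_⟩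
  rw [hx.c zN]
  exact h x fun y hy => by rw [mul_assoc, ← hx.c (mul_mem hy hr), mul_assoc, h0, mul_zero]
theorem N2_pyth {S : SB} {ε : H} (ep : Pj e) (fp : Pj f) (ef : e * f = f) (eX : e * X = X) :
    N2 S ε (f * X) + N2 S ε ((e - f) * X) = N2 S ε X := by
  unfold N2
  rw [← ENNReal.tsum_add]
  refine tsum_congr fun i => ?_
  rw [← ENNReal.ofReal_add (by positivity) (by positivity)]
  congr 1
  have h1 := proj_normsq fp (X (i.1 ε))
  have h2 := proj_normsq (proj_sub fp ep ef) (X (i.1 ε))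
  have h3 := proj_normsq ep (X (i.1 ε))
  rw [Asub, inner_sub_right, h1, h3] at h2
  have h4 : e (X (i.1 ε)) = X (i.1 ε) := by rw [← mapp, eX]
  rw [mapp, mapp]
  have h5 : (e - f) (X (i.1 ε)) = X (i.1 ε) - f (X (i.1 ε)) := (Asub e f _).trans (by rw [h4])
  rw [h4] at h2
  rw [h5]
  have : ‖X (i.1 ε)‖ ^ 2 - ‖f (X (i.1 ε))‖ ^ 2 = ‖X (i.1 ε) - f (X (i.1 ε))‖ ^ 2 := by exact_mod_cast h2
  linarith
def Clm (N A : VN H) (r0 g : BB) (S : SB) (ε : H) (K : ℝ) (c : ℝ≥0∞) : Prop :=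
  ∀ r, Adm N A r0 r → ∀ z, Cen N z → (∀ x, Cen N x → r * x = 0 → z * x = 0) → c * N2 S ε (g * z) ≤ ENNReal.ofReal K * N2 S ε (r * z)
namespace SFN
variable {N A : VN H} {g r0 : BH H} {ε : H} {K : ℝ} {S : Set (BH H)}
local notation "SS" => SFN N g ε K S
theorem exy (s : SS) (hr : r ∈ N) (hq : qS S * r = r) (r1 : r ≠ 0) : ∃ y ∈ N, r * y * g ≠ 0 := by
  by_contra! h
  refine r1 ?_
  rw [← hq, s.QC hr, ← zero_mul (qS S)]
  refine mul_osum s.wp fun i => ?_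
  rw [← mul_assoc, ← (s.w i).2.2, ← mul_assoc, h _ (s.w i).1, zero_mul, zero_mul]
theorem base (s : SS) (hV : ∀ V ∈ N, V * star V * V = V → V * g = V → Adm N A r0 (V * star V) → V = 0) (hA : ∀ a ∈ A, a ∈ N) : Clm N A r0 g S ε K 1 := by
  intro r hr z cz hz
  obtain ⟨W, WN, pi, rW, Wg, hW⟩ := compar s.gp hr.rp s.gN hr.rN
  have WsN : star W ∈ N := vst WN
  obtain ⟨z1, z1p, z1N, z1N', h1, h2⟩ := csup (vsb s.gN (mul_mem WsN WN))
  have c1 : Cen N z1 := ⟨z1N, z1N', z1p⟩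
  have h3 : r * z1 = W * star W * z1 := by rw [← sub_eq_zero, ← sub_mul]; exact h2 _ hW
  have VV : W * z1 * star (W * z1) = r * z1 := by
    rw [star_mul, star_proj z1p, mul_assoc, ← mul_assoc z1, proj_mul z1p, ← c1.c WsN, ← mul_assoc, h3]
  have V0 := hV (W * z1) (mul_mem WN z1N) (by rw [VV, mul_assoc, ← mul_assoc z1, ← c1.c WN, mul_assoc, proj_mul z1p, ← mul_assoc, rW])
    (by rw [mul_assoc, ← c1.c s.gN, ← mul_assoc, Wg]) (VV ▸ hr.mul hA c1)
  have rz : r * z1 = 0 := by rw [← VV, V0, zero_mul]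
  have zz := hz z1 c1 rz
  have h4 : g * z = star W * (W * z) := by
    rw [← sub_eq_zero, ← mul_assoc, ← sub_mul, ← h1, ← c1.c (vsb s.gN (mul_mem WsN WN)), mul_assoc, ← c1.c cz.zN, zz, mul_zero]
  have h5 : star (W * z) = star W * (r * z) := by rw [star_mul, star_proj cz.zp, ← cz.c WsN, ← mul_assoc, star_fix hr.rp rW]
  have pn : ∀ v, ‖star W v‖ ≤ ‖v‖ := pi_norm (by rw [star_star]; exact pi_s pi)
  rw [one_mul, h4]
  refine (N2_contr _ pn).trans ((s.swap (mul_mem WN cz.zN)).trans ?_)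
  rw [h5]
  gcongr
  exact N2_contr _ pn
theorem cutV (s : SS) (hA : ∀ a ∈ A, a ∈ N) (hq : qS S * r0 = r0) (hr : Adm N A r0 r) (r1 : r ≠ 0) (eA : e ∈ A) (ep : Pj e) (er : e * r = r)
    (h : ∀ f ∈ A, Pj f → e * f = f → ∃ z, Cen N z ∧ f * r = z * r) : ∃ V ∈ N, V * star V * V = V ∧ V * g = V ∧ V ≠ 0 ∧ Adm N A r0 (V * star V) := by
  obtain ⟨y, yN, hy⟩ := s.exy hr.rN (by rw [← hr.r0r, ← mul_assoc, hq]) r1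
  obtain ⟨V, hVN, pi, V0, rV, Vg⟩ := pi_cut (q := r) (p := g) (mul_mem (mul_mem hr.rN yN) s.gN) hy (by simp only [← mul_assoc, proj_mul hr.rp]) (by rw [mul_assoc, proj_mul s.gp])
  refine ⟨V, hVN, pi, Vg, V0, mul_mem hVN (vst hVN), pi_r pi, ?_, e, eA, ep, ?_, comm_proj eA ep fun f fA fp ef => ?_⟩
  · rw [← rV]; simp only [← mul_assoc, hr.r0r]
  · rw [← rV]; simp only [← mul_assoc, er]
  · obtain ⟨z, cz, hz⟩ := h f fA fp ef
    have k : f * (V * star V) = z * (V * star V) := by rw [← rV]; simp only [← mul_assoc, hz]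
    have k' := congrArg star k
    simp only [star_mul, star_star, star_proj fp, star_proj cz.zp] at k'
    rw [k, k', cz.c (mul_mem hVN (vst hVN))]
theorem step (s : SS) (hV : ∀ V ∈ N, V * star V * V = V → V * g = V → Adm N A r0 (V * star V) → V = 0) (hA : ∀ a ∈ A, a ∈ N) (hq : qS S * r0 = r0)
    {c : ℝ≥0∞} (hc : Clm N A r0 g S ε K c) : Clm N A r0 g S ε K (2 * c) := by
  intro r hr z0 cz0 hz0
  obtain ⟨S', s1, s2, s3⟩ := max_proj (vnInf N N.commutant) (s := z0) (fun z => 2 * c * N2 S ε (g * z) ≤ ENNReal.ofReal K * N2 S ε (r * z))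
  have ip : ∀ i : S', Pj i.1 := fun i => (s1 i.1 i.2).1
  have ho : ∀ i j : S', i ≠ j → i.1 * j.1 = 0 := s2
  have iN : ∀ i : S', Cen N i.1 := fun i => ⟨(mem_vnInf.1 (s1 i.1 i.2).2.1).1, (mem_vnInf.1 (s1 i.1 i.2).2.1).2, ip i⟩
  have cz : Cen N (osum fun i : S' => i.1) := ⟨osum_mem fun i => (iN i).zN, osum_mem fun i => (iN i).zN', osum_proj⟩
  have zz : z0 * (osum fun i : S' => i.1) = osum fun i : S' => i.1 := osum_le ip fun i => (s1 i.1 i.2).2.2.1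
  have gd : 2 * c * N2 S ε (g * osum fun i : S' => i.1) ≤ ENNReal.ofReal K * N2 S ε (r * osum fun i : S' => i.1) := by
    rw [cz.c s.gN, cz.c hr.rN, N2_osum ip ho, N2_osum ip ho, ← ENNReal.tsum_mul_left, ← ENNReal.tsum_mul_left]
    refine ENNReal.tsum_le_tsum fun i => ?_
    rw [← (iN i).c s.gN, ← (iN i).c hr.rN]
    exact (s1 i.1 i.2).2.2.2
  generalize (osum fun i : S' => i.1) = z at *
  have ct := cz0.sub cz zz
  by_cases rt : r * (z0 - z) = 0
  · have := hz0 _ ct rt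
    rw [mul_sub, proj_mul cz0.zp, zz, sub_eq_zero] at this
    rwa [this]
  · exfalso
    have hr' := hr.mul hA ct
    have zt : z * (z0 - z) = 0 := by rw [mul_sub, ← cz.c cz0.zN, zz, proj_mul cz.zp, sub_self]
    have z0t : z0 * (z0 - z) = z0 - z := by rw [mul_sub, proj_mul cz0.zp, zz]
    obtain ⟨e, eA, ep, er, hcm⟩ := hr'.ex
    have key : ∀ f ∈ A, Pj f → e * f = f → ∃ x, Cen N x ∧ f * (r * (z0 - z)) = x * (r * (z0 - z)) := by
      intro f fA fp ef
      have a1 := hr'.cut hA ep hcm fA fp ef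
      have a2 := hr'.cut hA ep hcm (vsb eA fA) (proj_sub fp ep ef) (by rw [mul_sub, proj_mul ep, ef])
      obtain ⟨z1, c1, h1, h1'⟩ := csupC a1.rN
      obtain ⟨z2, c2, h2, h2'⟩ := csupC a2.rN
      have c12 := c1.mul c2
      have q1 : ∀ x, Cen N x → f * (r * (z0 - z)) * x = 0 → z1 * z2 * x = 0 := fun x cx h => by rw [mul_assoc, cx.c c2.zN, ← mul_assoc, h1' x cx h, zero_mul]
      have q2 : ∀ x, Cen N x → (e - f) * (r * (z0 - z)) * x = 0 → z1 * z2 * x = 0 := fun x cx h => by rw [mul_assoc, h2' x cx h, mul_zero]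
      have e1 := hc _ a1 _ c12 q1
      have e2 := hc _ a2 _ c12 q2
      have tz : (z0 - z) * (z1 * z2) = z1 * z2 := by
        have := q1 (1 - (z0 - z)) (Cen.one.sub ct (one_mul _)) (by rw [mul_assoc, mul_assoc r, mul_sub (z0 - z), mul_one, proj_mul ct.zp, sub_self, mul_zero, mul_zero])
        rw [mul_sub, mul_one, ct.c c12.zN, sub_eq_zero] at this
        exact this.symm
      have h0 : z1 * z2 = 0 := by
        refine s3 _ c12.zp (mem_vnInf.2 ⟨c12.zN, c12.zN'⟩) ?_ ?_ ?_
        · rw [← tz, ← mul_assoc, z0t]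
        · have p := N2_pyth (S := S) (ε := ε) (X := r * (z0 - z) * (z1 * z2)) ep fp ef (by rw [← mul_assoc, er])
          rw [← mul_assoc, ← mul_assoc (e - f)] at p
          have e3 := add_le_add e1 e2
          rw [← mul_add (ENNReal.ofReal K), p, mul_assoc r, tz, ← two_mul, ← mul_assoc] at e3
          exact e3
        · rw [← tz, ← mul_assoc, zt, zero_mul]
      refine ⟨z1, c1, ?_⟩
      have : z1 * (r * (z0 - z)) = z1 * (f * (r * (z0 - z))) + z1 * ((e - f) * (r * (z0 - z))) := by rw [← mul_add, ← add_mul, add_sub_cancel, er]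
      rw [this, h1, ← h2, ← mul_assoc z1, h0, zero_mul, add_zero]
    obtain ⟨V, hVN, pi, Vg, V0, aV⟩ := s.cutV hA hq hr' rt eA ep er key
    exact V0 (hV V hVN pi Vg aV)
theorem endgame (s : SS) (hA : ∀ a ∈ A, a ∈ N) (hq : qS S * r0 = r0) (h0 : r0 ≠ 0) (hr : Adm N A r0 r0) (hf : N2 S ε r0 ≠ ⊤) :
    ∃ V ∈ N, V ≠ 0 ∧ V * star V * V = V ∧ V * g = V ∧ Adm N A r0 (V * star V) := by
  by_contra! hV
  have hV' : ∀ V ∈ N, V * star V * V = V → V * g = V → Adm N A r0 (V * star V) → V = 0 := fun V hVN pi Vg a => by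
    by_contra V0; exact hV V hVN V0 pi Vg a
  have all : ∀ n : ℕ, Clm N A r0 g S ε K (2 ^ n) := fun n => by
    induction n with
    | zero => simpa using s.base hV' hA
    | succ n ih => rw [pow_succ']; exact s.step hV' hA hq ih
  obtain ⟨z, cz, zr, hz⟩ := csupC hr.rN
  have e1 : ∀ n : ℕ, 2 ^ n * N2 S ε (g * z) ≤ ENNReal.ofReal K * N2 S ε r0 := fun n => by
    have := all n r0 hr z cz hz
    rwa [cz.c hr.rN, zr] at this
  have n0 : N2 S ε (g * z) = 0 := by
    by_contra n0
    have ht : Tendsto (fun n : ℕ => (2 : ℝ≥0∞) ^ n * N2 S ε (g * z)) atTop (𝓝 (⊤ * N2 S ε (g * z))) :=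
      ENNReal.Tendsto.mul_const (ENNReal.tendsto_pow_atTop_nhds_top_iff.2 (by norm_num)) (Or.inl (by simp))
    rw [ENNReal.top_mul n0] at ht
    have := le_of_tendsto' ht e1
    exact (ENNReal.mul_lt_top ENNReal.ofReal_lt_top hf.lt_top).ne (top_le_iff.1 this)
  have g0 : g * z = 0 := by
    have := s.zero (mul_mem s.gN cz.zN) n0
    have q1 := s.Q 1 (one_mem _)
    rw [one_mul] at q1
    rw [← s.QC (mul_mem s.gN cz.zN), ← mul_assoc, q1] at this
    exact this
  obtain ⟨y, yN, hy⟩ := s.exy hr.rN hq h0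
  refine hy ?_
  rw [← zr, ← cz.c hr.rN, mul_assoc r0, ← cz.c yN, mul_assoc, mul_assoc, ← cz.c s.gN, g0, mul_zero, mul_zero]
end SFN
namespace Dat
theorem setup (d : DD) {K : ℝ} (K0 : 0 < K) (fB : f ∈ B) (fp : Pj f)
    (h : ∀ X ∈ B, f * X = X → X * f = X → ‖star X ξ‖ ^ 2 ≤ K * ‖X ξ‖ ^ 2) : ∃ S, SFN 𝒩 (f * eB) (f ξ) K S := by
  have fe := d.eb fB
  have eξ := eξ (B := B) (ξ := ξ)
  have fN := d.MN (d.BM fB)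
  refine mkSFN K0 (mul_mem fN d.eN) (comm_pr_mul fp (pr_proj _) fe) (by rw [mapp, ← mapp eB, ← fe, mapp, eξ, ← mapp, proj_mul fp]) ?_ ?_
  · intro X hX h1 h2
    have eX : eB * X = X := by rw [← h1, fe, mul_assoc, ← mul_assoc eB eB, proj_mul (pr_proj _)]
    have Xe : X * eB = X := by rw [← h2, mul_assoc, mul_assoc, proj_mul (pr_proj _)]
    obtain ⟨k, kB, hk, -⟩ := d.eNe hX
    rw [eX, Xe] at hk
    have fX : f * X = X := by rw [← h1, ← mul_assoc, ← mul_assoc, proj_mul fp]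
    have Xf : X * f = X := by rw [← h2, fe, mul_assoc, mul_assoc, proj_mul fp]
    have fk : f * k = k := d.sepe (d.BM (mul_mem fB kB)) (d.BM kB) (by rw [mul_assoc, ← hk, fX])
    have kf : k * f = k := d.sepe (d.BM (mul_mem kB fB)) (d.BM kB) (by rw [mul_assoc, fe, ← mul_assoc, ← hk, Xf])
    have a1 : X (f ξ) = k ξ := by rw [← mapp, Xf, hk, mapp, eξ]
    have a2 : star X (f ξ) = star k ξ := by
      rw [← mapp, star_fix fp fX, hk, star_mul, star_proj (pr_proj _), ← d.eb (vst kB), mapp, eξ]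
    rw [a1, a2]; exact h k kB fk kf
  · intro X hX h1 h2
    rw [← h1, ← mul_assoc]
    have := d.ext (X := X * f) (Y := 0) (mul_mem hX fN) (vze _) (by rw [mapp, h2]; rfl)
    rw [this, zero_mul]
theorem setup2 (d : DD) (t : TD) (fB : f ∈ B) (fp : Pj f) (hT : T * f ≠ 0) : ∃ p, PD sf B A T p ∧ ∃ x ∈ 𝒩, sf.c p * x * (f * eB) ≠ 0 := by
  obtain ⟨z, zp, zB, zB', zf, hz⟩ := csup fB
  obtain ⟨p, q, pz⟩ := d.exPD t zB zB' zp (fun h => hT (by rw [← zf, ← mul_assoc, h, zero_mul]))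
  exact ⟨p, q, d.nv q fB zp zB zB' pz hz⟩
end Dat
theorem N2_add_sub {S : SB} {ε : H} (X Y : BB) : N2 S ε (X + Y) + N2 S ε (X - Y) = 2 * (N2 S ε X + N2 S ε Y) := by
  unfold N2
  rw [← ENNReal.tsum_add, ← ENNReal.tsum_add, ← ENNReal.tsum_mul_left]
  refine tsum_congr fun i => ?_
  rw [← ENNReal.ofReal_add (by positivity) (by positivity), ← ENNReal.ofReal_add (by positivity) (by positivity), ← ENNReal.ofReal_ofNat 2, ← ENNReal.ofReal_mul (by norm_num)]
  congr 1
  have := parallelogram_law_with_norm ℂ (X (i.1 ε)) (Y (i.1 ε))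
  rw [Aadd, Asub]
  nlinarith [this]
theorem N2_smul {S : SB} {ε : H} (c : ℂ) (X : BB) : N2 S ε (c • X) = ENNReal.ofReal (‖c‖ ^ 2) * N2 S ε X := by
  unfold N2
  rw [← ENNReal.tsum_mul_left]
  refine tsum_congr fun i => ?_
  rw [← ENNReal.ofReal_mul (by positivity), Asmul, norm_smul, mul_pow]
def sN (G : SB) (S : SB) (ε : H) (Y : BB) : ℝ≥0∞ := ⨆ u : G, N2 S ε (Y * u.1)
structure GG (N : VN H) (G : SB) : Prop where
  one : 1 ∈ G
  mul : ∀ u ∈ G, ∀ v ∈ G, u * v ∈ G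
  st : ∀ u ∈ G, star u ∈ G
  un : ∀ u ∈ G, u * star u = 1
  mem : ∀ u ∈ G, u ∈ N
theorem GG.un' {G : SB} (h : GG N G) (hu : u ∈ G) : star u * u = 1 := by
  have := h.un _ (h.st u hu); rwa [star_star] at this
theorem GG.norm {G : SB} (h : GG N G) (hu : u ∈ G) (v : H) : ‖u v‖ ≤ ‖v‖ := pi_norm (by rw [h.un u hu, one_mul]) v
theorem GG.N2 {G S : SB} {ε : H} (h : GG N G) (hu : u ∈ G) (Y : BB) : N2 S ε (u * Y) = N2 S ε Y := by
  refine le_antisymm (N2_contr _ (h.norm hu)) ?_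
  conv_lhs => rw [← one_mul Y, ← h.un' hu, mul_assoc]
  exact N2_contr _ (h.norm (h.st u hu))
theorem GG.sN {G S : SB} {ε : H} (h : GG N G) (hu : u ∈ G) (Y : BB) : sN G S ε (u * Y * star u) ≤ sN G S ε Y := by
  refine iSup_le fun v => ?_
  rw [mul_assoc, mul_assoc, h.N2 hu]
  exact le_iSup (fun w : G => AFP.N2 S ε (Y * w.1)) ⟨star u * v.1, h.mul _ (h.st u hu) _ v.2⟩
theorem near_e {a b m δ : ℝ≥0∞} (hm : m ≠ ⊤) (h1 : 4 * m ≤ a + 4 * δ) (h2 : a + b ≤ 4 * m + 4 * δ) : b ≤ 8 * δ := by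
  have h3 : b + 4 * m ≤ 8 * δ + 4 * m := calc
    b + 4 * m ≤ b + (a + 4 * δ) := by gcongr
    _ = a + b + 4 * δ := by ring
    _ ≤ 4 * m + 4 * δ + 4 * δ := by gcongr
    _ = _ := by ring
  exact (ENNReal.add_le_add_iff_right (ENNReal.mul_ne_top (by norm_num) hm)).1 h3
namespace SFN
variable {g : BH H} {ε : H} {K : ℝ} {S G : Set (BH H)}
local notation "SS" => SFN N g ε K S
theorem near (s : SS) (hG : GG N G) {Y' : BB} {m δ : ℝ≥0∞} (hm : m ≠ ⊤) (δ0 : δ ≠ 0) (hY : IsSelfAdjoint Y) (hY' : IsSelfAdjoint Y') (YN : Y ∈ N) (YN' : Y' ∈ N)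
    (h : m ≤ sN G S ε ((1 / 2 : ℂ) • (Y + Y'))) (h1 : sN G S ε Y ≤ m + δ) (h2 : sN G S ε Y' ≤ m + δ) : N2 S ε (Y - Y') ≤ ENNReal.ofReal K * (8 * δ) := by
  have ⟨u, hu, hh⟩ : ∃ u ∈ G, m ≤ N2 S ε ((1 / 2 : ℂ) • (Y + Y') * u) + δ := by
    by_contra! hc
    have k : sN G S ε ((1 / 2 : ℂ) • (Y + Y')) ≤ m - δ := iSup_le fun u => ENNReal.le_sub_of_add_le_right (ne_top_of_le_ne_top hm (le_add_self.trans (hc u.1 u.2).le)) (hc u.1 u.2).le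
    exact (h.trans k).not_gt (ENNReal.sub_lt_self hm (ne_bot_of_gt (hc 1 hG.one)) δ0)
  have e1 := N2_add_sub (S := S) (ε := ε) (Y * u) (Y' * u)
  have e2 : N2 S ε (Y * u + Y' * u) = 4 * N2 S ε ((1 / 2 : ℂ) • (Y + Y') * u) := by
    rw [smul_mul_assoc, N2_smul, ← mul_assoc, add_mul, ← ENNReal.ofReal_ofNat 4, ← ENNReal.ofReal_mul (by norm_num)]
    norm_num
  have l1 := (le_iSup (fun w : G => N2 S ε (Y * w.1)) ⟨u, hu⟩).trans h1
  have l2 := (le_iSup (fun w : G => N2 S ε (Y' * w.1)) ⟨u, hu⟩).trans h2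
  have e3 : N2 S ε (Y * u - Y' * u) ≤ 8 * δ := by
    refine near_e (a := N2 S ε (Y * u + Y' * u)) hm ?_ ?_
    · rw [e2, ← mul_add]; gcongr
    · rw [e1]
      calc 2 * (N2 S ε (Y * u) + N2 S ε (Y' * u)) ≤ 2 * ((m + δ) + (m + δ)) := by gcongr
        _ = _ := by ring
  rw [← hG.N2 (hG.st u hu) (Y - Y')]
  refine (s.swap (mul_mem (hG.mem _ (hG.st u hu)) (vsb YN YN'))).trans ?_
  rw [star_mul, star_star, star_sub, hY.star_eq, hY'.star_eq, sub_mul]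
  gcongr
theorem cauchy (s : SS) {Y : ℕ → BB} (Y1 : ∀ n v, ‖Y n v‖ ≤ ‖v‖) (YN : ∀ n, Y n ∈ N) (Yq : ∀ n, Y n * qS S = Y n) (h : ∀ i : S, CauchySeq fun n => Y n (i.1 ε)) (v : H) : CauchySeq fun n => Y n v := by
  obtain ⟨W, hW⟩ : ∃ W : Submodule ℂ H, ∀ v, v ∈ W ↔ CauchySeq fun n => Y n v := ⟨
    { carrier := {v | CauchySeq fun n => Y n v}
      add_mem' := fun {a b} ha hb => by
        have := CauchySeq.add ha hb
        simpa [Pi.add_def] using this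
      zero_mem' := by simpa using cauchySeq_const (0 : H)
      smul_mem' := fun c v hv => by
        have := (show CauchySeq (fun n => Y n v) from hv).map (uniformContinuous_const_smul c)
        show CauchySeq fun n => Y n (c • v)
        simp only [map_smul]
        exact this }, fun _ => Iff.rfl⟩
  have Wc : ∀ x ∈ W.topologicalClosure, x ∈ W := fun x hx => by
    rw [hW, Metric.cauchySeq_iff]
    intro e e0
    obtain ⟨y, yW, hy⟩ := Metric.mem_closure_iff.1 hx (e / 4) (by positivity)
    obtain ⟨n0, hn⟩ := Metric.cauchySeq_iff.1 ((hW y).1 yW) (e / 4) (by positivity)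
    refine ⟨n0, fun n h1 m h2 => ?_⟩
    have a := hn n h1 m h2
    have b : ∀ k, dist (Y k x) (Y k y) < e / 4 := fun k => by
      rw [dist_eq_norm, ← map_sub]; rw [dist_eq_norm] at hy; exact (Y1 k _).trans_lt hy
    have c := b m
    rw [dist_comm] at c
    linarith [dist_triangle4 (Y n x) (Y n y) (Y m y) (Y m x), b n]
  have ker : (1 - pr (Submodule.span ℂ (orbG N.commutant {z | ∃ i : S, i.1 ε = z}))) * qS S = 0 :=
    s.wsep (vsb (one_mem N) (pr_orbG_mem N _)) fun i => by
      rw [Asub, pr_orbG_self (show i.1 ε ∈ {z | ∃ i : S, i.1 ε = z} from ⟨i, rfl⟩)]; simp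
  have le : Submodule.span ℂ (orbG N.commutant {z | ∃ i : S, i.1 ε = z}) ≤ W := Submodule.span_le.2 fun z hz => by
    obtain ⟨a, ⟨i, hi⟩, y, hy, rfl⟩ := hz
    subst hi
    refine (hW _).2 ?_
    have : (fun n => Y n (y (i.1 ε))) = fun n => y (Y n (i.1 ε)) := funext fun n => (comm_app hy (YN n) _).symm
    rw [this]
    exact (h i).map y.uniformContinuous
  have q : qS S v ∈ W := by
    refine Wc _ (Submodule.topologicalClosure_mono le ?_)
    rw [← sub_fix ker, mapp]; exact pr_mem _ _
  have := (hW _).1 q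
  simpa only [← mapp, Yq] using this
theorem avg (s : SS) (hG : GG N G) {L : SB} {C : ℝ≥0∞} (hC : C ≠ ⊤) (mid : ∀ X ∈ L, ∀ Y ∈ L, (1 / 2 : ℂ) • (X + Y) ∈ L) (cj : ∀ u ∈ G, ∀ Y ∈ L, u * Y * star u ∈ L)
    (ne : L.Nonempty) (hL : ∀ Y ∈ L, Y ∈ N ∧ 0 ≤ Y ∧ Y ≤ 1 ∧ Y * qS S = Y ∧ N2 S ε Y ≤ C) :
    ∃ Y : ℕ → BB, ∃ d, (∀ n, Y n ∈ L) ∧ (∀ v, Tendsto (fun n => Y n v) atTop (𝓝 (d v))) ∧ d ∈ N ∧ (∀ u ∈ G, u * d = d * u) ∧ N2 S ε d ≤ C := by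
  have fin : ∀ Y ∈ L, sN G S ε Y ≤ ENNReal.ofReal K * C := fun Y hY => iSup_le fun u => by
    refine (s.swap (mul_mem (hL Y hY).1 (hG.mem _ u.2))).trans ?_
    rw [star_mul, (sa_of_nonneg (hL Y hY).2.1).star_eq, hG.N2 (hG.st _ u.2)]
    gcongr
    exact (hL Y hY).2.2.2.2
  obtain ⟨m, hmd⟩ : ∃ m, m = ⨅ Y : L, sN G S ε Y.1 := ⟨_, rfl⟩
  have ml : ∀ Y ∈ L, m ≤ sN G S ε Y := fun Y hY => hmd ▸ iInf_le (fun Y : L => sN G S ε Y.1) ⟨Y, hY⟩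
  have mt : m ≠ ⊤ := by
    obtain ⟨Y, hY⟩ := ne
    exact ne_top_of_le_ne_top (ENNReal.mul_ne_top ENNReal.ofReal_ne_top hC) ((ml Y hY).trans (fin Y hY))
  have nr : ∀ δ : ℝ≥0∞, δ ≠ 0 → ∀ X ∈ L, ∀ Y ∈ L, sN G S ε X ≤ m + δ → sN G S ε Y ≤ m + δ → N2 S ε (X - Y) ≤ ENNReal.ofReal K * (8 * δ) := fun δ δ0 X hX Y hY h1 h2 =>
    s.near hG mt δ0 (sa_of_nonneg (hL X hX).2.1) (sa_of_nonneg (hL Y hY).2.1) (hL X hX).1 (hL Y hY).1 (ml _ (mid X hX Y hY)) h1 h2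
  have ex : ∀ n : ℕ, ∃ Y ∈ L, sN G S ε Y ≤ m + ((n : ℝ≥0∞) + 1)⁻¹ := fun n => by
    have : (⨅ Y : L, sN G S ε Y.1) < m + ((n : ℝ≥0∞) + 1)⁻¹ := by
      rw [← hmd]; exact ENNReal.lt_add_right mt (ENNReal.inv_ne_zero.2 (by finiteness))
    obtain ⟨Y, hY⟩ := iInf_lt_iff.1 this
    exact ⟨Y.1, Y.2, hY.le⟩
  choose Y YL hY using ex
  have pt : ∀ (D : BB) (i : S), ENNReal.ofReal (‖D (i.1 ε)‖ ^ 2) ≤ N2 S ε D := fun D i => ENNReal.le_tsum i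
  have small : ∀ e : ℝ, 0 < e → ∃ n : ℕ, ∀ D : BB, N2 S ε D ≤ ENNReal.ofReal K * (8 * ((n : ℝ≥0∞) + 1)⁻¹) → ∀ i : S, ‖D (i.1 ε)‖ < e := fun e e0 => by
    obtain ⟨n, hn⟩ := exists_nat_gt (K * 8 / e ^ 2)
    refine ⟨n, fun D hD i => ?_⟩
    have h1 := (pt D i).trans hD
    have h2 : ENNReal.ofReal K * (8 * ((n : ℝ≥0∞) + 1)⁻¹) = ENNReal.ofReal (K * (8 * ((n : ℝ) + 1)⁻¹)) := by
      rw [ENNReal.ofReal_mul s.K0.le, ENNReal.ofReal_mul (by norm_num), ENNReal.ofReal_inv_of_pos (by positivity), ENNReal.ofReal_add (by positivity) (by norm_num)]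
      simp
    rw [h2, ENNReal.ofReal_le_ofReal_iff (by have := s.K0; positivity)] at h1
    refine lt_of_pow_lt_pow_left₀ 2 e0.le (h1.trans_lt ?_)
    rw [div_lt_iff₀ (by positivity)] at hn
    rw [← mul_assoc, ← div_eq_mul_inv, div_lt_iff₀ (by positivity)]
    nlinarith [sq_nonneg e]
  have mono : ∀ n k : ℕ, n ≤ k → sN G S ε (Y k) ≤ m + ((n : ℝ≥0∞) + 1)⁻¹ := fun n k h => (hY k).trans (by gcongr)
  have p0 : ∀ n : ℕ, ((n : ℝ≥0∞) + 1)⁻¹ ≠ 0 := fun n => ENNReal.inv_ne_zero.2 (by finiteness)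
  have Y1 : ∀ n v, ‖Y n v‖ ≤ ‖v‖ := fun n v => by
    have := (CStarAlgebra.norm_le_one_iff_of_nonneg (Y n) (hL _ (YL n)).2.1).2 (hL _ (YL n)).2.2.1
    exact ((Y n).le_opNorm v).trans (mul_le_of_le_one_left (norm_nonneg _) this)
  have ci : ∀ i : S, CauchySeq fun n => Y n (i.1 ε) := fun i => by
    rw [Metric.cauchySeq_iff]
    intro e e0
    obtain ⟨n, hn⟩ := small e e0
    refine ⟨n, fun a ha b hb => ?_⟩
    have := hn (Y a - Y b) (nr _ (p0 n) _ (YL a) _ (YL b) (mono n a ha) (mono n b hb)) i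
    rwa [dist_eq_norm]
  have lim : ∀ v, ∃ w, Tendsto (fun n => Y n v) atTop (𝓝 w) := fun v => cauchySeq_tendsto_of_complete (s.cauchy Y1 (fun n => (hL _ (YL n)).1) (fun n => (hL _ (YL n)).2.2.2.1) ci v)
  choose f hf using lim
  obtain ⟨d, hd⟩ : ∃ d : BB, ∀ v, d v = f v := ⟨continuousLinearMapOfTendsto Y (tendsto_pi_nhds.2 hf), fun v => rfl⟩
  have hd' : ∀ v, Tendsto (fun n => Y n v) atTop (𝓝 (d v)) := fun v => hd v ▸ hf v
  have dN : d ∈ N := vn_iff.2 fun y hy => ContinuousLinearMap.ext fun v => by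
    refine tendsto_nhds_unique ((y.continuous.tendsto _).comp (hd' v)) ((hd' (y v)).congr fun n => ?_)
    exact (comm_app hy (hL _ (YL n)).1 v).symm
  have dq : d * qS S = d := ContinuousLinearMap.ext fun v => tendsto_nhds_unique ((hd' (qS S v)).congr fun n => by rw [← mapp, (hL _ (YL n)).2.2.2.1]) (hd' v)
  refine ⟨Y, d, YL, hd', dN, fun u hu => ?_, ?_⟩
  · have k : (u * d * star u - d) * qS S = 0 := s.wsep (vsb (mul_mem (mul_mem (hG.mem u hu) dN) (hG.mem _ (hG.st u hu))) dN) fun i => by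
      have t1 : Tendsto (fun n => (u * Y n * star u - Y n) (i.1 ε)) atTop (𝓝 ((u * d * star u - d) (i.1 ε))) := by
        exact ((u.continuous.tendsto _).comp (hd' (star u (i.1 ε)))).sub (hd' (i.1 ε))
      refine tendsto_nhds_unique t1 (Metric.tendsto_atTop.2 fun e e0 => ?_)
      obtain ⟨n, hn⟩ := small e e0
      refine ⟨n, fun k hk => ?_⟩
      rw [dist_zero_right]
      exact hn _ (nr _ (p0 n) _ (cj u hu _ (YL k)) _ (YL k) ((hG.sN hu _).trans (mono n k hk)) (mono n k hk)) i
    rw [sub_mul, dq, mul_assoc, ← s.QC (hG.mem _ (hG.st u hu)), ← mul_assoc, mul_assoc u d, dq, sub_eq_zero] at k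
    calc u * d = u * d * star u * u := by rw [mul_assoc (u * d), hG.un' hu, mul_one]
      _ = _ := by rw [k]
  · unfold N2
    rw [ENNReal.tsum_eq_iSup_sum]
    refine iSup_le fun a => ?_
    have t2 : Tendsto (fun n => ∑ i ∈ a, ENNReal.ofReal (‖Y n (i.1 ε)‖ ^ 2)) atTop (𝓝 (∑ i ∈ a, ENNReal.ofReal (‖d (i.1 ε)‖ ^ 2))) :=
      tendsto_finset_sum _ fun i _ => ENNReal.tendsto_ofReal ((hd' _).norm.pow 2)
    exact le_of_tendsto' t2 fun n => (ENNReal.sum_le_tsum a).trans (hL _ (YL n)).2.2.2.2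
end SFN
theorem sym_un (hq : Pj q) : star (1 - (q + q)) = 1 - (q + q) ∧ (1 - (q + q)) * (1 - (q + q)) = 1 := by
  refine ⟨by rw [star_sub, star_add, star_one, star_proj hq], ?_⟩
  simp only [sub_mul, mul_sub, add_mul, mul_add, one_mul, mul_one, proj_mul hq]; abel
theorem sym_comm (h : (1 - (q + q)) * x = x * (1 - (q + q))) : q * x = x * q := by
  rw [sub_mul, mul_sub, one_mul, mul_one, sub_right_inj, add_mul, mul_add, ← two_smul ℂ, ← two_smul ℂ (x * q)] at h
  exact smul_right_injective _ (by norm_num : (2 : ℂ) ≠ 0) h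
theorem fix_of (pi : V * star V * V = V) (h : q * (V * star V) = V * star V) : q * V = V := by
  rw [← pi, ← mul_assoc, h]
namespace Dat
theorem fin1 (d : DD) (t : TD) (q : PD sf B A T p) {K : ℝ} {S : SB} {d0 : BB} (s : SFN 𝒩 (f * eB) (f ξ) K S) (eA : e ∈ A) (ep : Pj e) (dN : d0 ∈ 𝒩) (dp : 0 ≤ d0)
    (hd : d0 ≠ 0) (com : ∀ u ∈ A, u * star u = 1 → star u * u = 1 → u * e = e * u → u * d0 = d0 * u) (hf : N2 S (f ξ) d0 ≠ ⊤) (pd : sf.c p * d0 = d0) (ed : e * d0 = d0) (qd : qS S * d0 = d0) :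
    ∃ e v, INT M₁ B A ξ e v := by
  have hA : ∀ a ∈ A, a ∈ 𝒩 := fun a ha => d.MN (d.leM (d.leA ha))
  obtain ⟨r0, g, rp, r1, gs, rg, gdg, hN, hq, -⟩ := inv_cut dp hd
  have gN := (hN _ dN).2
  have fr : N2 S (f ξ) r0 ≠ ⊤ := by
    rw [← gdg, mul_assoc]
    refine ne_top_of_le_ne_top ?_ (N2_mul _ _)
    refine ENNReal.mul_ne_top ENNReal.ofReal_ne_top (ne_top_of_le_ne_top ?_ (s.swap (mul_mem dN gN)))
    rw [star_mul, gs, (sa_of_nonneg dp).star_eq]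
    exact ENNReal.mul_ne_top ENNReal.ofReal_ne_top (ne_top_of_le_ne_top (ENNReal.mul_ne_top ENNReal.ofReal_ne_top hf) (N2_mul _ _))
  have adm : Adm 𝒩 A r0 r0 := by
    refine ⟨(hN _ dN).1, rp, proj_mul rp, e, eA, ep, hq e ep ed, comm_proj eA ep fun x xA xp ex => ?_⟩
    obtain ⟨h1, h2⟩ := sym_un xp
    have xe := proj_swap xp ep ex
    have k := com (1 - (x + x)) (vsb (one_mem A) (add_mem xA xA)) (by rw [h1, h2]) (by rw [h1, h2])
      (by rw [sub_mul, mul_sub, add_mul, mul_add, ex, xe, one_mul, mul_one])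
    exact sym_comm (comm_of_mem (fun N h => (hN N h).1) k (by rw [h1, k]))
  obtain ⟨V, hVN, V0, pi, Vg, a⟩ := s.endgame hA (hq _ s.Qp qd) r1 adm fr
  obtain ⟨e', eA', ep', er, hc⟩ := a.ex
  have rV := fix_of pi a.r0r
  exact d.mkINT t q hVN pi V0 (by rw [← rV, ← mul_assoc, hq _ (sf.c_proj q.pp) pd])
    (by rw [← Vg, mul_assoc, mul_assoc, proj_mul (pr_proj _)]) eA' ep' (fix_of pi er) hc
end Dat
def DS (M₁ : VN H) (P : BB) : Submodule ℂ BB := Submodule.span ℂ {x | ∃ a ∈ M₁, ∃ b ∈ M₁, x = a * P * b}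
theorem DS.mk (ha : a ∈ M₁) (hb : b ∈ M₁) : a * P * b ∈ DS M₁ P := Submodule.subset_span ⟨a, ha, b, hb, rfl⟩
theorem DS.ind {Q : BB → Prop} (h : ∀ a ∈ M₁, ∀ b ∈ M₁, Q (a * P * b)) (h0 : Q 0) (hadd : ∀ x ∈ DS M₁ P, ∀ y ∈ DS M₁ P, Q x → Q y → Q (x + y)) (hs : ∀ (c : ℂ), ∀ x ∈ DS M₁ P, Q x → Q (c • x)) (hk : k ∈ DS M₁ P) : Q k := by
  unfold DS at hk
  induction hk using Submodule.span_induction with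
  | mem x hx => obtain ⟨a, ha, b, hb, rfl⟩ := hx; exact h a ha b hb
  | zero => exact h0
  | add x y hx hy h1 h2 => exact hadd x hx y hy h1 h2
  | smul c x hx h1 => exact hs c x hx h1
namespace Dat
theorem DC (d : DD) (hk : k ∈ DS M₁ P) : k ∈ (sf.cv M₁).commutant :=
  DS.ind (fun a ha b hb => mul_mem (mul_mem (d.MC (d.leM ha)) d.PC) (d.MC (d.leM hb))) (vze _) (fun x _ y _ h1 h2 => vad h1 h2) (fun c x _ h => vn_smul c h) hk
theorem Dl (d : DD) (ha : a ∈ M₁) (hk : k ∈ DS M₁ P) : a * k ∈ DS M₁ P :=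
  DS.ind (Q := fun k => a * k ∈ DS M₁ P) (fun x hx b hb => by rw [← mul_assoc, ← mul_assoc]; exact DS.mk (mul_mem ha hx) hb) (by rw [mul_zero]; exact zero_mem _) (fun x _ y _ h1 h2 => by rw [mul_add]; exact add_mem h1 h2)
    (fun c x _ h => by rw [mul_smul_comm]; exact Submodule.smul_mem _ _ h) hk
theorem Dr (d : DD) (ha : a ∈ M₁) (hk : k ∈ DS M₁ P) : k * a ∈ DS M₁ P :=
  DS.ind (Q := fun k => k * a ∈ DS M₁ P) (fun x hx b hb => by rw [mul_assoc]; exact DS.mk hx (mul_mem hb ha)) (by rw [zero_mul]; exact zero_mem _) (fun x _ y _ h1 h2 => by rw [add_mul]; exact add_mem h1 h2)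
    (fun c x _ h => by rw [smul_mul_assoc]; exact Submodule.smul_mem _ _ h) hk
theorem Dm (d : DD) (hk : k ∈ DS M₁ P) (hl : l ∈ DS M₁ P) : k * l ∈ DS M₁ P := by
  refine DS.ind (Q := fun k => k * l ∈ DS M₁ P) (fun a ha b hb => ?_) (by rw [zero_mul]; exact zero_mem _) (fun x _ y _ h1 h2 => by rw [add_mul]; exact add_mem h1 h2)
    (fun c x _ h => by rw [smul_mul_assoc]; exact Submodule.smul_mem _ _ h) hk
  refine DS.ind (Q := fun l => a * P * b * l ∈ DS M₁ P) (fun a' ha' b' hb' => ?_) (by rw [mul_zero]; exact zero_mem _) (fun x _ y _ h1 h2 => by rw [mul_add]; exact add_mem h1 h2)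
    (fun c x _ h => by rw [mul_smul_comm]; exact Submodule.smul_mem _ _ h) hl
  have h1 := d.PE _ (mul_mem hb ha')
  have : a * P * b * (a' * P * b') = a * (P * (b * a') * P) * b' := by simp only [mul_assoc]
  rw [this, h1, ← mul_assoc]
  exact DS.mk (mul_mem ha (d.le (d.ceE.maps_to _ (mul_mem (d.leM hb) (d.leM ha'))))) hb'
theorem to0 (d : DD) {β : ℕ → BB} {R : ℝ} (hM : ∀ n, β n ∈ M) (hR : ∀ n, ‖β n‖ ≤ R) (h : Tendsto (fun n => β n ξ) atTop (𝓝 0)) (ζ : H) : Tendsto (fun n => β n ζ) atTop (𝓝 0) := by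
  have hR0 : 0 ≤ R := (norm_nonneg _).trans (hR 0)
  have hz : ζ ∈ (orb M.commutant ξ).topologicalClosure := by rw [← pr_eq_self, StandardForm.dense_comm d.g.sep]; rfl
  rw [Metric.tendsto_atTop]
  intro e e0
  obtain ⟨z, zW, hy⟩ := Metric.mem_closure_iff.1 hz (e / (2 * (R + 1))) (by positivity)
  obtain ⟨y, hy', rfl⟩ := mem_orb.1 zW
  have t2 : Tendsto (fun n => β n (y ξ)) atTop (𝓝 0) := by
    have : (fun n => β n (y ξ)) = fun n => y (β n ξ) := funext fun n => (comm_app hy' (hM n) _).symm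
    rw [this]; have := (y.continuous.tendsto 0).comp h
    rwa [map_zero] at this
  obtain ⟨n0, hn⟩ := Metric.tendsto_atTop.1 t2 (e / 2) (by positivity)
  refine ⟨n0, fun n h1 => ?_⟩
  have a := hn n h1
  rw [dist_zero_right] at a ⊢
  rw [dist_eq_norm] at hy
  have b : ‖β n (ζ - y ξ)‖ ≤ R * ‖ζ - y ξ‖ := ((β n).le_opNorm _).trans (by gcongr; exact hR n)
  have c : (R + 1) * ‖ζ - y ξ‖ ≤ e / 2 := by
    have := mul_le_mul_of_nonneg_left hy.le (by positivity : 0 ≤ R + 1)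
    refine this.trans (le_of_eq ?_); field_simp
  have e1 : β n ζ = β n (ζ - y ξ) + β n (y ξ) := by rw [map_sub, sub_add_cancel]
  rw [e1]
  have := norm_nonneg (ζ - y ξ)
  linarith [norm_add_le (β n (ζ - y ξ)) (β n (y ξ))]
theorem F0 (d : DD) (t : TD) {Y' : ℕ → BB} (YC : ∀ n, Y' n ∈ (sf.cv M₁).commutant)
    (h : ∀ a ∈ M₁, ∀ b ∈ M₁, ∃ R : ℝ, ∃ β : ℕ → BB, (∀ n, β n ∈ B ∧ ‖β n‖ ≤ R ∧ P * a * Y' n * b * P = β n * P) ∧ Tendsto (fun n => β n ξ) atTop (𝓝 0)) (hk : k ∈ DS M₁ P) (hl : l ∈ DS M₁ P) :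
    Tendsto (fun n => ⟪ξ, Ψ (k * Y' n * l) ξ⟫) atTop (𝓝 0) := by
  have add : ∀ X Z : ℕ → BB, (∀ n, X n ∈ (sf.cv M₁).commutant) → (∀ n, Z n ∈ (sf.cv M₁).commutant) → Tendsto (fun n => ⟪ξ, Ψ (X n) ξ⟫) atTop (𝓝 0) → Tendsto (fun n => ⟪ξ, Ψ (Z n) ξ⟫) atTop (𝓝 0) → Tendsto (fun n => ⟪ξ, Ψ (X n + Z n) ξ⟫) atTop (𝓝 0) := fun X Z hX hZ h1 h2 => by
    have := h1.add h2
    rw [add_zero] at this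
    refine this.congr fun n => ?_
    rw [d.ceΨ.map_add _ (hX n) _ (hZ n), Aadd, inner_add_right]
  have sm : ∀ (c : ℂ) (X : ℕ → BB), (∀ n, X n ∈ (sf.cv M₁).commutant) → Tendsto (fun n => ⟪ξ, Ψ (X n) ξ⟫) atTop (𝓝 0) → Tendsto (fun n => ⟪ξ, Ψ (c • X n) ξ⟫) atTop (𝓝 0) := fun c X hX h1 => by
    have := h1.const_mul c
    rw [mul_zero] at this
    refine this.congr fun n => ?_
    rw [d.ceΨ.map_smul _ _ (hX n), Asmul, inner_smul_right]
  have z0 : Tendsto (fun n : ℕ => ⟪ξ, Ψ 0 ξ⟫) atTop (𝓝 0) := by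
    rw [d.ceΨ.zero, Azero, inner_zero_right]; exact tendsto_const_nhds
  have mm : ∀ {k l : BB}, k ∈ DS M₁ P → l ∈ DS M₁ P → ∀ n, k * Y' n * l ∈ (sf.cv M₁).commutant := fun hk hl n => mul_mem (mul_mem (d.DC hk) (YC n)) (d.DC hl)
  refine DS.ind (Q := fun k => Tendsto (fun n => ⟪ξ, Ψ (k * Y' n * l) ξ⟫) atTop (𝓝 0)) (fun a ha b hb => ?_) (by simpa only [zero_mul] using z0) (fun x hx y hy h1 h2 => by simpa only [add_mul] using add _ _ (mm hx hl) (mm hy hl) h1 h2)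
    (fun c x hx h => by simpa only [smul_mul_assoc] using sm c _ (mm hx hl) h) hk
  have hk' : a * P * b ∈ DS M₁ P := DS.mk ha hb
  refine DS.ind (Q := fun l => Tendsto (fun n => ⟪ξ, Ψ (a * P * b * Y' n * l) ξ⟫) atTop (𝓝 0)) (fun a' ha' b' hb' => ?_) (by simpa only [mul_zero] using z0) (fun x hx y hy h1 h2 => by simpa only [mul_add] using add _ _ (mm hk' hx) (mm hk' hy) h1 h2)
    (fun c x hx h => by simpa only [mul_smul_comm] using sm c _ (mm hk' hx) h) hl
  obtain ⟨R, β, hβ, h0⟩ := h b hb a' ha'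
  have t0 := d.to0 (fun n => d.BM (hβ n).1) (fun n => (hβ n).2.1) h0 (T (b' η))
  have t1 : Tendsto (fun n => ⟪star a η, β n (T (b' η))⟫) atTop (𝓝 0) := by
    simpa using (tendsto_const_nhds (x := star a η)).inner t0
  refine t1.congr fun n => ?_
  have e1 : a * P * b * Y' n * (a' * P * b') = star (star a) * P * (β n * b') := by
    have : a * P * b * Y' n * (a' * P * b') = a * (P * b * Y' n * a' * P) * b' := by simp only [mul_assoc]
    rw [this, (hβ n).2.2, star_star, comm_iff.1 d.PB _ (hβ n).1]
    simp only [mul_assoc]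
  rw [e1, ← t.eq _ (vst ha) _ (mul_mem (d.le (hβ n).1) hb'), mapp, comm_app t.TB (hβ n).1]
end Dat
theorem sq_aux (k0 : 0 ≤ k) (k1 : k ≤ 1) (Y0 : 0 ≤ Y) (Y1 : Y ≤ 1) :
    0 ≤ (1 - k) * Y * (1 - k) ∧ k + (1 - k) * Y * (1 - k) ≤ 1 ∧ Y ≤ (2 : ℂ) • (k * Y * k) + (2 : ℂ) • ((1 - k) * Y * (1 - k)) := by
  have ks : star k = k := (sa_of_nonneg k0).star_eq
  have ls : star (1 - k) = 1 - k := by rw [star_sub, star_one, ks]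
  have a0 := star_left_conjugate_nonneg Y0 (1 - k)
  rw [ls] at a0
  have a1 := star_left_conjugate_nonneg (sub_nonneg.2 Y1) (1 - k)
  rw [ls] at a1
  have sk : 0 ≤ k - k * k := by
    obtain ⟨ss, sq, -⟩ := sqrt_facts k0
    have := star_left_conjugate_nonneg (sub_nonneg.2 k1) (CFC.sqrt k)
    rw [ss.star_eq] at this
    convert this using 1
    generalize CFC.sqrt k = r at *
    subst sq
    simp only [mul_sub, sub_mul, mul_one, one_mul, mul_assoc]
  have a2 := star_left_conjugate_nonneg Y0 (k - (1 - k))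
  rw [star_sub, ks, ls] at a2
  refine ⟨a0, ?_, ?_⟩
  · rw [← sub_nonneg]
    convert add_nonneg a1 sk using 1
    simp only [mul_sub, sub_mul, mul_one, one_mul]; abel
  · rw [← sub_nonneg]
    convert a2 using 1
    rw [two_smul, two_smul]
    simp only [mul_sub, sub_mul, mul_one, one_mul]; abel
namespace Dat
theorem nz (d : DD) (t : TD) {Y' : ℕ → BB} (YD : ∀ n, Y' n ∈ DS M₁ P) (Y0 : ∀ n, 0 ≤ Y' n) (Y1 : ∀ n, Y' n ≤ 1)
    (h : ∀ a ∈ M₁, ∀ b ∈ M₁, ∃ R : ℝ, ∃ β : ℕ → BB, (∀ n, β n ∈ B ∧ ‖β n‖ ≤ R ∧ P * a * Y' n * b * P = β n * P) ∧ Tendsto (fun n => β n ξ) atTop (𝓝 0))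
    {c : ℝ} (c0 : 0 < c) (hc : ∀ n, c ≤ (⟪ξ, Ψ (Y' n) ξ⟫).re) : False := by
  obtain ⟨F, hF⟩ : ∃ F : BB → ℝ, ∀ X, F X = (⟪ξ, Ψ X ξ⟫).re := ⟨_, fun _ => rfl⟩
  have Fa : ∀ X ∈ (sf.cv M₁).commutant, ∀ Y ∈ (sf.cv M₁).commutant, F (X + Y) = F X + F Y := fun X hX Y hY => by
    rw [hF, hF, hF, d.ceΨ.map_add _ hX _ hY, Aadd, inner_add_right, Complex.add_re]
  have F2 : ∀ X ∈ (sf.cv M₁).commutant, F ((2 : ℂ) • X) = 2 * F X := fun X hX => by rw [two_smul, Fa _ hX _ hX]; ring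
  obtain ⟨W, hW⟩ : ∃ W : Set ℝ, ∀ r, r ∈ W ↔ ∃ k ∈ DS M₁ P, 0 ≤ k ∧ k ≤ 1 ∧ F k = r := ⟨_, fun _ => Iff.rfl⟩
  have ne : W.Nonempty := ⟨_, (hW _).2 ⟨_, YD 0, Y0 0, Y1 0, rfl⟩⟩
  have bd : BddAbove W := ⟨F 1, fun r hr => by
    obtain ⟨k, kD, -, k1, rfl⟩ := (hW r).1 hr
    rw [hF, hF]; exact d.mono (d.DC kD) (one_mem _) k1⟩
  obtain ⟨r, hr, hr'⟩ := exists_lt_of_lt_csSup ne (show sSup W - c / 8 < sSup W by linarith)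
  obtain ⟨k, kD, k0, k1, rfl⟩ := (hW r).1 hr
  have small : ∀ n, F ((1 - k) * Y' n * (1 - k)) ≤ c / 8 ∧ F (Y' n) ≤ 2 * F (k * Y' n * k) + 2 * F ((1 - k) * Y' n * (1 - k)) := fun n => by
    obtain ⟨s1, s2, s3⟩ := sq_aux k0 k1 (Y0 n) (Y1 n)
    have mD : (1 - k) * Y' n * (1 - k) ∈ DS M₁ P := by
      have : (1 - k) * Y' n * (1 - k) = Y' n - k * Y' n - (Y' n * k - k * Y' n * k) := by
        simp only [mul_sub, sub_mul, mul_one, one_mul]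
      rw [this]
      exact sub_mem (sub_mem (YD n) (d.Dm kD (YD n))) (sub_mem (d.Dm (YD n) kD) (d.Dm (d.Dm kD (YD n)) kD))
    have kk := d.DC (d.Dm (d.Dm kD (YD n)) kD)
    constructor
    · have := le_csSup bd ((hW _).2 ⟨_, add_mem kD mD, add_nonneg k0 s1, s2, rfl⟩)
      rw [Fa _ (d.DC kD) _ (d.DC mD)] at this
      linarith
    · rw [← F2 _ kk, ← F2 _ (d.DC mD), ← Fa _ (vn_smul _ kk) _ (vn_smul _ (d.DC mD)), hF, hF]
      exact d.mono (d.DC (YD n)) (vad (vn_smul _ kk) (vn_smul _ (d.DC mD))) s3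
  have t0 := d.F0 t (fun n => d.DC (YD n)) h kD kD
  obtain ⟨n, hn⟩ := (Metric.tendsto_atTop.1 t0 (c / 8) (by positivity))
  have h1 := hn n le_rfl
  rw [dist_zero_right] at h1
  have h2 := (Complex.re_le_norm _).trans_lt h1
  rw [← hF] at h2
  have h3 := hc n
  rw [← hF] at h3
  have := small n
  linarith [this.1, this.2]
end Dat
def GA (A : VN H) (e : BB) : SB := {u | u ∈ A ∧ u * star u = 1 ∧ star u * u = 1 ∧ u * e = e * u}
structure RR {M : VN H} (sf : StandardForm M) (M₁ B A : VN H) (Ψ : BB → BB) (ξ : H) (P p e : BB) (S : SB) (ζ : H) (C : ℝ≥0∞) (δ : ℝ) (Y Y' : BB) : Prop where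
  YN : Y ∈ (sf.cv B).commutant
  Y0 : 0 ≤ Y
  Y1 : Y ≤ 1
  Yq : Y * qS S = Y
  n2 : ∀ u ∈ GA A e, N2 S ζ (Y * u) ≤ C
  cp : sf.c p * Y = Y
  eY : e * Y = Y
  D : Y' ∈ DS M₁ P
  D0 : 0 ≤ Y'
  D1 : Y' ≤ 1
  pair : ∀ a ∈ M₁, ∀ b ∈ M₁, ∃ β ∈ B, pr (orb B ξ) * a * Y * b * pr (orb B ξ) = β * pr (orb B ξ) ∧ P * a * Y' * b * P = β * P
  ge : (δ : ℂ) • e ≤ Ψ Y'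
theorem half_add_le (h1 : X ≤ Z) (h2 : Y ≤ Z) : (1 / 2 : ℂ) • (X + Y) ≤ Z := by
  rw [le_iff] at *
  intro v
  have a := h1 v
  have b := h2 v
  rw [Asmul, Aadd, inner_smul_right, inner_add_right]
  rw [Complex.le_def] at *
  simp at *
  constructor <;> linarith [a.1, a.2, b.1, b.2]
theorem le_half_add (h1 : Z ≤ X) (h2 : Z ≤ Y) : Z ≤ (1 / 2 : ℂ) • (X + Y) := by
  have := half_add_le (neg_le_neg h1) (neg_le_neg h2)
  rw [← neg_add, smul_neg] at this
  exact neg_le_neg_iff.1 this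
theorem N2_half {S : SB} {ζ : H} {C : ℝ≥0∞} (h1 : N2 S ζ X ≤ C) (h2 : N2 S ζ Y ≤ C) : N2 S ζ ((1 / 2 : ℂ) • (X + Y)) ≤ C := by
  rw [N2_smul]
  have h3 : N2 S ζ (X + Y) ≤ 4 * C := by
    refine (le_add_right le_rfl).trans ((N2_add_sub (S := S) (ε := ζ) X Y).le.trans ?_)
    calc 2 * (N2 S ζ X + N2 S ζ Y) ≤ 2 * (C + C) := by gcongr
      _ = 4 * C := by ring
  have h4 : ENNReal.ofReal (‖(1 / 2 : ℂ)‖ ^ 2) = 4⁻¹ := by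
    rw [show ‖(1 / 2 : ℂ)‖ ^ 2 = (4 : ℝ)⁻¹ by norm_num, ENNReal.ofReal_inv_of_pos (by norm_num)]; norm_num
  rw [h4]
  refine (mul_le_mul_right h3 _).trans ?_
  rw [← mul_assoc, ENNReal.inv_mul_cancel (by norm_num) (by norm_num), one_mul]
namespace Dat
theorem gg (d : DD) (ep : Pj e) : GG 𝒩 (GA A e) where
  one := ⟨one_mem A, by simp, by simp, by simp⟩
  mul u hu v hv := by
    refine ⟨mul_mem hu.1 hv.1, ?_, ?_, by rw [mul_assoc, hv.2.2.2, ← mul_assoc, hu.2.2.2, mul_assoc]⟩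
    · rw [star_mul, mul_assoc, ← mul_assoc v, hv.2.1, one_mul, hu.2.1]
    · rw [star_mul, mul_assoc, ← mul_assoc _ u, hu.2.2.1, one_mul, hv.2.2.1]
  st u hu := ⟨vst hu.1, by rw [star_star, hu.2.2.1], by rw [star_star, hu.2.1], by
    have := congrArg star hu.2.2.2
    rw [star_mul, star_mul, star_proj ep] at this; exact this.symm⟩
  un u hu := hu.2.1
  mem u hu := d.MN (d.leM (d.leA hu.1))
theorem rr_mid (d : DD) {S : SB} {ζ : H} {C : ℝ≥0∞} {δ : ℝ} {X' Y' : BB} 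
    (r : RR sf M₁ B A Ψ ξ P p e S ζ C δ X X') (s : RR sf M₁ B A Ψ ξ P p e S ζ C δ Y Y') : RR sf M₁ B A Ψ ξ P p e S ζ C δ ((1 / 2 : ℂ) • (X + Y)) ((1 / 2 : ℂ) • (X' + Y')) where
  YN := vn_smul _ (vad r.YN s.YN)
  Y0 := le_half_add r.Y0 s.Y0
  Y1 := half_add_le r.Y1 s.Y1
  Yq := by rw [smul_mul_assoc, add_mul, r.Yq, s.Yq]
  n2 u hu := by rw [smul_mul_assoc, add_mul]; exact N2_half (r.n2 u hu) (s.n2 u hu)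
  cp := by rw [mul_smul_comm, mul_add, r.cp, s.cp]
  eY := by rw [mul_smul_comm, mul_add, r.eY, s.eY]
  D := Submodule.smul_mem _ _ (add_mem r.D s.D)
  D0 := le_half_add r.D0 s.D0
  D1 := half_add_le r.D1 s.D1
  pair a ha b hb := by
    obtain ⟨x, xB, h1, h2⟩ := r.pair a ha b hb
    obtain ⟨y, yB, h3, h4⟩ := s.pair a ha b hb
    refine ⟨(1 / 2 : ℂ) • (x + y), vn_smul _ (vad xB yB), ?_, ?_⟩
    · rw [mul_smul_comm, smul_mul_assoc, smul_mul_assoc, smul_mul_assoc, mul_add, add_mul, add_mul, add_mul, h1, h3]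
    · rw [mul_smul_comm, smul_mul_assoc, smul_mul_assoc, smul_mul_assoc, mul_add, add_mul, add_mul, add_mul, h2, h4]
  ge := by
    rw [d.ceΨ.map_smul _ _ (vad (d.DC r.D) (d.DC s.D)), d.ceΨ.map_add _ (d.DC r.D) _ (d.DC s.D)]
    exact le_half_add r.ge s.ge
theorem rr_cj (d : DD) (q : PD sf B A T p) {S : SB} {ζ : H} {K : ℝ} {C : ℝ≥0∞} {δ : ℝ} {Y' : BB} (ep : Pj e) (ss : SFN 𝒩 g ζ K S) (hu : u ∈ GA A e)
    (s : RR sf M₁ B A Ψ ξ P p e S ζ C δ Y Y') : RR sf M₁ B A Ψ ξ P p e S ζ C δ (u * Y * star u) (u * Y' * star u) := by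
  have G := d.gg ep
  have u1 := d.leA hu.1
  have us := d.leA (vst hu.1)
  have uA' := vst hu.1
  have le1 : ∀ X : BB, X ≤ 1 → u * X * star u ≤ 1 := fun X hX => by
    have := star_right_conjugate_nonneg (sub_nonneg.2 hX) u
    rwa [mul_sub, sub_mul, mul_one, hu.2.1, sub_nonneg] at this
  refine ⟨mul_mem (mul_mem (G.mem _ hu) s.YN) (G.mem _ (G.st _ hu)), star_right_conjugate_nonneg s.Y0 u, le1 _ s.Y1, ?_, ?_, ?_, ?_, d.Dr us (d.Dl u1 s.D), star_right_conjugate_nonneg s.D0 u, le1 _ s.D1, ?_, ?_⟩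
  · rw [mul_assoc, ← ss.QC (G.mem _ (G.st _ hu)), ← mul_assoc, mul_assoc u, s.Yq]
  · intro v hv
    rw [mul_assoc, mul_assoc, G.N2 hu]
    exact s.n2 _ (G.mul _ (G.st _ hu) _ hv)
  · rw [← mul_assoc, ← mul_assoc, ← (d.pN q).2 _ hu.1, mul_assoc u, s.cp]
  · rw [← mul_assoc, ← mul_assoc, ← hu.2.2.2, mul_assoc u, s.eY]
  · intro a ha b hb
    obtain ⟨x, xB, h1, h2⟩ := s.pair (a * u) (mul_mem ha u1) (star u * b) (mul_mem us hb)
    refine ⟨x, xB, ?_, ?_⟩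
    · rw [← h1]; simp only [mul_assoc]
    · rw [← h2]; simp only [mul_assoc]
  · rw [d.ceΨ.bimod _ hu.1 _ uA' _ (d.DC s.D)]
    have := star_right_conjugate_nonneg (sub_nonneg.2 s.ge) u
    rwa [mul_sub, sub_mul, mul_smul_comm, smul_mul_assoc, hu.2.2.2, mul_assoc e, hu.2.1, mul_one, sub_nonneg] at this
end Dat
theorem wQw_le {Q : BB} (hw : ‖w‖ ≤ 1) (hQ : Pj Q) : 0 ≤ w * Q * star w ∧ w * Q * star w ≤ 1 := by
  have h0 : w * Q * star w = star (Q * star w) * (Q * star w) := by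
    rw [star_mul, star_star, star_proj hQ, ← mul_assoc, mul_assoc w Q Q, proj_mul hQ]
  refine ⟨by rw [h0]; exact star_mul_self_nonneg _, le_iff.2 fun v => ?_⟩
  rw [h0, normsq_inner, Aone, inner_self_eq_norm_sq_to_K]
  have h1 : ‖(Q * star w) v‖ ≤ ‖v‖ := by
    rw [mapp]
    refine (proj_norm_le hQ _).trans (((star w).le_opNorm v).trans ?_)
    rw [norm_star]; nlinarith [norm_nonneg v]
  have h2 : ‖(Q * star w) v‖ ^ 2 ≤ ‖v‖ ^ 2 := by gcongr
  have h3 : ((‖(Q * star w) v‖ ^ 2 : ℝ) : ℂ) ≤ ((‖v‖ ^ 2 : ℝ) : ℂ) := Complex.real_le_real.2 h2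
  refine h3.trans (le_of_eq ?_)
  rw [Complex.ofReal_pow]; rfl
namespace Dat
theorem init (d : DD) (t : TD) (q : PD sf B A T p) (fB : f ∈ B) (fp : Pj f) (hx : x ∈ 𝒩) (h : sf.c p * x * (f * eB) ≠ 0) :
    ∃ z ∈ M₁, z ≠ 0 ∧ ‖z‖ ≤ 1 ∧ z * f = z ∧ sf.c p * (z * eB) = z * eB := by
  have cc := proj_mul (sf.c_proj q.pp)
  obtain ⟨z, zM, hz⟩ := d.Tb t q (Z := sf.c p * x * (f * eB)) (mul_mem (mul_mem (d.pN q).1 hx) (mul_mem (d.MN (d.BM fB)) d.eN)) (by simp only [← mul_assoc]; rw [cc]) (by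
    rw [mul_assoc, mul_assoc f, proj_mul (pr_proj _)])
  have z0 : z ≠ 0 := by rintro rfl; exact h (by rw [hz, zero_mul])
  have zf : z * f = z := d.sepe (mul_mem (d.leM zM) (d.BM fB)) (d.leM zM) (by
    rw [mul_assoc, d.eb fB, ← mul_assoc, ← hz, mul_assoc, mul_assoc f, ← d.eb fB, ← mul_assoc f, proj_mul fp])
  have zc : sf.c p * (z * eB) = z * eB := by rw [← hz]; simp only [← mul_assoc]; rw [cc]
  have n0 : ‖z‖ ≠ 0 := norm_ne_zero_iff.2 z0
  refine ⟨((‖z‖⁻¹ : ℝ) : ℂ) • z, vn_smul _ zM, smul_ne_zero (by exact_mod_cast inv_ne_zero n0) z0, ?_, by rw [smul_mul_assoc, zf], by rw [smul_mul_assoc, mul_smul_comm, zc]⟩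
  rw [norm_smul, Complex.norm_real, norm_inv, norm_norm, inv_mul_cancel₀ n0]
theorem pairE (d : DD) (hm : m ∈ M₁) : eB * m * eB = E m * eB ∧ P * m * P = E m * P ∧ E m ∈ B := by
  have := d.eE (vst hm) (one_mem M₁)
  rwa [star_mul, star_star, star_proj (pr_proj _), one_mul, mul_one] at this
theorem rr_init (d : DD) (t : TD) (q : PD sf B A T p) {K : ℝ} {S : SB} (s : SFN 𝒩 (f * eB) (f ξ) K S) (fB : f ∈ B) (fp : Pj f) (hx : x ∈ 𝒩) (h : sf.c p * x * (f * eB) ≠ 0) :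
    ∃ e ∈ A, Pj e ∧ e ≠ 0 ∧ ∃ δ > 0, ∃ C : ℝ≥0∞, C ≠ ⊤ ∧ ∃ Y Y', RR sf M₁ B A Ψ ξ P p e S (f ξ) C δ Y Y' := by
  obtain ⟨z, zM, z0, z1, zf, zc⟩ := d.init t q fB fp hx h
  have zs := vst zM
  have mC : z * P * star z ∈ (sf.cv M₁).commutant := d.DC (DS.mk zM zs)
  obtain ⟨e, g, ep, e0, -, -, -, hN, -, δ, δ0, hδ⟩ := inv_cut (c := Ψ (z * P * star z)) (d.ceΨ.pos _ mC (wQw_le z1 d.Pp).1) (by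
    intro h0; refine d.cone_ne t q zM z0 zc ?_; rw [h0, Azero, inner_zero_right])
  have eA : e ∈ A := (hN A (d.ceΨ.maps_to _ mC)).1
  obtain ⟨w, hw⟩ : ∃ w, w = e * z := ⟨_, rfl⟩
  have wM : w ∈ M₁ := hw ▸ mul_mem (d.leA eA) zM
  have ws := vst wM
  have w1 : ‖w‖ ≤ 1 := by
    refine ContinuousLinearMap.opNorm_le_bound _ zero_le_one fun v => ?_
    rw [hw, mapp]
    exact (proj_norm_le ep _).trans ((z.le_opNorm v).trans (by gcongr))
  have wf : w * (f * eB) = w * eB := by rw [← mul_assoc, hw, mul_assoc e, zf]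
  have wN := d.MN (d.leM wM)
  have YN : w * eB * star w ∈ 𝒩 := mul_mem (mul_mem wN d.eN) (d.MN (d.leM ws))
  have Ys : star (w * eB * star w) = w * eB * star w := (sa_of_nonneg (wQw_le w1 (pr_proj _)).1).star_eq
  have fin : N2 S (f ξ) (w * eB * star w) ≠ ⊤ := by
    refine ne_top_of_le_ne_top ?_ (s.swap YN)
    rw [Ys, mul_assoc]
    refine ENNReal.mul_ne_top ENNReal.ofReal_ne_top (ne_top_of_le_ne_top ?_ (N2_mul _ _))
    refine ENNReal.mul_ne_top ENNReal.ofReal_ne_top (ne_top_of_le_ne_top ?_ (s.swap (mul_mem d.eN (d.MN (d.leM ws)))))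
    rw [star_mul, star_star, star_proj (pr_proj _)]
    refine ENNReal.mul_ne_top ENNReal.ofReal_ne_top (s.fin ?_).ne
    rw [mul_assoc, ← mul_assoc eB, ← d.eb fB, mul_assoc, proj_mul (pr_proj _), wf]
  have G := d.gg (A := A) ep
  refine ⟨e, eA, ep, e0, δ, δ0, ENNReal.ofReal K * N2 S (f ξ) (w * eB * star w), ENNReal.mul_ne_top ENNReal.ofReal_ne_top fin, w * eB * star w, w * P * star w,
    YN, (wQw_le w1 (pr_proj _)).1, (wQw_le w1 (pr_proj _)).2, ?_, fun u hu => ?_, ?_, ?_, DS.mk wM ws, (wQw_le w1 d.Pp).1, (wQw_le w1 d.Pp).2, fun a ha b hb => ?_, ?_⟩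
  · rw [← s.QC YN, ← mul_assoc, ← wf, s.Q _ wN]
  · have := s.swap (mul_mem YN (G.mem _ hu))
    rwa [star_mul, Ys, G.N2 (G.st _ hu)] at this
  · rw [← mul_assoc, hw, mul_assoc e, ← mul_assoc (sf.c p) e, ← (d.pN q).2 _ eA, mul_assoc e, zc]
  · rw [hw, ← mul_assoc, ← mul_assoc, ← mul_assoc e, proj_mul ep]
  · have h1 := d.pairE (mul_mem ha wM)
    have h2 := d.pairE (mul_mem ws hb)
    refine ⟨_, mul_mem h1.2.2 h2.2.2, ?_, ?_⟩
    · have : eB * a * (w * eB * star w) * b * eB = (eB * (a * w) * eB) * (star w * b) * eB := by simp only [mul_assoc]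
      rw [this, h1.1, mul_assoc, mul_assoc, ← mul_assoc eB, h2.1, mul_assoc]
    · have : P * a * (w * P * star w) * b * P = (P * (a * w) * P) * (star w * b) * P := by simp only [mul_assoc]
      rw [this, h1.2.1, mul_assoc, mul_assoc, ← mul_assoc P, h2.2.1, mul_assoc]
  · have : w * P * star w = e * (z * P * star z) * e := by rw [hw, star_mul, star_proj ep]; simp only [mul_assoc]
    rw [this, d.ceΨ.bimod _ eA _ eA _ mC]
    have := star_left_conjugate_nonneg (sub_nonneg.2 hδ) e
    rwa [star_proj ep, mul_sub, sub_mul, mul_smul_comm, smul_mul_assoc, proj_mul ep, proj_mul ep, sub_nonneg] at this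
end Dat
theorem lim_fix {Y : ℕ → BB} {d0 : BB} (hY : ∀ v, Tendsto (fun n => Y n v) atTop (𝓝 (d0 v))) (h : ∀ n, q * Y n = Y n) : q * d0 = d0 := by
  ext v
  rw [mapp]
  refine tendsto_nhds_unique ((q.continuous.tendsto _).comp (hY v)) ((hY v).congr fun n => ?_)
  show Y n v = q (Y n v)
  rw [← mapp, h]
theorem lim_nn {Y : ℕ → BB} {d0 : BB} (hY : ∀ v, Tendsto (fun n => Y n v) atTop (𝓝 (d0 v))) (h : ∀ n, 0 ≤ Y n) : 0 ≤ d0 := by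
  rw [nonneg_iff]
  intro v
  exact ge_of_tendsto' ((tendsto_const_nhds (x := v)).inner (hY v)) fun n => nonneg_iff.1 (h n) v
namespace Dat
theorem nz2 (d : DD) (t : TD) {S : SB} {ζ : H} {C : ℝ≥0∞} {δ : ℝ} (eA : e ∈ A) (ep : Pj e) (e0 : e ≠ 0) (δ0 : 0 < δ) {Y Y' : ℕ → BB}
    (r : ∀ n, RR sf M₁ B A Ψ ξ P p e S ζ C δ (Y n) (Y' n)) (h : ∀ v, Tendsto (fun n => Y n v) atTop (𝓝 0)) : False := by
  have eξ : e ξ ≠ 0 := fun h0 => e0 (d.g.sep _ (d.leM (d.leA eA)) h0)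
  refine d.nz t (fun n => (r n).D) (fun n => (r n).D0) (fun n => (r n).D1) (fun a ha b hb => ?_) (c := δ * ‖e ξ‖ ^ 2) (by positivity) fun n => ?_
  · choose β hB h1 h2 using fun n => (r n).pair a ha b hb
    have aN := d.MN (d.leM ha)
    have bN := d.MN (d.leM hb)
    refine ⟨‖a‖ * 1 * ‖b‖, β, fun n => ⟨hB n, ?_, h2 n⟩, ?_⟩
    · obtain ⟨k, kB, hk, nk⟩ := d.eNe (mul_mem (mul_mem aN (r n).YN) bN)
      have : k = β n := d.sepe (d.BM kB) (d.BM (hB n)) (by rw [← hk, ← h1 n]; simp only [mul_assoc])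
      rw [← this]
      have y1 := (CStarAlgebra.norm_le_one_iff_of_nonneg (Y n) (r n).Y0).2 (r n).Y1
      refine nk.trans ((norm_mul_le _ _).trans ?_)
      gcongr
      exact (norm_mul_le _ _).trans (by gcongr)
    · have t1 : Tendsto (fun n => (eB * a) (Y n (b ξ))) atTop (𝓝 0) := by
        have := ((eB * a).continuous.tendsto 0).comp (h (b ξ))
        rwa [map_zero] at this
      refine t1.congr fun n => ?_
      have h3 := congrArg (fun X : BB => X ξ) (h1 n)
      simp only [mapp, pr_orb_self] at h3
      rw [mapp]; exact h3
  · have := (cL (le_iff.1 (r n).ge ξ)).1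
    refine le_trans (le_of_eq ?_) this
    have h4 := normsq_inner e ξ
    rw [star_proj ep, proj_mul ep] at h4
    rw [Asmul, inner_smul_right, h4, ← Complex.ofReal_mul, Complex.ofReal_re]
theorem final (d : DD) (t : TD) (T0 : T ≠ 0) : ∃ e v, INT M₁ B A ξ e v := by
  rcases d.dich t T0 with h | ⟨K, K0, f, fB, fp, hT, hK⟩
  · exact h
  obtain ⟨S, s⟩ := d.setup K0 fB fp hK
  obtain ⟨p, q, x, hx, hne⟩ := d.setup2 t fB fp hT
  obtain ⟨e, eA, ep, e0, δ, δ0, C, hC, Y0, Y0', r0⟩ := d.rr_init t q s fB fp hx hne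
  have G := d.gg (A := A) ep
  obtain ⟨Y, d0, YL, hY, dN, dc, dC⟩ := s.avg G (L := {Y | ∃ Y', RR sf M₁ B A Ψ ξ P p e S (f ξ) C δ Y Y'}) hC
    (fun X ⟨X', hX⟩ Y ⟨Y', hY⟩ => ⟨_, d.rr_mid hX hY⟩) (fun u hu Y ⟨Y', hY⟩ => ⟨_, d.rr_cj q ep s hu hY⟩) ⟨_, _, r0⟩
    (fun Y ⟨Y', r⟩ => ⟨r.YN, r.Y0, r.Y1, r.Yq, by simpa using r.n2 1 G.one⟩)
  choose Y' r using YL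
  refine d.fin1 t q s eA ep dN (lim_nn hY fun n => (r n).Y0) ?_ (fun u uA h1 h2 h3 => dc u ⟨uA, h1, h2, h3⟩) (ne_top_of_le_ne_top hC dC) (lim_fix hY fun n => (r n).cp) (lim_fix hY fun n => (r n).eY)
    (lim_fix hY fun n => by rw [s.QC (r n).YN, (r n).Yq])
  rintro rfl
  exact d.nz2 t eA ep e0 δ0 r (by simpa using hY)
end Dat
/-- **Main Theorem.** Let `M = M₁ *_B M₂` be an amalgamated free product of σ-finite von
Neumann algebras and let `Q ⊆ M` be a von Neumann subalgebra with expectation such that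
(i) `Q` is amenable relative to `M₁` inside `M`, and (ii) `Q ∩ M₁ ⊆ M₁` is with expectation
and `Q ∩ M₁ ⋠_{M₁} B`.  Then `Q ⊆ M₁`. -/
theorem amenable_absorption_in_AFP
    {H : Type*} [NormedAddCommGroup H] [InnerProductSpace ℂ H] [CompleteSpace H]
    (M M₁ M₂ B : VonNeumannAlgebra H) (E : BH H → BH H)
    (hAFP : IsAFP M M₁ M₂ B E)
    (hσB : SigmaFinite (B : Set (BH H))) (hσ₁ : SigmaFinite (M₁ : Set (BH H)))
    (hσ₂ : SigmaFinite (M₂ : Set (BH H))) (hσM : SigmaFinite (M : Set (BH H)))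
    (sf : StandardForm M)
    (Q : VonNeumannAlgebra H) (hQM : (Q : Set (BH H)) ⊆ (M : Set (BH H)))
    (hQexp : WithExpectation (M : Set (BH H)) (Q : Set (BH H)))
    -- (i) `Q` is amenable relative to `M₁` inside `M`
    (hrelamen : AmenableRel sf.J (M : Set (BH H)) (Q : Set (BH H)) (M₁ : Set (BH H)))
    -- (ii) `Q ∩ M₁ ⊆ M₁` is with expectation and `Q ∩ M₁ ⋠_{M₁} B`
    (hQcapExp : WithExpectation (M₁ : Set (BH H)) ((Q : Set (BH H)) ∩ (M₁ : Set (BH H))))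
    (hnotembed : ¬ EmbedsWE (M₁ : Set (BH H)) ((Q : Set (BH H)) ∩ (M₁ : Set (BH H)))
      (B : Set (BH H))) :
    (Q : Set (BH H)) ⊆ (M₁ : Set (BH H)) := by
  obtain ⟨E1, EA, Ψ, ξ, η, P, d, h⟩ := mkDat hAFP hσM sf hQM hrelamen hQcapExp
  refine h fun T t => ?_
  by_contra T0
  obtain ⟨e, v, i⟩ := d.final t T0
  have em := d.embed i
  rw [coe_vnInf] at em
  exact hnotembed em


end AFP
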